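/- For every positive real γ there exists δ > 0 such that for every ε > 0 there exist constants C, D, and ξ > 0 with the following property. If p ≥ C(log n / n)^{1/2}, then asymptotically almost surely every subgraph G ⊆ G(n,p) with δ(G) ≥ (2/3 + γ)np contains a subgraph G' ⊆ G whose vertex set can be partitioned into sets B, S, and W'₁, …, W'_{3k} with k ≤ D such that: (i) |B| ≤ D·p^{-2}; (ii) G[S] contains a perfect triangle packing; (iii) for every t ∈ {1, …, k}, the triple (W'_{3t−2}, W'_{3t−1}, W'_{3t}) is (δ, ε, p)-strong-super-regular in G'; and (iv) |W'_{3t−2}| = |W'_{3t−1}| = |W'_{3t}| ≥ ξn for all t. -/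

import Mathlib

open Finset

open scoped Classical

noncomputable section

namespace RandomTriangle

/-- Number of ordered adjacent pairs between `X` and `Y`. -/
def eBtw {V : Type*} (G : SimpleGraph V) (X Y : Finset V) : ℕ :=
  ((X ×ˢ Y).filter fun a => G.Adj a.1 a.2).card

/-- Edge density between `X` and `Y`. -/
def dens {V : Type*} (G : SimpleGraph V) (X Y : Finset V) : ℝ :=
  (eBtw G X Y : ℝ) / ((X.card : ℝ) * (Y.card : ℝ))

/-- Number of neighbours of `v` in `X`. -/
def degIn {V : Type*} (G : SimpleGraph V) (v : V) (X : Finset V) : ℕ :=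
  (X.filter fun w => G.Adj v w).card

/-- Neighbourhood of `v` inside `X`. -/
def nbhdIn {V : Type*} (G : SimpleGraph V) (v : V) (X : Finset V) : Finset V :=
  X.filter fun w => G.Adj v w

/-- Number of common neighbours of `u` and `w` inside `X`. -/
def codegIn {V : Type*} (G : SimpleGraph V) (u w : V) (X : Finset V) : ℕ :=
  (X.filter fun x => G.Adj u x ∧ G.Adj w x).card

/-- `(ε, p)`-regular pair `(X, Y)`. -/
def RegularPair {V : Type*} (G : SimpleGraph V) (ε p : ℝ) (X Y : Finset V) : Prop :=
  ∀ X' ⊆ X, ∀ Y' ⊆ Y, ε * X.card ≤ (X'.card : ℝ) → ε * Y.card ≤ (Y'.card : ℝ) →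
    |dens G X Y - dens G X' Y'| ≤ ε * p

/-- `(ε, p)`-regular triple. -/
def RegularTriple {V : Type*} (G : SimpleGraph V) (ε p : ℝ) (V₁ V₂ V₃ : Finset V) : Prop :=
  RegularPair G ε p V₁ V₂ ∧ RegularPair G ε p V₁ V₃ ∧ RegularPair G ε p V₂ V₃

/-- `v ∈ V₁` is an `ε`-typical vertex of the triple `(V₁, V₂, V₃)`:
its neighbourhoods in `V₂`, `V₃` have the expected size `(1 ± ε)·d₁ᵢp|Vᵢ|`
(note `d₁ᵢ p = dens G V₁ Vᵢ`), and they contain large subsets forming an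
`(ε, p)`-regular pair of density `(1 ± ε)·d₂₃p`. -/
def TypicalVertex {V : Type*} (G : SimpleGraph V) (ε p : ℝ) (V₁ V₂ V₃ : Finset V) (v : V) :
    Prop :=
  ((1 - ε) * (dens G V₁ V₂ * V₂.card) ≤ ((nbhdIn G v V₂).card : ℝ) ∧
    ((nbhdIn G v V₂).card : ℝ) ≤ (1 + ε) * (dens G V₁ V₂ * V₂.card)) ∧
  ((1 - ε) * (dens G V₁ V₃ * V₃.card) ≤ ((nbhdIn G v V₃).card : ℝ) ∧
    ((nbhdIn G v V₃).card : ℝ) ≤ (1 + ε) * (dens G V₁ V₃ * V₃.card)) ∧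
  ∃ N₂' ⊆ nbhdIn G v V₂, ∃ N₃' ⊆ nbhdIn G v V₃,
    (1 - ε) * ((nbhdIn G v V₂).card : ℝ) ≤ (N₂'.card : ℝ) ∧
    (1 - ε) * ((nbhdIn G v V₃).card : ℝ) ≤ (N₃'.card : ℝ) ∧
    RegularPair G ε p N₂' N₃' ∧
    (1 - ε) * dens G V₂ V₃ ≤ dens G N₂' N₃' ∧
    dens G N₂' N₃' ≤ (1 + ε) * dens G V₂ V₃

/-- An `ε`-typical triple: `(ε,p)`-regular and in each part all but at most an
`ε`-fraction of the vertices are `ε`-typical. -/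
def TypicalTriple {V : Type*} (G : SimpleGraph V) (ε p : ℝ) (V₁ V₂ V₃ : Finset V) : Prop :=
  RegularTriple G ε p V₁ V₂ V₃ ∧
  ((V₁.filter fun v => ¬ TypicalVertex G ε p V₁ V₂ V₃ v).card : ℝ) ≤ ε * V₁.card ∧
  ((V₂.filter fun v => ¬ TypicalVertex G ε p V₂ V₁ V₃ v).card : ℝ) ≤ ε * V₂.card ∧
  ((V₃.filter fun v => ¬ TypicalVertex G ε p V₃ V₁ V₂ v).card : ℝ) ≤ ε * V₃.card

/-- A `(δ, ε, p)`-super-regular triple. -/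
def SuperRegularTriple {V : Type*} (G : SimpleGraph V) (δ ε p : ℝ) (V₁ V₂ V₃ : Finset V) :
    Prop :=
  RegularTriple G ε p V₁ V₂ V₃ ∧
  δ * p ≤ dens G V₁ V₂ ∧ δ * p ≤ dens G V₁ V₃ ∧ δ * p ≤ dens G V₂ V₃ ∧
  (∀ v ∈ V₁, TypicalVertex G ε p V₁ V₂ V₃ v) ∧
  (∀ v ∈ V₂, TypicalVertex G ε p V₂ V₁ V₃ v) ∧
  (∀ v ∈ V₃, TypicalVertex G ε p V₃ V₁ V₂ v)

/-- An edge `(u, w)` with `u ∈ V₂`, `w ∈ V₃` is `ε`-good (w.r.t. `V₁`) if its endpoints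
have at least `(1 - ε)·d₁₂d₁₃p²|V₁|` common neighbours in `V₁`
(note `d₁₂d₁₃p² = dens G V₁ V₂ * dens G V₁ V₃`). -/
def GoodEdge {V : Type*} (G : SimpleGraph V) (ε : ℝ) (V₁ V₂ V₃ : Finset V) (u w : V) : Prop :=
  (1 - ε) * (dens G V₁ V₂ * dens G V₁ V₃ * V₁.card) ≤ (codegIn G u w V₁ : ℝ)

/-- An `ε`-typical vertex `v ∈ V₁` is `ε`-good if the pair of its neighbourhoods in
`V₂`, `V₃` spans at most `ε·d₁₂d₁₃d₂₃p³|V₂||V₃|` edges that are not `ε`-good. -/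
def GoodVertex {V : Type*} (G : SimpleGraph V) (ε p : ℝ) (V₁ V₂ V₃ : Finset V) (v : V) :
    Prop :=
  TypicalVertex G ε p V₁ V₂ V₃ v ∧
  ((((nbhdIn G v V₂) ×ˢ (nbhdIn G v V₃)).filter fun uw =>
      G.Adj uw.1 uw.2 ∧ ¬ GoodEdge G ε V₁ V₂ V₃ uw.1 uw.2).card : ℝ) ≤
    ε * (dens G V₁ V₂ * dens G V₁ V₃ * dens G V₂ V₃ * V₂.card * V₃.card)

/-- A `(δ, ε, p)`-strong-super-regular triple. -/
def StrongSuperRegularTriple {V : Type*} (G : SimpleGraph V) (δ ε p : ℝ)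
    (V₁ V₂ V₃ : Finset V) : Prop :=
  SuperRegularTriple G δ ε p V₁ V₂ V₃ ∧
  (∀ v ∈ V₁, GoodVertex G ε p V₁ V₂ V₃ v) ∧
  (∀ v ∈ V₂, GoodVertex G ε p V₂ V₁ V₃ v) ∧
  (∀ v ∈ V₃, GoodVertex G ε p V₃ V₁ V₂ v)

/-- A triangle packing: a collection of pairwise vertex-disjoint triangles of `G`. -/
def IsTrianglePacking {V : Type*} [DecidableEq V] (G : SimpleGraph V)
    (T : Finset (Finset V)) : Prop :=
  (∀ t ∈ T, t.card = 3 ∧ ∀ x ∈ t, ∀ y ∈ t, x ≠ y → G.Adj x y) ∧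
  (∀ s ∈ T, ∀ t ∈ T, s ≠ t → Disjoint s t)

def idx0 {k : ℕ} (t : Fin k) : Fin (3 * k) := ⟨3 * t.1, by have := t.2; omega⟩
def idx1 {k : ℕ} (t : Fin k) : Fin (3 * k) := ⟨3 * t.1 + 1, by have := t.2; omega⟩
def idx2 {k : ℕ} (t : Fin k) : Fin (3 * k) := ⟨3 * t.1 + 2, by have := t.2; omega⟩

/-- The endpoints of every edge between `A` and `B` have at most `4|C|p²` common
neighbours in `C`. -/
def CodegBound {V : Type*} (G : SimpleGraph V) (p : ℝ) (A B C : Finset V) : Prop :=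
  ∀ u ∈ A, ∀ w ∈ B, G.Adj u w → (codegIn G u w C : ℝ) ≤ 4 * C.card * p ^ 2

/-- The probability, in the Erdős–Rényi random graph `G(n, p)`, of the event `A`. -/
def gnpProb (n : ℕ) (p : ℝ) (A : Set (SimpleGraph (Fin n))) : ℝ :=
  ∑ G ∈ Finset.univ.filter (fun G => G ∈ A),
    p ^ ((Finset.univ.filter fun e : Sym2 (Fin n) => e ∈ G.edgeSet).card) *
      (1 - p) ^ (n.choose 2 - (Finset.univ.filter fun e : Sym2 (Fin n) => e ∈ G.edgeSet).card)

/-- A sequence of graph properties holds asymptotically almost surely in `G(n, p n)`. -/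
def AAS (p : ℕ → ℝ) (P : ∀ n : ℕ, SimpleGraph (Fin n) → Prop) : Prop :=
  Filter.Tendsto (fun n => gnpProb n (p n) {G | P n G}) Filter.atTop (nhds 1)

end RandomTriangle

open RandomTriangle

set_option linter.all false

section Part1
/-! ## Module 1: probability in `G(n,p)` -/

def eset {n : ℕ} (G : SimpleGraph (Fin n)) : Finset (Sym2 (Fin n)) :=
  Finset.univ.filter fun e : Sym2 (Fin n) => e ∈ G.edgeSet

def ndg (n : ℕ) : Finset (Sym2 (Fin n)) := Finset.univ.filter fun e => ¬ e.IsDiag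

def wt (n : ℕ) (p : ℝ) (G : SimpleGraph (Fin n)) : ℝ :=
  p ^ (eset G).card * (1 - p) ^ (n.choose 2 - (eset G).card)

def Ex (n : ℕ) (p : ℝ) (g : SimpleGraph (Fin n) → ℝ) : ℝ :=
  ∑ G : SimpleGraph (Fin n), wt n p G * g G

lemma ndg_card (n : ℕ) : (ndg n).card = n.choose 2 := by
  have h := Sym2.card_subtype_not_diag (α := Fin n)
  rw [Fintype.card_fin] at h
  rw [← h, ndg, Fintype.card_subtype]

lemma eset_subset {n : ℕ} (G : SimpleGraph (Fin n)) : eset G ⊆ ndg n := by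
  intro e he
  simp only [eset, ndg, mem_filter, mem_univ, true_and] at *
  exact G.not_isDiag_of_mem_edgeSet he

lemma eset_fromEdgeSet {n : ℕ} {s : Finset (Sym2 (Fin n))} (hs : s ⊆ ndg n) :
    eset (SimpleGraph.fromEdgeSet (s : Set (Sym2 (Fin n)))) = s := by
  ext e
  simp only [eset, mem_filter, mem_univ, true_and, SimpleGraph.edgeSet_fromEdgeSet]
  constructor
  · intro h; exact_mod_cast h.1
  · intro h
    refine ⟨by exact_mod_cast h, ?_⟩
    have := hs h
    simp only [ndg, mem_filter, mem_univ, true_and] at this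
    simpa using this

lemma sum_graph {n : ℕ} (F : Finset (Sym2 (Fin n)) → ℝ) :
    ∑ G : SimpleGraph (Fin n), F (eset G) = ∑ s ∈ (ndg n).powerset, F s := by
  refine Finset.sum_nbij' eset (fun s => SimpleGraph.fromEdgeSet (s : Set (Sym2 (Fin n)))) ?_ ?_ ?_ ?_ ?_
  · intro G _; simpa using eset_subset G
  · intro s _; simp
  · intro G _
    have : ((eset G : Finset _) : Set (Sym2 (Fin n))) = G.edgeSet := by
      ext e; simp [eset]
    rw [this, SimpleGraph.fromEdgeSet_edgeSet]
  · intro s hs; exact eset_fromEdgeSet (by simpa using hs)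
  · intro G _; rfl

lemma Ex_sub {n : ℕ} (p : ℝ) (J : Finset (Sym2 (Fin n))) (hJ : J ⊆ ndg n) :
    Ex n p (fun G => if J ⊆ eset G then 1 else 0) = p ^ J.card := by
  have h1 := sum_graph (n := n) (fun s => p ^ s.card * (1 - p) ^ (n.choose 2 - s.card) *
    (if J ⊆ s then (1:ℝ) else 0))
  have h2 : Ex n p (fun G => if J ⊆ eset G then 1 else 0) = _ := h1
  rw [h2]
  have h3 := Finset.prod_add (fun _ : Sym2 (Fin n) => p)
    (fun e => if e ∈ J then 0 else 1 - p) (ndg n)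
  have h4 : ∏ e ∈ ndg n, (p + (if e ∈ J then 0 else 1 - p)) = p ^ J.card := by
    rw [← Finset.prod_subset hJ]
    · rw [Finset.prod_congr rfl (g := fun _ => p)]
      · simp
      · intro e he; simp [he]
    · intro e _ he; simp [he]
  rw [← h4, h3]
  refine Finset.sum_congr rfl fun s hs => ?_
  rw [mem_powerset] at hs
  rw [mul_assoc]
  congr 1
  · simp
  · by_cases h : J ⊆ s
    · rw [if_pos h, mul_one, ← ndg_card, ← Finset.card_sdiff_of_subset hs,
        Finset.prod_congr rfl (g := fun _ => 1 - p)]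
      · simp
      · intro e he
        rw [if_neg]
        intro h'; exact (mem_sdiff.1 he).2 (h h')
    · rw [if_neg h, mul_zero]
      obtain ⟨e, he, hes⟩ := Finset.not_subset.1 h
      symm
      exact Finset.prod_eq_zero (i := e) (mem_sdiff.2 ⟨hJ he, hes⟩) (by simp [he])

lemma Ex_one {n : ℕ} (p : ℝ) : Ex n p (fun _ => 1) = 1 := by
  have := Ex_sub (n := n) p ∅ (by simp)
  simpa using this

lemma wt_nonneg {n : ℕ} {p : ℝ} (h0 : 0 ≤ p) (h1 : p ≤ 1) (G : SimpleGraph (Fin n)) :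
    0 ≤ wt n p G := by
  have : 0 ≤ 1 - p := by linarith
  unfold wt; positivity

lemma Ex_sum {n : ℕ} {ι : Type*} (p : ℝ) (s : Finset ι) (g : ι → SimpleGraph (Fin n) → ℝ) :
    Ex n p (fun G => ∑ i ∈ s, g i G) = ∑ i ∈ s, Ex n p (g i) := by
  unfold Ex
  rw [Finset.sum_comm]
  simp_rw [Finset.mul_sum]

lemma Ex_smul {n : ℕ} (p c : ℝ) (g : SimpleGraph (Fin n) → ℝ) :
    Ex n p (fun G => c * g G) = c * Ex n p g := by
  unfold Ex
  rw [Finset.mul_sum]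
  exact Finset.sum_congr rfl fun G _ => by ring

lemma Ex_mono {n : ℕ} {p : ℝ} (h0 : 0 ≤ p) (h1 : p ≤ 1) {g g' : SimpleGraph (Fin n) → ℝ}
    (h : ∀ G, g G ≤ g' G) : Ex n p g ≤ Ex n p g' :=
  Finset.sum_le_sum fun G _ => mul_le_mul_of_nonneg_left (h G) (wt_nonneg h0 h1 G)

/-- the product identity for disjoint edge sets -/
lemma Ex_prod {n : ℕ} {ι : Type*} (p : ℝ) (X : Finset ι) (t : ι → ℝ)
    (J : ι → Finset (Sym2 (Fin n))) (hJ : ∀ x ∈ X, J x ⊆ ndg n)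
    (hd : ∀ x ∈ X, ∀ y ∈ X, x ≠ y → Disjoint (J x) (J y)) :
    Ex n p (fun G => ∏ x ∈ X, (1 + t x * (if J x ⊆ eset G then 1 else 0)))
      = ∏ x ∈ X, (1 + t x * p ^ (J x).card) := by
  simp_rw [Finset.prod_one_add]
  rw [Ex_sum]
  refine Finset.sum_congr rfl fun S hS => ?_
  rw [mem_powerset] at hS
  have h1 : (fun G : SimpleGraph (Fin n) => ∏ x ∈ S, (t x * (if J x ⊆ eset G then (1:ℝ) else 0)))
      = fun G => (∏ x ∈ S, t x) * (if S.biUnion J ⊆ eset G then 1 else 0) := by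
    funext G
    rw [Finset.prod_mul_distrib]
    congr 1
    by_cases h : S.biUnion J ⊆ eset G
    · rw [if_pos h]
      rw [Finset.biUnion_subset] at h
      exact Finset.prod_eq_one fun x hx => by rw [if_pos (h x hx)]
    · rw [if_neg h]
      rw [Finset.biUnion_subset] at h
      push Not at h
      obtain ⟨x, hx, hx'⟩ := h
      exact Finset.prod_eq_zero hx (by rw [if_neg hx'])
  rw [h1, Ex_smul, Ex_sub, Finset.card_biUnion, Finset.prod_mul_distrib,
    ← Finset.prod_pow_eq_pow_sum]
  · intro x hx y hy hxy; exact hd x (hS hx) y (hS hy) hxy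
  · rw [Finset.biUnion_subset]; exact fun x hx => hJ x (hS hx)

lemma gnpProb_eq {n : ℕ} (p : ℝ) (A : Set (SimpleGraph (Fin n))) :
    gnpProb n p A = Ex n p (fun G => if G ∈ A then 1 else 0) := by
  unfold gnpProb Ex
  rw [Finset.sum_filter]
  refine Finset.sum_congr rfl fun G _ => ?_
  by_cases h : G ∈ A
  · simp only [h, if_true, mul_one]; rfl
  · simp only [h, if_false, mul_zero]

lemma gnpProb_le {n : ℕ} {p : ℝ} (h0 : 0 ≤ p) (h1 : p ≤ 1) {A : Set (SimpleGraph (Fin n))}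
    {g : SimpleGraph (Fin n) → ℝ} (hg : ∀ G, 0 ≤ g G) (h : ∀ G ∈ A, 1 ≤ g G) :
    gnpProb n p A ≤ Ex n p g := by
  rw [gnpProb_eq]
  refine Ex_mono h0 h1 fun G => ?_
  split_ifs with hG
  · exact h G hG
  · exact hg G

lemma gnpProb_compl {n : ℕ} (p : ℝ) (P : SimpleGraph (Fin n) → Prop) :
    gnpProb n p {G | P G} = 1 - gnpProb n p {G | ¬ P G} := by
  rw [eq_sub_iff_add_eq, gnpProb_eq, gnpProb_eq]
  refine Eq.trans ?_ (Ex_one (n := n) p)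
  unfold Ex
  rw [← Finset.sum_add_distrib]
  refine Finset.sum_congr rfl fun G _ => ?_
  by_cases h : P G <;> simp [h]

lemma gnpProb_true {n : ℕ} (p : ℝ) (P : SimpleGraph (Fin n) → Prop) (h : ∀ G, P G) :
    gnpProb n p {G | P G} = 1 := by
  rw [gnpProb_eq]
  refine Eq.trans ?_ (Ex_one (n := n) p)
  congr 1
  funext G; simp [h]

lemma gnpProb_nonneg {n : ℕ} {p : ℝ} (h0 : 0 ≤ p) (h1 : p ≤ 1) (A : Set (SimpleGraph (Fin n))) :
    0 ≤ gnpProb n p A := by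
  rw [gnpProb_eq]
  exact Finset.sum_nonneg fun G _ => mul_nonneg (wt_nonneg h0 h1 G) (by dsimp only; split_ifs <;> norm_num)

lemma gnpProb_mono {n : ℕ} {p : ℝ} (h0 : 0 ≤ p) (h1 : p ≤ 1) {A B : Set (SimpleGraph (Fin n))}
    (h : A ⊆ B) : gnpProb n p A ≤ gnpProb n p B := by
  rw [gnpProb_eq, gnpProb_eq]
  refine Ex_mono h0 h1 fun G => ?_
  by_cases h1 : G ∈ A
  · simp [h1, h h1]
  · simp only [h1, if_false]; split_ifs <;> norm_num

lemma gnpProb_union {n : ℕ} {p : ℝ} (h0 : 0 ≤ p) (h1 : p ≤ 1) {A B : Set (SimpleGraph (Fin n))} :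
    gnpProb n p (A ∪ B) ≤ gnpProb n p A + gnpProb n p B := by
  rw [gnpProb_eq, gnpProb_eq, gnpProb_eq]
  unfold Ex
  rw [← Finset.sum_add_distrib]
  refine Finset.sum_le_sum fun G _ => ?_
  rw [← mul_add]
  refine mul_le_mul_of_nonneg_left ?_ (wt_nonneg h0 h1 G)
  by_cases h1 : G ∈ A <;> by_cases h2 : G ∈ B <;> simp [h1, h2]

/-- With high probability, uniformly in p. -/
def Whp (C : ℝ) (P : ∀ n : ℕ, ℝ → SimpleGraph (Fin n) → Prop) : Prop :=
  ∀ τ : ℝ, 0 < τ → ∃ n0 : ℕ, ∀ n ≥ n0, ∀ p : ℝ, C * Real.sqrt (Real.log n / n) ≤ p → p ≤ 1 →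
    gnpProb n p {G | ¬ P n p G} ≤ τ

lemma Whp.mono {C C' : ℝ} {P Q : ∀ n : ℕ, ℝ → SimpleGraph (Fin n) → Prop} (hC : 0 ≤ C)
    (hCC : C ≤ C') (h : Whp C P) (hPQ : ∀ n p G, P n p G → Q n p G) : Whp C' Q := by
  intro τ hτ
  obtain ⟨n0, hn0⟩ := h τ hτ
  refine ⟨n0, fun n hn p hp hp1 => ?_⟩
  have h1 : C * Real.sqrt (Real.log n / n) ≤ p :=
    le_trans (mul_le_mul_of_nonneg_right hCC (Real.sqrt_nonneg _)) hp
  have h2 : 0 ≤ p := le_trans (mul_nonneg hC (Real.sqrt_nonneg _)) h1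
  refine le_trans (gnpProb_mono h2 hp1 ?_) (hn0 n hn p h1 hp1)
  intro G hG h3; exact hG (hPQ n p G h3)

lemma Whp.and {C : ℝ} {P Q : ∀ n : ℕ, ℝ → SimpleGraph (Fin n) → Prop} (hC : 0 ≤ C)
    (h : Whp C P) (h' : Whp C Q) : Whp C (fun n p G => P n p G ∧ Q n p G) := by
  intro τ hτ
  obtain ⟨n0, hn0⟩ := h (τ/2) (by positivity)
  obtain ⟨n1, hn1⟩ := h' (τ/2) (by positivity)
  refine ⟨max n0 n1, fun n hn p hp hp1 => ?_⟩
  have h2 : 0 ≤ p := le_trans (mul_nonneg hC (Real.sqrt_nonneg _)) hp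
  have h3 : {G : SimpleGraph (Fin n) | ¬ (P n p G ∧ Q n p G)} ⊆ {G | ¬ P n p G} ∪ {G | ¬ Q n p G} := by
    intro G hG
    by_cases h : P n p G
    · right; intro h4; exact hG ⟨h, h4⟩
    · left; exact h
  have := hn0 n (le_trans (le_max_left _ _) hn) p hp hp1
  have := hn1 n (le_trans (le_max_right _ _) hn) p hp hp1
  linarith [gnpProb_mono h2 hp1 h3, gnpProb_union h2 hp1 (A := {G : SimpleGraph (Fin n) | ¬ P n p G}) (B := {G | ¬ Q n p G})]

end Part1

section Part2
/-! ## Module 2: Chernoff bounds and N1 -/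

def cntJ {n : ℕ} {ι : Type*} (X : Finset ι) (J : ι → Finset (Sym2 (Fin n)))
    (G : SimpleGraph (Fin n)) : ℕ := (X.filter fun x => J x ⊆ eset G).card

lemma pow_cntJ {n : ℕ} {ι : Type*} (X : Finset ι) (J : ι → Finset (Sym2 (Fin n)))
    (G : SimpleGraph (Fin n)) (t : ℝ) :
    (1 + t) ^ (cntJ X J G) = ∏ x ∈ X, (1 + t * (if J x ⊆ eset G then 1 else 0)) := by
  unfold cntJ
  rw [Finset.card_filter, ← Finset.prod_pow_eq_pow_sum]
  refine Finset.prod_congr rfl fun x _ => ?_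
  split_ifs <;> simp

lemma Ex_pow_cntJ {n : ℕ} {ι : Type*} (p : ℝ) (hp : 0 ≤ p) (hp1 : p ≤ 1) (X : Finset ι) (m : ℕ)
    (J : ι → Finset (Sym2 (Fin n))) (hJ : ∀ x ∈ X, J x ⊆ ndg n) (hm : ∀ x ∈ X, (J x).card = m)
    (hd : ∀ x ∈ X, ∀ y ∈ X, x ≠ y → Disjoint (J x) (J y)) (t : ℝ) (ht : -1 ≤ t) :
    Ex n p (fun G => (1 + t) ^ (cntJ X J G)) ≤ Real.exp (t * p ^ m * X.card) := by
  simp_rw [pow_cntJ]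
  rw [Ex_prod p X (fun _ => t) J hJ hd]
  have : ∀ x ∈ X, 1 + t * p ^ (J x).card ≤ Real.exp (t * p ^ m) := by
    intro x hx; rw [hm x hx]; linarith [Real.add_one_le_exp (t * p ^ m)]
  refine le_trans (Finset.prod_le_prod ?_ this) ?_
  · intro x _
    have h1 : p ^ (J x).card ≤ 1 := pow_le_one₀ hp hp1
    have h2 : 0 ≤ p ^ (J x).card := by positivity
    nlinarith
  · rw [Finset.prod_const, ← Real.exp_nat_mul]
    apply le_of_eq; congr 1; ring

lemma chernoff_upper {n : ℕ} {ι : Type*} (p : ℝ) (hp : 0 ≤ p) (hp1 : p ≤ 1) (X : Finset ι) (m : ℕ)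
    (J : ι → Finset (Sym2 (Fin n))) (hJ : ∀ x ∈ X, J x ⊆ ndg n) (hm : ∀ x ∈ X, (J x).card = m)
    (hd : ∀ x ∈ X, ∀ y ∈ X, x ≠ y → Disjoint (J x) (J y)) (N η : ℝ) (hN : (X.card : ℝ) ≤ N)
    (hη : 0 < η) (hη1 : η ≤ 1) :
    gnpProb n p {G | p ^ m * X.card + η * p ^ m * N < cntJ X J G} ≤
      Real.exp (- (η ^ 2 / 3) * (p ^ m * N)) := by
  set L := Real.log (1 + η) with hL
  have hL1 : 2 * η / (η + 2) ≤ L := Real.le_log_one_add_of_nonneg hη.le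
  have hL0 : 0 ≤ L := le_trans (by positivity) hL1
  set thr := p ^ m * X.card + η * p ^ m * N with hthr
  have hN0 : 0 ≤ N := le_trans (by positivity) hN
  have hthr0 : 0 ≤ thr := by positivity
  have h1 : gnpProb n p {G | thr < cntJ X J G} ≤
      Ex n p (fun G => Real.exp (-L * thr) * (1 + η) ^ (cntJ X J G)) := by
    refine gnpProb_le hp hp1 (fun G => by positivity) fun G hG => ?_
    have h2 : (1 + η) ^ (cntJ X J G) = Real.exp (L * cntJ X J G) := by
      rw [mul_comm, Real.exp_nat_mul, Real.exp_log (by linarith)]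
    rw [h2, ← Real.exp_add]
    have hG' : thr < cntJ X J G := hG
    refine Real.one_le_exp ?_
    nlinarith
  refine le_trans h1 ?_
  rw [Ex_smul]
  refine le_trans (mul_le_mul_of_nonneg_left (Ex_pow_cntJ p hp hp1 X m J hJ hm hd η (by linarith))
    (Real.exp_nonneg _)) ?_
  rw [← Real.exp_add]
  apply Real.exp_le_exp.2
  have h3 : 2 * η / (η + 2) * thr ≤ L * thr := mul_le_mul_of_nonneg_right hL1 hthr0
  have hq : 0 ≤ p ^ m := by positivity
  have h4 : η * p ^ m * X.card - 2 * η / (η + 2) * thr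
      = η ^ 2 / (η + 2) * (p ^ m * (X.card - 2 * N)) := by
    rw [hthr]; field_simp; ring
  have h5 : η ^ 2 / (η + 2) * (p ^ m * (X.card - 2 * N)) ≤ η ^ 2 / (η + 2) * (p ^ m * (- N)) := by
    gcongr; linarith
  have h6 : η ^ 2 / 3 * (p ^ m * N) ≤ η ^ 2 / (η + 2) * (p ^ m * N) := by
    gcongr; linarith
  nlinarith

lemma chernoff_lower {n : ℕ} {ι : Type*} (p : ℝ) (hp : 0 ≤ p) (hp1 : p ≤ 1) (X : Finset ι) (m : ℕ)
    (J : ι → Finset (Sym2 (Fin n))) (hJ : ∀ x ∈ X, J x ⊆ ndg n) (hm : ∀ x ∈ X, (J x).card = m)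
    (hd : ∀ x ∈ X, ∀ y ∈ X, x ≠ y → Disjoint (J x) (J y)) (N η : ℝ) (hN : (X.card : ℝ) ≤ N)
    (hη : 0 < η) (hη1 : η ≤ 1) :
    gnpProb n p {G | (cntJ X J G : ℝ) < p ^ m * X.card - η * p ^ m * N} ≤
      Real.exp (- (η ^ 2 / 8) * (p ^ m * N)) := by
  set t := η / 4 with ht
  set L := -Real.log (1 - t) with hL
  have hL1 : t ≤ L := by
    have := Real.log_le_sub_one_of_pos (show 0 < 1 - t by linarith)
    linarith
  have hL2 : L ≤ t + 2 * t ^ 2 := by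
    have h1 := Real.log_le_sub_one_of_pos (show 0 < (1 - t)⁻¹ by
      apply inv_pos.2; linarith)
    rw [Real.log_inv] at h1
    have h2 : (1 - t)⁻¹ - 1 ≤ t + 2 * t ^ 2 := by
      rw [sub_le_iff_le_add, inv_le_iff_one_le_mul₀ (by linarith)]
      nlinarith [sq_nonneg t]
    linarith
  set thr := p ^ m * X.card - η * p ^ m * N with hthr
  have hN0 : 0 ≤ N := le_trans (by positivity) hN
  have h1 : gnpProb n p {G | (cntJ X J G : ℝ) < thr} ≤
      Ex n p (fun G => Real.exp (L * thr) * (1 + (-t)) ^ (cntJ X J G)) := by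
    refine gnpProb_le hp hp1 (fun G => ?_) fun G hG => ?_
    · have : 0 ≤ 1 + -t := by linarith
      positivity
    have h2 : (1 + -t) ^ (cntJ X J G) = Real.exp (-L * cntJ X J G) := by
      rw [mul_comm, Real.exp_nat_mul, hL, neg_neg, Real.exp_log (by linarith)]; ring_nf
    rw [h2, ← Real.exp_add]
    have hG' : (cntJ X J G : ℝ) < thr := hG
    refine Real.one_le_exp ?_
    nlinarith
  refine le_trans h1 ?_
  rw [Ex_smul]
  refine le_trans (mul_le_mul_of_nonneg_left (Ex_pow_cntJ p hp hp1 X m J hJ hm hd (-t) (by linarith))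
    (Real.exp_nonneg _)) ?_
  rw [← Real.exp_add]
  apply Real.exp_le_exp.2
  have hq : 0 ≤ p ^ m := by positivity
  have e1 : L * (p ^ m * X.card) ≤ (t + 2 * t ^ 2) * (p ^ m * X.card) := by gcongr
  have e2 : t * (η * p ^ m * N) ≤ L * (η * p ^ m * N) := by gcongr
  have e3 : 2 * t ^ 2 * (p ^ m * X.card) ≤ 2 * t ^ 2 * (p ^ m * N) := by gcongr
  have e4 : 2 * t ^ 2 * (p ^ m * N) - t * (η * p ^ m * N) = - (η ^ 2 / 8) * (p ^ m * N) := by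
    rw [ht]; ring
  rw [hthr]
  nlinarith

lemma mem_eset {n : ℕ} (G : SimpleGraph (Fin n)) (x y : Fin n) : s(x, y) ∈ eset G ↔ G.Adj x y := by
  simp [eset]

/-- N1 -/
def N1 (η : ℝ) (n : ℕ) (p : ℝ) (G : SimpleGraph (Fin n)) : Prop :=
  (∀ v, (1 - η) * (p * n) ≤ (degIn G v univ : ℝ) ∧ (degIn G v univ : ℝ) ≤ (1 + η) * (p * n)) ∧
  ∀ u v, u ≠ v → (codegIn G u v univ : ℝ) ≤ (1 + η) * (p ^ 2 * n)

lemma gnpProb_biUnion {n : ℕ} {ι : Type*} {p : ℝ} (h0 : 0 ≤ p) (h1 : p ≤ 1) (s : Finset ι)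
    (A : ι → Set (SimpleGraph (Fin n))) (B : Set (SimpleGraph (Fin n)))
    (h : ∀ G ∈ B, ∃ i ∈ s, G ∈ A i) :
    gnpProb n p B ≤ ∑ i ∈ s, gnpProb n p (A i) := by
  simp_rw [gnpProb_eq (p := p) (A := A _)]
  rw [← Ex_sum]
  refine gnpProb_le h0 h1 (fun G => ?_) fun G hG => ?_
  · exact Finset.sum_nonneg fun i _ => by split_ifs <;> norm_num
  · obtain ⟨i, hi, hi'⟩ := h G hG
    refine le_trans ?_ (Finset.single_le_sum (f := fun i => if G ∈ A i then (1:ℝ) else 0)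
      (fun i _ => by split_ifs <;> norm_num) hi)
    simp [hi']

lemma N1_deg {n : ℕ} (v : Fin n) (G : SimpleGraph (Fin n)) :
    degIn G v univ = cntJ (univ.erase v) (fun x => {s(v, x)}) G := by
  unfold degIn cntJ
  congr 1
  ext x
  simp only [mem_filter, mem_univ, true_and, mem_erase, singleton_subset_iff, mem_eset]
  constructor
  · intro h; exact ⟨⟨h.ne', trivial⟩, h⟩
  · intro h; exact h.2

lemma N1_codeg {n : ℕ} (u v : Fin n) (G : SimpleGraph (Fin n)) :
    codegIn G u v univ = cntJ ((univ.erase v).erase u) (fun x => {s(u, x), s(v, x)}) G := by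
  unfold codegIn cntJ
  congr 1
  ext x
  simp only [mem_filter, mem_univ, true_and, mem_erase, insert_subset_iff, singleton_subset_iff,
    mem_eset]
  constructor
  · intro h; exact ⟨⟨h.1.ne', h.2.ne', trivial⟩, h⟩
  · intro h; exact h.2

lemma p_facts {C : ℝ} (hC : 0 < C) {n : ℕ} (hn : 2 ≤ n) {p : ℝ}
    (hp : C * Real.sqrt (Real.log n / n) ≤ p) :
    0 < p ∧ C ^ 2 * Real.log n ≤ p ^ 2 * n := by
  have hn' : (2:ℝ) ≤ n := by exact_mod_cast hn
  have hl : 0 < Real.log n := Real.log_pos (by linarith)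
  have hq : 0 < Real.log n / n := by positivity
  have h1 : 0 < C * Real.sqrt (Real.log n / n) := by positivity
  refine ⟨lt_of_lt_of_le h1 hp, ?_⟩
  have h2 : (C * Real.sqrt (Real.log n / n)) ^ 2 ≤ p ^ 2 := by gcongr
  rw [mul_pow, Real.sq_sqrt hq.le] at h2
  have h3 := mul_le_mul_of_nonneg_right h2 (show (0:ℝ) ≤ n by positivity)
  calc C ^ 2 * Real.log n = C ^ 2 * (Real.log n / n) * n := by field_simp
    _ ≤ _ := h3

theorem whp_N1 (η : ℝ) (hη : 0 < η) (hη1 : η ≤ 1) : ∃ C, 0 < C ∧ Whp C (N1 η) := by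
  refine ⟨20 / η, by positivity, fun τ hτ => ?_⟩
  obtain ⟨n0, hn0⟩ := exists_nat_gt (3 / τ + 4 / η + 2)
  refine ⟨n0, fun n hn p hp hp1 => ?_⟩
  have hnn : 3 / τ + 4 / η + 2 < (n : ℝ) := lt_of_lt_of_le hn0 (by exact_mod_cast hn)
  have hn1 : 3 / τ < n := by
    have : 0 < 4 / η := by positivity
    linarith
  have hn3 : 4 / η < n := by
    have : 0 < 3 / τ := by positivity
    linarith
  have hn2 : (2:ℝ) < n := by
    have : 0 < 3 / τ := by positivity
    have : 0 < 4 / η := by positivity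
    linarith
  obtain ⟨hp0, hpn⟩ := p_facts (by positivity) (by exact_mod_cast hn2.le) hp
  have hl : 0 < Real.log n := Real.log_pos (by linarith)
  have hbig : ∀ c q : ℝ, p ^ 2 ≤ q → η ^ 2 / 32 ≤ c →
      Real.exp (-c * (q * n)) ≤ (n : ℝ)⁻¹ ^ 3 := by
    intro c q hq hc
    have h1 : (n:ℝ)⁻¹ ^ 3 = Real.exp (-(3 * Real.log n)) := by
      rw [Real.exp_neg, mul_comm, Real.exp_mul, Real.exp_log (by linarith)]
      norm_num
    rw [h1]
    apply Real.exp_le_exp.2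
    have h2 : (20 / η) ^ 2 * Real.log n ≤ q * n := le_trans hpn (by gcongr)
    have h3 : η ^ 2 / 32 * ((20 / η) ^ 2 * Real.log n) ≤ c * (q * n) := by
      have hc0 : 0 ≤ c := le_trans (by positivity) hc
      gcongr
    have h4 : η ^ 2 / 32 * ((20 / η) ^ 2 * Real.log n) = 12.5 * Real.log n := by
      field_simp; norm_num
    linarith
  have hpp : p ^ 2 ≤ p := by nlinarith
  set X := (univ : Finset (Fin n × Fin n))
  have key : gnpProb n p {G | ¬ N1 η n p G} ≤ ∑ x ∈ X, 3 * (n:ℝ)⁻¹ ^ 3 := by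
    refine le_trans (gnpProb_biUnion hp0.le hp1 X (fun x =>
      ({G | p ^ 1 * ((univ.erase x.1).card : ℝ) + η * p ^ 1 * n <
          cntJ (univ.erase x.1) (fun y => {s(x.1, y)}) G} ∪
      {G | (cntJ (univ.erase x.1) (fun y => {s(x.1, y)}) G : ℝ) <
        p ^ 1 * ((univ.erase x.1).card : ℝ) - η / 2 * p ^ 1 * n}) ∪
      (if x.1 = x.2 then ∅ else
      {G | p ^ 2 * (((univ.erase x.2).erase x.1).card : ℝ) + η * p ^ 2 * n <
        cntJ ((univ.erase x.2).erase x.1) (fun y => {s(x.1, y), s(x.2, y)}) G})) _ ?_) ?_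
    · intro G hG
      by_contra hcon
      push Not at hcon
      apply hG
      have hcon' : ∀ i : Fin n × Fin n, _ := fun i => hcon i (mem_univ _)
      simp only [Set.mem_union, not_or, Set.mem_ofPred_eq, not_lt] at hcon'
      refine ⟨fun v => ?_, fun u v huv => ?_⟩
      · have h := (hcon' (v, v)).1
        rw [N1_deg]
        have hc : (((univ : Finset (Fin n)).erase v).card : ℝ) = n - 1 := by
          rw [card_erase_of_mem (mem_univ _)]
          simp only [card_univ, Fintype.card_fin]
          rw [Nat.cast_sub (by exact_mod_cast (by linarith : (1:ℝ) ≤ n))]; simp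
        dsimp only at h
        rw [hc] at h
        have h5 : 4 < n * η := by rwa [div_lt_iff₀ hη] at hn3
        refine ⟨?_, ?_⟩
        · nlinarith [h.2]
        · nlinarith [h.1]
      · have h := (hcon' (u, v)).2
        simp only [huv, if_false, Set.mem_ofPred_eq, not_lt] at h
        rw [N1_codeg]
        refine le_trans h ?_
        have hc : (((univ.erase v).erase u : Finset (Fin n)).card : ℝ) ≤ n := by
          have := Finset.card_le_univ ((univ.erase v).erase u : Finset (Fin n))
          rw [Fintype.card_fin] at this
          exact_mod_cast this
        nlinarith [mul_le_mul_of_nonneg_left hc (sq_nonneg p)]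
    · refine Finset.sum_le_sum fun x _ => ?_
      have hcard : ∀ s : Finset (Fin n), (s.card : ℝ) ≤ n := by
        intro s
        have := Finset.card_le_univ s
        rw [Fintype.card_fin] at this
        exact_mod_cast this
      have hJ1 : ∀ y ∈ univ.erase x.1, ({s(x.1, y)} : Finset (Sym2 (Fin n))) ⊆ ndg n := by
        intro y hy
        simp only [mem_erase, mem_univ, and_true] at hy
        simp [ndg, Ne.symm hy]
      have hd1 : ∀ y ∈ univ.erase x.1, ∀ z ∈ univ.erase x.1, y ≠ z →
          Disjoint ({s(x.1, y)} : Finset (Sym2 (Fin n))) {s(x.1, z)} := by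
        intro y hy z hz hyz
        simp only [mem_erase, mem_univ, and_true] at hy hz
        simp [hyz, hy]
      have b1 := chernoff_upper p hp0.le hp1 (univ.erase x.1) 1 (fun y => {s(x.1, y)}) hJ1
        (fun _ _ => by simp) hd1 n η (hcard _) hη hη1
      have b2 := chernoff_lower p hp0.le hp1 (univ.erase x.1) 1 (fun y => {s(x.1, y)}) hJ1
        (fun _ _ => by simp) hd1 n (η/2) (hcard _) (by linarith) (by linarith)
      have b3 : gnpProb n p (if x.1 = x.2 then ∅ else
          {G | p ^ 2 * (((univ.erase x.2).erase x.1).card : ℝ) + η * p ^ 2 * n <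
          cntJ ((univ.erase x.2).erase x.1) (fun y => {s(x.1, y), s(x.2, y)}) G}) ≤ (n:ℝ)⁻¹ ^ 3 := by
        split_ifs with hx
        · rw [gnpProb_eq]
          simp [Ex]
        · refine le_trans (chernoff_upper p hp0.le hp1 _ 2 _ ?_ ?_ ?_ n η (hcard _) hη hη1)
            (hbig _ _ le_rfl (by nlinarith [sq_nonneg η]))
          · intro y hy
            simp only [mem_erase, mem_univ, and_true] at hy
            simp [ndg, insert_subset_iff, Ne.symm hy.1, Ne.symm hy.2]
          · intro y hy
            simp only [mem_erase, mem_univ, and_true] at hy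
            rw [card_pair]
            simp [hx, Ne.symm hy.1]
          · intro y hy z hz hyz
            simp only [mem_erase, mem_univ, and_true] at hy hz
            simp [Ne.symm hyz, hx, hz.1, hz.2, Ne.symm hx]
      refine le_trans (gnpProb_union hp0.le hp1) ?_
      have b4 := gnpProb_union hp0.le hp1
        (A := {G | p ^ 1 * ((univ.erase x.1).card : ℝ) + η * p ^ 1 * n <
          cntJ (univ.erase x.1) (fun y => {s(x.1, y)}) G})
        (B := {G | (cntJ (univ.erase x.1) (fun y => {s(x.1, y)}) G : ℝ) <
        p ^ 1 * ((univ.erase x.1).card : ℝ) - η / 2 * p ^ 1 * n})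
      have b5 := hbig (η ^ 2 / 3) (p ^ 1) (by simpa using hpp) (by nlinarith [sq_nonneg η])
      have b6 := hbig ((η / 2) ^ 2 / 8) (p ^ 1) (by simpa using hpp) (by nlinarith [sq_nonneg η])
      linarith
  refine le_trans key ?_
  rw [Finset.sum_const]
  simp only [X, card_univ, Fintype.card_prod, Fintype.card_fin, nsmul_eq_mul]
  push_cast
  have : (n:ℝ) * n * (3 * (n:ℝ)⁻¹ ^ 3) = 3 / n := by
    field_simp
  rw [this, div_le_iff₀ (by linarith)]
  rw [div_lt_iff₀ hτ] at hn1
  linarith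

end Part2

section Part3
/-! ## Module 3: deterministic sampling lemma -/

lemma maurey {α β : Type*} (f : α → β → ℝ) (S : Finset α) (hS : S.Nonempty) (Y : Finset β)
    (q : ℝ) (hq : ∀ x ∈ S, ∑ y ∈ Y, f x y ^ 2 ≤ q) (s : ℕ) :
    ∃ xs : Fin s → α, (∀ i, xs i ∈ S) ∧
      ∑ y ∈ Y, (∑ i, f (xs i) y - s * ((∑ x ∈ S, f x y) / S.card)) ^ 2 ≤ s * q := by
  have hc : (0:ℝ) < S.card := by exact_mod_cast hS.card_pos
  set g : β → ℝ := fun y => (∑ x ∈ S, f x y) / S.card with hg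
  have hgS : ∀ y, ∑ x ∈ S, (f x y - g y) = 0 := by
    intro y
    rw [Finset.sum_sub_distrib, Finset.sum_const, nsmul_eq_mul, hg]
    field_simp; ring
  induction s with
  | zero => exact ⟨Fin.elim0, fun i => i.elim0, by simp⟩
  | succ s ih =>
    obtain ⟨xs, hxs, hb⟩ := ih
    set R : β → ℝ := fun y => ∑ i, f (xs i) y - s * g y with hR
    have hex : ∃ x ∈ S, ∑ y ∈ Y, (R y + (f x y - g y)) ^ 2 ≤ ∑ y ∈ Y, R y ^ 2 + q := by
      by_contra hcon
      push Not at hcon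
      have h1 : ∑ x ∈ S, (∑ y ∈ Y, R y ^ 2 + q) < ∑ x ∈ S, ∑ y ∈ Y, (R y + (f x y - g y)) ^ 2 :=
        Finset.sum_lt_sum_of_nonempty hS hcon
      have h2 : ∑ x ∈ S, ∑ y ∈ Y, (R y + (f x y - g y)) ^ 2
          = ∑ x ∈ S, ∑ y ∈ Y, R y ^ 2 + ∑ x ∈ S, ∑ y ∈ Y, (f x y ^ 2)
            - ∑ y ∈ Y, S.card * g y ^ 2 := by
        have : ∀ x y, (R y + (f x y - g y)) ^ 2 = R y ^ 2 + f x y ^ 2 - g y ^ 2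
            + (2 * R y - 2 * g y) * (f x y - g y) := by intro x y; ring
        simp_rw [this, Finset.sum_add_distrib, Finset.sum_sub_distrib, Finset.sum_add_distrib]
        have h3 : ∑ x ∈ S, ∑ y ∈ Y, (2 * R y - 2 * g y) * (f x y - g y) = 0 := by
          rw [Finset.sum_comm]
          refine Finset.sum_eq_zero fun y _ => ?_
          rw [← Finset.mul_sum, hgS, mul_zero]
        rw [h3, add_zero]
        congr 1
        simp [Finset.mul_sum]
      have h4 : ∑ x ∈ S, ∑ y ∈ Y, (f x y ^ 2) ≤ ∑ x ∈ S, q := Finset.sum_le_sum hq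
      have h5 : 0 ≤ ∑ y ∈ Y, S.card * g y ^ 2 := Finset.sum_nonneg fun y _ => by positivity
      rw [Finset.sum_add_distrib] at h1
      linarith
    obtain ⟨x, hx, hx2⟩ := hex
    refine ⟨Fin.snoc xs x, ?_, ?_⟩
    · intro i
      refine Fin.lastCases ?_ ?_ i
      · simpa using hx
      · intro i; simpa using hxs i
    · refine le_trans (le_of_eq ?_) (le_trans hx2 ?_)
      · refine Finset.sum_congr rfl fun y _ => ?_
        rw [Fin.sum_univ_castSucc]
        simp only [Fin.snoc_castSucc, Fin.snoc_last, hR]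
        push_cast; ring
      · push_cast; linarith

/-- the positive set of a sample -/
def posSet {α β : Type*} (f : α → β → ℝ) (Y : Finset β) {s : ℕ} (xs : Fin s → α) : Finset β :=
  Y.filter fun y => 0 < ∑ i, f (xs i) y

lemma sampling {α β : Type*} (f : α → β → ℝ) (S : Finset α) (Y T : Finset β)
    (q σ E M c0 : ℝ) (s : ℕ) (hs : 0 < s) (hT : T ⊆ Y)
    (hq : ∀ x ∈ S, ∑ y ∈ Y, f x y ^ 2 ≤ q) (hσ : (S.card : ℝ) ≤ σ) (hE0 : 0 < E)
    (hE : E < ∑ x ∈ S, ∑ y ∈ T, f x y) (hc0 : 0 ≤ c0) (hσ4 : σ * c0 ≤ E / 4)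
    (hsE : 16 * σ ^ 2 * Y.card * q ≤ s * E ^ 2)
    (hM : ∀ x ∈ S, ∀ T' ⊆ Y, ∑ y ∈ T', f x y ≤ M) :
    ∃ xs : Fin s → α, (∀ i, xs i ∈ S) ∧
      E / 4 ≤ M * (S.filter fun x => c0 < ∑ y ∈ posSet f Y xs, f x y).card := by
  have hSne : S.Nonempty := by
    rcases S.eq_empty_or_nonempty with h | h
    · rw [h] at hE; simp at hE; linarith
    · exact h
  have hc : (0:ℝ) < S.card := by exact_mod_cast hSne.card_pos
  have hs' : (0:ℝ) < s := by exact_mod_cast hs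
  obtain ⟨xs, hxs, hb⟩ := maurey f S hSne Y q hq s
  refine ⟨xs, hxs, ?_⟩
  set g : β → ℝ := fun y => (∑ x ∈ S, f x y) / S.card with hg
  set F : β → ℝ := fun y => ∑ i, f (xs i) y with hF
  set T' := posSet f Y xs with hT'
  set B := ∑ y ∈ Y, |F y - s * g y| with hB
  have hB0 : 0 ≤ B := Finset.sum_nonneg fun _ _ => abs_nonneg _
  have hB2 : B ^ 2 ≤ Y.card * (s * q) := by
    have h1 := sq_sum_le_card_mul_sum_sq (s := Y) (f := fun y => |F y - s * g y|)
    refine le_trans h1 ?_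
    simp only [sq_abs]
    gcongr
  have hσ0 : 0 < σ := lt_of_lt_of_le hc hσ
  have hBE : 2 * σ * B ≤ s * E / 2 := by
    refine (pow_le_pow_iff_left₀ (by positivity) (by positivity) (two_ne_zero)).1 ?_
    calc (2 * σ * B) ^ 2 = 4 * σ ^ 2 * B ^ 2 := by ring
      _ ≤ 4 * σ ^ 2 * (Y.card * (s * q)) := by gcongr
      _ = s / 4 * (16 * σ ^ 2 * Y.card * q) := by ring
      _ ≤ s / 4 * (s * E ^ 2) := by gcongr
      _ = _ := by ring
  have hT'Y : T' ⊆ Y := Finset.filter_subset _ _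
  have habs : ∀ A ⊆ Y, |∑ y ∈ A, (F y - s * g y)| ≤ B := by
    intro A hA
    refine le_trans (Finset.abs_sum_le_sum_abs _ _) ?_
    exact Finset.sum_le_sum_of_subset_of_nonneg hA fun _ _ _ => abs_nonneg _
  have hFT : ∑ y ∈ T, F y ≤ ∑ y ∈ T', F y := by
    have h1 : ∑ y ∈ T, F y ≤ ∑ y ∈ T ∩ T', F y := by
      rw [← Finset.sum_sdiff (Finset.inter_subset_left : T ∩ T' ⊆ T)]
      have : ∑ y ∈ T \ (T ∩ T'), F y ≤ 0 := by
        refine Finset.sum_nonpos fun y hy => ?_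
        simp only [mem_sdiff, mem_inter, not_and] at hy
        by_contra hcon
        exact hy.2 hy.1 (by simp only [hT', posSet, mem_filter]; exact ⟨hT hy.1, not_le.1 hcon⟩)
      linarith
    refine le_trans h1 ?_
    refine Finset.sum_le_sum_of_subset_of_nonneg Finset.inter_subset_right fun y hy _ => ?_
    simp only [hT', posSet, mem_filter] at hy
    exact hy.2.le
  have hgsum : ∀ A : Finset β, S.card * ∑ y ∈ A, g y = ∑ x ∈ S, ∑ y ∈ A, f x y := by
    intro A
    rw [Finset.sum_comm, Finset.mul_sum]
    refine Finset.sum_congr rfl fun y _ => ?_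
    rw [hg]; field_simp
  have hmain : E / 2 ≤ ∑ x ∈ S, ∑ y ∈ T', f x y := by
    have a1 := (abs_le.1 (habs T hT)).1
    have a2 := (abs_le.1 (habs T' hT'Y)).2
    rw [Finset.sum_sub_distrib, ← Finset.mul_sum] at a1 a2
    have a3 : s * ∑ y ∈ T, g y - 2 * B ≤ s * ∑ y ∈ T', g y := by linarith
    have a4 := mul_le_mul_of_nonneg_left a3 hc.le
    rw [← hgsum] at hE ⊢
    have a5 : S.card * B ≤ σ * B := by gcongr
    have a6 : s * E < s * (S.card * ∑ y ∈ T, g y) := by gcongr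
    have a7 : s * (E / 2) ≤ s * (S.card * ∑ y ∈ T', g y) := by nlinarith
    exact le_of_mul_le_mul_left a7 hs'
  have hsplit := Finset.sum_filter_add_sum_filter_not S (fun x => c0 < ∑ y ∈ T', f x y)
    (fun x => ∑ y ∈ T', f x y)
  have hlow : ∑ x ∈ S with ¬ c0 < ∑ y ∈ T', f x y, ∑ y ∈ T', f x y ≤ E / 4 := by
    calc _ ≤ ∑ x ∈ S with ¬ c0 < ∑ y ∈ T', f x y, c0 := by
          refine Finset.sum_le_sum fun x hx => ?_
          simp only [mem_filter, not_lt] at hx; exact hx.2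
      _ ≤ ∑ x ∈ S, c0 := Finset.sum_le_sum_of_subset_of_nonneg (Finset.filter_subset _ _)
            fun _ _ _ => hc0
      _ = S.card * c0 := by simp
      _ ≤ σ * c0 := by gcongr
      _ ≤ _ := hσ4
  have hup : ∑ x ∈ S with c0 < ∑ y ∈ T', f x y, ∑ y ∈ T', f x y ≤
      M * (S.filter fun x => c0 < ∑ y ∈ T', f x y).card := by
    calc _ ≤ ∑ x ∈ S with c0 < ∑ y ∈ T', f x y, M := by
          refine Finset.sum_le_sum fun x hx => ?_
          exact hM x (Finset.mem_filter.1 hx).1 T' hT'Y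
      _ = _ := by simp [mul_comm]
  linarith

/-- number bound: `C(N,j) p^j` -/
lemma choose_mul_pow_le (N j : ℕ) (p κ : ℝ) (hp : 0 ≤ p) (h : (N : ℝ) * p * Real.exp 1 ≤ Real.exp (-κ) * j) :
    (N.choose j : ℝ) * p ^ j ≤ Real.exp (-κ * j) := by
  have h1 : (N.choose j : ℝ) ≤ (N:ℝ) ^ j / (j.factorial : ℝ) := Nat.choose_le_pow_div j N
  have h2 : (j:ℝ) ^ j / (j.factorial : ℝ) ≤ Real.exp j := Real.pow_div_factorial_le_exp j (by positivity) j
  have hf : (0:ℝ) < j.factorial := by positivity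
  have h3 : ((N:ℝ) * p * Real.exp 1) ^ j ≤ (Real.exp (-κ) * j) ^ j := by gcongr
  rw [mul_pow, mul_pow, mul_pow, ← Real.exp_nat_mul, ← Real.exp_nat_mul, mul_one] at h3
  have h4 : Real.exp (-κ * j) = Real.exp (j * -κ) := by ring_nf
  rw [h4]
  calc (N.choose j : ℝ) * p ^ j ≤ (N:ℝ) ^ j / (j.factorial : ℝ) * p ^ j := by gcongr
    _ = ((N:ℝ) ^ j * p ^ j * Real.exp j) / (j.factorial * Real.exp j) := by
        field_simp
    _ ≤ (Real.exp (j * -κ) * j ^ j) / (j.factorial * Real.exp j) := by gcongr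
    _ = Real.exp (j * -κ) * ((j:ℝ) ^ j / j.factorial) / Real.exp j := by field_simp
    _ ≤ Real.exp (j * -κ) * Real.exp j / Real.exp j := by gcongr
    _ = _ := by field_simp

end Part3

section Part4
/-! ## Module 4: certificates for irregular neighbourhoods -/

def sg (b : Bool) : ℝ := if b then 1 else -1

def Zset {α β : Type*} (f : α → β → ℝ) (X : Finset α) (Y : Finset β) (c0 : ℝ) {s : ℕ}
    (xs : Fin s → α) : Finset α := X.filter fun x => c0 < ∑ y ∈ posSet f Y xs, f x y

def fam {α β : Type*} (f : α → β → ℝ) (X : Finset α) (Y : Finset β) (c0 : ℝ) (s j : ℕ) :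
    Finset (Σ _ : Bool × (Fin s → α), Finset α) :=
  ((univ : Finset Bool) ×ˢ (Fintype.piFinset fun _ : Fin s => X)).sigma
    fun bx => powersetCard j (Zset (fun x y => sg bx.1 * f x y) X Y c0 bx.2)

lemma sg_sq (b : Bool) : sg b ^ 2 = 1 := by cases b <;> simp [sg]

lemma Zset_card {α β : Type*} (f : α → β → ℝ) (X : Finset α) (Y : Finset β) (c0 B : ℝ) {s : ℕ}
    (xs : Fin s → α) (hcut : ∀ X' ⊆ X, ∀ Y' ⊆ Y, ∑ x ∈ X', ∑ y ∈ Y', f x y ≤ B) :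
    c0 * (Zset f X Y c0 xs).card ≤ B := by
  refine le_trans ?_ (hcut (Zset f X Y c0 xs) (filter_subset _ _) (posSet f Y xs) (filter_subset _ _))
  rw [mul_comm, ← nsmul_eq_mul, ← Finset.sum_const]
  refine Finset.sum_le_sum fun x hx => ?_
  exact (Finset.mem_filter.1 hx).2.le

lemma stage {α β : Type*} (f : α → β → ℝ) (X S : Finset α) (Y T : Finset β) (hS : S ⊆ X)
    (hT : T ⊆ Y) (p w m Λ ε : ℝ) (s j : ℕ) (hp : 0 < p) (hw : 0 < w) (hm : 0 < m) (hΛ : 1 ≤ Λ)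
    (hε : 0 < ε) (hs : 32 * Λ ^ 5 / (ε ^ 2 * p) ≤ s) (hj : (j : ℝ) < ε / (4 * Λ ^ 2) * (p * w) + 1)
    (hSc : (S.card : ℝ) ≤ Λ * p * w) (hY : (Y.card : ℝ) ≤ Λ * m)
    (hq : ∀ x ∈ S, ∑ y ∈ Y, f x y ^ 2 ≤ 2 * Λ ^ 2 * p * m)
    (hM : ∀ x ∈ S, ∀ T' ⊆ Y, |∑ y ∈ T', f x y| ≤ Λ ^ 2 * p * m)
    (hE : ε * p ^ 2 * w * m < |∑ x ∈ S, ∑ y ∈ T, f x y|) :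
    ∃ c ∈ fam f X Y (ε / (4 * Λ ^ 2) * p * m) s j, c.2 ⊆ S := by
  have hs0 : 0 < s := by
    have : (0:ℝ) < s := lt_of_lt_of_le (by positivity) hs
    exact_mod_cast this
  obtain ⟨b, hb⟩ : ∃ b : Bool, ε * p ^ 2 * w * m < ∑ x ∈ S, ∑ y ∈ T, sg b * f x y := by
    rcases lt_abs.1 hE with h | h
    · exact ⟨true, by simpa [sg] using h⟩
    · refine ⟨false, ?_⟩
      simpa [sg] using h
  obtain ⟨xs, hxs, hc⟩ := sampling (fun x y => sg b * f x y) S Y T (2 * Λ ^ 2 * p * m) (Λ * p * w)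
    (ε * p ^ 2 * w * m) (Λ ^ 2 * p * m) (ε / (4 * Λ ^ 2) * p * m) s hs0 hT
    (by intro x hx; simp only [mul_pow, sg_sq, one_mul]; exact hq x hx) hSc (by positivity) hb
    (by positivity)
    (by
      have h1 : Λ * p * w * (ε / (4 * Λ ^ 2) * p * m) = ε * p ^ 2 * w * m / 4 * (1 / Λ) := by field_simp
      rw [h1]
      exact mul_le_of_le_one_right (by positivity) (by rw [div_le_one (by linarith)]; exact hΛ))
    (by
      have h1 : 32 * Λ ^ 5 ≤ s * (ε ^ 2 * p) := by
        rwa [div_le_iff₀ (by positivity)] at hs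
      calc 16 * (Λ * p * w) ^ 2 * Y.card * (2 * Λ ^ 2 * p * m)
          ≤ 16 * (Λ * p * w) ^ 2 * (Λ * m) * (2 * Λ ^ 2 * p * m) := by gcongr
        _ = 32 * Λ ^ 5 * (p ^ 3 * w ^ 2 * m ^ 2) := by ring
        _ ≤ s * (ε ^ 2 * p) * (p ^ 3 * w ^ 2 * m ^ 2) := by gcongr
        _ = _ := by ring)
    (by
      intro x hx T' hT'
      have h1 := hM x hx T' hT'
      rw [← Finset.mul_sum]
      have h2 : |sg b| = 1 := by cases b <;> simp [sg]
      refine le_trans (le_abs_self _) ?_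
      rw [abs_mul, h2, one_mul]; exact h1)
  set Z := S.filter fun x => ε / (4 * Λ ^ 2) * p * m < ∑ y ∈ posSet (fun x y => sg b * f x y) Y xs,
    sg b * f x y with hZ
  have hjZ : j ≤ Z.card := by
    have h1 : ε / (4 * Λ ^ 2) * (p * w) ≤ Z.card := by
      have h2 : Λ ^ 2 * p * m * (ε / (4 * Λ ^ 2) * (p * w)) ≤ Λ ^ 2 * p * m * Z.card := by
        refine le_trans (le_of_eq ?_) hc
        field_simp
      exact le_of_mul_le_mul_left h2 (by positivity)
    have : (j : ℝ) < Z.card + 1 := by linarith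
    have : j < Z.card + 1 := by exact_mod_cast this
    omega
  obtain ⟨J, hJZ, hJc⟩ := Finset.exists_subset_card_eq hjZ
  refine ⟨⟨(b, xs), J⟩, ?_, ?_⟩
  · simp only [fam, mem_sigma, mem_product, mem_univ, true_and, Fintype.mem_piFinset,
      mem_powersetCard]
    refine ⟨fun i => hS (hxs i), fun x hx => ?_, hJc⟩
    have := hJZ hx
    rw [hZ, mem_filter] at this
    exact mem_filter.2 ⟨hS this.1, this.2⟩
  · exact hJZ.trans (filter_subset _ _)

lemma fam_sum {α β : Type*} (f : α → β → ℝ) (X : Finset α) (Y : Finset β)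
    (p w m Λ ε η K : ℝ) (s j : ℕ) (hp : 0 < p) (hw : 0 < w) (hm : 0 < m) (hΛ : 1 ≤ Λ)
    (hε : 0 < ε) (hη : η = Real.exp (-((K + 5) * (4 * Λ ^ 2 / ε)) - 1) * (ε / (4 * Λ ^ 2)) ^ 2)
    (hK : 0 ≤ K)
    (hj : ε / (4 * Λ ^ 2) * (p * w) ≤ j)
    (hcut : ∀ X' ⊆ X, ∀ Y' ⊆ Y, |∑ x ∈ X', ∑ y ∈ Y', f x y| ≤ η * p * w * m)
    (hXs : (X.card : ℝ) ^ s ≤ Real.exp (p * w)) (h2 : 2 ≤ Real.exp (p * w)) :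
    ∑ c ∈ fam f X Y (ε / (4 * Λ ^ 2) * p * m) s j, p ^ c.2.card ≤ Real.exp (-(K + 3) * (p * w)) := by
  set κ := (K + 5) * (4 * Λ ^ 2 / ε) with hκ
  unfold fam
  rw [Finset.sum_sigma]
  have hin : ∀ bx ∈ (univ : Finset Bool) ×ˢ (Fintype.piFinset fun _ : Fin s => X),
      ∑ J ∈ powersetCard j (Zset (fun x y => sg bx.1 * f x y) X Y (ε / (4 * Λ ^ 2) * p * m) bx.2),
        p ^ J.card ≤ Real.exp (-(K + 5) * (p * w)) := by
    intro bx _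
    set Z := Zset (fun x y => sg bx.1 * f x y) X Y (ε / (4 * Λ ^ 2) * p * m) bx.2 with hZ
    have h1 : ∑ J ∈ powersetCard j Z, p ^ J.card = (Z.card.choose j) * p ^ j := by
      rw [Finset.sum_congr rfl (g := fun _ => p ^ j)]
      · simp
      · intro J hJ; rw [(mem_powersetCard.1 hJ).2]
    rw [h1]
    have hZc : (Z.card : ℝ) ≤ 4 * Λ ^ 2 / ε * η * w := by
      have h3 := Zset_card (fun x y => sg bx.1 * f x y) X Y (ε / (4 * Λ ^ 2) * p * m) (η * p * w * m) bx.2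
        (by
          intro X' hX' Y' hY'
          simp only [← Finset.mul_sum]
          have h2 : |sg bx.1| = 1 := by cases bx.1 <;> simp [sg]
          refine le_trans (le_abs_self _) ?_
          rw [abs_mul, h2, one_mul]; exact hcut X' hX' Y' hY')
      have h4 : ε / (4 * Λ ^ 2) * p * m * Z.card ≤ ε / (4 * Λ ^ 2) * p * m * (4 * Λ ^ 2 / ε * η * w) := by
        refine le_trans h3 (le_of_eq ?_)
        field_simp
      exact le_of_mul_le_mul_left h4 (by positivity)
    have h5 := choose_mul_pow_le Z.card j p κ hp.le (by
      calc (Z.card : ℝ) * p * Real.exp 1 ≤ 4 * Λ ^ 2 / ε * η * w * p * Real.exp 1 := by gcongr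
        _ = Real.exp (-κ) * (ε / (4 * Λ ^ 2) * (p * w)) := by
            rw [hη, sub_eq_add_neg, Real.exp_add, Real.exp_neg 1]
            field_simp
        _ ≤ _ := by gcongr)
    refine le_trans h5 (Real.exp_le_exp.2 ?_)
    have : κ * (ε / (4 * Λ ^ 2) * (p * w)) ≤ κ * j := by
      have : 0 ≤ κ := by positivity
      gcongr
    have h6 : κ * (ε / (4 * Λ ^ 2) * (p * w)) = (K + 5) * (p * w) := by
      rw [hκ]; field_simp
    linarith
  refine le_trans (Finset.sum_le_sum hin) ?_
  rw [Finset.sum_const, card_product, Fintype.card_piFinset_const, nsmul_eq_mul]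
  simp only [card_univ, Fintype.card_bool]
  push_cast
  calc (2 * (X.card : ℝ) ^ s) * Real.exp (-(K + 5) * (p * w))
      ≤ Real.exp (p * w) * Real.exp (p * w) * Real.exp (-(K + 5) * (p * w)) := by gcongr
    _ = _ := by rw [← Real.exp_add, ← Real.exp_add]; congr 1; ring

def starE {n : ℕ} (v : Fin n) (K : Finset (Fin n)) : Finset (Sym2 (Fin n)) := K.image fun x => s(v, x)

lemma starE_card {n : ℕ} (v : Fin n) (K : Finset (Fin n)) : (starE v K).card = K.card := by
  unfold starE
  rw [Finset.card_image_of_injective]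
  intro x y h
  exact Sym2.congr_right.1 h

/-- product of sums of monomials -/
lemma Ex_prod_sum {n : ℕ} {ι κ : Type*} (p : ℝ) (h : Finset (Sym2 (Fin n))) (hh : h ⊆ ndg n)
    (X : Finset ι) (F : ι → Finset κ) (J : ι → κ → Finset (Sym2 (Fin n)))
    (hJ : ∀ x ∈ X, ∀ c ∈ F x, J x c ⊆ ndg n) (hJh : ∀ x ∈ X, ∀ c ∈ F x, Disjoint h (J x c))
    (hd : ∀ x ∈ X, ∀ y ∈ X, x ≠ y → ∀ c ∈ F x, ∀ c' ∈ F y, Disjoint (J x c) (J y c')) :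
    Ex n p (fun G => (if h ⊆ eset G then 1 else 0) *
        ∏ x ∈ X, ∑ c ∈ F x, (if J x c ⊆ eset G then 1 else 0))
      = p ^ h.card * ∏ x ∈ X, ∑ c ∈ F x, p ^ (J x c).card := by
  simp_rw [Finset.prod_sum, Finset.mul_sum]
  rw [Ex_sum]
  refine Finset.sum_congr rfl fun a ha => ?_
  rw [Finset.mem_pi] at ha
  set U := h ∪ X.attach.biUnion (fun x => J x.1 (a x.1 x.2)) with hU
  have h1 : (fun G : SimpleGraph (Fin n) => (if h ⊆ eset G then (1:ℝ) else 0) *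
      ∏ x ∈ X.attach, (if J x.1 (a x.1 x.2) ⊆ eset G then (1:ℝ) else 0))
      = fun G => if U ⊆ eset G then 1 else 0 := by
    funext G
    by_cases hUG : U ⊆ eset G
    · rw [if_pos hUG]
      rw [hU, union_subset_iff, biUnion_subset] at hUG
      rw [if_pos hUG.1, one_mul]
      exact Finset.prod_eq_one fun x hx => by rw [if_pos (hUG.2 x hx)]
    · rw [if_neg hUG]
      rw [hU, union_subset_iff, biUnion_subset, not_and_or] at hUG
      rcases hUG with h2 | h2
      · rw [if_neg h2, zero_mul]
      · push Not at h2
        obtain ⟨x, hx, hx'⟩ := h2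
        rw [Finset.prod_eq_zero hx (by rw [if_neg hx']), mul_zero]
  rw [h1, Ex_sub, hU, card_union_of_disjoint, card_biUnion, pow_add, Finset.prod_pow_eq_pow_sum]
  · intro x _ y _ hxy
    exact hd x x.2 y y.2 (fun h => hxy (Subtype.ext h)) _ (ha _ _) _ (ha _ _)
  · rw [disjoint_biUnion_right]
    intro x _; exact hJh x x.2 _ (ha _ _)
  · rw [hU, union_subset_iff, biUnion_subset]
    exact ⟨hh, fun x _ => hJ x x.2 _ (ha _ _)⟩

end Part4

section Part5
/-! ## Module 5: P3, regularity of random neighbourhoods -/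

def fH {n : ℕ} (h : Finset (Sym2 (Fin n))) (d : ℝ) (x y : Fin n) : ℝ :=
  (if s(x, y) ∈ h then 1 else 0) - d

def dH {n : ℕ} (h : Finset (Sym2 (Fin n))) (A : Finset (Fin n)) : ℝ := h.card / ((A.card : ℝ) * A.card)

def btw {n : ℕ} (A B : Finset (Fin n)) : Finset (Sym2 (Fin n)) := (A ×ˢ B).image fun x => s(x.1, x.2)

def hdeg {n : ℕ} (h : Finset (Sym2 (Fin n))) (x : Fin n) (A : Finset (Fin n)) : ℕ :=
  (A.filter fun y => s(x, y) ∈ h).card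

structure Adm (n : ℕ) (p η Λ μ : ℝ) (A B : Finset (Fin n)) (h : Finset (Sym2 (Fin n))) : Prop where
  disj : Disjoint A B
  card : A.card = B.card
  large : μ * n ≤ A.card
  hd : dH h A ≤ Λ * p
  hsub : h ⊆ btw A B
  cut : ∀ S ⊆ A, ∀ T ⊆ B, |∑ x ∈ S, ∑ y ∈ T, fH h (dH h A) x y| ≤ η * p * A.card * A.card

/-- stage 1 regularity of a set `U ⊆ A` -/
def OKset (n : ℕ) (p ε Λ : ℝ) (A B : Finset (Fin n)) (h : Finset (Sym2 (Fin n)))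
    (U : Finset (Fin n)) : Prop :=
  U ⊆ A ∧ (U.card : ℝ) ≤ Λ * p * A.card ∧
  ∀ S ⊆ B, ∀ T ⊆ U.filter (fun x => (hdeg h x B : ℝ) ≤ Λ * p * A.card),
    |∑ x ∈ S, ∑ y ∈ T, fH h (dH h A) x y| ≤ ε * p * A.card * (p * A.card)

/-- the certificate family -/
def certs (n : ℕ) (p ε' ε Λ : ℝ) (s j' j : ℕ) (A B : Finset (Fin n)) (h : Finset (Sym2 (Fin n))) :
    Finset ((Σ _ : Bool × (Fin s → Fin n), Finset (Fin n)) ⊕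
      (Σ _ : Finset (Fin n), Σ _ : Bool × (Fin s → Fin n), Finset (Fin n))) :=
  (fam (fH h (dH h A)) A B (ε' / (4 * Λ ^ 2) * p * A.card) s j').disjSum
    ((univ.filter fun U => OKset n p ε' Λ A B h U).sigma fun U =>
      fam (fH h (dH h A)) B (U.filter (fun x => (hdeg h x B : ℝ) ≤ Λ * p * A.card))
        (ε / (4 * Λ ^ 2) * p * (p * A.card)) s j)

def certV {n s : ℕ} : ((Σ _ : Bool × (Fin s → Fin n), Finset (Fin n)) ⊕
      (Σ _ : Finset (Fin n), Σ _ : Bool × (Fin s → Fin n), Finset (Fin n))) → Finset (Fin n)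
  | Sum.inl c => c.2
  | Sum.inr c => c.1 ∪ c.2.2

lemma dH_nonneg {n : ℕ} (h : Finset (Sym2 (Fin n))) (A : Finset (Fin n)) : 0 ≤ dH h A := by
  unfold dH; positivity

lemma Adm.dH_le_one {n : ℕ} {p η Λ μ : ℝ} {A B : Finset (Fin n)} {h : Finset (Sym2 (Fin n))}
    (H : Adm n p η Λ μ A B h) : dH h A ≤ 1 := by
  unfold dH
  apply div_le_one_of_le₀ _ (by positivity)
  have h1 := card_le_card H.hsub
  have h2 : (btw A B).card ≤ A.card * A.card := by
    refine le_trans card_image_le ?_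
    rw [card_product, ← H.card]
  exact_mod_cast h1.trans h2

lemma fH_sum {n : ℕ} (h : Finset (Sym2 (Fin n))) (d : ℝ) (x : Fin n) (T : Finset (Fin n)) :
    ∑ y ∈ T, fH h d x y = hdeg h x T - d * T.card := by
  unfold fH hdeg
  rw [Finset.sum_sub_distrib, Finset.card_filter]
  push_cast
  simp [mul_comm]

lemma fH_sq_sum {n : ℕ} (h : Finset (Sym2 (Fin n))) (d : ℝ) (hd : 0 ≤ d) (hd1 : d ≤ 1) (x : Fin n)
    (T : Finset (Fin n)) :
    ∑ y ∈ T, fH h d x y ^ 2 ≤ hdeg h x T + d * T.card := by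
  have : ∑ y ∈ T, fH h d x y ^ 2 ≤ ∑ y ∈ T, ((if s(x, y) ∈ h then (1:ℝ) else 0) + d) := by
    refine Finset.sum_le_sum fun y _ => ?_
    unfold fH
    split_ifs <;> nlinarith
  refine le_trans this (le_of_eq ?_)
  unfold hdeg
  rw [Finset.sum_add_distrib, Finset.card_filter]
  push_cast
  simp [mul_comm]

lemma hdeg_mono {n : ℕ} (h : Finset (Sym2 (Fin n))) (x : Fin n) {S T : Finset (Fin n)} (hST : S ⊆ T) :
    hdeg h x S ≤ hdeg h x T := card_le_card (filter_subset_filter _ hST)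

lemma fH_abs_sum {n : ℕ} (h : Finset (Sym2 (Fin n))) (d : ℝ) (hd : 0 ≤ d) (x : Fin n)
    (T : Finset (Fin n)) (M : ℝ) (h1 : (hdeg h x T : ℝ) ≤ M) (h2 : d * T.card ≤ M) :
    |∑ y ∈ T, fH h d x y| ≤ M := by
  rw [fH_sum, abs_le]
  have : (0:ℝ) ≤ hdeg h x T := by positivity
  have : 0 ≤ d * T.card := by positivity
  constructor <;> linarith

lemma fH_comm {n : ℕ} (h : Finset (Sym2 (Fin n))) (d : ℝ) (x y : Fin n) : fH h d x y = fH h d y x := by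
  unfold fH; rw [Sym2.eq_swap]

/-- bad vertex abstractly: neighbourhoods `N ⊆ A`, `N' ⊆ B` -/
def AbsBad (n : ℕ) (p ε Λ : ℝ) (A B : Finset (Fin n)) (h : Finset (Sym2 (Fin n)))
    (N N' : Finset (Fin n)) : Prop :=
  (N.card : ℝ) ≤ Λ * p * A.card ∧ (N'.card : ℝ) ≤ Λ * p * A.card ∧
  ∃ S ⊆ N, ∃ T ⊆ N', (∀ x ∈ S, (hdeg h x B : ℝ) ≤ Λ * p * A.card) ∧
    (∀ y ∈ T, (hdeg h y N : ℝ) ≤ Λ * p ^ 2 * A.card) ∧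
    ε * p ^ 3 * A.card ^ 2 < |∑ x ∈ S, ∑ y ∈ T, fH h (dH h A) x y|

lemma fH_sum_comm {n : ℕ} (h : Finset (Sym2 (Fin n))) (d : ℝ) (S T : Finset (Fin n)) :
    ∑ x ∈ S, ∑ y ∈ T, fH h d x y = ∑ y ∈ T, ∑ x ∈ S, fH h d y x := by
  rw [Finset.sum_comm]
  exact Finset.sum_congr rfl fun x _ => Finset.sum_congr rfl fun y _ => fH_comm h d _ _

set_option maxHeartbeats 1000000 in
lemma exists_cert {n : ℕ} {p η ε' ε Λ μ : ℝ} {A B N N' : Finset (Fin n)}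
    {h : Finset (Sym2 (Fin n))} (s j' j : ℕ) (H : Adm n p η Λ μ A B h) (hp : 0 < p)
    (hΛ : 1 ≤ Λ) (hε : 0 < ε) (hε' : 0 < ε') (hA : 0 < A.card)
    (hs' : 32 * Λ ^ 5 / (ε' ^ 2 * p) ≤ s) (hs : 32 * Λ ^ 5 / (ε ^ 2 * p) ≤ s)
    (hj' : (j' : ℝ) < ε' / (4 * Λ ^ 2) * (p * A.card) + 1)
    (hj : (j : ℝ) < ε / (4 * Λ ^ 2) * (p * A.card) + 1)
    (hN : N ⊆ A) (hN' : N' ⊆ B) (hbad : AbsBad n p ε Λ A B h N N') :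
    ∃ c ∈ certs n p ε' ε Λ s j' j A B h, certV c ⊆ N ∪ N' := by
  obtain ⟨hNc, hN'c, S, hSN, T, hTN', hS, hT, hE⟩ := hbad
  have hw : (0:ℝ) < A.card := by exact_mod_cast hA
  have hd0 := dH_nonneg h A
  have hd1 := H.dH_le_one
  have hBc : (B.card : ℝ) = A.card := by exact_mod_cast H.card.symm
  set d := dH h A with hd
  set N0 := N.filter (fun x => (hdeg h x B : ℝ) ≤ Λ * p * A.card) with hN0
  by_cases hOK : OKset n p ε' Λ A B h N
  · -- stage 2
    obtain ⟨c, hc, hcT⟩ := stage (fH h d) B T N0 S (hTN'.trans hN')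
      (fun x hx => mem_filter.2 ⟨hSN hx, hS x hx⟩) p A.card (p * A.card) Λ ε s j hp hw
      (by positivity) hΛ hε hs hj (le_trans (by exact_mod_cast card_le_card hTN') hN'c)
      (by
        refine le_trans (by exact_mod_cast card_le_card (filter_subset _ _)) (le_trans hNc ?_)
        linarith)
      (by
        intro x hx
        refine le_trans (fH_sq_sum h d hd0 hd1 x N0) ?_
        have h1 : (hdeg h x N0 : ℝ) ≤ Λ * p ^ 2 * A.card :=
          le_trans (by exact_mod_cast hdeg_mono h x (filter_subset _ _)) (hT x hx)
        have h2 : (N0.card : ℝ) ≤ Λ * p * A.card :=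
          le_trans (by exact_mod_cast card_le_card (filter_subset _ _)) hNc
        have h3 : d * N0.card ≤ (Λ * p) * (Λ * p * A.card) :=
          mul_le_mul H.hd h2 (by positivity) (by positivity)
        have h4 : Λ * (p ^ 2 * A.card) ≤ Λ ^ 2 * (p ^ 2 * A.card) := by
          apply mul_le_mul_of_nonneg_right _ (by positivity); nlinarith
        linarith)
      (by
        intro x hx T' hT'
        have h1 : (hdeg h x T' : ℝ) ≤ Λ * p ^ 2 * A.card :=
          le_trans (by exact_mod_cast hdeg_mono h x (hT'.trans (filter_subset _ _))) (hT x hx)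
        have h2 : (T'.card : ℝ) ≤ Λ * p * A.card :=
          le_trans (by exact_mod_cast card_le_card (hT'.trans (filter_subset _ _))) hNc
        have h3 : d * T'.card ≤ (Λ * p) * (Λ * p * A.card) :=
          mul_le_mul H.hd h2 (by positivity) (by positivity)
        have h4 : Λ * (p ^ 2 * A.card) ≤ Λ ^ 2 * (p ^ 2 * A.card) := by
          apply mul_le_mul_of_nonneg_right _ (by positivity); nlinarith
        refine fH_abs_sum h d hd0 x T' _ ?_ ?_
        · linarith
        · linarith)
      (by
        rw [fH_sum_comm]
        refine lt_of_le_of_lt (le_of_eq ?_) hE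
        ring)
    refine ⟨Sum.inr ⟨N, c⟩, ?_, ?_⟩
    · exact Finset.inr_mem_disjSum.2 (mem_sigma.2 ⟨mem_filter.2 ⟨mem_univ _, hOK⟩, hc⟩)
    · simp only [certV]
      exact union_subset_union_right (hcT.trans hTN')
  · have hcon : ∃ T ⊆ B, ∃ S ⊆ N0, ε' * p * A.card * (p * A.card) <
        |∑ x ∈ T, ∑ y ∈ S, fH h d x y| := by
      by_contra hcon
      push Not at hcon
      exact hOK ⟨hN, hNc, hcon⟩
    obtain ⟨T1, hT1, S1, hS1, hE1⟩ := hcon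
    obtain ⟨c, hc, hcS⟩ := stage (fH h d) A S1 B T1 (hS1.trans ((filter_subset _ _).trans hN)) hT1
      p A.card A.card Λ ε' s j' hp hw hw hΛ hε' hs' hj'
      (le_trans (by exact_mod_cast card_le_card (hS1.trans (filter_subset _ _))) hNc)
      (by rw [hBc]; nlinarith)
      (by
        intro x hx
        refine le_trans (fH_sq_sum h d hd0 hd1 x B) ?_
        have h1 := (mem_filter.1 (hS1 hx)).2
        rw [hBc]
        have h3 : d * A.card ≤ Λ * p * A.card := mul_le_mul_of_nonneg_right H.hd hw.le
        have h4 : Λ * (p * A.card) ≤ Λ ^ 2 * (p * A.card) := by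
          apply mul_le_mul_of_nonneg_right _ (by positivity); nlinarith
        linarith)
      (by
        intro x hx T' hT'
        have h4 : Λ * p * A.card ≤ Λ ^ 2 * p * A.card := by
          gcongr; nlinarith
        refine fH_abs_sum h d hd0 x T' _ ?_ ?_
        · exact le_trans (le_trans (by exact_mod_cast hdeg_mono h x hT') (mem_filter.1 (hS1 hx)).2) h4
        · have : (T'.card : ℝ) ≤ A.card := by rw [← hBc]; exact_mod_cast card_le_card hT'
          exact le_trans (mul_le_mul H.hd this (by positivity) (by positivity)) h4)
      (by
        rw [fH_sum_comm]
        refine lt_of_le_of_lt (le_of_eq ?_) hE1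
        ring)
    refine ⟨Sum.inl c, ?_, ?_⟩
    · exact Finset.inl_mem_disjSum.2 hc
    · simp only [certV]
      exact (hcS.trans (hS1.trans (filter_subset _ _))).trans subset_union_left

end Part5

section Part6
/-! ## Module 6: P3 holds with high probability -/

lemma fam_sub {α β : Type*} {f : α → β → ℝ} {X : Finset α} {Y : Finset β} {c0 : ℝ} {s j : ℕ}
    {c : Σ _ : Bool × (Fin s → α), Finset α} (hc : c ∈ fam f X Y c0 s j) : c.2 ⊆ X := by
  have := (mem_sigma.1 hc).2
  exact (mem_powersetCard.1 this).1.trans (filter_subset _ _)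

lemma certV_sub {n : ℕ} {p ε' ε Λ : ℝ} {s j' j : ℕ} {A B : Finset (Fin n)} {h : Finset (Sym2 (Fin n))}
    {c} (hc : c ∈ certs n p ε' ε Λ s j' j A B h) : certV c ⊆ A ∪ B := by
  rcases c with c | c
  · exact (fam_sub (Finset.inl_mem_disjSum.1 hc)).trans subset_union_left
  · have := Finset.inr_mem_disjSum.1 hc
    rw [mem_sigma, mem_filter] at this
    exact union_subset_union this.1.2.1 (fam_sub this.2)

lemma sum_powerset_pow {α : Type*} (A : Finset α) (p : ℝ) (hp : 0 ≤ p) :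
    ∑ U ∈ A.powerset, p ^ U.card ≤ Real.exp (p * A.card) := by
  have h1 := Finset.sum_pow_mul_eq_add_pow p 1 A
  simp only [one_pow, mul_one] at h1
  rw [h1, mul_comm, Real.exp_nat_mul]
  gcongr
  exact Real.add_one_le_exp p

lemma certs_sum {n : ℕ} {p η ε' ε Λ μ K : ℝ} {A B : Finset (Fin n)}
    {h : Finset (Sym2 (Fin n))} (s j' j : ℕ) (H : Adm n p η Λ μ A B h) (hp : 0 < p)
    (hΛ : 1 ≤ Λ) (hε : 0 < ε) (hε' : 0 < ε') (hA : 0 < A.card) (hK : 0 ≤ K)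
    (hη : η = Real.exp (-((K + 5) * (4 * Λ ^ 2 / ε')) - 1) * (ε' / (4 * Λ ^ 2)) ^ 2)
    (hη' : ε' = Real.exp (-((K + 5) * (4 * Λ ^ 2 / ε)) - 1) * (ε / (4 * Λ ^ 2)) ^ 2)
    (hj' : ε' / (4 * Λ ^ 2) * (p * A.card) ≤ j') (hj : ε / (4 * Λ ^ 2) * (p * A.card) ≤ j)
    (hXs : (A.card : ℝ) ^ s ≤ Real.exp (p * A.card)) (h2 : 2 ≤ Real.exp (p * A.card)) :
    ∑ c ∈ certs n p ε' ε Λ s j' j A B h, p ^ (certV c).card ≤ Real.exp (-K * (p * A.card)) := by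
  have hw : (0:ℝ) < A.card := by exact_mod_cast hA
  unfold certs
  rw [Finset.sum_disjSum, Finset.sum_sigma]
  have b1 := fam_sum (fH h (dH h A)) A B p A.card A.card Λ ε' η K s j' hp hw hw hΛ hε' hη hK hj'
    H.cut hXs h2
  have b2 : ∑ U ∈ univ.filter (fun U => OKset n p ε' Λ A B h U),
      ∑ c ∈ fam (fH h (dH h A)) B (U.filter (fun x => (hdeg h x B : ℝ) ≤ Λ * p * A.card))
        (ε / (4 * Λ ^ 2) * p * (p * A.card)) s j, p ^ (U ∪ c.2).card ≤
      Real.exp (p * A.card) * Real.exp (-(K + 3) * (p * A.card)) := by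
    calc _ ≤ ∑ U ∈ univ.filter (fun U => OKset n p ε' Λ A B h U),
        p ^ U.card * Real.exp (-(K + 3) * (p * A.card)) := by
          refine Finset.sum_le_sum fun U hU => ?_
          rw [mem_filter] at hU
          have b3 := fam_sum (fH h (dH h A)) B
            (U.filter (fun x => (hdeg h x B : ℝ) ≤ Λ * p * A.card)) p A.card (p * A.card) Λ ε ε' K s j
            hp hw (by positivity) hΛ hε hη' hK hj hU.2.2.2 (by rw [← H.card]; exact hXs) h2
          refine le_trans (le_of_eq ?_) (mul_le_mul_of_nonneg_left b3 (by positivity))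
          rw [Finset.mul_sum]
          refine Finset.sum_congr rfl fun c hc => ?_
          rw [card_union_of_disjoint, pow_add]
          exact disjoint_of_subset_left hU.2.1 (disjoint_of_subset_right (fam_sub hc) H.disj)
      _ ≤ ∑ U ∈ A.powerset, p ^ U.card * Real.exp (-(K + 3) * (p * A.card)) := by
          refine Finset.sum_le_sum_of_subset_of_nonneg ?_ fun _ _ _ => by positivity
          intro U hU
          rw [mem_filter] at hU
          exact mem_powerset.2 hU.2.1
      _ ≤ _ := by
          rw [← Finset.sum_mul]
          gcongr
          exact sum_powerset_pow A p hp.le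
  refine le_trans (add_le_add b1 b2) ?_
  set a := p * (A.card : ℝ) with ha
  have ha0 : 0 < a := by positivity
  have e1 : Real.exp a * Real.exp (-(K+3) * a) = Real.exp (-(K+2) * a) := by
    rw [← Real.exp_add]; congr 1; ring
  have e2 : Real.exp (-(K+3) * a) ≤ Real.exp (-(K+2)*a) := Real.exp_le_exp.2 (by nlinarith)
  have e3 : 2 * Real.exp (-(K+2) * a) ≤ Real.exp a * Real.exp (-(K+2) * a) := by gcongr
  have e4 : Real.exp a * Real.exp (-(K+2) * a) ≤ Real.exp (-K * a) := by
    rw [← Real.exp_add]; exact Real.exp_le_exp.2 (by nlinarith)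
  rw [e1]; linarith

/-- the bad vertices in P3 -/
def P3Bad {n : ℕ} (Γ H : SimpleGraph (Fin n)) (ε Λ p : ℝ) (A B : Finset (Fin n)) (v : Fin n) : Prop :=
  ((nbhdIn Γ v A).card : ℝ) ≤ Λ * p * A.card ∧ ((nbhdIn Γ v B).card : ℝ) ≤ Λ * p * A.card ∧
  ∃ S ⊆ nbhdIn Γ v A, ∃ T ⊆ nbhdIn Γ v B, (∀ x ∈ S, (degIn H x B : ℝ) ≤ Λ * p * A.card) ∧
    (∀ y ∈ T, (degIn H y (nbhdIn Γ v A) : ℝ) ≤ Λ * p ^ 2 * A.card) ∧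
    ε * p ^ 3 * A.card ^ 2 < |(eBtw H S T : ℝ) - dens H A B * S.card * T.card|

def CutReg {n : ℕ} (H : SimpleGraph (Fin n)) (η p : ℝ) (A B : Finset (Fin n)) : Prop :=
  ∀ S ⊆ A, ∀ T ⊆ B, |(eBtw H S T : ℝ) - dens H A B * S.card * T.card| ≤ η * p * (A.card * A.card)

def P3 (ε ζ Λ μ η : ℝ) (n : ℕ) (p : ℝ) (Γ : SimpleGraph (Fin n)) : Prop :=
  ∀ A B : Finset (Fin n), Disjoint A B → A.card = B.card → μ * n ≤ A.card →
    ∀ H ≤ Γ, dens H A B ≤ Λ * p → CutReg H η p A B →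
      (((univ \ (A ∪ B)).filter fun v => P3Bad Γ H ε Λ p A B v).card : ℝ) ≤ ζ * A.card

def hOf {n : ℕ} (H : SimpleGraph (Fin n)) (A B : Finset (Fin n)) : Finset (Sym2 (Fin n)) :=
  (btw A B).filter fun e => e ∈ eset H

lemma mem_hOf {n : ℕ} {H : SimpleGraph (Fin n)} {A B : Finset (Fin n)} {x y : Fin n} (hx : x ∈ A)
    (hy : y ∈ B) : s(x, y) ∈ hOf H A B ↔ H.Adj x y := by
  unfold hOf
  rw [mem_filter, mem_eset]
  refine ⟨fun h => h.2, fun h => ⟨?_, h⟩⟩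
  exact mem_image.2 ⟨(x, y), mem_product.2 ⟨hx, hy⟩, rfl⟩

lemma eBtw_sum {n : ℕ} (H : SimpleGraph (Fin n)) (S T : Finset (Fin n)) :
    (eBtw H S T : ℝ) = ∑ x ∈ S, ∑ y ∈ T, (if H.Adj x y then 1 else 0) := by
  unfold eBtw
  rw [Finset.card_filter, Finset.sum_product]
  push_cast
  rfl

lemma hOf_card {n : ℕ} (H : SimpleGraph (Fin n)) (A B : Finset (Fin n)) (hd : Disjoint A B) :
    (hOf H A B).card = eBtw H A B := by
  unfold eBtw hOf _root_.btw
  rw [Finset.filter_image, Finset.card_image_of_injOn]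
  · congr 1
    ext x
    simp [mem_eset]
  · rintro ⟨x, y⟩ hx ⟨x', y'⟩ hx' h
    simp only [coe_filter, mem_product, Set.mem_ofPred_eq] at hx hx'
    simp only [Sym2.eq, Sym2.rel_iff', Prod.mk.injEq, Prod.swap_prod_mk] at h
    rcases h with h | h
    · exact Prod.ext h.1 h.2
    · exfalso
      refine Finset.disjoint_left.1 hd hx.1.1 ?_
      rw [h.1]; exact hx'.1.2

lemma fH_hOf {n : ℕ} (H : SimpleGraph (Fin n)) {A B : Finset (Fin n)} (d : ℝ) {S T : Finset (Fin n)}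
    (hS : S ⊆ A) (hT : T ⊆ B) :
    ∑ x ∈ S, ∑ y ∈ T, fH (hOf H A B) d x y = (eBtw H S T : ℝ) - d * S.card * T.card := by
  rw [eBtw_sum]
  have : ∀ x ∈ S, ∑ y ∈ T, fH (hOf H A B) d x y = ∑ y ∈ T, (if H.Adj x y then (1:ℝ) else 0) - d * T.card := by
    intro x hx
    unfold fH
    rw [Finset.sum_sub_distrib]
    congr 1
    · refine Finset.sum_congr rfl fun y hy => ?_
      rw [if_congr (mem_hOf (hS hx) (hT hy)) rfl rfl]
    · simp [mul_comm]
  rw [Finset.sum_congr rfl this, Finset.sum_sub_distrib]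
  simp; ring

lemma dH_hOf {n : ℕ} (H : SimpleGraph (Fin n)) {A B : Finset (Fin n)} (hd : Disjoint A B)
    (hc : A.card = B.card) : dH (hOf H A B) A = dens H A B := by
  unfold dH RandomTriangle.dens
  rw [hOf_card H A B hd, hc]

lemma absBad_of {n : ℕ} {Γ H : SimpleGraph (Fin n)} {ε Λ p : ℝ} {A B : Finset (Fin n)} {v : Fin n}
    (hd : Disjoint A B) (hc : A.card = B.card) (h : P3Bad Γ H ε Λ p A B v) :
    AbsBad n p ε Λ A B (hOf H A B) (nbhdIn Γ v A) (nbhdIn Γ v B) := by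
  obtain ⟨h1, h2, S, hS, T, hT, h3, h4, h5⟩ := h
  have hSA : S ⊆ A := hS.trans (filter_subset _ _)
  have hTB : T ⊆ B := hT.trans (filter_subset _ _)
  refine ⟨h1, h2, S, hS, T, hT, fun x hx => ?_, fun y hy => ?_, ?_⟩
  · refine le_trans (le_of_eq ?_) (h3 x hx)
    unfold hdeg degIn
    congr 2
    exact Finset.filter_congr fun y hy => mem_hOf (hSA hx) hy
  · refine le_trans (le_of_eq ?_) (h4 y hy)
    unfold hdeg degIn
    congr 2
    refine Finset.filter_congr fun x hx => ?_
    rw [Sym2.eq_swap, mem_hOf (filter_subset _ _ hx) (hTB hy), SimpleGraph.adj_comm]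
  · rw [fH_hOf H _ hSA hTB, dH_hOf H hd hc]
    exact h5

set_option maxHeartbeats 1000000 in
lemma P3_prob {n : ℕ} {p η ε' ε Λ μ ζ K : ℝ} (s : ℕ) (hp : 0 < p) (hp1 : p ≤ 1)
    (hΛ : 1 ≤ Λ) (hε : 0 < ε) (hε' : 0 < ε') (hζ : 0 < ζ) (hK : K = 2 / ζ) (hμ : 0 < μ) (hn : 0 < n)
    (hη : η = Real.exp (-((K + 5) * (4 * Λ ^ 2 / ε')) - 1) * (ε' / (4 * Λ ^ 2)) ^ 2)
    (hη' : ε' = Real.exp (-((K + 5) * (4 * Λ ^ 2 / ε)) - 1) * (ε / (4 * Λ ^ 2)) ^ 2)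
    (hs' : 32 * Λ ^ 5 / (ε' ^ 2 * p) ≤ s) (hs : 32 * Λ ^ 5 / (ε ^ 2 * p) ≤ s)
    (hXs : (n : ℝ) ^ s ≤ Real.exp (p * (μ * n))) (h2 : 2 ≤ Real.exp (p * (μ * n))) :
    gnpProb n p {Γ | ¬ P3 ε ζ Λ μ η n p Γ} ≤ 8 ^ n * Real.exp (-p * (μ * n) ^ 2) := by
  set jf : Finset (Fin n) → ℕ := fun A => ⌈ε / (4 * Λ ^ 2) * (p * A.card)⌉₊ with hjf
  set jf' : Finset (Fin n) → ℕ := fun A => ⌈ε' / (4 * Λ ^ 2) * (p * A.card)⌉₊ with hjf'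
  have hK0 : 0 ≤ K := by rw [hK]; positivity
  -- index set
  set Q : Finset (Finset (Fin n) × Finset (Fin n) × Finset (Fin n)) := univ with hQ
  set hs1 : (Finset (Fin n) × Finset (Fin n) × Finset (Fin n)) → Finset (Finset (Sym2 (Fin n))) :=
    fun t => (btw t.1 t.2.1).powerset.filter fun h => Adm n p η Λ μ t.1 t.2.1 h ∧
      Disjoint t.2.2 (t.1 ∪ t.2.1) ∧ ζ * t.1.card ≤ t.2.2.card with hhs1
  set g : SimpleGraph (Fin n) → ℝ := fun G => ∑ t ∈ Q, ∑ h ∈ hs1 t,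
    ((if h ⊆ eset G then 1 else 0) * ∏ v ∈ t.2.2,
      ∑ c ∈ certs n p ε' ε Λ s (jf' t.1) (jf t.1) t.1 t.2.1 h,
        (if starE v (certV c) ⊆ eset G then (1:ℝ) else 0)) with hg
  have hgnn : ∀ (t : Finset (Fin n) × Finset (Fin n) × Finset (Fin n)) (h : Finset (Sym2 (Fin n)))
      (G : SimpleGraph (Fin n)), 0 ≤ ((if h ⊆ eset G then (1:ℝ) else 0) * ∏ v ∈ t.2.2,
      ∑ c ∈ certs n p ε' ε Λ s (jf' t.1) (jf t.1) t.1 t.2.1 h,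
        (if starE v (certV c) ⊆ eset G then (1:ℝ) else 0)) := by
    intro t h G
    refine mul_nonneg (by split_ifs <;> norm_num) (Finset.prod_nonneg fun v _ =>
      Finset.sum_nonneg fun c _ => by split_ifs <;> norm_num)
  have hbigA : ∀ A : Finset (Fin n), μ * n ≤ A.card → 0 < A.card := by
    intro A hA
    have : (0:ℝ) < μ * n := by positivity
    exact_mod_cast lt_of_lt_of_le this hA
  have step1 : gnpProb n p {Γ | ¬ P3 ε ζ Λ μ η n p Γ} ≤ Ex n p g := by
    refine gnpProb_le hp.le hp1 (fun G => Finset.sum_nonneg fun t _ => Finset.sum_nonneg fun h _ =>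
      hgnn t h G) fun G hG => ?_
    have hG' : ¬ P3 ε ζ Λ μ η n p G := hG
    unfold P3 at hG'
    push Not at hG'
    obtain ⟨A, B, hd, hc, hl, H, hHG, hdens, hcut, hbad⟩ := hG'
    set Y := (univ \ (A ∪ B)).filter fun v => P3Bad G H ε Λ p A B v with hY
    set h := hOf H A B with hh
    have hAdm : Adm n p η Λ μ A B h := by
      refine ⟨hd, hc, hl, by rw [dH_hOf H hd hc]; exact hdens, filter_subset _ _, ?_⟩
      intro S hS T hT
      rw [fH_hOf H _ hS hT, dH_hOf H hd hc]
      refine le_trans (hcut S hS T hT) (le_of_eq (by ring))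
    have hA0 := hbigA A hl
    have hYd : Disjoint Y (A ∪ B) := by
      refine disjoint_of_subset_left (filter_subset _ _) sdiff_disjoint
    have hmem : h ∈ hs1 (A, B, Y) := by
      simp only [hhs1, mem_filter, mem_powerset]
      exact ⟨filter_subset _ _, hAdm, hYd, hbad.le⟩
    refine le_trans ?_ (Finset.single_le_sum (f := fun t => ∑ h ∈ hs1 t,
      ((if h ⊆ eset G then (1:ℝ) else 0) * ∏ v ∈ t.2.2,
      ∑ c ∈ certs n p ε' ε Λ s (jf' t.1) (jf t.1) t.1 t.2.1 h,
        (if starE v (certV c) ⊆ eset G then (1:ℝ) else 0)))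
      (fun t _ => Finset.sum_nonneg fun h _ => hgnn t h G) (mem_univ (A, B, Y)))
    refine le_trans ?_ (Finset.single_le_sum (f := fun h =>
      ((if h ⊆ eset G then (1:ℝ) else 0) * ∏ v ∈ Y,
      ∑ c ∈ certs n p ε' ε Λ s (jf' A) (jf A) A B h,
        (if starE v (certV c) ⊆ eset G then (1:ℝ) else 0)))
      (fun h _ => hgnn (A, B, Y) h G) hmem)
    have hhG : h ⊆ eset G := by
      intro e he
      have := (mem_filter.1 he).2
      simp only [eset, mem_filter, mem_univ, true_and] at this ⊢
      exact SimpleGraph.edgeSet_mono hHG this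
    rw [if_pos hhG, one_mul]
    refine le_trans (le_of_eq (Finset.prod_const_one (s := Y)).symm) ?_
    refine Finset.prod_le_prod (fun _ _ => zero_le_one) fun v hv => ?_
    have hbv := (mem_filter.1 hv).2
    obtain ⟨c, hc1, hc2⟩ := exists_cert (ε' := ε') s (jf' A) (jf A) hAdm hp hΛ hε hε' hA0 hs' hs
      (Nat.ceil_lt_add_one (by positivity)) (Nat.ceil_lt_add_one (by positivity))
      (filter_subset _ _) (filter_subset _ _) (absBad_of hd hc hbv)
    refine le_trans ?_ (Finset.single_le_sum (f := fun c =>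
      if starE v (certV c) ⊆ eset G then (1:ℝ) else 0)
      (fun c _ => by split_ifs <;> norm_num) hc1)
    rw [if_pos]
    intro e he
    obtain ⟨x, hx, rfl⟩ := mem_image.1 he
    rw [mem_eset]
    rcases mem_union.1 (hc2 hx) with h3 | h3
    · exact (mem_filter.1 h3).2
    · exact (mem_filter.1 h3).2
  refine le_trans step1 ?_
  rw [hg, Ex_sum]
  have step2 : ∀ t ∈ Q, Ex n p (fun G => ∑ h ∈ hs1 t,
    ((if h ⊆ eset G then 1 else 0) * ∏ v ∈ t.2.2,
      ∑ c ∈ certs n p ε' ε Λ s (jf' t.1) (jf t.1) t.1 t.2.1 h,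
        (if starE v (certV c) ⊆ eset G then (1:ℝ) else 0))) ≤ Real.exp (-p * (μ * n) ^ 2) := by
    rintro ⟨A, B, Y⟩ -
    rw [Ex_sum]
    dsimp only
    by_cases hl : μ * n ≤ A.card ∧ A.card = B.card
    swap
    · have : hs1 (A, B, Y) = ∅ := by
        rw [hhs1, Finset.filter_eq_empty_iff]
        rintro h - ⟨h1, -, -⟩
        exact hl ⟨h1.large, h1.card⟩
      rw [this, Finset.sum_empty]
      positivity
    have hA0 := hbigA A hl.1
    have hw : (0:ℝ) < A.card := by exact_mod_cast hA0
    have hterm : ∀ h ∈ hs1 (A, B, Y), Ex n p (fun G => (if h ⊆ eset G then 1 else 0) * ∏ v ∈ Y,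
      ∑ c ∈ certs n p ε' ε Λ s (jf' A) (jf A) A B h,
        (if starE v (certV c) ⊆ eset G then (1:ℝ) else 0)) ≤
        p ^ h.card * Real.exp (-2 * (p * A.card ^ 2)) := by
      intro h hh
      simp only [hhs1, mem_filter, mem_powerset] at hh
      obtain ⟨hsub, hAdm, hYd, hYc⟩ := hh
      have hdiag : ∀ x ∈ A, ∀ y ∈ B, x ≠ y := fun x hx y hy hxy =>
        Finset.disjoint_left.1 hAdm.disj hx (hxy ▸ hy)
      have hvn : ∀ v ∈ Y, v ∉ A ∪ B := fun v hv => Finset.disjoint_left.1 hYd hv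
      rw [Ex_prod_sum]
      · refine mul_le_mul_of_nonneg_left ?_ (by positivity)
        have hcs := certs_sum s (jf' A) (jf A) hAdm hp hΛ hε hε' hA0 hK0 hη hη'
          (Nat.le_ceil _) (Nat.le_ceil _)
          (by
            have h1 : (A.card : ℝ) ≤ n := by
              have := Finset.card_le_univ A
              rw [Fintype.card_fin] at this
              exact_mod_cast this
            calc (A.card : ℝ) ^ s ≤ (n:ℝ) ^ s := by gcongr
              _ ≤ _ := hXs
              _ ≤ _ := Real.exp_le_exp.2 (by gcongr; exact hl.1))
          (le_trans h2 (Real.exp_le_exp.2 (by gcongr; exact hl.1)))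
        calc _ ≤ ∏ v ∈ Y, Real.exp (-K * (p * A.card)) := by
              refine Finset.prod_le_prod (fun v _ => Finset.sum_nonneg fun c _ => by positivity) ?_
              intro v _
              simp_rw [starE_card]
              exact hcs
          _ = Real.exp (Y.card * (-K * (p * A.card))) := by
              rw [Finset.prod_const, ← Real.exp_nat_mul]
          _ ≤ _ := by
              apply Real.exp_le_exp.2
              have h3 : (ζ * A.card) * (K * (p * A.card)) ≤ Y.card * (K * (p * A.card)) := by
                gcongr
              have h4 : (ζ * A.card) * (K * (p * A.card)) = 2 * (p * A.card ^ 2) := by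
                rw [hK]; field_simp
              nlinarith
      · intro e he
        obtain ⟨x, hx, rfl⟩ := mem_image.1 (hsub he)
        rw [mem_product] at hx
        simp [ndg, hdiag _ hx.1 _ hx.2]
      · intro v hv c hc e he
        obtain ⟨x, hx, rfl⟩ := mem_image.1 he
        have : v ≠ x := fun h => hvn v hv (h ▸ certV_sub hc hx)
        simp [ndg, this]
      · intro v hv c hc
        rw [Finset.disjoint_left]
        intro e he he'
        obtain ⟨x, hx, rfl⟩ := mem_image.1 he'
        obtain ⟨y, hy, hxy⟩ := mem_image.1 (hsub he)
        rw [mem_product] at hy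
        have hv' := hvn v hv
        rw [mem_union, not_or] at hv'
        simp only [Sym2.eq, Sym2.rel_iff', Prod.mk.injEq, Prod.swap_prod_mk] at hxy
        rcases hxy with h | h
        · exact hv'.1 (h.1 ▸ hy.1)
        · exact hv'.2 (h.2 ▸ hy.2)
      · intro v hv v' hv' hvv c hc c' hc'
        rw [Finset.disjoint_left]
        intro e he he'
        obtain ⟨x, hx, rfl⟩ := mem_image.1 he
        obtain ⟨y, hy, hxy⟩ := mem_image.1 he'
        simp only [Sym2.eq, Sym2.rel_iff', Prod.mk.injEq, Prod.swap_prod_mk] at hxy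
        rcases hxy with h | h
        · exact hvv h.1.symm
        · exact hvn v' hv' (h.1 ▸ certV_sub hc hx)
    refine le_trans (Finset.sum_le_sum hterm) ?_
    calc _ ≤ ∑ h ∈ (btw A B).powerset, p ^ h.card * Real.exp (-2 * (p * A.card ^ 2)) :=
          Finset.sum_le_sum_of_subset_of_nonneg (filter_subset _ _) fun _ _ _ => by positivity
      _ ≤ Real.exp (p * (btw A B).card) * Real.exp (-2 * (p * A.card ^ 2)) := by
          rw [← Finset.sum_mul]
          gcongr
          exact sum_powerset_pow _ p hp.le
      _ ≤ Real.exp (p * A.card ^ 2) * Real.exp (-2 * (p * A.card ^ 2)) := by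
          gcongr
          have h2 : (btw A B).card ≤ A.card ^ 2 := by
            refine le_trans card_image_le ?_
            rw [card_product, ← hl.2, sq]
          exact_mod_cast h2
      _ = Real.exp (-p * A.card ^ 2) := by rw [← Real.exp_add]; congr 1; ring
      _ ≤ _ := by
          apply Real.exp_le_exp.2
          have : p * (μ * n) ^ 2 ≤ p * A.card ^ 2 := by
            gcongr; exact hl.1
          linarith
  refine le_trans (Finset.sum_le_sum step2) ?_
  rw [Finset.sum_const, nsmul_eq_mul, hQ, card_univ]
  simp only [Fintype.card_prod, Fintype.card_finset, Fintype.card_fin]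
  push_cast
  apply le_of_eq
  congr 1
  rw [← mul_pow, ← mul_pow]; norm_num

end Part6

section Part7
lemma eight_pow (n : ℕ) : (8:ℝ) ^ n ≤ Real.exp (3 * n) := by
  have e3 : Real.exp (3 * n) = (Real.exp 1 ^ 3) ^ n := by
    rw [← pow_mul, ← Real.exp_nat_mul]; congr 1; push_cast; ring
  rw [e3]
  have := Real.exp_one_gt_d9
  refine pow_le_pow_left₀ (by norm_num) ?_ n
  calc (8:ℝ) = 2 ^ 3 := by norm_num
    _ ≤ _ := pow_le_pow_left₀ (by norm_num) (by linarith) 3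

set_option maxHeartbeats 1000000 in
theorem whp_P3 (ε ζ Λ : ℝ) (hε : 0 < ε) (hζ : 0 < ζ) (hΛ : 1 ≤ Λ) :
    ∃ η, 0 < η ∧ ∀ μ, 0 < μ → ∃ C, 0 < C ∧ Whp C (P3 ε ζ Λ μ η) := by
  obtain ⟨K, hK⟩ : ∃ K, K = 2 / ζ := ⟨_, rfl⟩
  obtain ⟨ε', hε'd⟩ : ∃ ε', ε' = Real.exp (-((K + 5) * (4 * Λ ^ 2 / ε)) - 1) * (ε / (4 * Λ ^ 2)) ^ 2 :=
    ⟨_, rfl⟩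
  have hε' : 0 < ε' := by rw [hε'd]; positivity
  obtain ⟨η, hηd⟩ : ∃ η, η = Real.exp (-((K + 5) * (4 * Λ ^ 2 / ε')) - 1) * (ε' / (4 * Λ ^ 2)) ^ 2 :=
    ⟨_, rfl⟩
  have hη : 0 < η := by rw [hηd]; positivity
  refine ⟨η, hη, fun μ hμ => ?_⟩
  set L : ℝ := 32 * Λ ^ 5 / ε' ^ 2 + 32 * Λ ^ 5 / ε ^ 2 with hL
  have hL1 : 0 ≤ 32 * Λ ^ 5 / ε' ^ 2 := by positivity
  have hL2 : 0 ≤ 32 * Λ ^ 5 / ε ^ 2 := by positivity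
  set C : ℝ := (L + 1) / μ + 4 / μ ^ 2 + 1 with hC
  have hC1 : 0 ≤ (L + 1) / μ := by positivity
  have hC2 : 0 < 4 / μ ^ 2 := by positivity
  have hC0 : 0 < C := by linarith
  have hCC : C ≤ C ^ 2 := by nlinarith
  refine ⟨C, hC0, fun τ hτ => ?_⟩
  obtain ⟨n0, hn0⟩ := exists_nat_gt (1 / τ + 3)
  refine ⟨n0, fun n hn p hp hp1 => ?_⟩
  have hnn : 1 / τ + 3 < (n : ℝ) := lt_of_lt_of_le hn0 (by exact_mod_cast hn)
  have h1τ : 0 < 1 / τ := by positivity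
  have hn2 : (3:ℝ) < n := by linarith
  have hn3 : 3 < n := by exact_mod_cast hn2
  obtain ⟨hp0, hpn⟩ := p_facts hC0 (by omega) hp
  have hl : 1 ≤ Real.log n := by
    rw [Real.le_log_iff_exp_le (by linarith)]
    linarith [Real.exp_one_lt_d9]
  have hk1 : (L + 1) * Real.log n ≤ μ * (p ^ 2 * n) := by
    have : (L + 1) / μ * Real.log n ≤ p ^ 2 * n := by
      refine le_trans ?_ hpn
      gcongr; linarith
    calc (L + 1) * Real.log n = μ * ((L + 1) / μ * Real.log n) := by field_simp
      _ ≤ _ := by gcongr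
  have hk2 : 4 ≤ μ ^ 2 * (p ^ 2 * n) := by
    have : 4 / μ ^ 2 * 1 ≤ p ^ 2 * n := by
      refine le_trans ?_ hpn
      gcongr; linarith
    calc (4:ℝ) = μ ^ 2 * (4 / μ ^ 2 * 1) := by field_simp
      _ ≤ _ := by gcongr
  have hpp : p ^ 2 ≤ p := by nlinarith
  set s : ℕ := ⌈L / p⌉₊ with hs
  have hs1 : L / p ≤ s := Nat.le_ceil _
  have hs2 : (s : ℝ) ≤ (L + 1) / p := by
    have := (Nat.ceil_lt_add_one (show 0 ≤ L / p by positivity)).le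
    have h1p : 1 ≤ 1 / p := by rw [le_div_iff₀ hp0]; linarith
    rw [add_div]; linarith
  have hX : (s : ℝ) * Real.log n ≤ p * (μ * n) := by
    calc (s : ℝ) * Real.log n ≤ (L + 1) / p * Real.log n := by gcongr
      _ = ((L + 1) * Real.log n) / p := by ring
      _ ≤ (μ * (p ^ 2 * n)) / p := by gcongr
      _ = _ := by field_simp
  refine le_trans (P3_prob (ε' := ε') s hp0 hp1 hΛ hε hε' hζ hK hμ (by omega) hηd hε'd ?_ ?_ ?_ ?_) ?_
  · refine le_trans ?_ hs1
    rw [← div_div]; gcongr; linarith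
  · refine le_trans ?_ hs1
    rw [← div_div]; gcongr; linarith
  · have : (n : ℝ) ^ s = Real.exp (s * Real.log n) := by
      rw [mul_comm, Real.exp_mul, Real.exp_log (by linarith)]; norm_num
    rw [this]
    exact Real.exp_le_exp.2 hX
  · have : (1:ℝ) ≤ p * (μ * n) := by
      calc (1:ℝ) ≤ (L + 1) * Real.log n := by nlinarith
        _ ≤ μ * (p ^ 2 * n) := hk1
        _ ≤ μ * (p * n) := by gcongr
        _ = _ := by ring
    linarith [Real.add_one_le_exp (p * (μ * n))]
  · have h8 := eight_pow n
    have h9 : 4 * (n:ℝ) ≤ p * (μ * n) ^ 2 := by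
      calc 4 * (n:ℝ) ≤ μ ^ 2 * (p ^ 2 * n) * n := by gcongr
        _ ≤ μ ^ 2 * (p * n) * n := by gcongr
        _ = _ := by ring
    calc (8:ℝ) ^ n * Real.exp (-p * (μ * n) ^ 2) ≤ Real.exp (3 * n) * Real.exp (-(4 * n)) := by
          gcongr; linarith
      _ = Real.exp (-n) := by rw [← Real.exp_add]; congr 1; ring
      _ ≤ (n : ℝ)⁻¹ := by
          rw [Real.exp_neg]
          gcongr
          linarith [Real.add_one_le_exp (n:ℝ)]
      _ ≤ τ := by
          rw [inv_le_comm₀ (by linarith) hτ, ← one_div]; linarith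

end Part7

section Part8
/-! ## P4 -/

lemma card_sym_split {n : ℕ} (F : Finset (Fin n × Fin n)) (hF : ∀ z ∈ F, z.swap ∈ F)
    (hd : ∀ z ∈ F, z.1 ≠ z.2) : F.card = 2 * (F.filter fun z => z.1 < z.2).card := by
  have h1 := Finset.card_filter_add_card_filter_not (s := F) (fun z => z.1 < z.2)
  have h2 : (F.filter fun z => ¬ z.1 < z.2).card = (F.filter fun z => z.1 < z.2).card := by
    refine Finset.card_bij (fun z _ => z.swap) ?_ ?_ ?_
    · intro z hz
      rw [mem_filter] at hz ⊢
      refine ⟨hF z hz.1, ?_⟩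
      have := hd z hz.1
      simp only [Prod.fst_swap, Prod.snd_swap]
      exact lt_of_le_of_ne (not_lt.1 hz.2) this.symm
    · intro a _ b _ h
      exact Prod.swap_injective h
    · intro z hz
      rw [mem_filter] at hz
      refine ⟨z.swap, ?_, by simp⟩
      rw [mem_filter]
      refine ⟨hF z hz.1, ?_⟩
      simp only [Prod.fst_swap, Prod.snd_swap]
      exact hz.2.not_gt
  omega

lemma P4_fixed {n : ℕ} (p τ : ℝ) (hp : 0 ≤ p) (hp1 : p ≤ 1) (hτ : 0 < τ) (hτ1 : τ ≤ 1)
    (F : Finset (Fin n × Fin n)) (hF : ∀ z ∈ F, z.swap ∈ F) :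
    gnpProb n p {G | p * F.card + τ * p * n ^ 2 < ((F.filter fun z => G.Adj z.1 z.2).card : ℝ)} ≤
      Real.exp (-(τ ^ 2 / 12) * (p * n ^ 2)) := by
  set X := F.filter fun z => z.1 < z.2 with hX
  have hXc : (X.card : ℝ) ≤ n ^ 2 := by
    have : X.card ≤ (univ : Finset (Fin n × Fin n)).card := card_le_univ _
    simp at this
    have h2 : (X.card : ℝ) ≤ n * n := by exact_mod_cast this
    linarith [sq (n:ℝ)]
  have := chernoff_upper (n := n) p hp hp1 X 1 (fun z => {s(z.1, z.2)}) ?_ ?_ ?_ (n ^ 2) (τ / 2) hXc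
    (by positivity) (by linarith)
  · refine le_trans (gnpProb_mono hp hp1 ?_) (le_trans this (le_of_eq ?_))
    · intro G hG
      rw [Set.mem_ofPred_eq] at hG ⊢
      have e1 : (F.filter fun z => G.Adj z.1 z.2).card = 2 * cntJ X (fun z => {s(z.1, z.2)}) G := by
        rw [card_sym_split]
        · congr 1
          unfold cntJ
          congr 1
          ext z
          simp only [mem_filter, hX, singleton_subset_iff, mem_eset]
          tauto
        · intro z hz
          rw [mem_filter] at hz ⊢
          exact ⟨hF z hz.1, hz.2.symm⟩
        · intro z hz
          exact (mem_filter.1 hz).2.ne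
      have e2 : 2 * X.card ≤ F.card := by
        have h1 := card_sym_split (F.filter fun z => z.1 ≠ z.2) ?_ ?_
        · have h2 : (F.filter fun z => z.1 ≠ z.2).card ≤ F.card := card_filter_le _ _
          have h3 : ((F.filter fun z => z.1 ≠ z.2).filter fun z => z.1 < z.2) = X := by
            ext z
            simp only [mem_filter, hX]
            constructor
            · rintro ⟨⟨a, b⟩, c⟩; exact ⟨a, c⟩
            · rintro ⟨a, c⟩; exact ⟨⟨a, c.ne⟩, c⟩
          rw [h3] at h1
          omega
        · intro z hz
          rw [mem_filter] at hz ⊢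
          exact ⟨hF z hz.1, hz.2.symm⟩
        · intro z hz
          exact (mem_filter.1 hz).2
      rw [e1] at hG
      push_cast at hG
      have e3 : 2 * (X.card : ℝ) ≤ F.card := by exact_mod_cast e2
      have e4 := mul_le_mul_of_nonneg_left e3 hp
      rw [pow_one]
      linarith
    · congr 1; ring
  · intro z hz
    rw [singleton_subset_iff]
    simp only [ndg, mem_filter, mem_univ, true_and, Sym2.mk_isDiag_iff]
    exact (mem_filter.1 hz).2.ne
  · intro z _; simp
  · intro z hz w hw hzw
    rw [disjoint_singleton]
    intro h
    have a1 := (mem_filter.1 hz).2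
    have a2 := (mem_filter.1 hw).2
    simp only [Sym2.eq, Sym2.rel_iff', Prod.mk.injEq, Prod.swap_prod_mk] at h
    rcases h with h | h
    · exact hzw (Prod.ext h.1 h.2)
    · rw [h.1, h.2] at a1
      exact absurd a1 a2.not_gt

def unc {n : ℕ} {ι : Type*} (X : Finset ι) (A : ι → Finset (Fin n)) : Finset (Fin n × Fin n) :=
  univ.filter fun z => ∀ v ∈ X, ¬ (z.1 ∈ A v ∧ z.2 ∈ A v)

def P4 (τ D : ℝ) (n : ℕ) (p : ℝ) (Γ : SimpleGraph (Fin n)) : Prop :=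
  ∀ X : Finset (Fin n), (X.card : ℝ) ≤ D / p ^ 2 → ∀ A : Fin n → Finset (Fin n),
    (∀ v ∈ X, ((A v).card : ℝ) ≤ 2 * p * n) →
    (((unc X A).filter fun z => Γ.Adj z.1 z.2).card : ℝ) ≤ p * (unc X A).card + τ * p * n ^ 2

def setOf' {n k : ℕ} (f : Fin k → Option (Fin n)) : Finset (Fin n) :=
  univ.filter fun x => ∃ j, f j = some x

lemma exists_setOf' {n k : ℕ} (U : Finset (Fin n)) (hU : U.card ≤ k) :
    ∃ f : Fin k → Option (Fin n), setOf' f = U := by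
  refine ⟨fun j => if h : j.1 < U.card then some (U.equivFin.symm ⟨j.1, h⟩) else none, ?_⟩
  ext x
  simp only [setOf', mem_filter, mem_univ, true_and]
  constructor
  · rintro ⟨j, hj⟩
    split_ifs at hj with h
    rw [← Option.some.inj hj]
    exact (U.equivFin.symm ⟨j.1, h⟩).2
  · intro hx
    refine ⟨⟨(U.equivFin ⟨x, hx⟩).1, lt_of_lt_of_le (U.equivFin ⟨x, hx⟩).2 hU⟩, ?_⟩
    rw [dif_pos (U.equivFin ⟨x, hx⟩).2]
    simp

lemma exists_unc {n k M : ℕ} (X : Finset (Fin n)) (hX : X.card ≤ M) (A : Fin n → Finset (Fin n))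
    (hA : ∀ v ∈ X, (A v).card ≤ k) :
    ∃ f : Fin M → Fin k → Option (Fin n), unc univ (fun i => setOf' (f i)) = unc X A := by
  obtain ⟨g, hg⟩ := exists_setOf' X hX
  have hgX : ∀ i v, g i = some v → v ∈ X := by
    intro i v h
    rw [← hg]
    simp only [setOf', mem_filter, mem_univ, true_and]
    exact ⟨i, h⟩
  have : ∀ i, ∃ f : Fin k → Option (Fin n), setOf' f = (g i).elim ∅ A := by
    intro i
    cases h : g i with
    | none => exact exists_setOf' _ (by simp)
    | some v => exact exists_setOf' _ (hA v (hgX i v h))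
  choose f hf using this
  refine ⟨f, ?_⟩
  ext z
  simp only [unc, mem_filter, mem_univ, true_and, forall_const]
  constructor
  · intro h v hv
    rw [← hg] at hv
    simp only [setOf', mem_filter, mem_univ, true_and] at hv
    obtain ⟨i, hi⟩ := hv
    have := h i
    rw [hf, hi] at this
    exact this
  · intro h i
    rw [hf]
    cases hi : g i with
    | none => simp
    | some v => exact h v (hgX i v hi)

set_option maxHeartbeats 1000000 in
theorem whp_P4 (τ D : ℝ) (hτ : 0 < τ) (hτ1 : τ ≤ 1) (hD : 0 < D) : ∃ C, 0 < C ∧ Whp C (P4 τ D) := by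
  set C : ℝ := 12 / τ ^ 2 * (4 * D + 1) + 1 with hC
  have hC1 : 0 < 12 / τ ^ 2 * (4 * D + 1) := by positivity
  have hC0 : 0 < C := by linarith
  have hCC : C ≤ C ^ 2 := by nlinarith
  refine ⟨C, hC0, fun σ hσ => ?_⟩
  obtain ⟨n0, hn0⟩ := exists_nat_gt (1 / σ + 3)
  refine ⟨n0, fun n hn p hp hp1 => ?_⟩
  have hnn : 1 / σ + 3 < (n : ℝ) := lt_of_lt_of_le hn0 (by exact_mod_cast hn)
  have h1τ : 0 < 1 / σ := by positivity
  have hn2 : (3:ℝ) < n := by linarith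
  have hn3 : 3 < n := by exact_mod_cast hn2
  obtain ⟨hp0, hpn⟩ := p_facts hC0 (by omega) hp
  have hl : 1 ≤ Real.log n := by
    rw [Real.le_log_iff_exp_le (by linarith)]
    linarith [Real.exp_one_lt_d9]
  set k := ⌊2 * p * n⌋₊
  set M := ⌊D / p ^ 2⌋₊
  have hk : (k : ℝ) ≤ 2 * p * n := Nat.floor_le (by positivity)
  have hM : (M : ℝ) ≤ D / p ^ 2 := Nat.floor_le (by positivity)
  refine le_trans (gnpProb_biUnion hp0.le hp1 (univ : Finset (Fin M → Fin k → Option (Fin n)))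
    (fun f => {G | p * (unc univ (fun i => setOf' (f i))).card + τ * p * n ^ 2 <
      (((unc univ (fun i => setOf' (f i))).filter fun z => G.Adj z.1 z.2).card : ℝ)}) _ ?_) ?_
  · intro G hG
    have hG' : ¬ P4 τ D n p G := hG
    unfold P4 at hG'
    push Not at hG'
    obtain ⟨X, hX, A, hA, hbad⟩ := hG'
    obtain ⟨f, hf⟩ := exists_unc (k := k) (M := M) X (Nat.le_floor hX) A
      (fun v hv => Nat.le_floor (hA v hv))
    refine ⟨f, mem_univ _, ?_⟩
    rw [Set.mem_ofPred_eq, hf]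
    exact hbad
  · refine le_trans (Finset.sum_le_sum fun f _ => P4_fixed p τ hp0.le hp1 hτ hτ1 _ ?_) ?_
    · intro z hz
      simp only [unc, mem_filter, mem_univ, true_and, Prod.fst_swap, Prod.snd_swap] at hz ⊢
      exact fun i hi h => hz i hi h.symm
    · rw [Finset.sum_const, nsmul_eq_mul]
      have hcard : (((univ : Finset (Fin M → Fin k → Option (Fin n))).card : ℕ) : ℝ) =
          ((n:ℝ) + 1) ^ (k * M) := by
        simp [pow_mul]
      rw [hcard]
      have hln : Real.log ((n:ℝ) + 1) ≤ 2 * Real.log n := by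
        have : 2 * Real.log n = Real.log ((n:ℝ) ^ 2) := by simp
        rw [this]
        refine Real.log_le_log (by linarith) (by nlinarith)
      have e1 : ((n:ℝ) + 1) ^ (k * M) ≤ Real.exp (4 * D * (n * Real.log n) / p) := by
        have : ((n:ℝ) + 1) ^ (k * M) = Real.exp ((k * M) * Real.log ((n:ℝ) + 1)) := by
          have hc : ((k:ℝ) * M) = ((k * M : ℕ) : ℝ) := by push_cast; rfl
          rw [hc, Real.exp_nat_mul, Real.exp_log (by linarith)]
        rw [this]
        apply Real.exp_le_exp.2
        calc (k * M : ℝ) * Real.log ((n:ℝ) + 1) ≤ (2 * p * n * (D / p ^ 2)) * (2 * Real.log n) := by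
              refine mul_le_mul (mul_le_mul hk hM (by positivity) (by positivity)) hln ?_ (by positivity)
              exact Real.log_nonneg (by linarith)
          _ = _ := by field_simp; ring
      have e2 : 4 * D * (n * Real.log n) / p + n ≤ τ ^ 2 / 12 * (p * n ^ 2) := by
        have h1 : (4 * D + 1) * Real.log n ≤ τ ^ 2 / 12 * (p ^ 2 * n) := by
          calc (4 * D + 1) * Real.log n = τ ^ 2 / 12 * ((12 / τ ^ 2 * (4 * D + 1)) * Real.log n) := by
                field_simp
            _ ≤ τ ^ 2 / 12 * (C ^ 2 * Real.log n) := by gcongr; linarith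
            _ ≤ _ := by gcongr
        have h2 : 4 * D * (n * Real.log n) / p + n ≤ (4 * D + 1) * Real.log n * (n / p) := by
          have : (n:ℝ) ≤ Real.log n * (n / p) := by
            have h3 : (n:ℝ) ≤ n / p := by rw [le_div_iff₀ hp0]; nlinarith
            nlinarith
          calc 4 * D * (n * Real.log n) / p + n ≤ 4 * D * (n * Real.log n) / p + Real.log n * (n / p) := by
                linarith
            _ = _ := by ring
        refine le_trans h2 ?_
        calc (4 * D + 1) * Real.log n * (n / p) ≤ τ ^ 2 / 12 * (p ^ 2 * n) * (n / p) := by gcongr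
          _ = _ := by field_simp
      calc ((n:ℝ) + 1) ^ (k * M) * Real.exp (-(τ ^ 2 / 12) * (p * n ^ 2)) ≤
          Real.exp (4 * D * (n * Real.log n) / p) * Real.exp (-(τ ^ 2 / 12) * (p * n ^ 2)) := by gcongr
        _ = Real.exp (4 * D * (n * Real.log n) / p + -(τ ^ 2 / 12) * (p * n ^ 2)) := by
          rw [Real.exp_add]
        _ ≤ Real.exp (-n) := Real.exp_le_exp.2 (by linarith)
        _ ≤ (n : ℝ)⁻¹ := by
          rw [Real.exp_neg]
          gcongr
          linarith [Real.add_one_le_exp (n:ℝ)]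
        _ ≤ σ := by
          rw [inv_le_comm₀ (by linarith) hσ, ← one_div]; linarith

end Part8

section Part9
/-! ## Deterministic consequences of N1 and P4 -/

def ad {n : ℕ} (G : SimpleGraph (Fin n)) (x y : Fin n) : ℝ := if G.Adj x y then 1 else 0

lemma ad_comm {n : ℕ} (G : SimpleGraph (Fin n)) (x y : Fin n) : ad G x y = ad G y x := by
  unfold ad; rw [G.adj_comm]

lemma ad_nonneg {n : ℕ} (G : SimpleGraph (Fin n)) (x y : Fin n) : 0 ≤ ad G x y := by
  unfold ad; split_ifs <;> norm_num

lemma ad_le_one {n : ℕ} (G : SimpleGraph (Fin n)) (x y : Fin n) : ad G x y ≤ 1 := by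
  unfold ad; split_ifs <;> norm_num

lemma ad_mono {n : ℕ} {G Γ : SimpleGraph (Fin n)} (h : G ≤ Γ) (x y : Fin n) : ad G x y ≤ ad Γ x y := by
  unfold ad
  by_cases h1 : G.Adj x y
  · simp [h1, h h1]
  · simp [h1]; split_ifs <;> norm_num

lemma ad_sq {n : ℕ} (G : SimpleGraph (Fin n)) (x y : Fin n) : ad G x y * ad G x y = ad G x y := by
  unfold ad; split_ifs <;> norm_num

lemma e_sum {n : ℕ} (G : SimpleGraph (Fin n)) (X Y : Finset (Fin n)) :
    (eBtw G X Y : ℝ) = ∑ x ∈ X, ∑ y ∈ Y, ad G x y := eBtw_sum G X Y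

lemma deg_sum {n : ℕ} (G : SimpleGraph (Fin n)) (v : Fin n) (X : Finset (Fin n)) :
    (degIn G v X : ℝ) = ∑ w ∈ X, ad G v w := by
  unfold degIn ad
  rw [Finset.card_filter]; push_cast; rfl

lemma e_deg {n : ℕ} (G : SimpleGraph (Fin n)) (X Y : Finset (Fin n)) :
    (eBtw G X Y : ℝ) = ∑ x ∈ X, (degIn G x Y : ℝ) := by
  rw [e_sum]; exact Finset.sum_congr rfl fun x _ => (deg_sum G x Y).symm

lemma e_comm {n : ℕ} (G : SimpleGraph (Fin n)) (X Y : Finset (Fin n)) :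
    (eBtw G X Y : ℝ) = eBtw G Y X := by
  rw [e_sum, e_sum, Finset.sum_comm]
  exact Finset.sum_congr rfl fun y _ => Finset.sum_congr rfl fun x _ => ad_comm G x y

lemma codeg_sum {n : ℕ} (G : SimpleGraph (Fin n)) (u w : Fin n) (X : Finset (Fin n)) :
    (codegIn G u w X : ℝ) = ∑ x ∈ X, ad G u x * ad G w x := by
  unfold codegIn ad
  rw [Finset.card_filter]; push_cast
  refine Finset.sum_congr rfl fun x _ => ?_
  by_cases h1 : G.Adj u x <;> by_cases h2 : G.Adj w x <;> simp [h1, h2]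

lemma codeg_self {n : ℕ} (G : SimpleGraph (Fin n)) (u : Fin n) (X : Finset (Fin n)) :
    codegIn G u u X = degIn G u X := by
  unfold codegIn degIn; simp

lemma deg_mono {n : ℕ} {G Γ : SimpleGraph (Fin n)} (h : G ≤ Γ) (v : Fin n) {X Y : Finset (Fin n)}
    (hXY : X ⊆ Y) : degIn G v X ≤ degIn Γ v Y := by
  unfold degIn
  refine card_le_card fun x hx => ?_
  rw [mem_filter] at hx ⊢
  exact ⟨hXY hx.1, h hx.2⟩

/-- sum of squared degrees as sum of codegrees -/
lemma sum_deg_sq {n : ℕ} (G : SimpleGraph (Fin n)) (A B : Finset (Fin n)) :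
    ∑ b ∈ B, (degIn G b A : ℝ) ^ 2 = ∑ a ∈ A, ∑ a' ∈ A, (codegIn G a a' B : ℝ) := by
  have : ∀ b, (degIn G b A : ℝ) ^ 2 = ∑ a ∈ A, ∑ a' ∈ A, ad G a b * ad G a' b := by
    intro b
    rw [deg_sum, sq, Finset.sum_mul_sum]
    exact Finset.sum_congr rfl fun a _ => Finset.sum_congr rfl fun a' _ => by
      rw [ad_comm G b a, ad_comm G b a']
  simp_rw [this]
  rw [Finset.sum_comm]
  refine Finset.sum_congr rfl fun a _ => ?_
  rw [Finset.sum_comm]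
  exact Finset.sum_congr rfl fun a' _ => (codeg_sum G a a' B).symm

lemma codeg_total {n : ℕ} {η p : ℝ} {Γ : SimpleGraph (Fin n)} (hη : 0 ≤ η) (hN : N1 η n p Γ)
    (A : Finset (Fin n)) :
    ∑ a ∈ A, ∑ a' ∈ A, (codegIn Γ a a' univ : ℝ) ≤
      A.card ^ 2 * ((1 + η) * (p ^ 2 * n)) + A.card * ((1 + η) * (p * n)) := by
  have h0 : 0 ≤ (1 + η) * (p ^ 2 * n) := by positivity
  have h1 : ∀ a ∈ A, ∑ a' ∈ A, (codegIn Γ a a' univ : ℝ) ≤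
      A.card * ((1 + η) * (p ^ 2 * n)) + (1 + η) * (p * n) := by
    intro a ha
    rw [← Finset.sum_erase_add _ _ ha, codeg_self]
    refine add_le_add ?_ (hN.1 a).2
    refine le_trans (Finset.sum_le_card_nsmul _ _ ((1 + η) * (p ^ 2 * n)) fun a' ha' =>
      hN.2 a a' (ne_of_mem_erase ha').symm) ?_
    rw [nsmul_eq_mul]
    gcongr
    exact erase_subset _ _
  refine le_trans (Finset.sum_le_card_nsmul _ _ _ h1) (le_of_eq ?_)
  rw [nsmul_eq_mul]; ring

lemma sum_dev_sq {n : ℕ} {η p : ℝ} {Γ : SimpleGraph (Fin n)} (hη : 0 ≤ η) (hη1 : η ≤ 1) (hp : 0 ≤ p)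
    (hN : N1 η n p Γ) (A : Finset (Fin n)) :
    ∑ b, ((degIn Γ b A : ℝ) - p * A.card) ^ 2 ≤ 3 * η * p ^ 2 * n * A.card ^ 2 + 2 * A.card * p * n := by
  have h1 : ∑ b, ((degIn Γ b A : ℝ) - p * A.card) ^ 2 = ∑ b, (degIn Γ b A : ℝ) ^ 2
      - 2 * p * A.card * ∑ b, (degIn Γ b A : ℝ) + n * (p * A.card) ^ 2 := by
    rw [Finset.mul_sum, ← Finset.sum_sub_distrib]
    have : (n : ℝ) * (p * A.card) ^ 2 = ∑ b : Fin n, (p * A.card) ^ 2 := by simp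
    rw [this, ← Finset.sum_add_distrib]
    exact Finset.sum_congr rfl fun b _ => by ring
  have h2 : A.card * ((1 - η) * (p * n)) ≤ ∑ b, (degIn Γ b A : ℝ) := by
    rw [← e_deg, e_comm, e_deg, ← nsmul_eq_mul]
    exact Finset.card_nsmul_le_sum _ _ _ fun a _ => (hN.1 a).1
  have h3 := codeg_total hη hN A
  rw [← sum_deg_sq] at h3
  rw [h1]
  have h4 := mul_le_mul_of_nonneg_left h2 (show 0 ≤ 2 * p * (A.card:ℝ) by positivity)
  have h5 : (A.card : ℝ) * ((1 + η) * (p * n)) ≤ 2 * A.card * p * n := by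
    have : (0:ℝ) ≤ A.card * (p * n) := by positivity
    nlinarith
  nlinarith

lemma jumbled {n : ℕ} {η p κ : ℝ} {Γ : SimpleGraph (Fin n)} (hη : 0 ≤ η) (hη1 : η ≤ 1) (hp : 0 < p)
    (hN : N1 η n p Γ) (hκ : 0 ≤ κ) (hn : 0 < n) (h : 3 * η + 2 / (p * n) ≤ κ ^ 2)
    (A B : Finset (Fin n)) : |(eBtw Γ A B : ℝ) - p * A.card * B.card| ≤ κ * p * n ^ 2 := by
  have hn' : (0:ℝ) < n := by exact_mod_cast hn
  refine abs_le_of_sq_le_sq ?_ (by positivity)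
  have e1 : (eBtw Γ A B : ℝ) - p * A.card * B.card = ∑ b ∈ B, ((degIn Γ b A : ℝ) - p * A.card) := by
    rw [e_comm, e_deg, Finset.sum_sub_distrib]
    simp; ring
  rw [e1]
  have hA : (A.card : ℝ) ≤ n := by
    have := card_le_univ A
    simp at this; exact_mod_cast this
  have hB : (B.card : ℝ) ≤ n := by
    have := card_le_univ B
    simp at this; exact_mod_cast this
  have hs := sum_dev_sq hη hη1 hp.le hN A
  calc (∑ b ∈ B, ((degIn Γ b A : ℝ) - p * A.card)) ^ 2
      ≤ B.card * ∑ b ∈ B, ((degIn Γ b A : ℝ) - p * A.card) ^ 2 := sq_sum_le_card_mul_sum_sq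
    _ ≤ n * ∑ b, ((degIn Γ b A : ℝ) - p * A.card) ^ 2 := by
        gcongr
        exact subset_univ _
    _ ≤ n * (3 * η * p ^ 2 * n * n ^ 2 + 2 * n * p * n) := by
        gcongr
        refine le_trans hs ?_
        gcongr
    _ = p ^ 2 * n ^ 4 * (3 * η + 2 / (p * n)) := by field_simp
    _ ≤ p ^ 2 * n ^ 4 * κ ^ 2 := by gcongr
    _ = _ := by ring

/-- few vertices have many neighbours in a small set -/
lemma few_heavy {n : ℕ} {η p γ : ℝ} {Γ : SimpleGraph (Fin n)} (hη : 0 ≤ η) (hη1 : η ≤ 1) (hp : 0 < p)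
    (hγ : 0 < γ) (hN : N1 η n p Γ) (hn : 0 < n) (F Z : Finset (Fin n))
    (hF : (F.card : ℝ) ≤ γ ^ 2 / 16 * n) (hZ : ∀ z ∈ Z, γ / 2 * (p * n) ≤ (degIn Γ z F : ℝ)) :
    (Z.card : ℝ) ≤ 1 / p := by
  have hn' : (0:ℝ) < n := by exact_mod_cast hn
  by_cases hZ0 : Z.card = 0
  · rw [hZ0]; push_cast; positivity
  have hZ' : (0:ℝ) < Z.card := by exact_mod_cast Nat.pos_of_ne_zero hZ0
  have h1 : Z.card * (γ / 2 * (p * n)) ≤ (eBtw Γ Z F : ℝ) := by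
    rw [e_deg, ← nsmul_eq_mul]
    exact Finset.card_nsmul_le_sum _ _ _ hZ
  have h2 : (eBtw Γ Z F : ℝ) ^ 2 ≤ F.card * ∑ b ∈ F, (degIn Γ b Z : ℝ) ^ 2 := by
    rw [e_comm, e_deg]; exact sq_sum_le_card_mul_sum_sq
  have h3 : ∑ b ∈ F, (degIn Γ b Z : ℝ) ^ 2 ≤ Z.card ^ 2 * (2 * (p ^ 2 * n)) + Z.card * (2 * (p * n)) := by
    calc ∑ b ∈ F, (degIn Γ b Z : ℝ) ^ 2 ≤ ∑ b, (degIn Γ b Z : ℝ) ^ 2 :=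
          Finset.sum_le_sum_of_subset_of_nonneg (subset_univ _) fun _ _ _ => sq_nonneg _
      _ ≤ _ := by
          rw [sum_deg_sq]
          refine le_trans (codeg_total hη hN Z) ?_
          gcongr <;> linarith
  have h4 : (Z.card * (γ / 2 * (p * n))) ^ 2 ≤ γ ^ 2 / 16 * n *
      (Z.card ^ 2 * (2 * (p ^ 2 * n)) + Z.card * (2 * (p * n))) := by
    calc (Z.card * (γ / 2 * (p * n))) ^ 2 ≤ (eBtw Γ Z F : ℝ) ^ 2 := by gcongr
      _ ≤ _ := h2
      _ ≤ _ := by gcongr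
  rw [le_div_iff₀ hp]
  have hc : 0 < γ ^ 2 / 8 * (Z.card * (p * n ^ 2)) := by positivity
  have h5 : γ ^ 2 / 8 * (Z.card * (p * n ^ 2)) * (Z.card * p) ≤ γ ^ 2 / 8 * (Z.card * (p * n ^ 2)) * 1 := by
    nlinarith
  exact le_of_mul_le_mul_left h5 hc

end Part9

section Part10
lemma nbhd_card {n : ℕ} (G : SimpleGraph (Fin n)) (v : Fin n) (X : Finset (Fin n)) :
    (nbhdIn G v X).card = degIn G v X := rfl

lemma mem_unc {n : ℕ} {ι : Type*} (X : Finset ι) (A : ι → Finset (Fin n)) (z : Fin n × Fin n) :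
    z ∈ unc X A ↔ ∀ v ∈ X, ¬ (z.1 ∈ A v ∧ z.2 ∈ A v) := by
  unfold unc; rw [mem_filter]; simp

lemma card_le_n {n : ℕ} (F : Finset (Fin n)) : (F.card : ℝ) ≤ n := by
  have := card_le_univ F
  simp at this; exact_mod_cast this

lemma card_sdiff_real {n : ℕ} {F X : Finset (Fin n)} (h : F ⊆ X) :
    ((X \ F).card : ℝ) = X.card - F.card := by
  have h1 := Finset.card_sdiff_add_card_eq_card h
  have h2 : ((X \ F).card : ℝ) + F.card = X.card := by exact_mod_cast h1
  linarith

/-- second moment of codegrees into X -/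
lemma codeg_dev {n : ℕ} {η p : ℝ} {Γ : SimpleGraph (Fin n)} (hη : 0 ≤ η) (hη1 : η ≤ 1) (hp : 0 ≤ p)
    (hN : N1 η n p Γ) (X : Finset (Fin n)) :
    ∑ z : Fin n × Fin n, ((codegIn Γ z.1 z.2 X : ℝ) - p ^ 2 * X.card) ^ 2 ≤
      (p ^ 2 * X.card) ^ 2 * n ^ 2 * (6 * η) + 4 * (p ^ 2 * X.card) * n ^ 2 := by
  have key : ∀ z : Fin n × Fin n, (codegIn Γ z.1 z.2 X : ℝ) = ∑ v ∈ X, ad Γ v z.1 * ad Γ v z.2 := by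
    intro z
    rw [codeg_sum]
    exact Finset.sum_congr rfl fun v _ => by rw [ad_comm Γ v, ad_comm Γ v]
  have s1 : ∑ z : Fin n × Fin n, (codegIn Γ z.1 z.2 X : ℝ) = ∑ v ∈ X, (degIn Γ v univ : ℝ) ^ 2 := by
    simp_rw [key]
    rw [Finset.sum_comm]
    refine Finset.sum_congr rfl fun v _ => ?_
    rw [deg_sum, sq, Finset.sum_mul_sum, ← Finset.univ_product_univ, Finset.sum_product]
  have s2 : ∑ z : Fin n × Fin n, (codegIn Γ z.1 z.2 X : ℝ) ^ 2 =
      ∑ v ∈ X, ∑ v' ∈ X, (codegIn Γ v v' univ : ℝ) ^ 2 := by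
    have : ∀ z : Fin n × Fin n, (codegIn Γ z.1 z.2 X : ℝ) ^ 2 =
        ∑ v ∈ X, ∑ v' ∈ X, (ad Γ v z.1 * ad Γ v z.2) * (ad Γ v' z.1 * ad Γ v' z.2) := by
      intro z
      rw [key, sq, Finset.sum_mul_sum]
    simp_rw [this]
    rw [Finset.sum_comm]
    refine Finset.sum_congr rfl fun v _ => ?_
    rw [Finset.sum_comm]
    refine Finset.sum_congr rfl fun v' _ => ?_
    rw [codeg_sum, sq, Finset.sum_mul_sum, ← Finset.univ_product_univ, Finset.sum_product]
    exact Finset.sum_congr rfl fun x _ => Finset.sum_congr rfl fun y _ => by ring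
  have b1 : X.card * (((1 - η) * (p * n)) ^ 2) ≤ ∑ v ∈ X, (degIn Γ v univ : ℝ) ^ 2 := by
    rw [← nsmul_eq_mul]
    refine Finset.card_nsmul_le_sum _ _ _ fun a _ => ?_
    have := (hN.1 a).1
    have h0 : 0 ≤ (1 - η) * (p * n) := mul_nonneg (by linarith) (by positivity)
    gcongr
  have b2 : ∑ v ∈ X, ∑ v' ∈ X, (codegIn Γ v v' univ : ℝ) ^ 2 ≤
      X.card * (X.card * ((1 + η) * (p ^ 2 * n)) ^ 2 + ((1 + η) * (p * n)) ^ 2) := by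
    rw [← nsmul_eq_mul]
    refine Finset.sum_le_card_nsmul _ _ _ fun a ha => ?_
    rw [← Finset.sum_erase_add _ _ ha, codeg_self]
    refine add_le_add ?_ (by have := (hN.1 a).2; gcongr)
    refine le_trans (Finset.sum_le_card_nsmul _ _ (((1 + η) * (p ^ 2 * n)) ^ 2) fun a' ha' => ?_) ?_
    · have := hN.2 a a' (ne_of_mem_erase ha').symm
      gcongr
    · rw [nsmul_eq_mul]
      gcongr
      exact erase_subset _ _
  have e0 : ∑ z : Fin n × Fin n, ((codegIn Γ z.1 z.2 X : ℝ) - p ^ 2 * X.card) ^ 2 =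
      ∑ z : Fin n × Fin n, (codegIn Γ z.1 z.2 X : ℝ) ^ 2 - 2 * (p ^ 2 * X.card) *
        ∑ z : Fin n × Fin n, (codegIn Γ z.1 z.2 X : ℝ) + n ^ 2 * (p ^ 2 * X.card) ^ 2 := by
    rw [Finset.mul_sum, ← Finset.sum_sub_distrib]
    have : (n : ℝ) ^ 2 * (p ^ 2 * X.card) ^ 2 = ∑ z : Fin n × Fin n, (p ^ 2 * (X.card : ℝ)) ^ 2 := by
      rw [Finset.sum_const, nsmul_eq_mul]; simp only [card_univ, Fintype.card_prod, Fintype.card_fin]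
      push_cast; ring
    rw [this, ← Finset.sum_add_distrib]
    exact Finset.sum_congr rfl fun b _ => by ring
  rw [e0, s1, s2]
  have b3 := mul_le_mul_of_nonneg_left b1 (show 0 ≤ 2 * (p ^ 2 * (X.card:ℝ)) by positivity)
  set x : ℝ := (X.card : ℝ)
  set q : ℝ := p ^ 2 * x
  have hx : (0:ℝ) ≤ x := by positivity
  have hq : 0 ≤ q := by positivity
  have c1 : x * (x * ((1 + η) * (p ^ 2 * n)) ^ 2 + ((1 + η) * (p * n)) ^ 2) =
    q ^ 2 * n ^ 2 * (1 + η) ^ 2 + (1 + η) ^ 2 * (q * n ^ 2) := by simp only [q]; ring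
  have c2 : 2 * q * (x * (((1 - η) * (p * n)) ^ 2)) = 2 * (q ^ 2 * n ^ 2) * (1 - η) ^ 2 := by
    simp only [q]; ring
  rw [c1] at b2
  rw [c2] at b3
  have d1 : (1 + η) ^ 2 * (q * n ^ 2) ≤ 4 * (q * n ^ 2) := by
    have : (1 + η) ^ 2 ≤ 4 := by nlinarith
    gcongr
  have d2 : 0 ≤ q ^ 2 * (n:ℝ) ^ 2 * η ^ 2 := by positivity
  nlinarith

set_option maxHeartbeats 2000000 in
/-- Covering lemma. -/
lemma cover {n : ℕ} {η p γ : ℝ} {Γ G : SimpleGraph (Fin n)} (hη : 0 ≤ η) (hp : 0 < p) (hp1 : p ≤ 1)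
    (hγ : 0 < γ) (hγ1 : γ ≤ 1 / 10) (hηγ : η ≤ γ ^ 2 / 27) (hN : N1 η n p Γ) (hn : 0 < n)
    (hP4 : P4 (1 / 36) (18 / γ ^ 2 + 1) n p Γ) (hG : G ≤ Γ)
    (hdeg : ∀ v, (2 / 3 + γ) * n * p ≤ (degIn G v univ : ℝ)) (F Pend : Finset (Fin n))
    (hF : (F.card : ℝ) ≤ γ ^ 2 / 16 * n) (hPend : (18 / γ ^ 2 + 2) / p ^ 2 ≤ Pend.card) :
    ∃ v ∈ Pend, ∃ x ∉ F, ∃ y ∉ F, G.Adj v x ∧ G.Adj v y ∧ G.Adj x y := by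
  have hn' : (0:ℝ) < n := by exact_mod_cast hn
  have hη1 : η ≤ 1 := by nlinarith
  have hp2 : 0 < p ^ 2 := by positivity
  by_contra hcon
  push Not at hcon
  set Z := Pend.filter fun z => γ / 2 * (p * n) ≤ (degIn Γ z F : ℝ) with hZ
  have hZc : (Z.card : ℝ) ≤ 1 / p := few_heavy hη hη1 hp hγ hN hn F Z hF fun z hz => (mem_filter.1 hz).2
  have h1p : 1 / p ≤ 1 / p ^ 2 := by
    apply one_div_le_one_div_of_le hp2; nlinarith
  have hone : 1 ≤ 1 / p ^ 2 := by
    rw [le_div_iff₀ hp2]; nlinarith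
  have hPZ : ((Pend \ Z).card : ℝ) ≥ (18 / γ ^ 2 + 1) / p ^ 2 := by
    have h2 := card_sdiff_real (filter_subset (fun z => γ / 2 * (p * n) ≤ (degIn Γ z F : ℝ)) Pend)
    rw [← hZ] at h2
    have h3 : (18 / γ ^ 2 + 2) / p ^ 2 = (18 / γ ^ 2 + 1) / p ^ 2 + 1 / p ^ 2 := by ring
    linarith
  have hfl : ⌊(18 / γ ^ 2 + 1) / p ^ 2⌋₊ ≤ (Pend \ Z).card := by
    have := Nat.floor_le_floor hPZ
    simpa using this
  obtain ⟨X, hXs, hXc⟩ := Finset.exists_subset_card_eq hfl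
  have hX1 : (X.card : ℝ) ≤ (18 / γ ^ 2 + 1) / p ^ 2 := by
    rw [hXc]; exact Nat.floor_le (by positivity)
  have hX2 : 18 / γ ^ 2 / p ^ 2 ≤ (X.card : ℝ) := by
    rw [hXc]
    have := (Nat.sub_one_lt_floor ((18 / γ ^ 2 + 1) / p ^ 2)).le
    have h3 : (18 / γ ^ 2 + 1) / p ^ 2 = 18 / γ ^ 2 / p ^ 2 + 1 / p ^ 2 := by ring
    linarith
  set A : Fin n → Finset (Fin n) := fun v => nbhdIn G v (univ \ F) with hA
  have hAub : ∀ v, ((A v).card : ℝ) ≤ 2 * p * n := by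
    intro v
    have h1 : (degIn G v (univ \ F) : ℝ) ≤ degIn Γ v univ := by
      exact_mod_cast deg_mono hG v (subset_univ _)
    have h2 := (hN.1 v).2
    have h3 : (1 + η) * (p * n) ≤ 2 * (p * n) := by gcongr; linarith
    calc ((A v).card : ℝ) = degIn G v (univ \ F) := by rw [← nbhd_card]
      _ ≤ _ := by linarith
  have hsplit : ∀ v, (degIn G v univ : ℝ) = degIn G v (univ \ F) + degIn G v F := by
    intro v
    rw [deg_sum, deg_sum, deg_sum, Finset.sum_sdiff (subset_univ F)]
  have hAlb : ∀ v ∈ X, (2 / 3 + γ / 2) * (p * n) ≤ ((A v).card : ℝ) := by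
    intro v hv
    have h1 := mem_sdiff.1 (hXs hv)
    have h2 : (degIn Γ v F : ℝ) < γ / 2 * (p * n) := by
      by_contra hc
      exact h1.2 (mem_filter.2 ⟨h1.1, not_lt.1 hc⟩)
    have h3 : (degIn G v F : ℝ) ≤ degIn Γ v F := by exact_mod_cast deg_mono hG v (le_refl _)
    have h4 := hdeg v
    rw [hsplit] at h4
    calc (2 / 3 + γ / 2) * (p * n) ≤ degIn G v (univ \ F) := by linarith
      _ = ((A v).card : ℝ) := by rw [← nbhd_card]
  have hP := hP4 X hX1 A fun v _ => hAub v
  -- size of covered pairs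
  set U := unc X A with hU
  set P := (univ : Finset (Fin n × Fin n)) \ U with hPd
  set q : ℝ := p ^ 2 * X.card with hq
  have hq1 : 18 / γ ^ 2 ≤ q := by
    have := mul_le_mul_of_nonneg_left hX2 hp2.le
    calc 18 / γ ^ 2 = p ^ 2 * (18 / γ ^ 2 / p ^ 2) := by field_simp
      _ ≤ _ := this
  have hq0 : 0 < q := lt_of_lt_of_le (by positivity) hq1
  have hlow : q * (2 / 3 + γ / 2) ^ 2 * n ^ 2 ≤ ∑ z ∈ P, (codegIn Γ z.1 z.2 X : ℝ) := by
    have h1 : ∑ v ∈ X, ((A v).card : ℝ) ^ 2 ≤ ∑ z ∈ P, (codegIn Γ z.1 z.2 X : ℝ) := by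
      have : ∀ v ∈ X, ((A v).card : ℝ) ^ 2 ≤ ∑ z ∈ P, (if Γ.Adj z.1 v ∧ Γ.Adj z.2 v then (1:ℝ) else 0) := by
        intro v hv
        rw [Finset.sum_boole, sq]
        have : (A v ×ˢ A v).card ≤ (P.filter fun z => Γ.Adj z.1 v ∧ Γ.Adj z.2 v).card := by
          refine card_le_card fun z hz => ?_
          rw [mem_product] at hz
          rw [mem_filter, hPd, mem_sdiff]
          refine ⟨⟨mem_univ _, fun hzU => ?_⟩, ?_⟩
          · rw [hU] at hzU
            exact (mem_unc _ _ _).1 hzU v hv hz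
          · exact ⟨(hG (mem_filter.1 hz.1).2).symm, (hG (mem_filter.1 hz.2).2).symm⟩
        rw [card_product] at this
        exact_mod_cast this
      refine le_trans (Finset.sum_le_sum this) ?_
      rw [Finset.sum_comm]
      refine le_of_eq (Finset.sum_congr rfl fun z _ => ?_)
      rw [Finset.sum_boole]; rfl
    refine le_trans ?_ h1
    have h2 : X.card * ((2 / 3 + γ / 2) * (p * n)) ^ 2 ≤ ∑ v ∈ X, ((A v).card : ℝ) ^ 2 := by
      rw [← nsmul_eq_mul]
      refine Finset.card_nsmul_le_sum _ _ _ fun v hv => ?_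
      have := hAlb v hv
      gcongr
    refine le_trans (le_of_eq ?_) h2
    rw [hq]; ring
  have hup : ∑ z ∈ P, (codegIn Γ z.1 z.2 X : ℝ) ≤ q * P.card + q * (2 / 3 * γ) * n ^ 2 := by
    have h1 : ∑ z ∈ P, (codegIn Γ z.1 z.2 X : ℝ) = q * P.card + ∑ z ∈ P, ((codegIn Γ z.1 z.2 X : ℝ) - q) := by
      rw [Finset.sum_sub_distrib]; simp; ring
    rw [h1]
    have h2 : (∑ z ∈ P, ((codegIn Γ z.1 z.2 X : ℝ) - q)) ^ 2 ≤ (q * (2 / 3 * γ) * n ^ 2) ^ 2 := by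
      have hPc : (P.card : ℝ) ≤ n ^ 2 := by
        have : P.card ≤ (univ : Finset (Fin n × Fin n)).card := card_le_univ _
        simp at this
        have h2 : (P.card : ℝ) ≤ n * n := by exact_mod_cast this
        linarith [sq (n:ℝ)]
      calc (∑ z ∈ P, ((codegIn Γ z.1 z.2 X : ℝ) - q)) ^ 2
          ≤ P.card * ∑ z ∈ P, ((codegIn Γ z.1 z.2 X : ℝ) - q) ^ 2 := sq_sum_le_card_mul_sum_sq
        _ ≤ n ^ 2 * ∑ z : Fin n × Fin n, ((codegIn Γ z.1 z.2 X : ℝ) - q) ^ 2 := by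
            gcongr
            exact subset_univ _
        _ ≤ n ^ 2 * (q ^ 2 * n ^ 2 * (6 * η) + 4 * q * n ^ 2) := by
            gcongr
            exact codeg_dev hη hη1 hp.le hN X
        _ = n ^ 4 * (q ^ 2 * (6 * η) + 4 * q) := by ring
        _ ≤ n ^ 4 * (q ^ 2 * (4 / 9 * γ ^ 2)) := by
            gcongr
            have h3 : 4 * q ≤ q ^ 2 * (2 / 9 * γ ^ 2) := by
              have : 18 ≤ q * γ ^ 2 := by rwa [div_le_iff₀ (by positivity)] at hq1
              nlinarith
            have h4 : q ^ 2 * (6 * η) ≤ q ^ 2 * (2 / 9 * γ ^ 2) :=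
              mul_le_mul_of_nonneg_left (by linarith) (sq_nonneg q)
            linarith
        _ = _ := by ring
    have h3 := abs_le_of_sq_le_sq' h2 (by positivity)
    linarith [h3.2]
  have hPl : 4 / 9 * (n:ℝ) ^ 2 ≤ P.card := by
    have h1 := le_trans hlow hup
    have h2 : q * (4 / 9 * (n:ℝ) ^ 2) ≤ q * P.card := by
      have h3 : q * (4 / 9 + 2 / 3 * γ) * (n:ℝ)^2 ≤ q * (2 / 3 + γ / 2) ^ 2 * n ^ 2 := by
        have : 4 / 9 + 2 / 3 * γ ≤ (2 / 3 + γ / 2) ^ 2 := by linarith [sq_nonneg γ, show (2 / 3 + γ / 2) ^ 2 = 4 / 9 + 2 / 3 * γ + γ ^ 2 / 4 by ring]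
        gcongr
      linarith [show q * (4 / 9 + 2 / 3 * γ) * (n:ℝ)^2 = q * (4 / 9 * (n:ℝ) ^ 2) + q * (2 / 3 * γ) * n ^ 2 by ring]
    exact le_of_mul_le_mul_left h2 hq0
  have hUc : (U.card : ℝ) ≤ 5 / 9 * n ^ 2 := by
    have h1 : P.card + U.card = n * n := by
      rw [hPd, Finset.card_sdiff_add_card_eq_card (subset_univ _)]
      simp
    have h2 : (P.card : ℝ) + U.card = n * n := by exact_mod_cast h1
    nlinarith
  -- G-edges avoiding F
  have hedge : 2 / 3 * (p * n ^ 2) ≤ (eBtw G (univ \ F) (univ \ F) : ℝ) := by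
    have h1 : (eBtw G univ (univ \ F) : ℝ) = eBtw G (univ \ F) (univ \ F) + eBtw G F (univ \ F) := by
      rw [e_deg, e_deg, e_deg, Finset.sum_sdiff (subset_univ F)]
    have h2 : (eBtw G univ (univ \ F) : ℝ) = ∑ v ∈ univ \ F, (degIn G v univ : ℝ) := by
      rw [e_comm, e_deg]
    have h3 : ((univ \ F).card : ℝ) * ((2 / 3 + γ) * n * p) ≤ ∑ v ∈ univ \ F, (degIn G v univ : ℝ) := by
      rw [← nsmul_eq_mul]
      exact Finset.card_nsmul_le_sum _ _ _ fun v _ => hdeg v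
    have h4 : (eBtw G F (univ \ F) : ℝ) ≤ F.card * (2 * p * n) := by
      rw [e_deg, ← nsmul_eq_mul]
      refine Finset.sum_le_card_nsmul _ _ _ fun v _ => ?_
      have := hAub v
      rwa [hA, nbhd_card] at this
    have h5 : ((univ \ F).card : ℝ) = n - F.card := by
      rw [card_sdiff_real (subset_univ F)]; simp
    rw [h5] at h3
    have hF2 : (F.card : ℝ) ≤ γ / 3 * n := by
      exact le_trans hF (mul_le_mul_of_nonneg_right (by nlinarith) hn'.le)
    have h6 : (F.card : ℝ) * (p * n) ≤ γ / 3 * n * (p * n) := by gcongr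
    have h7 : (n - F.card : ℝ) * ((2 / 3 + γ) * n * p) = (2/3 + γ) * (p * n^2) - (2/3 + γ) * (F.card * (p * n)) := by ring
    have h8 : (2/3 + γ) * (F.card * (p * n)) ≤ 1 * (F.card * (p * n)) := by gcongr; linarith
    nlinarith
  have hsub : (eBtw G (univ \ F) (univ \ F) : ℝ) ≤ ((U.filter fun z => Γ.Adj z.1 z.2).card : ℝ) := by
    unfold eBtw
    have : (((univ \ F) ×ˢ (univ \ F)).filter fun a => G.Adj a.1 a.2).card ≤ (U.filter fun z => Γ.Adj z.1 z.2).card := by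
      refine card_le_card fun z hz => ?_
      rw [mem_filter, mem_product, mem_sdiff, mem_sdiff] at hz
      rw [mem_filter]
      refine ⟨?_, hG hz.2⟩
      rw [hU, mem_unc]
      intro v hv hvz
      exact hcon v (mem_sdiff.1 (hXs hv)).1 z.1 hz.1.1.2 z.2 hz.1.2.2 (mem_filter.1 hvz.1).2
        (mem_filter.1 hvz.2).2 hz.2
    exact_mod_cast this
  have hfin : p * U.card ≤ p * (5 / 9 * n ^ 2) := by gcongr
  have : 0 < p * (n:ℝ) ^ 2 := by positivity
  nlinarith

end Part10

section Part11
/-! ## Sparse regularity lemma -/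

def Fam {n : ℕ} (P : Finset (Finset (Fin n))) (b : ℕ) : Prop :=
  (∀ A ∈ P, A.card = b) ∧ ∀ A ∈ P, ∀ B ∈ P, A ≠ B → Disjoint A B

lemma chop1 {n : ℕ} (b : ℕ) (hb : 0 < b) (m : ℕ) : ∀ S : Finset (Fin n), S.card = m →
    ∃ R : Finset (Finset (Fin n)), Fam R b ∧ (∀ A ∈ R, A ⊆ S) ∧ S.card ≤ R.card * b + b := by
  induction m using Nat.strong_induction_on with
  | _ m ih =>
    intro S hS
    by_cases h : S.card < b
    · exact ⟨∅, ⟨by simp, by simp⟩, by simp, by simp; omega⟩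
    · push Not at h
      obtain ⟨A, hA, hAc⟩ := exists_subset_card_eq h
      have hc := card_sdiff_add_card_eq_card hA
      obtain ⟨R, hR1, hR2, hR3⟩ := ih (S \ A).card (by omega) (S \ A) rfl
      have hdis : ∀ B ∈ R, Disjoint A B := fun B hB =>
        disjoint_of_subset_right (hR2 B hB) disjoint_sdiff
      have hAR : A ∉ R := by
        intro hAR
        have := hdis A hAR
        rw [disjoint_self_iff_empty] at this
        rw [this] at hAc
        simp at hAc; omega
      refine ⟨insert A R, ⟨?_, ?_⟩, ?_, ?_⟩
      · intro B hB
        rcases mem_insert.1 hB with rfl | hB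
        · exact hAc
        · exact hR1.1 B hB
      · intro B hB C hC hBC
        rcases mem_insert.1 hB with hB' | hB' <;> rcases mem_insert.1 hC with hC' | hC'
        · exact absurd (hB'.trans hC'.symm) hBC
        · rw [hB']; exact hdis C hC'
        · rw [hC']; exact (hdis B hB').symm
        · exact hR1.2 B hB' C hC' hBC
      · intro B hB
        rcases mem_insert.1 hB with rfl | hB
        · exact hA
        · exact (hR2 B hB).trans sdiff_subset
      · rw [card_insert_of_notMem hAR]
        have : (R.card + 1) * b = R.card * b + b := by ring
        omega

lemma fam_biUnion {n : ℕ} {ι : Type*} {b : ℕ} (hb : 0 < b) (I : Finset ι) (S : ι → Finset (Fin n))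
    (hS : ∀ i ∈ I, ∀ j ∈ I, i ≠ j → Disjoint (S i) (S j)) (R : ι → Finset (Finset (Fin n)))
    (hR : ∀ i ∈ I, Fam (R i) b) (hRS : ∀ i ∈ I, ∀ A ∈ R i, A ⊆ S i) :
    Fam (I.biUnion R) b ∧ (∀ i ∈ I, ∀ j ∈ I, i ≠ j → Disjoint (R i) (R j)) := by
  have hne : ∀ i ∈ I, ∀ A ∈ R i, A.Nonempty := by
    intro i hi A hA
    rw [← card_pos, (hR i hi).1 A hA]; exact hb
  have hd : ∀ i ∈ I, ∀ j ∈ I, i ≠ j → ∀ A ∈ R i, ∀ B ∈ R j, Disjoint A B := by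
    intro i hi j hj hij A hA B hB
    exact disjoint_of_subset_left (hRS i hi A hA) (disjoint_of_subset_right (hRS j hj B hB) (hS i hi j hj hij))
  refine ⟨⟨?_, ?_⟩, ?_⟩
  · intro A hA
    obtain ⟨i, hi, hA⟩ := mem_biUnion.1 hA
    exact (hR i hi).1 A hA
  · intro A hA B hB hAB
    obtain ⟨i, hi, hA⟩ := mem_biUnion.1 hA
    obtain ⟨j, hj, hB⟩ := mem_biUnion.1 hB
    by_cases hij : i = j
    · subst hij; exact (hR i hi).2 A hA B hB hAB
    · exact hd i hi j hj hij A hA B hB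
  · intro i hi j hj hij
    rw [disjoint_left]
    intro A hA hA'
    have := hd i hi j hj hij A hA A hA'
    rw [disjoint_self_iff_empty] at this
    exact (hne i hi A hA).ne_empty this

lemma chop2 {n : ℕ} {ι : Type*} (b : ℕ) (hb : 0 < b) (S : Finset (Fin n)) (I : Finset ι)
    (c : Fin n → ι) (hc : ∀ x ∈ S, c x ∈ I) :
    ∃ R : Finset (Finset (Fin n)), Fam R b ∧ (∀ A ∈ R, A ⊆ S) ∧ S.card ≤ R.card * b + I.card * b ∧
      ∀ A ∈ R, ∀ x ∈ A, ∀ y ∈ A, c x = c y := by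
  have hex : ∀ i : ι, ∃ R : Finset (Finset (Fin n)), Fam R b ∧ (∀ A ∈ R, A ⊆ S.filter fun x => c x = i) ∧
      (S.filter fun x => c x = i).card ≤ R.card * b + b := fun i => chop1 b hb _ _ rfl
  choose R hR1 hR2 hR3 using hex
  have hS : ∀ i ∈ I, ∀ j ∈ I, i ≠ j →
      Disjoint (S.filter fun x => c x = i) (S.filter fun x => c x = j) := by
    intro i _ j _ hij
    rw [disjoint_left]
    intro x hx hx'
    exact hij ((mem_filter.1 hx).2.symm.trans (mem_filter.1 hx').2)
  obtain ⟨hF, hD⟩ := fam_biUnion hb I _ hS R (fun i _ => hR1 i) (fun i _ => hR2 i)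
  refine ⟨I.biUnion R, hF, ?_, ?_, ?_⟩
  · intro A hA
    obtain ⟨i, _, hA⟩ := mem_biUnion.1 hA
    exact (hR2 i A hA).trans (filter_subset _ _)
  · rw [card_biUnion hD, Finset.sum_mul]
    rw [Finset.card_eq_sum_card_fiberwise hc]
    have : I.card * b = ∑ i ∈ I, b := by simp
    rw [this, ← Finset.sum_add_distrib]
    exact Finset.sum_le_sum fun i _ => hR3 i
  · intro A hA x hx y hy
    obtain ⟨i, _, hA⟩ := mem_biUnion.1 hA
    rw [(mem_filter.1 (hR2 i A hA hx)).2, (mem_filter.1 (hR2 i A hA hy)).2]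

lemma fam_card_le {n : ℕ} {P : Finset (Finset (Fin n))} {b : ℕ} (h : Fam P b) (S : Finset (Fin n))
    (hS : ∀ A ∈ P, A ⊆ S) : P.card * b ≤ S.card := by
  have h1 : (P.biUnion id).card = P.card * b := by
    rw [card_biUnion (s := P) (t := id) (fun A hA B hB hAB => h.2 A hA B hB hAB)]
    rw [Finset.sum_congr rfl (fun A hA => (h.1 A hA : (id A).card = b))]; simp
  rw [← h1]
  exact card_le_card (biUnion_subset.2 hS)

/-- sum of e over families is e of union -/
lemma e_biUnion {n : ℕ} (G : SimpleGraph (Fin n)) {P Q : Finset (Finset (Fin n))} {b b' : ℕ}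
    (hP : Fam P b) (hQ : Fam Q b') :
    ∑ A ∈ P, ∑ B ∈ Q, (eBtw G A B : ℝ) = eBtw G (P.biUnion id) (Q.biUnion id) := by
  have hp : (P : Set (Finset (Fin n))).PairwiseDisjoint id := fun A hA B hB hAB => hP.2 A hA B hB hAB
  have hq : (Q : Set (Finset (Fin n))).PairwiseDisjoint id := fun A hA B hB hAB => hQ.2 A hA B hB hAB
  rw [e_sum, Finset.sum_biUnion hp]
  refine Finset.sum_congr rfl fun A _ => ?_
  simp_rw [e_sum]
  rw [Finset.sum_comm]
  refine Finset.sum_congr rfl fun x _ => ?_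
  rw [Finset.sum_biUnion hq]; rfl

lemma fam_union_card {n : ℕ} {P : Finset (Finset (Fin n))} {b : ℕ} (h : Fam P b) :
    (P.biUnion id).card = P.card * b := by
  rw [card_biUnion (s := P) (t := id) (fun A hA B hB hAB => h.2 A hA B hB hAB)]
  rw [Finset.sum_congr rfl (fun A hA => (h.1 A hA : (id A).card = b))]; simp

lemma Fam.sub' {n : ℕ} {P Q : Finset (Finset (Fin n))} {b : ℕ} (h : Fam P b) (hQ : Q ⊆ P) : Fam Q b :=
  ⟨fun A hA => h.1 A (hQ hA), fun A hA B hB => h.2 A (hQ hA) B (hQ hB)⟩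

def UB {n : ℕ} (G : SimpleGraph (Fin n)) (p κ : ℝ) : Prop :=
  ∀ A B : Finset (Fin n), (eBtw G A B : ℝ) ≤ p * A.card * B.card + κ * p * n ^ 2

def energy {n : ℕ} (G : SimpleGraph (Fin n)) (p : ℝ) (b : ℕ) (P : Finset (Finset (Fin n))) : ℝ :=
  ∑ A ∈ P, ∑ B ∈ P, (eBtw G A B : ℝ) ^ 2 / (p ^ 2 * b ^ 2)

lemma e_mono {n : ℕ} (G : SimpleGraph (Fin n)) {A A' B B' : Finset (Fin n)} (hA : A' ⊆ A) (hB : B' ⊆ B) :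
    (eBtw G A' B' : ℝ) ≤ eBtw G A B := by
  rw [e_sum, e_sum]
  calc ∑ x ∈ A', ∑ y ∈ B', ad G x y ≤ ∑ x ∈ A', ∑ y ∈ B, ad G x y :=
        Finset.sum_le_sum fun x _ => Finset.sum_le_sum_of_subset_of_nonneg hB fun y _ _ => ad_nonneg G x y
    _ ≤ _ := Finset.sum_le_sum_of_subset_of_nonneg hA fun x _ _ =>
        Finset.sum_nonneg fun y _ => ad_nonneg G x y

lemma e_split_left {n : ℕ} (G : SimpleGraph (Fin n)) {A A' : Finset (Fin n)} (B : Finset (Fin n))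
    (hA : A' ⊆ A) : (eBtw G A B : ℝ) = eBtw G A' B + eBtw G (A \ A') B := by
  rw [e_sum, e_sum, e_sum, add_comm, Finset.sum_sdiff hA]

lemma e_split_right {n : ℕ} (G : SimpleGraph (Fin n)) (A : Finset (Fin n)) {B B' : Finset (Fin n)}
    (hB : B' ⊆ B) : (eBtw G A B : ℝ) = eBtw G A B' + eBtw G A (B \ B') := by
  rw [e_comm, e_split_left G A hB, e_comm, e_comm G (B \ B')]

/-- loss of edges when removing few vertices -/
lemma e_loss {n : ℕ} {G : SimpleGraph (Fin n)} {p κ : ℝ} (hp : 0 ≤ p) (hU : UB G p κ)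
    {A A' B B' : Finset (Fin n)} (hA : A' ⊆ A) (hB : B' ⊆ B) {t b : ℝ} (hAb : (A.card : ℝ) ≤ b)
    (hBb : (B.card : ℝ) ≤ b) (htA : (A.card : ℝ) ≤ A'.card + t) (htB : (B.card : ℝ) ≤ B'.card + t) :
    (eBtw G A B : ℝ) ≤ eBtw G A' B' + 2 * (p * t * b + κ * p * n ^ 2) := by
  have h1 := hU (A \ A') B
  have h2 := hU A' (B \ B')
  rw [card_sdiff_real hA] at h1
  rw [card_sdiff_real hB] at h2
  rw [e_split_left G B hA, e_split_right G A' hB]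
  have hb : 0 ≤ b := le_trans (by positivity) hAb
  have ht : 0 ≤ t := by
    have : (A'.card : ℝ) ≤ A.card := by exact_mod_cast card_le_card hA
    have : ((A.card : ℝ) - A'.card) ≤ t := by linarith
    linarith
  have h3 : p * ((A.card : ℝ) - A'.card) * B.card ≤ p * t * b := by
    have : (A.card : ℝ) - A'.card ≤ t := by linarith
    gcongr
  have h4 : p * (A'.card : ℝ) * ((B.card : ℝ) - B'.card) ≤ p * t * b := by
    have : (B.card : ℝ) - B'.card ≤ t := by linarith
    have h5 : (A'.card : ℝ) ≤ b := le_trans (by exact_mod_cast card_le_card hA) hAb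
    calc p * (A'.card : ℝ) * ((B.card : ℝ) - B'.card) ≤ p * (A'.card : ℝ) * t := by gcongr
      _ ≤ p * b * t := by gcongr
      _ = _ := by ring
  linarith

end Part11

section Part12
lemma union_loss {n : ℕ} {A : Finset (Fin n)} {R : Finset (Finset (Fin n))} {b : ℕ} (hR : Fam R b)
    (hRA : ∀ X ∈ R, X ⊆ A) {t : ℝ} (hc : (A.card : ℝ) ≤ R.card * b + t)
    {S : Finset (Fin n)} (hS : S ⊆ A) (hmono : ∀ X ∈ R, X ⊆ S ∨ Disjoint X S) :
    ((R.filter fun X => X ⊆ S).biUnion id) ⊆ S ∧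
    (S.card : ℝ) ≤ ((R.filter fun X => X ⊆ S).biUnion id).card + t := by
  have hsub : ((R.filter fun X => X ⊆ S).biUnion id) ⊆ S := by
    rw [biUnion_subset]; intro X hX; exact (mem_filter.1 hX).2
  refine ⟨hsub, ?_⟩
  have h1 : S \ ((R.filter fun X => X ⊆ S).biUnion id) ⊆ A \ (R.biUnion id) := by
    intro x hx
    rw [mem_sdiff] at hx ⊢
    refine ⟨hS hx.1, fun h => hx.2 ?_⟩
    obtain ⟨X, hX, hxX⟩ := mem_biUnion.1 h
    rcases hmono X hX with h' | h'
    · exact mem_biUnion.2 ⟨X, mem_filter.2 ⟨hX, h'⟩, hxX⟩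
    · exact absurd hx.1 (disjoint_left.1 h' hxX)
  have h2 : ((S \ ((R.filter fun X => X ⊆ S).biUnion id)).card : ℝ) ≤ (A \ (R.biUnion id)).card := by
    exact_mod_cast card_le_card h1
  rw [card_sdiff_real hsub, card_sdiff_real (F := R.biUnion id) (biUnion_subset.2 hRA), fam_union_card hR] at h2
  push_cast at h2
  linarith

lemma pair_sum_sq {n : ℕ} (R Q R' Q' : Finset (Finset (Fin n))) (hR : R' ⊆ R) (hQ : Q' ⊆ Q)
    (f : Finset (Fin n) → Finset (Fin n) → ℝ) :
    (∑ X ∈ R', ∑ Y ∈ Q', f X Y) ^ 2 ≤ (R'.card * Q'.card : ℝ) * ∑ X ∈ R, ∑ Y ∈ Q, (f X Y) ^ 2 := by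
  rw [← Finset.sum_product', ← Finset.sum_product']
  have h := sq_sum_le_card_mul_sum_sq (s := R' ×ˢ Q') (f := fun z => f z.1 z.2)
  rw [card_product] at h
  push_cast at h
  refine h.trans ?_
  have : ∑ z ∈ R' ×ˢ Q', f z.1 z.2 ^ 2 ≤ ∑ z ∈ R ×ˢ Q, f z.1 z.2 ^ 2 :=
    Finset.sum_le_sum_of_subset_of_nonneg (product_subset_product hR hQ) fun _ _ _ => sq_nonneg _
  exact mul_le_mul_of_nonneg_left this (by positivity)

set_option maxHeartbeats 1000000 in
/-- energy increment for one pair -/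
lemma pair_inc {n : ℕ} {G : SimpleGraph (Fin n)} {p κ θ η : ℝ} (hp : 0 < p) (hκ : 0 ≤ κ) (hη : 0 < η)
    (hθ : 0 ≤ θ)
    (hU : UB G p κ) {A B : Finset (Fin n)} {b b' : ℕ} (hb : 0 < b) (hb' : 0 < b')
    (hA : A.card = b) (hB : B.card = b) {RA RB : Finset (Finset (Fin n))}
    (hRA : Fam RA b') (hRB : Fam RB b') (hRA' : ∀ X ∈ RA, X ⊆ A) (hRB' : ∀ X ∈ RB, X ⊆ B)
    (hcA : (b : ℝ) ≤ RA.card * b' + θ * b) (hcB : (b : ℝ) ≤ RB.card * b' + θ * b)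
    (hκb : 12 * (θ * b ^ 2 + κ * n ^ 2) ≤ η * b ^ 2) (hη1 : η ≤ 1) :
    (eBtw G A B : ℝ) ^ 2 / (p ^ 2 * b ^ 2) - 8 * (θ * b ^ 2 + κ * n ^ 2) ≤
      ∑ X ∈ RA, ∑ Y ∈ RB, (eBtw G X Y : ℝ) ^ 2 / (p ^ 2 * b' ^ 2) ∧
    ((∃ S ⊆ A, ∃ T ⊆ B, (∀ X ∈ RA, X ⊆ S ∨ Disjoint X S) ∧ (∀ Y ∈ RB, Y ⊆ T ∨ Disjoint Y T) ∧
      η * p * (b * b) < |(eBtw G S T : ℝ) - RandomTriangle.dens G A B * S.card * T.card|) →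
    (eBtw G A B : ℝ) ^ 2 / (p ^ 2 * b ^ 2) - 8 * (θ * b ^ 2 + κ * n ^ 2) + η ^ 2 / 4 * b ^ 2 ≤
      ∑ X ∈ RA, ∑ Y ∈ RB, (eBtw G X Y : ℝ) ^ 2 / (p ^ 2 * b' ^ 2)) := by
  have hbR : (0 : ℝ) < b := by exact_mod_cast hb
  have hbR' : (0 : ℝ) < b' := by exact_mod_cast hb'
  set e : ℝ := (eBtw G A B : ℝ) with he
  set d : ℝ := RandomTriangle.dens G A B with hd
  set q : ℝ := θ * b ^ 2 + κ * n ^ 2 with hq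
  have hq0 : 0 ≤ q := by positivity
  have hde : e = d * b ^ 2 := by
    rw [hd]; unfold RandomTriangle.dens; rw [hA, hB]; field_simp; rw [he]
  have hd0 : 0 ≤ d := by rw [hd]; unfold RandomTriangle.dens; positivity
  have hqb : 12 * q ≤ b ^ 2 := hκb.trans (by nlinarith [sq_nonneg (b : ℝ)])
  have hd2 : d ≤ 2 * p := by
    have h1 := hU A B
    rw [hA, hB, ← he, hde] at h1
    have h2 : κ * n ^ 2 ≤ b ^ 2 := by
      have : 0 ≤ θ * (b : ℝ) ^ 2 := by positivity
      linarith
    have h3 : d * b ^ 2 ≤ 2 * p * b ^ 2 := by nlinarith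
    exact le_of_mul_le_mul_right h3 (by positivity)
  set V : ℝ := ∑ X ∈ RA, ∑ Y ∈ RB, ((eBtw G X Y : ℝ) - d * b' ^ 2) ^ 2 with hV
  have hV0 : 0 ≤ V := Finset.sum_nonneg fun _ _ => Finset.sum_nonneg fun _ _ => sq_nonneg _
  have hNA : (RA.card : ℝ) * b' ≤ b := by
    have := fam_card_le hRA A hRA'; rw [hA] at this; exact_mod_cast this
  have hNB : (RB.card : ℝ) * b' ≤ b := by
    have := fam_card_le hRB B hRB'; rw [hB] at this; exact_mod_cast this
  set N : ℝ := RA.card * RB.card with hN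
  have hNb : N * b' ^ 2 ≤ b ^ 2 := by
    have := mul_le_mul hNA hNB (by positivity) hbR.le
    calc N * b' ^ 2 = RA.card * b' * (RB.card * b') := by rw [hN]; ring
      _ ≤ _ := this
      _ = _ := by ring
  set E1 : ℝ := ∑ X ∈ RA, ∑ Y ∈ RB, (eBtw G X Y : ℝ) with hE1
  have hE1' : e - 2 * p * q ≤ E1 := by
    have h1 := e_loss hp.le hU (biUnion_subset.2 hRA') (biUnion_subset.2 hRB') (t := θ * b) (b := b)
      (by rw [hA]) (by rw [hB]) (by rw [hA]; erw [fam_union_card hRA]; push_cast; exact hcA)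
      (by rw [hB]; erw [fam_union_card hRB]; push_cast; exact hcB)
    rw [hE1, e_biUnion G hRA hRB]
    have : 2 * (p * (θ * b) * b + κ * p * n ^ 2) = 2 * p * q := by rw [hq]; ring
    rw [this] at h1
    have h2 : (eBtw G A B : ℝ) = e := rfl
    rw [h2] at h1
    have h3 : (eBtw G (RA.biUnion id) (RB.biUnion id) : ℝ) = eBtw G (RA.biUnion fun i => i) (RB.biUnion fun i => i) := rfl
    rw [h3]; linarith
  have hsum : ∑ X ∈ RA, ∑ Y ∈ RB, (eBtw G X Y : ℝ) ^ 2 / (p ^ 2 * b' ^ 2) =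
      (2 * d * b' ^ 2 * E1 - d ^ 2 * b' ^ 4 * N + V) / (p ^ 2 * b' ^ 2) := by
    have : ∀ X Y : Finset (Fin n), (eBtw G X Y : ℝ) ^ 2 / (p ^ 2 * b' ^ 2) =
        (2 * d * b' ^ 2 * (eBtw G X Y : ℝ) - d ^ 2 * b' ^ 4 + ((eBtw G X Y : ℝ) - d * b' ^ 2) ^ 2) /
          (p ^ 2 * b' ^ 2) := by
      intro X Y; congr 1; ring
    simp_rw [this]
    simp_rw [← Finset.sum_div, Finset.sum_add_distrib, Finset.sum_sub_distrib, ← Finset.mul_sum]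
    congr 2
    simp [hN]; ring
  have hmain : e ^ 2 / (p ^ 2 * b ^ 2) - 8 * q + V / (p ^ 2 * b' ^ 2) ≤
      ∑ X ∈ RA, ∑ Y ∈ RB, (eBtw G X Y : ℝ) ^ 2 / (p ^ 2 * b' ^ 2) := by
    rw [hsum, add_div]
    have h1 : (2 * d * b' ^ 2 * E1 - d ^ 2 * b' ^ 4 * N) / (p ^ 2 * b' ^ 2) =
        (2 * d * E1 - d ^ 2 * (N * b' ^ 2)) / p ^ 2 := by field_simp
    rw [h1]
    have h2 : e ^ 2 / (p ^ 2 * b ^ 2) - 8 * q ≤ (2 * d * E1 - d ^ 2 * (N * b' ^ 2)) / p ^ 2 := by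
      rw [le_div_iff₀ (by positivity)]
      have h3 : (e ^ 2 / (p ^ 2 * b ^ 2) - 8 * q) * p ^ 2 = d ^ 2 * b ^ 2 - 8 * q * p ^ 2 := by
        rw [hde]; field_simp
      rw [h3]
      have h4 : 2 * d * (e - 2 * p * q) ≤ 2 * d * E1 := mul_le_mul_of_nonneg_left hE1' (by positivity)
      have h5 : d ^ 2 * (N * b' ^ 2) ≤ d ^ 2 * b ^ 2 := mul_le_mul_of_nonneg_left hNb (by positivity)
      have h6 : d * (4 * p * q) ≤ 2 * p * (4 * p * q) := mul_le_mul_of_nonneg_right hd2 (by positivity)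
      rw [hde] at h4
      nlinarith
    linarith
  refine ⟨?_, ?_⟩
  · have : 0 ≤ V / (p ^ 2 * b' ^ 2) := by positivity
    linarith
  · rintro ⟨S, hS, T, hT, hSm, hTm, hbig⟩
    refine le_trans ?_ hmain
    have hAc : (A.card : ℝ) ≤ RA.card * b' + θ * b := by rw [hA]; exact hcA
    have hBc : (B.card : ℝ) ≤ RB.card * b' + θ * b := by rw [hB]; exact hcB
    obtain ⟨hS1, hS2⟩ := union_loss hRA hRA' hAc hS hSm
    obtain ⟨hT1, hT2⟩ := union_loss hRB hRB' hBc hT hTm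
    set RS := RA.filter fun X => X ⊆ S with hRS
    set RT := RB.filter fun X => X ⊆ T with hRT
    have hFS : Fam RS b' := hRA.sub' (filter_subset _ _)
    have hFT : Fam RT b' := hRB.sub' (filter_subset _ _)
    have hSb : (S.card : ℝ) ≤ b := by rw [← hA]; exact_mod_cast card_le_card hS
    have hTb : (T.card : ℝ) ≤ b := by rw [← hB]; exact_mod_cast card_le_card hT
    have hl := e_loss hp.le hU hS1 hT1 (t := θ * b) (b := b) hSb hTb hS2 hT2
    have hl2 := e_mono G hS1 hT1
    have h3 : 2 * (p * (θ * b) * b + κ * p * n ^ 2) = 2 * p * q := by rw [hq]; ring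
    rw [h3] at hl
    have hS3 : ((RS.biUnion id).card : ℝ) ≤ S.card := by exact_mod_cast card_le_card hS1
    have hT3 : ((RT.biUnion id).card : ℝ) ≤ T.card := by exact_mod_cast card_le_card hT1
    have hF : ∑ X ∈ RS, ∑ Y ∈ RT, ((eBtw G X Y : ℝ) - d * b' ^ 2) =
        eBtw G (RS.biUnion id) (RT.biUnion id) - d * ((RS.biUnion id).card * (RT.biUnion id).card) := by
      simp_rw [Finset.sum_sub_distrib]
      rw [e_biUnion G hFS hFT, fam_union_card hFS, fam_union_card hFT]
      simp; ring
    set s : ℝ := (S.card : ℝ)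
    set t : ℝ := (T.card : ℝ)
    set s' : ℝ := ((RS.biUnion id).card : ℝ) with hs'
    set t' : ℝ := ((RT.biUnion id).card : ℝ) with ht'
    have hs'0 : 0 ≤ s' := by positivity
    have ht'0 : 0 ≤ t' := by positivity
    have hst : s * t - s' * t' ≤ 2 * (θ * b ^ 2) := by
      have e1 : (s - s') * t ≤ (θ * b) * b := mul_le_mul (by linarith) hTb (by linarith) (by positivity)
      have e2 : s' * (t - t') ≤ b * (θ * b) := mul_le_mul (by linarith) (by linarith) (by linarith) (by positivity)
      have e3 : s * t - s' * t' = (s - s') * t + s' * (t - t') := by ring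
      rw [e3]; linarith
    have hst0 : s' * t' ≤ s * t := mul_le_mul hS3 hT3 ht'0 (by linarith)
    have hdst : d * (s * t - s' * t') ≤ 4 * p * q := by
      calc d * (s * t - s' * t') ≤ 2 * p * (2 * (θ * b ^ 2)) := mul_le_mul hd2 hst (by linarith) (by positivity)
        _ ≤ 4 * p * q := by
          have : 0 ≤ p * (κ * (n : ℝ) ^ 2) := by positivity
          rw [hq]; linarith
    have hdst0 : 0 ≤ d * (s * t - s' * t') := mul_nonneg hd0 (by linarith)
    set F : ℝ := ∑ X ∈ RS, ∑ Y ∈ RT, ((eBtw G X Y : ℝ) - d * b' ^ 2) with hFdef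
    have hF2 : η * p * (b * b) / 2 ≤ |F| := by
      have hpq : 12 * (p * q) ≤ η * p * (b * b) := by
        have := mul_le_mul_of_nonneg_left hκb hp.le
        linarith
      have hpq0 : 0 ≤ p * q := by positivity
      rcases lt_abs.1 hbig with h | h
      · refine le_trans ?_ (le_abs_self _)
        rw [hF]; linarith
      · refine le_trans ?_ (neg_le_abs _)
        rw [hF]; linarith
    have hCS := pair_sum_sq RA RB RS RT (filter_subset _ _) (filter_subset _ _)
      (fun X Y => (eBtw G X Y : ℝ) - d * b' ^ 2)
    have hN2 : (RS.card * RT.card : ℝ) * b' ^ 2 ≤ b ^ 2 := by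
      refine le_trans ?_ hNb
      have h1 : (RS.card : ℝ) ≤ RA.card := by exact_mod_cast card_le_card (filter_subset _ _)
      have h2 : (RT.card : ℝ) ≤ RB.card := by exact_mod_cast card_le_card (filter_subset _ _)
      have : (RS.card * RT.card : ℝ) ≤ N := mul_le_mul h1 h2 (by positivity) (by positivity)
      exact mul_le_mul_of_nonneg_right this (by positivity)
    have hF3 : (η * p * (b * b) / 2) ^ 2 ≤ F ^ 2 := by
      rw [← sq_abs F]
      exact pow_le_pow_left₀ (by positivity) hF2 2
    have hVb : η ^ 2 / 4 * b ^ 2 ≤ V / (p ^ 2 * b' ^ 2) := by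
      rw [le_div_iff₀ (by positivity)]
      have h1 : (η * p * (b * b) / 2) ^ 2 * b' ^ 2 ≤ (RS.card * RT.card : ℝ) * V * b' ^ 2 :=
        mul_le_mul_of_nonneg_right (hF3.trans hCS) (by positivity)
      have h2 : (RS.card * RT.card : ℝ) * b' ^ 2 * V ≤ b ^ 2 * V := mul_le_mul_of_nonneg_right hN2 hV0
      have h3 : b ^ 2 * (η ^ 2 / 4 * b ^ 2 * (p ^ 2 * b' ^ 2)) ≤ b ^ 2 * V := by linarith
      exact le_of_mul_le_mul_left h3 (by positivity)
    linarith

end Part12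

section Part13
def Irr {n : ℕ} (G : SimpleGraph (Fin n)) (η p : ℝ) (P : Finset (Finset (Fin n))) :
    Finset (Finset (Fin n) × Finset (Fin n)) :=
  (P ×ˢ P).filter fun z => z.1 ≠ z.2 ∧ ¬ CutReg G η p z.1 z.2

set_option maxHeartbeats 1000000 in
lemma refine_step {n : ℕ} {G : SimpleGraph (Fin n)} {p κ θ η : ℝ} (hp : 0 < p) (hκ : 0 ≤ κ) (hη : 0 < η)
    (hη1 : η ≤ 1) (hθ : 0 ≤ θ) (hU : UB G p κ) {b b' M : ℕ} (hb : 0 < b) (hb' : 0 < b')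
    {P : Finset (Finset (Fin n))} (hP : Fam P b) (hM : P.card ≤ M)
    (hbb : (4 : ℝ) ^ M * b' ≤ θ * b)
    (hκb : 12 * (θ * b ^ 2 + κ * n ^ 2) ≤ η * b ^ 2)
    (hI : η * (P.card : ℝ) ^ 2 ≤ (Irr G η p P).card) :
    ∃ P', Fam P' b' ∧ (P.card : ℝ) * b ≤ P'.card * b' + θ * (P.card * b) ∧
      energy G p b P + (P.card : ℝ) ^ 2 * (η ^ 3 / 4 * b ^ 2 - 8 * (θ * b ^ 2 + κ * n ^ 2)) ≤ energy G p b' P' := by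
  have hw : ∀ A B : Finset (Fin n), ∃ S T : Finset (Fin n), S ⊆ A ∧ T ⊆ B ∧ (¬ CutReg G η p A B →
      η * p * (A.card * A.card) < |(eBtw G S T : ℝ) - RandomTriangle.dens G A B * S.card * T.card|) := by
    intro A B
    by_cases h : CutReg G η p A B
    · exact ⟨∅, ∅, empty_subset _, empty_subset _, fun h' => absurd h h'⟩
    · unfold CutReg at h
      push Not at h
      obtain ⟨S, hS, T, hT, h⟩ := h
      exact ⟨S, T, hS, hT, fun _ => h⟩
  choose S T hS hT hST using hw
  let col : Finset (Fin n) → Fin n → Finset (Finset (Fin n)) × Finset (Finset (Fin n)) :=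
    fun A x => (P.filter fun B => x ∈ S A B, P.filter fun B => x ∈ T B A)
  have hch : ∀ A : Finset (Fin n), ∃ R : Finset (Finset (Fin n)), Fam R b' ∧ (∀ X ∈ R, X ⊆ A) ∧
      A.card ≤ R.card * b' + (P.powerset ×ˢ P.powerset).card * b' ∧
      ∀ X ∈ R, ∀ x ∈ X, ∀ y ∈ X, col A x = col A y := fun A =>
    chop2 b' hb' A (P.powerset ×ˢ P.powerset) (col A) (fun x _ => by
      rw [mem_product, mem_powerset, mem_powerset]; exact ⟨filter_subset _ _, filter_subset _ _⟩)
  choose R hR1 hR2 hR3 hR4 using hch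
  have hcard : (((P.powerset ×ˢ P.powerset).card : ℕ) : ℝ) ≤ 4 ^ M := by
    rw [card_product, card_powerset]
    push_cast
    rw [← mul_pow]
    norm_num
    exact pow_le_pow_right₀ (by norm_num) hM
  have hcov : ∀ A ∈ P, (b : ℝ) ≤ (R A).card * b' + θ * b := by
    intro A hA
    have h := hR3 A
    rw [hP.1 A hA] at h
    have h' : (b : ℝ) ≤ (R A).card * b' + ((P.powerset ×ˢ P.powerset).card : ℝ) * b' := by exact_mod_cast h
    have := mul_le_mul_of_nonneg_right hcard (Nat.cast_nonneg (α := ℝ) b')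
    linarith
  obtain ⟨hF, hD⟩ := fam_biUnion hb' P (fun A => A) (fun A hA B hB h => hP.2 A hA B hB h) R (fun A _ => hR1 A)
    (fun A _ => hR2 A)
  have hpd : (P : Set (Finset (Fin n))).PairwiseDisjoint R := fun A hA B hB h => hD A hA B hB h
  refine ⟨P.biUnion R, hF, ?_, ?_⟩
  · rw [card_biUnion hD]
    push_cast
    rw [Finset.sum_mul]
    have h1 : ∑ A ∈ P, (b : ℝ) ≤ ∑ A ∈ P, ((R A).card * b' + θ * b : ℝ) := Finset.sum_le_sum hcov
    rw [Finset.sum_add_distrib] at h1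
    simp only [sum_const, nsmul_eq_mul] at h1
    linarith
  · have hen : energy G p b' (P.biUnion R) = ∑ z ∈ P ×ˢ P, ∑ X ∈ R z.1, ∑ Y ∈ R z.2,
        (eBtw G X Y : ℝ) ^ 2 / (p ^ 2 * b' ^ 2) := by
      unfold energy
      rw [Finset.sum_product, Finset.sum_biUnion hpd]
      refine Finset.sum_congr rfl fun A _ => ?_
      simp only
      rw [Finset.sum_comm (s := P) (t := R A)]
      refine Finset.sum_congr rfl fun X _ => ?_
      rw [Finset.sum_biUnion hpd]
    have hen0 : energy G p b P = ∑ z ∈ P ×ˢ P, (eBtw G z.1 z.2 : ℝ) ^ 2 / (p ^ 2 * b ^ 2) := by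
      unfold energy
      rw [Finset.sum_product]
    have hterm : ∀ z ∈ P ×ˢ P, (eBtw G z.1 z.2 : ℝ) ^ 2 / (p ^ 2 * b ^ 2) - 8 * (θ * b ^ 2 + κ * n ^ 2) +
        (if z.1 ≠ z.2 ∧ ¬ CutReg G η p z.1 z.2 then η ^ 2 / 4 * (b : ℝ) ^ 2 else 0) ≤
        ∑ X ∈ R z.1, ∑ Y ∈ R z.2, (eBtw G X Y : ℝ) ^ 2 / (p ^ 2 * b' ^ 2) := by
      rintro ⟨A, B⟩ hz
      rw [mem_product] at hz
      obtain ⟨hA, hB⟩ := hz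
      simp only at hA hB ⊢
      have hi := pair_inc hp hκ hη hθ hU hb hb' (hP.1 A hA) (hP.1 B hB) (hR1 A) (hR1 B) (hR2 A) (hR2 B)
        (hcov A hA) (hcov B hB) hκb hη1
      split_ifs with hc
      · refine hi.2 ⟨S A B, hS A B, T A B, hT A B, ?_, ?_, ?_⟩
        · intro X hX
          by_cases hx : ∃ x ∈ X, x ∈ S A B
          · left
            obtain ⟨x, hx, hxS⟩ := hx
            intro y hy
            have h1 := congrArg Prod.fst (hR4 A X hX x hx y hy)
            have h2 : B ∈ P.filter fun B => x ∈ S A B := mem_filter.2 ⟨hB, hxS⟩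
            have h3 : B ∈ P.filter fun B => y ∈ S A B := (Finset.ext_iff.1 h1 _).1 h2
            exact (mem_filter.1 h3).2
          · right
            push Not at hx
            exact disjoint_left.2 hx
        · intro X hX
          by_cases hx : ∃ x ∈ X, x ∈ T A B
          · left
            obtain ⟨x, hx, hxS⟩ := hx
            intro y hy
            have h1 := congrArg Prod.snd (hR4 B X hX x hx y hy)
            have h2 : A ∈ P.filter fun B' => x ∈ T B' B := mem_filter.2 ⟨hA, hxS⟩
            have h3 : A ∈ P.filter fun B' => y ∈ T B' B := (Finset.ext_iff.1 h1 _).1 h2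
            exact (mem_filter.1 h3).2
          · right
            push Not at hx
            exact disjoint_left.2 hx
        · have := hST A B hc.2
          rw [hP.1 A hA] at this
          exact this
      · have := hi.1
        linarith
    have hsum := Finset.sum_le_sum hterm
    rw [← hen, Finset.sum_add_distrib, Finset.sum_sub_distrib, ← hen0, ← Finset.sum_filter] at hsum
    simp only [sum_const, nsmul_eq_mul, card_product] at hsum
    change _ + ((Irr G η p P).card : ℝ) * _ ≤ _ at hsum
    push_cast at hsum
    have h5 : η * (P.card : ℝ) ^ 2 * (η ^ 2 / 4 * b ^ 2) ≤ ((Irr G η p P).card : ℝ) * (η ^ 2 / 4 * b ^ 2) :=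
      mul_le_mul_of_nonneg_right hI (by positivity)
    linarith

lemma energy_le {n : ℕ} {G : SimpleGraph (Fin n)} {p κ : ℝ} (hp : 0 < p)
    (hU : UB G p κ) {b : ℕ} (hb : 0 < b) {P : Finset (Finset (Fin n))} (hP : Fam P b)
    (hκb : κ * n ^ 2 ≤ b ^ 2) : energy G p b P ≤ 4 * n ^ 2 := by
  have hbR : (0 : ℝ) < b := by exact_mod_cast hb
  have h1 : ∀ A ∈ P, ∀ B ∈ P, (eBtw G A B : ℝ) ^ 2 / (p ^ 2 * b ^ 2) ≤ 4 * b ^ 2 := by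
    intro A hA B hB
    have h := hU A B
    rw [hP.1 A hA, hP.1 B hB] at h
    have h' : (eBtw G A B : ℝ) ≤ 2 * p * b ^ 2 := by
      have := mul_le_mul_of_nonneg_left hκb hp.le
      linarith
    rw [div_le_iff₀ (by positivity)]
    calc (eBtw G A B : ℝ) ^ 2 ≤ (2 * p * b ^ 2) ^ 2 := pow_le_pow_left₀ (by positivity) h' 2
      _ = _ := by ring
  have h2 : energy G p b P ≤ ∑ A ∈ P, ∑ B ∈ P, 4 * (b : ℝ) ^ 2 :=
    Finset.sum_le_sum fun A hA => Finset.sum_le_sum fun B hB => h1 A hA B hB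
  simp only [sum_const, nsmul_eq_mul] at h2
  have h3 : (P.card : ℝ) * b ≤ n := by
    have := fam_card_le hP univ (fun A _ => subset_univ A)
    rw [card_univ, Fintype.card_fin] at this
    exact_mod_cast this
  have h4 : ((P.card : ℝ) * b) ^ 2 ≤ n ^ 2 := pow_le_pow_left₀ (by positivity) h3 2
  linarith

set_option maxHeartbeats 1000000 in
lemma reg_aux (η θ : ℝ) (hη : 0 < η) (hη1 : η ≤ 1 / 2) (hθ : 0 < θ) (hθ1 : θ ≤ η ^ 3 / 256) (j : ℕ) :
    ∀ c : ℝ, 0 < c → c ≤ 1 → ∃ c' κ0 : ℝ, ∃ N0 : ℕ, 0 < c' ∧ 0 < κ0 ∧ ∀ n ≥ N0, ∀ (G : SimpleGraph (Fin n)) (p κ : ℝ),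
      0 < p → 0 ≤ κ → κ ≤ κ0 → UB G p κ → ∀ (P : Finset (Finset (Fin n))) (b : ℕ), Fam P b →
      c * n ≤ b → b ≤ η * n → (1 - η + j * θ) * n ≤ P.card * b →
      4 * (n : ℝ) ^ 2 < energy G p b P + j * (η ^ 3 / 64) * n ^ 2 →
      ∃ (P : Finset (Finset (Fin n))) (b : ℕ), Fam P b ∧ c' * n ≤ b ∧ b ≤ η * n ∧
        (1 - η) * n ≤ P.card * b ∧ ((Irr G η p P).card : ℝ) ≤ η * (P.card : ℝ) ^ 2 := by
  induction j with
  | zero =>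
    intro c hc _
    refine ⟨1, c ^ 2, 1, one_pos, by positivity, ?_⟩
    intro n hn G p κ hp hκ hκ0 hU P b hP hcb hbn hcov hE
    exfalso
    have hnR : (1 : ℝ) ≤ n := by exact_mod_cast hn
    have hb : 0 < b := by
      have : (0 : ℝ) < b := lt_of_lt_of_le (by positivity) hcb
      exact_mod_cast this
    have h1 : κ * (n : ℝ) ^ 2 ≤ b ^ 2 := by
      calc κ * (n : ℝ) ^ 2 ≤ c ^ 2 * n ^ 2 := mul_le_mul_of_nonneg_right hκ0 (by positivity)
        _ = (c * n) ^ 2 := by ring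
        _ ≤ _ := pow_le_pow_left₀ (by positivity) hcb 2
    have := energy_le hp hU hb hP h1
    simp at hE
    linarith
  | succ j ih =>
    intro c hc hc1
    set M : ℕ := ⌊1 / c⌋₊ with hM
    set c1 : ℝ := θ * c / (2 * 4 ^ M) with hc1d
    have h4M : (1 : ℝ) ≤ 4 ^ M := one_le_pow₀ (by norm_num)
    have hc1p : 0 < c1 := by positivity
    have hθ2 : θ ≤ 1 := hθ1.trans (by
      have : η ^ 3 ≤ 1 := pow_le_one₀ hη.le (by linarith)
      linarith)
    have hc11 : c1 ≤ 1 := by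
      rw [hc1d, div_le_one (by positivity)]
      have : θ * c ≤ 1 := mul_le_one₀ hθ2 hc.le hc1
      linarith
    obtain ⟨c', κ0, N0, hc', hκ0, ih⟩ := ih c1 hc1p hc11
    refine ⟨min c c', min κ0 (θ * c ^ 2), max N0 (⌈2 * 4 ^ M / (θ * c)⌉₊ + 1), lt_min hc hc',
      lt_min hκ0 (by positivity), ?_⟩
    intro n hn G p κ hp hκ hκle hU P b hP hcb hbn hcov hE
    have hn0 : N0 ≤ n := le_trans (le_max_left _ _) hn
    have hn1 : ⌈2 * 4 ^ M / (θ * c)⌉₊ + 1 ≤ n := le_trans (le_max_right _ _) hn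
    have hnR : (1 : ℝ) ≤ n := by
      have : 1 ≤ n := by omega
      exact_mod_cast this
    have hnbig : 2 * 4 ^ M / (θ * c) ≤ (n : ℝ) := by
      refine (Nat.le_ceil _).trans ?_
      have : ⌈2 * 4 ^ M / (θ * c)⌉₊ ≤ n := by omega
      exact_mod_cast this
    have hbR : (0 : ℝ) < b := lt_of_lt_of_le (by positivity) hcb
    have hb : 0 < b := by exact_mod_cast hbR
    by_cases hirr : ((Irr G η p P).card : ℝ) ≤ η * (P.card : ℝ) ^ 2
    · refine ⟨P, b, hP, ?_, hbn, ?_, hirr⟩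
      · exact (mul_le_mul_of_nonneg_right (min_le_left _ _) (by positivity)).trans hcb
      · refine le_trans ?_ hcov
        have : (0 : ℝ) ≤ ((j + 1 : ℕ) : ℝ) * θ * n := by positivity
        linarith
    · push Not at hirr
      have hmb : (P.card : ℝ) * b ≤ n := by
        have := fam_card_le hP univ (fun A _ => subset_univ A)
        rw [card_univ, Fintype.card_fin] at this
        exact_mod_cast this
      have hPM : P.card ≤ M := by
        rw [hM]
        refine Nat.le_floor ?_
        rw [le_div_iff₀ hc]
        have h1 : (P.card : ℝ) * (c * n) ≤ 1 * n := by
          have := mul_le_mul_of_nonneg_left hcb (Nat.cast_nonneg (α := ℝ) P.card)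
          linarith
        have h2 : (P.card : ℝ) * c * n ≤ 1 * n := by linarith
        exact le_of_mul_le_mul_right h2 (by linarith)
      set b' : ℕ := ⌊θ * b / 4 ^ M⌋₊ with hb'd
      have hx2 : 2 ≤ θ * b / 4 ^ M := by
        rw [le_div_iff₀ (by positivity)]
        rw [div_le_iff₀ (by positivity)] at hnbig
        have := mul_le_mul_of_nonneg_left hcb hθ.le
        linarith
      have hb'le : (b' : ℝ) ≤ θ * b / 4 ^ M := Nat.floor_le (by positivity)
      have hb'ge : θ * b / 4 ^ M / 2 ≤ b' := by
        have := Nat.lt_floor_add_one (θ * b / 4 ^ M)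
        rw [← hb'd] at this
        linarith
      have hb'0 : 0 < b' := by
        have : (0 : ℝ) < b' := by linarith
        exact_mod_cast this
      have hbb : (4 : ℝ) ^ M * b' ≤ θ * b := by
        rw [le_div_iff₀ (by positivity)] at hb'le
        linarith
      have hκn : κ * (n : ℝ) ^ 2 ≤ θ * b ^ 2 := by
        calc κ * (n : ℝ) ^ 2 ≤ θ * c ^ 2 * n ^ 2 :=
              mul_le_mul_of_nonneg_right (hκle.trans (min_le_right _ _)) (by positivity)
          _ = θ * (c * n) ^ 2 := by ring
          _ ≤ _ := mul_le_mul_of_nonneg_left (pow_le_pow_left₀ (by positivity) hcb 2) hθ.le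
      have hb2 : (0 : ℝ) < b ^ 2 := by positivity
      have hη3 : η ^ 3 ≤ η := by
        calc η ^ 3 = η * η ^ 2 := by ring
          _ ≤ η * 1 := mul_le_mul_of_nonneg_left (pow_le_one₀ hη.le (by linarith)) hη.le
          _ = η := by ring
      have hκb : 12 * (θ * b ^ 2 + κ * n ^ 2) ≤ η * b ^ 2 := by
        have : 24 * θ * b ^ 2 ≤ η * b ^ 2 := mul_le_mul_of_nonneg_right (by linarith) hb2.le
        linarith
      obtain ⟨P', hP', hcov', hE'⟩ := refine_step hp hκ hη (by linarith) hθ.le hU hb hb'0 hP hPM hbb hκb hirr.le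
      refine (ih n hn0 G p κ hp hκ (hκle.trans (min_le_left _ _)) hU P' b' hP' ?_ ?_ ?_ ?_).imp fun P h =>
        h.imp fun b h => ⟨h.1, (mul_le_mul_of_nonneg_right (min_le_right _ _) (by positivity)).trans h.2.1, h.2.2⟩
      · refine le_trans ?_ hb'ge
        rw [hc1d]
        have h1 : θ * c / (2 * 4 ^ M) * (n : ℝ) = θ * (c * n) / 4 ^ M / 2 := by field_simp
        rw [h1]
        gcongr
      · refine le_trans ?_ hbn
        refine hb'le.trans ?_
        rw [div_le_iff₀ (by positivity)]
        have h1 : θ * (b : ℝ) ≤ 1 * b := mul_le_mul_of_nonneg_right hθ2 hbR.le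
        have h2 : (b : ℝ) * 1 ≤ b * 4 ^ M := mul_le_mul_of_nonneg_left h4M hbR.le
        linarith
      · push_cast at hcov
        have := mul_le_mul_of_nonneg_left hmb hθ.le
        linarith
      · push_cast at hE
        have hcov2 : (n : ℝ) / 2 ≤ P.card * b := by
          have : (0 : ℝ) ≤ ((j + 1 : ℕ) : ℝ) * θ * n := by positivity
          have h2 : (1 / 2 : ℝ) * n ≤ (1 - η) * n := mul_le_mul_of_nonneg_right (by linarith) (by linarith)
          linarith
        have h6 : ((n : ℝ) / 2) ^ 2 ≤ (P.card * b) ^ 2 := pow_le_pow_left₀ (by positivity) hcov2 2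
        have h7 : η ^ 3 / 16 * (b : ℝ) ^ 2 ≤ (η ^ 3 / 4 * b ^ 2 - 8 * (θ * b ^ 2 + κ * n ^ 2)) := by
          have : 16 * θ * b ^ 2 ≤ (η ^ 3 / 16) * b ^ 2 := mul_le_mul_of_nonneg_right (by linarith) hb2.le
          have : 0 ≤ η ^ 3 * (b : ℝ) ^ 2 := by positivity
          linarith
        have h8 := mul_le_mul_of_nonneg_left h7 (sq_nonneg (P.card : ℝ))
        have h9 := mul_le_mul_of_nonneg_left h6 (show 0 ≤ η ^ 3 / 16 by positivity)
        linarith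

/-- sparse regularity lemma -/
lemma sparse_regularity (η : ℝ) (hη : 0 < η) (hη1 : η ≤ 1 / 2) :
    ∃ c' κ0 : ℝ, ∃ N0 : ℕ, 0 < c' ∧ 0 < κ0 ∧ ∀ n ≥ N0, ∀ (G : SimpleGraph (Fin n)) (p κ : ℝ),
      0 < p → 0 ≤ κ → κ ≤ κ0 → UB G p κ →
      ∃ (P : Finset (Finset (Fin n))) (b : ℕ), Fam P b ∧ c' * n ≤ b ∧ b ≤ η * n ∧
        (1 - η) * n ≤ P.card * b ∧ ((Irr G η p P).card : ℝ) ≤ η * (P.card : ℝ) ^ 2 := by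
  set J : ℕ := ⌈256 / η ^ 3⌉₊ + 1 with hJ
  have hJ1 : 256 / η ^ 3 < J := by
    rw [hJ]; push_cast
    have := Nat.le_ceil (256 / η ^ 3)
    linarith
  have hJ2 : (J : ℝ) ≤ 256 / η ^ 3 + 2 := by
    rw [hJ]; push_cast
    have := Nat.ceil_lt_add_one (show 0 ≤ 256 / η ^ 3 by positivity)
    linarith
  have hJ3 : (J : ℝ) * η ^ 3 ≤ 258 := by
    have : η ^ 3 ≤ 1 := pow_le_one₀ hη.le (by linarith)
    calc (J : ℝ) * η ^ 3 ≤ (256 / η ^ 3 + 2) * η ^ 3 := mul_le_mul_of_nonneg_right hJ2 (by positivity)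
      _ = 256 + 2 * η ^ 3 := by field_simp
      _ ≤ _ := by linarith
  have hJ4 : 4 < J * (η ^ 3 / 64) := by
    rw [div_lt_iff₀ (by positivity)] at hJ1
    linarith
  obtain ⟨c', κ0, N0, hc', hκ0, h⟩ := reg_aux η (η ^ 4 / 1000) hη hη1 (by positivity) (by
    have : η ^ 4 ≤ η ^ 3 := pow_le_pow_of_le_one hη.le (by linarith) (by norm_num)
    have : 0 < η ^ 3 := by positivity
    linarith) J (η / 8) (by positivity) (by linarith)
  refine ⟨c', κ0, max N0 (⌈8 / η⌉₊ + 1), hc', hκ0, ?_⟩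
  intro n hn G p κ hp hκ hκle hU
  have hn0 : N0 ≤ n := le_trans (le_max_left _ _) hn
  have hn1 : ⌈8 / η⌉₊ + 1 ≤ n := le_trans (le_max_right _ _) hn
  have hnbig : 8 / η ≤ (n : ℝ) := by
    refine (Nat.le_ceil _).trans ?_
    have : ⌈8 / η⌉₊ ≤ n := by omega
    exact_mod_cast this
  have hnR : (1 : ℝ) ≤ n := by
    have : 1 ≤ n := by omega
    exact_mod_cast this
  rw [div_le_iff₀ hη] at hnbig
  set b : ℕ := ⌊η / 4 * n⌋₊ with hb
  have hb1 : (b : ℝ) ≤ η / 4 * n := Nat.floor_le (by positivity)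
  have hb2 : η / 8 * n ≤ b := by
    have := Nat.lt_floor_add_one (η / 4 * n)
    rw [← hb] at this
    linarith
  have hb0 : 0 < b := by
    have : (0 : ℝ) < b := lt_of_lt_of_le (by positivity) hb2
    exact_mod_cast this
  obtain ⟨P, hP, _, hPc⟩ := chop1 b hb0 n (univ : Finset (Fin n)) (by simp)
  rw [card_univ, Fintype.card_fin] at hPc
  have hPc' : (n : ℝ) ≤ P.card * b + b := by exact_mod_cast hPc
  have hηn : 0 < η * n := by positivity
  refine h n hn0 G p κ hp hκ hκle hU P b hP hb2 (by linarith) ?_ ?_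
  · have h1 : (J : ℝ) * (η ^ 4 / 1000) * n ≤ 258 / 1000 * (η * n) := by
      have : (J : ℝ) * (η ^ 4 / 1000) * n = (J * η ^ 3) * (η * n) / 1000 := by ring
      rw [this]
      have := mul_le_mul_of_nonneg_right hJ3 hηn.le
      linarith
    linarith
  · have hE : 0 ≤ energy G p b P := Finset.sum_nonneg fun _ _ => Finset.sum_nonneg fun _ _ => by positivity
    have : 4 * (n : ℝ) ^ 2 < J * (η ^ 3 / 64) * n ^ 2 := mul_lt_mul_of_pos_right hJ4 (by positivity)
    linarith

end Part13

section Part14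
/-! ## Fractional triangle tiling -/

def IsTri {ι : Type*} (H : SimpleGraph ι) (τ : Fin 3 → ι) : Prop := ∀ r s, r ≠ s → H.Adj (τ r) (τ s)

def triPt {ι : Type*} (τ : Fin 3 → ι) : ι → ℝ := fun i => ∑ r, if τ r = i then 1 / 3 else 0

lemma tri_best {ι : Type*} [Fintype ι] (H : SimpleGraph ι) (a : ι → ℝ) (ha : ∀ i, 0 ≤ a i)
    (hs : ∑ i, a i = 1) (hn : ∀ i, ∑ j, (if H.Adj i j then 0 else a j) ≤ 1 / 3) (y : ι → ℝ) :
    ∃ τ, IsTri H τ ∧ ∑ i, a i * y i ≤ (∑ r, y (τ r)) / 3 := by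
  have hne : (univ : Finset ι).Nonempty := by
    rw [univ_nonempty_iff]
    by_contra h
    rw [not_nonempty_iff] at h
    simp at hs
  obtain ⟨v1, -, h1⟩ := exists_max_image univ y hne
  have hne2 : (univ.filter fun i => H.Adj v1 i).Nonempty := by
    by_contra h
    rw [not_nonempty_iff_eq_empty, filter_eq_empty_iff] at h
    have := hn v1
    rw [Finset.sum_congr rfl (fun j hj => if_neg (h hj)), hs] at this
    linarith
  obtain ⟨v2, hv2, h2⟩ := exists_max_image _ y hne2
  have hne3 : (univ.filter fun i => H.Adj v1 i ∧ H.Adj v2 i).Nonempty := by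
    by_contra h
    rw [not_nonempty_iff_eq_empty, filter_eq_empty_iff] at h
    have e1 := hn v1
    have e2 := hn v2
    have : ∑ i, a i ≤ ∑ j, ((if H.Adj v1 j then 0 else a j) + (if H.Adj v2 j then 0 else a j)) := by
      refine Finset.sum_le_sum fun j hj => ?_
      have := h hj
      have := ha j
      split_ifs <;> first | linarith | tauto
    rw [Finset.sum_add_distrib] at this
    linarith
  obtain ⟨v3, hv3, h3⟩ := exists_max_image _ y hne3
  have a12 : H.Adj v1 v2 := (mem_filter.1 hv2).2
  have a13 : H.Adj v1 v3 := (mem_filter.1 hv3).2.1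
  have a23 : H.Adj v2 v3 := (mem_filter.1 hv3).2.2
  have y12 : y v2 ≤ y v1 := h1 v2 (mem_univ _)
  have y23 : y v3 ≤ y v2 := h2 v3 (mem_filter.2 ⟨mem_univ _, a13⟩)
  refine ⟨![v1, v2, v3], ?_, ?_⟩
  · intro r s hrs
    fin_cases r <;> fin_cases s <;> simp_all [H.adj_comm]
  · have hpt : ∀ i ∈ univ, a i * y i ≤ a i * y v3 + (y v2 - y v3) * ((if H.Adj v1 i then 0 else a i) +
        (if H.Adj v2 i then 0 else a i)) + (y v1 - y v2) * (if H.Adj v1 i then 0 else a i) := by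
      intro i _
      have hai := ha i
      have p1 := h1 i (mem_univ _)
      by_cases c1 : H.Adj v1 i
      · have p2 := h2 i (mem_filter.2 ⟨mem_univ _, c1⟩)
        by_cases c2 : H.Adj v2 i
        · have p3 := h3 i (mem_filter.2 ⟨mem_univ _, c1, c2⟩)
          simp only [c1, c2, if_true]
          have := mul_le_mul_of_nonneg_left p3 hai
          linarith
        · simp only [c1, c2, if_true, if_false]
          have := mul_le_mul_of_nonneg_left p2 hai
          linarith
      · simp only [c1, if_false]
        have := mul_le_mul_of_nonneg_left p1 hai
        have h0 : 0 ≤ (y v2 - y v3) * (if H.Adj v2 i then 0 else a i) := by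
          refine mul_nonneg (by linarith) ?_
          split_ifs <;> linarith
        linarith
    have hsum := Finset.sum_le_sum hpt
    rw [Finset.sum_add_distrib, Finset.sum_add_distrib, ← Finset.sum_mul, hs, ← Finset.mul_sum, ← Finset.mul_sum,
      Finset.sum_add_distrib] at hsum
    have q1 := mul_le_mul_of_nonneg_left (add_le_add (hn v1) (hn v2)) (sub_nonneg.2 y23)
    have q2 := mul_le_mul_of_nonneg_left (hn v1) (sub_nonneg.2 y12)
    have : ∑ r, y (![v1, v2, v3] r) = y v1 + y v2 + y v3 := by
      rw [Fin.sum_univ_three]; rfl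
    rw [this]
    linarith

lemma tri_hull {ι : Type*} [Fintype ι] (H : SimpleGraph ι) (a : ι → ℝ) (ha : ∀ i, 0 ≤ a i)
    (hs : ∑ i, a i = 1) (hn : ∀ i, ∑ j, (if H.Adj i j then 0 else a j) ≤ 1 / 3) :
    a ∈ convexHull ℝ (triPt '' {τ | IsTri H τ}) := by
  by_contra hcon
  have hfin : (triPt '' {τ : Fin 3 → ι | IsTri H τ}).Finite := (Set.toFinite _).image _
  obtain ⟨f, u, hf1, hf2⟩ := geometric_hahn_banach_closed_point (convex_convexHull ℝ _)
    (hfin.isClosed_convexHull ℝ) hcon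
  have hfx : ∀ x : ι → ℝ, f x = ∑ i, x i * f (Pi.single i 1) := by
    intro x
    conv_lhs => rw [show x = ∑ i, x i • (Pi.single i (1 : ℝ) : ι → ℝ) from by
      ext j; simp [Finset.sum_apply, Pi.single_apply]]
    rw [map_sum]
    simp
  obtain ⟨τ, hτ, hle⟩ := tri_best H a ha hs hn (fun i => f (Pi.single i 1))
  have h1 := hf1 (triPt τ) (subset_convexHull ℝ _ ⟨τ, hτ, rfl⟩)
  have h2 : f (triPt τ) = (∑ r, f (Pi.single (τ r) 1)) / 3 := by
    rw [hfx]
    unfold triPt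
    simp_rw [Finset.sum_mul]
    rw [Finset.sum_comm, Finset.sum_div]
    refine Finset.sum_congr rfl fun r _ => ?_
    simp only [ite_mul, zero_mul, Finset.sum_ite_eq, mem_univ, if_true]
    ring
  rw [hfx a] at hf2
  rw [h2] at h1
  linarith

/-- fractional tiling with few triangles -/
lemma frac_tiling {ι : Type*} [Fintype ι] (H : SimpleGraph ι) (a : ι → ℝ) (ha : ∀ i, 0 ≤ a i)
    (hn : ∀ i, ∑ j, (if H.Adj i j then 0 else a j) ≤ (∑ j, a j) / 3) :
    ∃ m : ℕ, m ≤ Fintype.card ι + 1 ∧ ∃ (T : Fin m → Fin 3 → ι) (y : Fin m → ℝ),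
      (∀ k, IsTri H (T k)) ∧ (∀ k, 0 ≤ y k) ∧
      ∀ i, ∑ k, ∑ r, (if T k r = i then y k else 0) = a i := by
  set A := ∑ j, a j with hA
  have hA0 : 0 ≤ A := Finset.sum_nonneg fun i _ => ha i
  rcases hA0.eq_or_lt with h0 | hpos
  · refine ⟨0, Nat.zero_le _, fun k => k.elim0, fun k => k.elim0, fun k => k.elim0, fun k => k.elim0, ?_⟩
    intro i
    have := (Finset.sum_eq_zero_iff_of_nonneg (fun i _ => ha i)).1 (hA.symm.trans h0.symm) i (mem_univ _)
    simp [this]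
  · have hmem := tri_hull H (fun i => a i / A) (fun i => div_nonneg (ha i) hA0)
      (by rw [← Finset.sum_div]; exact div_self hpos.ne') (by
        intro i
        have : ∀ j, (if H.Adj i j then 0 else a j / A) = (if H.Adj i j then 0 else a j) / A := by
          intro j; split_ifs <;> simp
        simp_rw [this]
        rw [← Finset.sum_div, div_le_iff₀ hpos]
        have := hn i
        linarith)
    obtain ⟨κ, hκ, z, w, hz, hai, hw, hw1, hsum⟩ := eq_pos_convex_span_of_mem_convexHull hmem
    have hcard : Fintype.card κ ≤ Fintype.card ι + 1 := by
      have := hai.card_le_finrank_succ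
      refine this.trans (Nat.succ_le_succ ?_)
      refine (Submodule.finrank_le _).trans ?_
      simp
    have hz' : ∀ k, ∃ τ, IsTri H τ ∧ triPt τ = z k := fun k => hz ⟨k, rfl⟩
    choose τ hτ hτz using hz'
    let e := (Fintype.equivFin κ).symm
    refine ⟨Fintype.card κ, hcard, fun k => τ (e k), fun k => w (e k) * A / 3, fun k => hτ _,
      fun k => by have := (hw (e k)).le; positivity, ?_⟩
    intro i
    have h1 := congrFun hsum i
    simp only [Finset.sum_apply, Pi.smul_apply, smul_eq_mul] at h1
    have h2 : ∑ k : Fin (Fintype.card κ), ∑ r : Fin 3, (if τ (e k) r = i then w (e k) * A / 3 else (0:ℝ)) =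
        ∑ k : κ, ∑ r : Fin 3, (if τ k r = i then w k * A / 3 else (0:ℝ)) :=
      e.sum_comp (fun k => ∑ r : Fin 3, (if τ k r = i then w k * A / 3 else (0:ℝ)))
    rw [h2]
    have h3 : ∀ k : κ, ∑ r : Fin 3, (if τ k r = i then w k * A / 3 else (0 : ℝ)) = A * (w k * z k i) := by
      intro k
      rw [← hτz k]
      unfold triPt
      simp only [Fin.sum_univ_three]
      split_ifs <;> ring
    simp_rw [h3]
    rw [← Finset.mul_sum, h1]
    field_simp

end Part14

section Part15
lemma dens_comm {n : ℕ} (G : SimpleGraph (Fin n)) (A B : Finset (Fin n)) :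
    RandomTriangle.dens G A B = RandomTriangle.dens G B A := by
  unfold RandomTriangle.dens; rw [e_comm, mul_comm]

lemma dens_nonneg {n : ℕ} (G : SimpleGraph (Fin n)) (A B : Finset (Fin n)) :
    0 ≤ RandomTriangle.dens G A B := by
  unfold RandomTriangle.dens; positivity

lemma CutReg.symm {n : ℕ} {G : SimpleGraph (Fin n)} {η p : ℝ} {A B : Finset (Fin n)}
    (h : CutReg G η p A B) (hAB : A.card = B.card) : CutReg G η p B A := by
  intro S hS T hT
  have := h T hT S hS
  rw [← hAB, e_comm, dens_comm]
  convert this using 2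
  ring

lemma dens_mul {n : ℕ} (G : SimpleGraph (Fin n)) (A B : Finset (Fin n)) (hA : 0 < A.card) (hB : 0 < B.card) :
    RandomTriangle.dens G A B * A.card * B.card = eBtw G A B := by
  unfold RandomTriangle.dens
  have : (0 : ℝ) < A.card := by exact_mod_cast hA
  have : (0 : ℝ) < B.card := by exact_mod_cast hB
  field_simp

lemma CutReg.sub {n : ℕ} {G : SimpleGraph (Fin n)} {η η' p : ℝ} {A B A' B' : Finset (Fin n)} {b w : ℕ}
    (h : CutReg G η p A B) (hp : 0 ≤ p) (hA : A.card = b) (hA' : A'.card = w)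
    (hB' : B'.card = w) (hw : 0 < w) (hAA : A' ⊆ A) (hBB : B' ⊆ B) (hη : 2 * η * b ^ 2 ≤ η' * w ^ 2) :
    CutReg G η' p A' B' ∧ RandomTriangle.dens G A B - η' * p / 2 ≤ RandomTriangle.dens G A' B' := by
  have hwR : (0 : ℝ) < w := by exact_mod_cast hw
  set d := RandomTriangle.dens G A B with hd
  set d' := RandomTriangle.dens G A' B' with hd'
  have h1 := h A' hAA B' hBB
  rw [← dens_mul G A' B' (by omega) (by omega), hA', hB', hA, ← hd, ← hd'] at h1
  have hpη : p * (2 * η * b ^ 2) ≤ p * (η' * w ^ 2) := mul_le_mul_of_nonneg_left hη hp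
  have h2 : |d' - d| * w ^ 2 ≤ η * p * (b * b) := by
    rw [← abs_of_pos (show (0 : ℝ) < (w : ℝ) ^ 2 by positivity), ← abs_mul]
    rw [show (d' - d) * (w : ℝ) ^ 2 = d' * w * w - d * w * w by ring]
    exact h1
  constructor
  · intro S hS T hT
    have h3 := h S (hS.trans hAA) T (hT.trans hBB)
    rw [hA, ← hd] at h3
    rw [← hd', hA']
    have hs : (S.card : ℝ) ≤ w := by rw [← hA']; exact_mod_cast card_le_card hS
    have ht : (T.card : ℝ) ≤ w := by rw [← hB']; exact_mod_cast card_le_card hT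
    have h4 : |(d - d') * (S.card * T.card)| ≤ η * p * (b * b) := by
      rw [abs_mul, abs_sub_comm, abs_of_nonneg (show (0 : ℝ) ≤ S.card * T.card by positivity)]
      refine le_trans (mul_le_mul_of_nonneg_left ?_ (abs_nonneg _)) h2
      calc (S.card * T.card : ℝ) ≤ w * w := mul_le_mul hs ht (by positivity) hwR.le
        _ = _ := by ring
    have h5 : (eBtw G S T : ℝ) - d' * S.card * T.card = ((eBtw G S T : ℝ) - d * S.card * T.card) +
      (d - d') * (S.card * T.card) := by ring
    rw [h5]
    refine (abs_add_le _ _).trans ?_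
    linarith
  · have h6 : (d - d') * w ^ 2 ≤ η' * p / 2 * w ^ 2 := by
      have : d - d' ≤ |d' - d| := by rw [abs_sub_comm]; exact le_abs_self _
      have := mul_le_mul_of_nonneg_right this (sq_nonneg (w : ℝ))
      linarith
    have := le_of_mul_le_mul_right h6 (by positivity)
    linarith

lemma e_union_le {n : ℕ} (G : SimpleGraph (Fin n)) (A X Y : Finset (Fin n)) :
    (eBtw G A (X ∪ Y) : ℝ) ≤ eBtw G A X + eBtw G A Y := by
  rw [e_split_right G A (subset_union_left : X ⊆ X ∪ Y)]
  have := e_mono G (Subset.refl A) (show (X ∪ Y) \ X ⊆ Y by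
    intro x hx; rw [mem_sdiff, mem_union] at hx; tauto)
  linarith

def RAdj {n : ℕ} (G : SimpleGraph (Fin n)) (η p δ0 : ℝ) (A B : Finset (Fin n)) : Prop :=
  A ≠ B ∧ CutReg G η p A B ∧ δ0 * p ≤ RandomTriangle.dens G A B

set_option maxHeartbeats 1000000 in
lemma reduced {n : ℕ} {G : SimpleGraph (Fin n)} {p κ γ σ : ℝ} (hp : 0 < p) (hκ : 0 ≤ κ) (hU : UB G p κ)
    (hγ : 0 < γ) (hγ1 : γ ≤ 1) (hσ : 0 < σ) (hσγ : σ ≤ γ / 20) {P : Finset (Finset (Fin n))} {b : ℕ} (hb : 0 < b)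
    (hP : Fam P b) (hbn : (b : ℝ) ≤ σ ^ 2 * n) (hcov : (1 - σ ^ 2) * n ≤ P.card * b)
    (hI : ((Irr G (σ ^ 2) p P).card : ℝ) ≤ σ ^ 2 * (P.card : ℝ) ^ 2)
    (hκb : 4 * κ * n ≤ σ * b) (hdeg : ∀ v, (2 / 3 + γ) * n * p ≤ (degIn G v univ : ℝ)) :
    ∃ P1 ⊆ P, (1 - σ) * P.card ≤ (P1.card : ℝ) ∧
      ∀ A ∈ P1, (2 / 3 + γ / 2) * n ≤ ((P1.filter fun B => RAdj G (σ ^ 2) p (γ / 10) A B).card : ℝ) * b := by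
  have hbR : (0 : ℝ) < b := by exact_mod_cast hb
  have hσ1 : σ ≤ 1 := by linarith
  have hσ2 : σ ^ 2 ≤ σ := by
    calc σ ^ 2 = σ * σ := by ring
      _ ≤ σ * 1 := mul_le_mul_of_nonneg_left hσ1 hσ.le
      _ = σ := by ring
  set ir : Finset (Fin n) → Finset (Finset (Fin n)) := fun A => P.filter fun B => A ≠ B ∧ ¬ CutReg G (σ ^ 2) p A B with hir
  set Dr := P.filter fun A => σ * P.card < ((ir A).card : ℝ) with hDr
  set m : ℝ := (P.card : ℝ) with hm
  have hIrr : ((Irr G (σ ^ 2) p P).card : ℝ) = ∑ A ∈ P, ((ir A).card : ℝ) := by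
    unfold Irr
    rw [Finset.card_filter, Finset.sum_product]
    push_cast
    refine Finset.sum_congr rfl fun A _ => ?_
    rw [hir]; simp only; rw [Finset.card_filter]; push_cast; rfl
  have hDrc : (Dr.card : ℝ) ≤ σ * m := by
    by_cases hm0 : P.card = 0
    · have : Dr.card ≤ P.card := card_le_card (filter_subset _ _)
      rw [hm0] at this
      have h0 : Dr.card = 0 := by omega
      rw [h0, hm, hm0]; simp
    · have hmpos : 0 < m := by rw [hm]; exact_mod_cast Nat.pos_of_ne_zero hm0
      have h1 : (Dr.card : ℝ) * (σ * m) ≤ σ ^ 2 * m ^ 2 := by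
        refine le_trans ?_ hI
        rw [hIrr]
        calc (Dr.card : ℝ) * (σ * m) = ∑ A ∈ Dr, σ * m := by simp
          _ ≤ ∑ A ∈ Dr, ((ir A).card : ℝ) := Finset.sum_le_sum fun A hA => (mem_filter.1 hA).2.le
          _ ≤ _ := Finset.sum_le_sum_of_subset_of_nonneg (filter_subset _ _) fun _ _ _ => by positivity
      have h2 : (Dr.card : ℝ) * (σ * m) ≤ (σ * m) * (σ * m) := by linarith
      exact le_of_mul_le_mul_right h2 (by positivity)
  have hP1c : ((P \ Dr).card : ℝ) = m - Dr.card := by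
    have h1 := Finset.card_sdiff_add_card_eq_card (filter_subset _ _ : Dr ⊆ P)
    have h2 : ((P \ Dr).card : ℝ) + Dr.card = P.card := by exact_mod_cast h1
    linarith
  refine ⟨P \ Dr, sdiff_subset, by rw [hP1c]; linarith, ?_⟩
  intro A hA
  set P1 := P \ Dr with hP1
  have hAP : A ∈ P := (mem_sdiff.1 hA).1
  have hAc : A.card = b := hP.1 A hAP
  have hnn : (0 : ℝ) ≤ n := by positivity
  have hirA : ((ir A).card : ℝ) ≤ σ * m := by
    by_contra h
    push Not at h
    exact (mem_sdiff.1 hA).2 (mem_filter.2 ⟨hAP, h⟩)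
  set N := P1.filter fun B => RAdj G (σ ^ 2) p (γ / 10) A B with hN
  set Lo := P1.filter fun B => RandomTriangle.dens G A B < γ / 10 * p with hLo
  have hF1 : Fam P1 b := hP.sub' sdiff_subset
  have hFN : Fam N b := hF1.sub' (filter_subset _ _)
  have hFL : Fam Lo b := hF1.sub' (filter_subset _ _)
  have hFI : Fam (ir A) b := hP.sub' (filter_subset _ _)
  have hmb : m * b ≤ n := by
    have := fam_card_le hP univ (fun A _ => subset_univ A)
    rw [card_univ, Fintype.card_fin] at this
    rw [hm]; exact_mod_cast this
  set rest := univ \ (P1.biUnion id) with hrest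
  have hsub : (univ : Finset (Fin n)) ⊆ N.biUnion id ∪ (A ∪ (rest ∪ ((ir A).biUnion id ∪ Lo.biUnion id))) := by
    intro x _
    by_cases hx : x ∈ P1.biUnion id
    · obtain ⟨B, hB, hxB⟩ := mem_biUnion.1 hx
      by_cases hAB : A = B
      · rw [mem_union, mem_union]; right; left; rw [hAB]; exact hxB
      · by_cases hr : CutReg G (σ ^ 2) p A B
        · by_cases hdn : RandomTriangle.dens G A B < γ / 10 * p
          · simp only [mem_union]; right; right; right; right
            exact mem_biUnion.2 ⟨B, mem_filter.2 ⟨hB, hdn⟩, hxB⟩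
          · simp only [mem_union]; left
            exact mem_biUnion.2 ⟨B, mem_filter.2 ⟨hB, hAB, hr, not_lt.1 hdn⟩, hxB⟩
        · simp only [mem_union]; right; right; right; left
          exact mem_biUnion.2 ⟨B, mem_filter.2 ⟨(mem_sdiff.1 hB).1, hAB, hr⟩, hxB⟩
    · simp only [mem_union]; right; right; left
      exact mem_sdiff.2 ⟨mem_univ _, hx⟩
  have htot : (2 / 3 + γ) * n * p * b ≤ eBtw G A univ := by
    rw [e_deg]
    calc (2 / 3 + γ) * n * p * b = ∑ x ∈ A, (2 / 3 + γ) * n * p := by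
          rw [Finset.sum_const, hAc, nsmul_eq_mul]; ring
      _ ≤ _ := Finset.sum_le_sum fun x _ => hdeg x
  have e0 := e_mono G (Subset.refl A) hsub
  have e1 := e_union_le G A (N.biUnion id) (A ∪ (rest ∪ ((ir A).biUnion id ∪ Lo.biUnion id)))
  have e2 := e_union_le G A A (rest ∪ ((ir A).biUnion id ∪ Lo.biUnion id))
  have e3 := e_union_le G A rest ((ir A).biUnion id ∪ Lo.biUnion id)
  have e4 := e_union_le G A ((ir A).biUnion id) (Lo.biUnion id)
  have u1 := hU A (N.biUnion id)
  have u2 := hU A A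
  have u3 := hU A rest
  have u4 := hU A ((ir A).biUnion id)
  rw [hAc, fam_union_card hFN] at u1
  rw [hAc] at u2 u3 u4
  rw [fam_union_card hFI] at u4
  push_cast at u1 u4
  have hP1b : (1 - 2 * σ) * n ≤ P1.card * b := by
    rw [hP1c]
    have h1 : Dr.card * (b : ℝ) ≤ σ * m * b := mul_le_mul_of_nonneg_right hDrc hbR.le
    have h2 : σ * (m * b) ≤ σ * n := mul_le_mul_of_nonneg_left hmb hσ.le
    have h3 : σ ^ 2 * n ≤ σ * n := mul_le_mul_of_nonneg_right hσ2 hnn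
    linarith
  have hrc : (rest.card : ℝ) ≤ 2 * σ * n := by
    rw [hrest, card_sdiff_real (subset_univ _), fam_union_card hF1, card_univ, Fintype.card_fin]
    push_cast
    linarith
  have u5 : (eBtw G A (Lo.biUnion id) : ℝ) ≤ γ / 10 * p * (b * n) := by
    have hfa : Fam {A} b := hP.sub' (singleton_subset_iff.2 hAP)
    have h1 := e_biUnion G hfa hFL
    rw [Finset.sum_singleton, Finset.singleton_biUnion] at h1
    simp only [id] at h1
    have h1' : (eBtw G A (Lo.biUnion id) : ℝ) = ∑ B ∈ Lo, (eBtw G A B : ℝ) := h1.symm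
    rw [h1']
    have h2 : ∀ B ∈ Lo, (eBtw G A B : ℝ) ≤ γ / 10 * p * b ^ 2 := by
      intro B hB
      have hBc := hFL.1 B hB
      rw [← dens_mul G A B (by omega) (by omega), hAc, hBc]
      have := mul_le_mul_of_nonneg_right (mem_filter.1 hB).2.le (show (0 : ℝ) ≤ b ^ 2 by positivity)
      linarith
    have h3 := Finset.sum_le_sum h2
    rw [Finset.sum_const, nsmul_eq_mul] at h3
    have h4 : (Lo.card : ℝ) * b ≤ n := by
      have := fam_card_le hFL univ (fun A _ => subset_univ A)
      rw [card_univ, Fintype.card_fin] at this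
      exact_mod_cast this
    have h5 := mul_le_mul_of_nonneg_left h4 (show 0 ≤ γ / 10 * p * b by positivity)
    linarith
  have k1 : p * b * (rest.card : ℝ) ≤ p * b * (2 * σ * n) := mul_le_mul_of_nonneg_left hrc (by positivity)
  have k2 : p * b * ((ir A).card * b : ℝ) ≤ p * b * (σ * n) := by
    refine mul_le_mul_of_nonneg_left ?_ (by positivity)
    have h1 := mul_le_mul_of_nonneg_right hirA hbR.le
    have h2 : σ * (m * b) ≤ σ * n := mul_le_mul_of_nonneg_left hmb hσ.le
    linarith
  have k3 : p * b * (b : ℝ) ≤ p * b * (σ * n) := by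
    refine mul_le_mul_of_nonneg_left (hbn.trans ?_) (by positivity)
    exact mul_le_mul_of_nonneg_right hσ2 hnn
  have k4 : (4 * κ * n) * (p * n) ≤ σ * b * (p * n) := mul_le_mul_of_nonneg_right hκb (by positivity)
  have hpb : 0 < p * b := by positivity
  have k5 : p * b * (5 * σ * n) ≤ p * b * (γ / 4 * n) := mul_le_mul_of_nonneg_left
    (mul_le_mul_of_nonneg_right (by linarith) hnn) hpb.le
  have k6 : 0 ≤ p * b * (γ * n) := by positivity
  have hfin : p * b * ((2 / 3 + γ / 2) * n) ≤ p * b * (N.card * b) := by linarith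
  exact le_of_mul_le_mul_left hfin hpb

end Part15

section Part16
lemma exists_injOn_fin {α : Type*} (S : Finset α) (L : ℕ) (hL : 0 < L) (h : S.card ≤ L) :
    ∃ f : α → Fin L, ∀ x ∈ S, ∀ y ∈ S, f x = f y → x = y := by
  refine ⟨fun x => if hx : x ∈ S then Fin.castLE h (S.equivFin ⟨x, hx⟩) else ⟨0, hL⟩, ?_⟩
  intro x hx y hy hxy
  simp only [hx, hy, dif_pos] at hxy
  have := S.equivFin.injective (Fin.castLE_injective h hxy)
  exact congrArg Subtype.val this

lemma pieces {n : ℕ} (A : Finset (Fin n)) (L w : ℕ) (hw : 0 < w) (h : (L + 1) * w ≤ A.card) :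
    ∃ f : Fin L → Finset (Fin n), (∀ i, f i ⊆ A) ∧ (∀ i, (f i).card = w) ∧ ∀ i j, i ≠ j → Disjoint (f i) (f j) := by
  obtain ⟨R, hR1, hR2, hR3⟩ := chop1 w hw _ A rfl
  have hL : L ≤ R.card := by
    have h1 : (L + 1) * w ≤ (R.card + 1) * w := by
      have : (R.card + 1) * w = R.card * w + w := by ring
      omega
    have := Nat.le_of_mul_le_mul_right h1 hw
    omega
  refine ⟨fun i => (R.equivFin.symm (Fin.castLE hL i)).1, fun i => hR2 _ (Subtype.prop _),
    fun i => hR1.1 _ (Subtype.prop _), ?_⟩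
  intro i j hij
  refine hR1.2 _ (Subtype.prop _) _ (Subtype.prop _) ?_
  intro h
  exact hij (Fin.castLE_injective hL (R.equivFin.symm.injective (Subtype.ext h)))

/-- integer tiling from fractional tiling -/
lemma int_tiling {ι : Type*} [Fintype ι] (H : SimpleGraph ι) (L : ℕ) 
    (hn : ∀ i, ∑ j, (if H.Adj i j then (0 : ℝ) else 1) ≤ (Fintype.card ι : ℝ) / 3) :
    ∃ (k : ℕ) (c : Fin k × Fin 3 → ι), (∀ t r s, r ≠ s → H.Adj (c (t, r)) (c (t, s))) ∧
      (∀ i, (univ.filter fun a => c a = i).card ≤ L) ∧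
      (L : ℝ) * Fintype.card ι ≤ 3 * k + 3 * (Fintype.card ι + 1) := by
  obtain ⟨m, hm, T, y, hT, hy, hsum⟩ := frac_tiling H (fun _ => 1) (fun _ => by norm_num) (by
    intro i
    simpa using hn i)
  set N : Fin m → ℕ := fun k => ⌊L * y k⌋₊ with hN
  set e : Fin (Fintype.card (Σ k : Fin m, Fin (N k))) ≃ (Σ k : Fin m, Fin (N k)) := (Fintype.equivFin _).symm
  refine ⟨Fintype.card (Σ k : Fin m, Fin (N k)), fun a => T (e a.1).1 a.2, ?_, ?_, ?_⟩
  · intro t r s hrs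
    exact hT _ r s hrs
  · intro i
    have h1 : ((univ.filter fun a : Fin (Fintype.card (Σ k : Fin m, Fin (N k))) × Fin 3 => T (e a.1).1 a.2 = i).card : ℝ)
        = ∑ k, (N k : ℝ) * ∑ r, (if T k r = i then (1 : ℝ) else 0) := by
      rw [Finset.card_filter]
      push_cast
      rw [Fintype.sum_prod_type]
      rw [e.sum_comp (fun z => ∑ r, (if T z.1 r = i then (1 : ℝ) else 0)), Fintype.sum_sigma]
      refine Finset.sum_congr rfl fun k _ => ?_
      simp
    have h2 : ∑ k, (N k : ℝ) * ∑ r, (if T k r = i then (1 : ℝ) else 0) ≤ L := by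
      have h3 := hsum i
      calc ∑ k, (N k : ℝ) * ∑ r, (if T k r = i then (1 : ℝ) else 0)
          ≤ ∑ k, (L * y k) * ∑ r, (if T k r = i then (1 : ℝ) else 0) := by
            refine Finset.sum_le_sum fun k _ => mul_le_mul_of_nonneg_right ?_ ?_
            · exact Nat.floor_le (mul_nonneg (by positivity) (hy k))
            · exact Finset.sum_nonneg fun r _ => by split_ifs <;> norm_num
        _ = L * ∑ k, ∑ r, (if T k r = i then y k else 0) := by
            rw [Finset.mul_sum]
            refine Finset.sum_congr rfl fun k _ => ?_
            rw [mul_assoc, Finset.mul_sum]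
            congr 1
            refine Finset.sum_congr rfl fun r _ => ?_
            split_ifs <;> simp
        _ = L := by rw [h3]; ring
    have h4 := h1.le.trans h2
    exact_mod_cast h4
  · have hcard : ((Fintype.card (Σ k : Fin m, Fin (N k)) : ℕ) : ℝ) = ∑ k, (N k : ℝ) := by
      rw [Fintype.card_sigma]; push_cast; simp
    rw [hcard]
    have htot : 3 * ∑ k, y k = (Fintype.card ι : ℝ) := by
      have h1 : ∑ i, ∑ k, ∑ r, (if T k r = i then y k else 0) = ∑ _i : ι, (1 : ℝ) :=
        Finset.sum_congr rfl fun i _ => hsum i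
      rw [Finset.sum_comm] at h1
      have h2 : ∀ k, ∑ i, ∑ r, (if T k r = i then y k else 0) = 3 * y k := by
        intro k
        rw [Finset.sum_comm]
        simp
      simp_rw [h2] at h1
      rw [← Finset.mul_sum] at h1
      simpa using h1
    have h5 : ∑ k, (L * y k) ≤ ∑ k : Fin m, ((N k : ℝ) + 1) :=
      Finset.sum_le_sum fun k _ => (Nat.lt_floor_add_one _).le
    rw [Finset.sum_add_distrib, ← Finset.mul_sum] at h5
    simp only [Finset.sum_const, card_univ, Fintype.card_fin, nsmul_eq_mul, mul_one] at h5
    have hmR : (m : ℝ) ≤ Fintype.card ι + 1 := by exact_mod_cast hm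
    rw [← htot] at *
    linarith

def Tiling {n : ℕ} (G : SimpleGraph (Fin n)) (γ θ η p : ℝ) (k w : ℕ) (W : Fin k × Fin 3 → Finset (Fin n))
    (R : SimpleGraph (Fin k × Fin 3)) : Prop :=
  (∀ a, (W a).card = w) ∧ (∀ a b, a ≠ b → Disjoint (W a) (W b)) ∧ (1 - θ) * n ≤ 3 * k * w ∧
  (∀ a b, R.Adj a b → CutReg G η p (W a) (W b) ∧ γ / 20 * p ≤ RandomTriangle.dens G (W a) (W b)) ∧
  (∀ t r s, r ≠ s → R.Adj (t, r) (t, s)) ∧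
  ∀ a, ((univ.filter fun b => ¬ R.Adj a b).card : ℝ) ≤ (1 / 3 - γ / 4) * (3 * k)

set_option maxHeartbeats 1000000 in
lemma tiling (γ θ η : ℝ) (hγ : 0 < γ) (hγ1 : γ ≤ 1 / 10) (hθ : 0 < θ) (hθ1 : θ ≤ 1) (hη : 0 < η) (hηγ : η ≤ γ / 10) :
    ∃ μ κ0 : ℝ, ∃ N0 : ℕ, 0 < μ ∧ μ ≤ 1 ∧ 0 < κ0 ∧ ∀ n ≥ N0, ∀ (G : SimpleGraph (Fin n)) (p κ : ℝ),
      0 < p → 0 ≤ κ → κ ≤ κ0 → UB G p κ → (∀ v, (2 / 3 + γ) * n * p ≤ (degIn G v univ : ℝ)) →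
      ∃ k w W R, Tiling G γ θ η p k w W R ∧ μ * n ≤ (w : ℝ) := by
  set L : ℕ := ⌈40 / θ⌉₊ + ⌈40 / γ⌉₊ + 1 with hL
  have hL0 : 0 < L := by omega
  have hLR : (1 : ℝ) ≤ L := by exact_mod_cast hL0
  have hLθ : 40 ≤ θ * L := by
    have h1 : 40 / θ ≤ L := (Nat.le_ceil _).trans (by rw [hL]; push_cast; have := Nat.zero_le ⌈40 / γ⌉₊; have : (0:ℝ) ≤ ⌈40 / γ⌉₊ := by positivity
                                                      linarith)
    rw [div_le_iff₀ hθ] at h1; linarith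
  have hLγ : 40 ≤ γ * L := by
    have h1 : 40 / γ ≤ L := (Nat.le_ceil _).trans (by rw [hL]; push_cast; have : (0:ℝ) ≤ ⌈40 / θ⌉₊ := by positivity
                                                      linarith)
    rw [div_le_iff₀ hγ] at h1; linarith
  set σ : ℝ := min (min (γ / 20) (θ / 16)) (η / (32 * L ^ 2)) with hσd
  have hσ : 0 < σ := lt_min (lt_min (by positivity) (by positivity)) (by positivity)
  have hσγ : σ ≤ γ / 20 := (min_le_left _ _).trans (min_le_left _ _)
  have hσθ : σ ≤ θ / 16 := (min_le_left _ _).trans (min_le_right _ _)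
  have hση : σ * (32 * L ^ 2) ≤ η := by
    have := min_le_right (min (γ / 20) (θ / 16)) (η / (32 * (L : ℝ) ^ 2))
    rw [← hσd, le_div_iff₀ (by positivity)] at this
    exact this
  have hσ1 : σ ≤ 1 := by linarith
  have hσ2 : σ ^ 2 ≤ σ := by
    calc σ ^ 2 = σ * σ := by ring
      _ ≤ σ * 1 := mul_le_mul_of_nonneg_left hσ1 hσ.le
      _ = σ := by ring
  obtain ⟨c, κ1, N1, hc, hκ1, hreg⟩ := sparse_regularity (σ ^ 2) (by positivity) (by linarith)
  have hc2 : 0 < min c 1 := lt_min hc one_pos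
  refine ⟨min c 1 / (4 * L), min κ1 (σ * c / 4), max N1 (⌈16 * L / (min c 1 * θ)⌉₊ + 1), by positivity, ?_,
    lt_min hκ1 (by positivity), ?_⟩
  · rw [div_le_one (by positivity)]
    have := min_le_right c 1
    linarith
  intro n hn G p κ hp hκ hκle hU hdeg
  have hn0 : N1 ≤ n := le_trans (le_max_left _ _) hn
  have hn1 : ⌈16 * L / (min c 1 * θ)⌉₊ + 1 ≤ n := le_trans (le_max_right _ _) hn
  have hnR : (1 : ℝ) ≤ n := by
    have : 1 ≤ n := by omega
    exact_mod_cast this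
  have hnbig : 16 * L / (min c 1 * θ) ≤ (n : ℝ) := by
    refine (Nat.le_ceil _).trans ?_
    have : ⌈16 * L / (min c 1 * θ)⌉₊ ≤ n := by omega
    exact_mod_cast this
  rw [div_le_iff₀ (by positivity)] at hnbig
  obtain ⟨P, b, hP, hcb, hbn, hcov, hI⟩ := hreg n hn0 G p κ hp hκ (hκle.trans (min_le_left _ _)) hU
  have hcb' : min c 1 * n ≤ b := (mul_le_mul_of_nonneg_right (min_le_left _ _) (by positivity)).trans hcb
  have hbR : (0 : ℝ) < b := lt_of_lt_of_le (by positivity) hcb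
  have hb : 0 < b := by exact_mod_cast hbR
  have hbL : 16 * L ≤ θ * b := by
    have := mul_le_mul_of_nonneg_left hcb' hθ.le
    linarith
  have hbL2 : 16 * L ≤ (b : ℝ) := by
    have : θ * (b : ℝ) ≤ 1 * b := mul_le_mul_of_nonneg_right hθ1 hbR.le
    linarith
  obtain ⟨P1, hP1, hP1c, hred⟩ := reduced hp hκ hU hγ (by linarith) hσ hσγ hb hP hbn hcov hI (by
    have h1 : κ ≤ σ * c / 4 := hκle.trans (min_le_right _ _)
    have h2 := mul_le_mul_of_nonneg_right h1 (show (0 : ℝ) ≤ n by positivity)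
    have h3 := mul_le_mul_of_nonneg_left hcb hσ.le
    linarith) hdeg
  have hF1 : Fam P1 b := hP.sub' hP1
  let H : SimpleGraph P1 :=
    { Adj := fun A B => RAdj G (σ ^ 2) p (γ / 10) A.1 B.1
      symm := ⟨fun A B h => ⟨h.1.symm, h.2.1.symm (by rw [hF1.1 _ A.2, hF1.1 _ B.2]), by rw [dens_comm]; exact h.2.2⟩⟩
      loopless := ⟨fun A h => h.1 rfl⟩ }
  have hmb : (P1.card : ℝ) * b ≤ n := by
    have := fam_card_le hF1 univ (fun A _ => subset_univ A)
    rw [card_univ, Fintype.card_fin] at this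
    exact_mod_cast this
  have hnon : ∀ i : P1, ∑ j, (if H.Adj i j then (0 : ℝ) else 1) ≤ (1 / 3 - γ / 2) * P1.card := by
    intro i
    have h1 := hred i.1 i.2
    have h2 : ∑ j : P1, (if H.Adj i j then (0 : ℝ) else 1) = ∑ B ∈ P1, (if RAdj G (σ ^ 2) p (γ / 10) i.1 B then (0 : ℝ) else 1) :=
      Finset.sum_coe_sort P1 (fun B => if RAdj G (σ ^ 2) p (γ / 10) i.1 B then (0 : ℝ) else 1)
    have h3 : ((P1.filter fun B => RAdj G (σ ^ 2) p (γ / 10) i.1 B).card : ℝ) =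
        ∑ B ∈ P1, (if RAdj G (σ ^ 2) p (γ / 10) i.1 B then (1 : ℝ) else 0) := by
      rw [Finset.card_filter]; push_cast; rfl
    have h4 : ∑ B ∈ P1, (if RAdj G (σ ^ 2) p (γ / 10) i.1 B then (0 : ℝ) else 1) + ∑ B ∈ P1, (if RAdj G (σ ^ 2) p (γ / 10) i.1 B then (1 : ℝ) else 0) = P1.card := by
      rw [← Finset.sum_add_distrib]
      have : ∀ B ∈ P1, ((if RAdj G (σ ^ 2) p (γ / 10) i.1 B then (0 : ℝ) else 1) + (if RAdj G (σ ^ 2) p (γ / 10) i.1 B then (1 : ℝ) else 0)) = 1 := by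
        intro B _; split_ifs <;> norm_num
      rw [Finset.sum_congr rfl this]; simp
    rw [h2]
    have h5 : (2 / 3 + γ / 2) * (P1.card * b) ≤ ((P1.filter fun B => RAdj G (σ ^ 2) p (γ / 10) i.1 B).card : ℝ) * b :=
      (mul_le_mul_of_nonneg_left hmb (by linarith)).trans h1
    have h6 : (2 / 3 + γ / 2) * P1.card ≤ ((P1.filter fun B => RAdj G (σ ^ 2) p (γ / 10) i.1 B).card : ℝ) := by
      refine le_of_mul_le_mul_right ?_ hbR
      linarith
    rw [h3] at h6
    linarith
  have hcP : (Fintype.card P1 : ℝ) = P1.card := by simp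
  obtain ⟨k, c', hadj, hfib, hk⟩ := int_tiling H L (by
    intro i
    refine (hnon i).trans ?_
    rw [hcP]
    have : 0 ≤ γ / 2 * (P1.card : ℝ) := by positivity
    linarith)
  rw [hcP] at hk
  have hfib' : ∀ i : P1, (univ.filter fun a => c' a = i).card ≤ L := fun i => by convert hfib i
  set w : ℕ := b / (L + 1) with hw
  have hwle : (L + 1) * w ≤ b := Nat.mul_div_le b (L + 1)
  have hwge : (b : ℝ) ≤ (L + 1) * w + L := by
    have := Nat.div_add_mod b (L + 1)
    have h2 := Nat.mod_lt b (show L + 1 > 0 by omega)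
    have h3 : b ≤ (L + 1) * w + L := by rw [hw]; omega
    exact_mod_cast h3
  have hw4 : (b : ℝ) ≤ 4 * L * w := by
    have h1 : (L : ℝ) * w ≥ 1 * w := mul_le_mul_of_nonneg_right hLR (by positivity)
    have h2 : (0 : ℝ) ≤ L * w := by positivity
    linarith
  have hw0 : 0 < w := by
    by_contra h
    have : w = 0 := Nat.eq_zero_of_not_pos h
    rw [this, Nat.cast_zero, mul_zero] at hw4
    linarith
  have hpc : ∀ A : P1, ∃ f : Fin L → Finset (Fin n), (∀ i, f i ⊆ A.1) ∧ (∀ i, (f i).card = w) ∧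
      ∀ i j, i ≠ j → Disjoint (f i) (f j) := fun A => pieces A.1 L w hw0 (by rw [hF1.1 _ A.2]; exact hwle)
  choose pc hpc1 hpc2 hpc3 using hpc
  have hinj := fun i : P1 => exists_injOn_fin (univ.filter fun a => c' a = i) L hL0 (hfib' i)
  choose f hf using hinj
  have hm0 : (0 : ℝ) ≤ P1.card := by positivity
  have hmpos : 1 ≤ (P1.card : ℝ) := by
    have h1 : (0 : ℝ) < P.card := by
      by_contra h
      have h0 : (P.card : ℝ) ≤ 0 := not_lt.1 h
      have := mul_le_mul_of_nonneg_right h0 hbR.le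
      have h9 : 0 < (1 - σ ^ 2) * (n : ℝ) := mul_pos (by linarith) (by linarith)
      linarith
    have h2 : (0 : ℝ) < P1.card := lt_of_lt_of_le (mul_pos (by linarith) h1) hP1c
    have h3 : 0 < P1.card := by exact_mod_cast h2
    exact_mod_cast h3
  refine ⟨k, w, fun a => pc (c' a) (f (c' a) a), H.comap c', ⟨?_, ?_, ?_, ?_, ?_, ?_⟩, ?_⟩
  · intro a; exact hpc2 _ _
  · intro a a' haa
    by_cases h : c' a = c' a'
    · show Disjoint (pc (c' a) (f (c' a) a)) (pc (c' a') (f (c' a') a'))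
      rw [← h]
      refine hpc3 _ _ _ fun h' => haa ?_
      exact hf (c' a) a (mem_filter.2 ⟨mem_univ _, rfl⟩) a' (mem_filter.2 ⟨mem_univ _, h.symm⟩) h'
    · exact disjoint_of_subset_left (hpc1 _ _) (disjoint_of_subset_right (hpc1 _ _)
        (hF1.2 _ (c' a).2 _ (c' a').2 fun h' => h (Subtype.ext h')))
  · -- coverage
    have h1 : (L : ℝ) * P1.card * w ≤ 3 * k * w + 3 * (P1.card + 1) * w := by
      have := mul_le_mul_of_nonneg_right hk (show (0 : ℝ) ≤ w by positivity)
      linarith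
    have h2 : (1 - 2 * σ) * n ≤ P1.card * b := by
      have e1 := mul_le_mul_of_nonneg_right hP1c hbR.le
      have e2 := mul_le_mul_of_nonneg_left hcov (show 0 ≤ 1 - σ by linarith)
      have e3 : σ ^ 2 * n ≤ σ * n := mul_le_mul_of_nonneg_right hσ2 (by linarith)
      have e4 : 0 ≤ σ * (σ ^ 2 * n) := by positivity
      linarith
    -- P1*b ≤ (L+1) w P1 + L P1
    have h3 : P1.card * (b : ℝ) ≤ P1.card * ((L + 1) * w + L) := mul_le_mul_of_nonneg_left hwge hm0
    have h4 : (P1.card : ℝ) * (16 * L) ≤ θ * n := by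
      have e1 := mul_le_mul_of_nonneg_left hbL hm0
      have e2 := mul_le_mul_of_nonneg_left hmb hθ.le
      linarith
    have h5 : (L : ℝ) * w ≤ b := by
      have : ((L + 1) * w : ℝ) ≤ b := by exact_mod_cast hwle
      have : (0 : ℝ) ≤ w := by positivity
      linarith
    have h6 : 40 * (P1.card * (w : ℝ)) ≤ θ * n := by
      have e1 := mul_le_mul_of_nonneg_right hLθ (show (0 : ℝ) ≤ P1.card * w by positivity)
      have e2 := mul_le_mul_of_nonneg_left h5 hm0
      have e3 := mul_le_mul_of_nonneg_left (e2.trans hmb) hθ.le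
      linarith
    have h7 : (w : ℝ) ≤ P1.card * w := by
      have := mul_le_mul_of_nonneg_right hmpos (show (0 : ℝ) ≤ w by positivity)
      linarith
    have h8 : 2 * σ * n ≤ θ / 8 * n := mul_le_mul_of_nonneg_right (by linarith) (by linarith)
    have h9 : 0 ≤ θ * n := by positivity
    linarith
  · intro a a' h
    have h' : RAdj G (σ ^ 2) p (γ / 10) (c' a).1 (c' a').1 := h
    have := h'.2.1.sub hp.le (hF1.1 _ (c' a).2) (hpc2 (c' a) (f (c' a) a)) (hpc2 (c' a') (f (c' a') a')) hw0
      (hpc1 _ _) (hpc1 _ _) (η' := η) (by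
        have e1 : (b : ℝ) ^ 2 ≤ (4 * L * w) ^ 2 := pow_le_pow_left₀ hbR.le hw4 2
        calc 2 * σ ^ 2 * (b : ℝ) ^ 2 ≤ 2 * σ * (4 * L * w) ^ 2 :=
              mul_le_mul (by linarith) e1 (by positivity) (by positivity)
          _ = σ * (32 * L ^ 2) * w ^ 2 := by ring
          _ ≤ η * w ^ 2 := mul_le_mul_of_nonneg_right hση (by positivity))
    refine ⟨this.1, le_trans ?_ this.2⟩
    have e1 := h'.2.2
    have e2 : η * p ≤ γ / 10 * p := mul_le_mul_of_nonneg_right hηγ hp.le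
    linarith
  · intro t r s hrs
    exact hadj t r s hrs
  · intro a
    have h1 : ((univ.filter fun a' => ¬ (H.comap c').Adj a a').card : ℝ) ≤ L * ∑ j, (if H.Adj (c' a) j then (0 : ℝ) else 1) := by
      have hmaps : ∀ a' ∈ (univ.filter fun a' => ¬ (H.comap c').Adj a a'), c' a' ∈ (univ.filter fun j => ¬ H.Adj (c' a) j) := by
        intro a' ha'
        exact mem_filter.2 ⟨mem_univ _, (mem_filter.1 ha').2⟩
      rw [Finset.card_eq_sum_card_fiberwise hmaps]
      push_cast
      calc ∑ j ∈ univ.filter (fun j => ¬ H.Adj (c' a) j), (((univ.filter fun a' => ¬ (H.comap c').Adj a a').filter fun a' => c' a' = j).card : ℝ)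
          ≤ ∑ j ∈ univ.filter (fun j => ¬ H.Adj (c' a) j), (L : ℝ) := by
            refine Finset.sum_le_sum fun j _ => ?_
            have : ((univ.filter fun a' => ¬ (H.comap c').Adj a a').filter fun a' => c' a' = j).card ≤ L :=
              (card_le_card (filter_subset_filter _ (filter_subset _ _))).trans (hfib' j)
            exact_mod_cast this
        _ = _ := by
            rw [Finset.sum_const, nsmul_eq_mul, Finset.card_filter, mul_comm]
            push_cast
            congr 1
            refine Finset.sum_congr rfl fun j _ => ?_
            by_cases h : H.Adj (c' a) j <;> simp [h]
    refine h1.trans ?_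
    have h2 := mul_le_mul_of_nonneg_left (hnon (c' a)) (show (0 : ℝ) ≤ L by positivity)
    refine h2.trans ?_
    have h3 : (1 / 3 - γ / 4) * (L * P1.card - 3 * (P1.card + 1)) ≤ (1 / 3 - γ / 4) * (3 * k) :=
      mul_le_mul_of_nonneg_left (by linarith) (by linarith)
    refine le_trans ?_ h3
    have h4 := mul_le_mul_of_nonneg_right hLγ hm0
    have h5 : 0 ≤ γ * (P1.card : ℝ) := by positivity
    linarith
  · have h1 : min c 1 / (4 * L) * (n : ℝ) = min c 1 * n / (4 * L) := by ring
    rw [h1, div_le_iff₀ (by positivity)]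
    linarith

end Part16

section Part17
/-! ## Module 17: counting atypical vertices -/

def JB {n : ℕ} (Γ : SimpleGraph (Fin n)) (p κ : ℝ) : Prop :=
  ∀ A B : Finset (Fin n), |(eBtw Γ A B : ℝ) - p * A.card * B.card| ≤ κ * p * n ^ 2

lemma up_count {n w : ℕ} {G : SimpleGraph (Fin n)} {η p δ0 ε' ζ : ℝ} {A B : Finset (Fin n)}
    (h : CutReg G η p A B) (hA : A.card = w) (hB : B.card = w) (hw : 0 < w) (hp : 0 < p)
    (hd : δ0 * p ≤ RandomTriangle.dens G A B) (he : 0 < ε') (hδ : 0 < δ0) (hη : η ≤ ζ * (ε' * δ0)) :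
    ((A.filter fun v => (1 + ε') * (RandomTriangle.dens G A B * w) < (degIn G v B : ℝ)).card : ℝ) ≤ ζ * w := by
  have hwR : (0 : ℝ) < w := by exact_mod_cast hw
  set Z := A.filter fun v => (1 + ε') * (RandomTriangle.dens G A B * w) < (degIn G v B : ℝ) with hZ
  set d := RandomTriangle.dens G A B with hdd
  have h1 := (abs_le.1 (h Z (filter_subset _ _) B (Subset.refl B))).2
  rw [← hdd, hA, hB] at h1
  have h2 : (Z.card : ℝ) * ((1 + ε') * (d * w)) ≤ eBtw G Z B := by
    rw [e_deg, ← nsmul_eq_mul]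
    exact Finset.card_nsmul_le_sum _ _ _ fun v hv => (mem_filter.1 hv).2.le
  have h3 : (Z.card : ℝ) * (ε' * w) * (δ0 * p) ≤ (Z.card : ℝ) * (ε' * w) * d :=
    mul_le_mul_of_nonneg_left hd (by positivity)
  have h4 : η * (p * (w * w)) ≤ ζ * (ε' * δ0) * (p * (w * w)) := mul_le_mul_of_nonneg_right hη (by positivity)
  have h5 : (Z.card : ℝ) * (ε' * δ0 * p * w) ≤ ζ * w * (ε' * δ0 * p * w) := by linarith
  exact le_of_mul_le_mul_right h5 (by positivity)

lemma low_count {n w : ℕ} {G : SimpleGraph (Fin n)} {η p δ0 ε' ζ ρ : ℝ} {A B Q : Finset (Fin n)}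
    (h : CutReg G η p A B) (hA : A.card = w) (hB : B.card = w) (hw : 0 < w) (hp : 0 < p)
    (hd : δ0 * p ≤ RandomTriangle.dens G A B) (he : 0 < ε') (hδ : 0 < δ0) (hη : 2 * η ≤ ζ * (ε' * δ0))
    (hρ : ρ ≤ ε' / 2) (hQ : ((Q ∩ B).card : ℝ) ≤ ρ * w) :
    ((A.filter fun v => (degIn G v (B \ Q) : ℝ) < (1 - ε') * (RandomTriangle.dens G A B * w)).card : ℝ) ≤ ζ * w := by
  have hwR : (0 : ℝ) < w := by exact_mod_cast hw
  set Z := A.filter fun v => (degIn G v (B \ Q) : ℝ) < (1 - ε') * (RandomTriangle.dens G A B * w) with hZ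
  set d := RandomTriangle.dens G A B with hdd
  have hd0 : 0 ≤ d := dens_nonneg _ _ _
  have h1 := (abs_le.1 (h Z (filter_subset _ _) (B \ Q) sdiff_subset)).1
  rw [← hdd, hA] at h1
  have h0 : (w : ℝ) - ρ * w ≤ (B \ Q).card := by
    have : ((B \ Q).card : ℝ) + (Q ∩ B).card = w := by
      rw [← hB, inter_comm]; exact_mod_cast card_sdiff_add_card_inter B Q
    linarith
  have h2 : (eBtw G Z (B \ Q) : ℝ) ≤ (Z.card : ℝ) * ((1 - ε') * (d * w)) := by
    rw [e_deg, ← nsmul_eq_mul]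
    exact Finset.sum_le_card_nsmul _ _ _ fun v hv => (mem_filter.1 hv).2.le
  have h2b : d * Z.card * (w - ε' / 2 * w) ≤ d * Z.card * (B \ Q).card := by
    refine mul_le_mul_of_nonneg_left (le_trans ?_ h0) (by positivity)
    have := mul_le_mul_of_nonneg_right hρ hwR.le
    linarith
  have h3 : (Z.card : ℝ) * (ε' * w) * (δ0 * p) ≤ (Z.card : ℝ) * (ε' * w) * d :=
    mul_le_mul_of_nonneg_left hd (by positivity)
  have h4 : 2 * η * (p * (w * w)) ≤ ζ * (ε' * δ0) * (p * (w * w)) := mul_le_mul_of_nonneg_right hη (by positivity)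
  have h5 : (Z.card : ℝ) * (ε' * δ0 * p * w) ≤ ζ * w * (ε' * δ0 * p * w) := by linarith
  exact le_of_mul_le_mul_right h5 (by positivity)

lemma sq_n_le {n w : ℕ} {μ : ℝ} (hμ : 0 < μ) (h : μ * n ≤ (w : ℝ)) : μ ^ 2 * (n : ℝ) ^ 2 ≤ w ^ 2 := by
  rw [← mul_pow]; exact pow_le_pow_left₀ (by positivity) h 2

lemma gam_count {n w : ℕ} {Γ : SimpleGraph (Fin n)} {κ p μ ζ : ℝ} {A B : Finset (Fin n)}
    (h : JB Γ p κ) (hB : B.card = w) (hw : 0 < w) (hp : 0 < p) (hμ : 0 < μ) (hμw : μ * n ≤ (w : ℝ))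
    (hζ : 0 ≤ ζ) (hκ : κ ≤ ζ * μ ^ 2) :
    ((A.filter fun v => 2 * p * w < (degIn Γ v B : ℝ)).card : ℝ) ≤ ζ * w := by
  have hwR : (0 : ℝ) < w := by exact_mod_cast hw
  set Z := A.filter fun v => 2 * p * w < (degIn Γ v B : ℝ) with hZ
  have h1 := (abs_le.1 (h Z B)).2
  rw [hB] at h1
  have h2 : (Z.card : ℝ) * (2 * p * w) ≤ eBtw Γ Z B := by
    rw [e_deg, ← nsmul_eq_mul]
    exact Finset.card_nsmul_le_sum _ _ _ fun v hv => (mem_filter.1 hv).2.le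
  have h3 : κ * (p * n ^ 2) ≤ ζ * μ ^ 2 * (p * n ^ 2) := mul_le_mul_of_nonneg_right hκ (by positivity)
  have h4 : ζ * p * (μ ^ 2 * (n : ℝ) ^ 2) ≤ ζ * p * w ^ 2 := mul_le_mul_of_nonneg_left (sq_n_le hμ hμw) (by positivity)
  have h5 : (Z.card : ℝ) * (p * w) ≤ ζ * w * (p * w) := by linarith
  exact le_of_mul_le_mul_right h5 (by positivity)

lemma JB.dens {n w : ℕ} {Γ : SimpleGraph (Fin n)} {κ p μ c : ℝ} {A B : Finset (Fin n)}
    (h : JB Γ p κ) (hA : A.card = w) (hB : B.card = w) (hw : 0 < w) (hp : 0 < p) (hμ : 0 < μ) (hμw : μ * n ≤ (w : ℝ))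
    (hc : 0 ≤ c) (hκ : κ ≤ c * μ ^ 2) : |RandomTriangle.dens Γ A B - p| ≤ c * p := by
  have hwR : (0 : ℝ) < w := by exact_mod_cast hw
  have h1 := h A B
  rw [← dens_mul Γ A B (by omega) (by omega), hA, hB] at h1
  have h3 : κ * (p * n ^ 2) ≤ c * μ ^ 2 * (p * n ^ 2) := mul_le_mul_of_nonneg_right hκ (by positivity)
  have h4 : c * p * (μ ^ 2 * (n : ℝ) ^ 2) ≤ c * p * w ^ 2 := mul_le_mul_of_nonneg_left (sq_n_le hμ hμw) (by positivity)
  have h2 : |RandomTriangle.dens Γ A B - p| * w ^ 2 ≤ c * p * w ^ 2 := by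
    rw [← abs_of_pos (show (0 : ℝ) < (w : ℝ) ^ 2 by positivity), ← abs_mul]
    rw [abs_of_pos (show (0 : ℝ) < (w : ℝ) ^ 2 by positivity)]
    rw [show (RandomTriangle.dens Γ A B - p) * (w : ℝ) ^ 2 = RandomTriangle.dens Γ A B * w * w - p * w * w by ring]
    linarith
  exact le_of_mul_le_mul_right h2 (by positivity)

lemma JB.cut {n w : ℕ} {Γ : SimpleGraph (Fin n)} {κ p μ c : ℝ} {A B : Finset (Fin n)}
    (h : JB Γ p κ) (hA : A.card = w) (hB : B.card = w) (hw : 0 < w) (hp : 0 < p) (hμ : 0 < μ) (hμw : μ * n ≤ (w : ℝ))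
    (hc : 0 ≤ c) (hκ : κ ≤ c * μ ^ 2) : CutReg Γ (2 * c) p A B := by
  have hwR : (0 : ℝ) < w := by exact_mod_cast hw
  have hd := h.dens hA hB hw hp hμ hμw hc hκ
  intro S hS T hT
  have h1 := h S T
  have h3 : κ * (p * n ^ 2) ≤ c * μ ^ 2 * (p * n ^ 2) := mul_le_mul_of_nonneg_right hκ (by positivity)
  have h4 : c * p * (μ ^ 2 * (n : ℝ) ^ 2) ≤ c * p * w ^ 2 := mul_le_mul_of_nonneg_left (sq_n_le hμ hμw) (by positivity)
  have hs : (S.card : ℝ) ≤ w := by rw [← hA]; exact_mod_cast card_le_card hS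
  have ht : (T.card : ℝ) ≤ w := by rw [← hB]; exact_mod_cast card_le_card hT
  have h5 : |(p - RandomTriangle.dens Γ A B) * (S.card * T.card)| ≤ c * p * (w * w) := by
    rw [abs_mul, abs_sub_comm, abs_of_nonneg (show (0 : ℝ) ≤ S.card * T.card by positivity)]
    exact mul_le_mul hd (mul_le_mul hs ht (by positivity) hwR.le) (by positivity) (by positivity)
  rw [hA, show (eBtw Γ S T : ℝ) - RandomTriangle.dens Γ A B * S.card * T.card =
    ((eBtw Γ S T : ℝ) - p * S.card * T.card) + (p - RandomTriangle.dens Γ A B) * (S.card * T.card) by ring]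
  refine (abs_add_le _ _).trans ?_
  linarith

def hvy {n : ℕ} (Γ : SimpleGraph (Fin n)) (p : ℝ) (A B : Finset (Fin n)) (v : Fin n) : Finset (Fin n) :=
  (nbhdIn Γ v B).filter fun y => 4 * p ^ 2 * A.card < (degIn Γ y (nbhdIn Γ v A) : ℝ)

lemma codeg_deg {n : ℕ} (Γ : SimpleGraph (Fin n)) (y v : Fin n) (A : Finset (Fin n)) :
    degIn Γ y (nbhdIn Γ v A) = codegIn Γ v y A := by
  unfold degIn nbhdIn codegIn
  rw [filter_filter]

lemma codeg_mono {n : ℕ} {G Γ : SimpleGraph (Fin n)} (h : G ≤ Γ) (y v : Fin n) {A B : Finset (Fin n)} (hAB : A ⊆ B) :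
    codegIn G v y A ≤ codegIn Γ v y B := by
  unfold codegIn
  refine card_le_card fun x hx => ?_
  rw [mem_filter] at hx ⊢
  exact ⟨hAB hx.1, h hx.2.1, h hx.2.2⟩

lemma N1.codeg {n w : ℕ} {Γ : SimpleGraph (Fin n)} {η0 p μ : ℝ} (h : N1 η0 n p Γ) (hη : η0 ≤ 1) 
    (hμ : 0 < μ) (hμw : μ * n ≤ (w : ℝ)) {u v : Fin n} (huv : u ≠ v) (A : Finset (Fin n)) :
    (codegIn Γ u v A : ℝ) ≤ 2 / μ * p ^ 2 * w := by
  have h1 : (codegIn Γ u v A : ℝ) ≤ codegIn Γ u v univ := by exact_mod_cast codeg_mono le_rfl _ _ (subset_univ A)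
  refine h1.trans ((h.2 u v huv).trans ?_)
  have h2 : (n : ℝ) ≤ w / μ := by rw [le_div_iff₀ hμ]; linarith
  calc (1 + η0) * (p ^ 2 * n) ≤ 2 * (p ^ 2 * (w / μ)) :=
        mul_le_mul (by linarith) (mul_le_mul_of_nonneg_left h2 (by positivity)) (by positivity) (by norm_num)
    _ = _ := by ring

lemma N1.deg {n w : ℕ} {Γ : SimpleGraph (Fin n)} {η0 p μ : ℝ} (h : N1 η0 n p Γ) (hη : η0 ≤ 1) (hp : 0 ≤ p)
    (hμ : 0 < μ) (hμw : μ * n ≤ (w : ℝ)) (u : Fin n) (A : Finset (Fin n)) :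
    (degIn Γ u A : ℝ) ≤ 2 / μ * p * w := by
  have h1 : (degIn Γ u A : ℝ) ≤ degIn Γ u univ := by exact_mod_cast deg_mono le_rfl _ (subset_univ A)
  refine h1.trans ((h.1 u).2.trans ?_)
  have h2 : (n : ℝ) ≤ w / μ := by rw [le_div_iff₀ hμ]; linarith
  calc (1 + η0) * (p * n) ≤ 2 * (p * (w / μ)) :=
        mul_le_mul (by linarith) (mul_le_mul_of_nonneg_left h2 (by positivity)) (by positivity) (by norm_num)
    _ = _ := by ring

lemma heavy_count {n w : ℕ} {Γ : SimpleGraph (Fin n)} {κ p μ ζ κh ηh η0 : ℝ} {A B : Finset (Fin n)}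
    (h : JB Γ p κ) (hN : N1 η0 n p Γ) (hη0 : η0 ≤ 1) (hP : P3 κh ζ (4 / μ) μ ηh n p Γ)
    (hA : A.card = w) (hB : B.card = w) (hw : 0 < w) (hp : 0 < p) (hμ : 0 < μ) (hμ1 : μ ≤ 1) (hμw : μ * n ≤ (w : ℝ))
    (hAB : Disjoint A B) (hηh : 0 < ηh) (hκ : κ ≤ ηh / 2 * μ ^ 2) (hκ2 : κ ≤ 1 / 2 * μ ^ 2) :
    (((univ \ (A ∪ B)).filter fun v => (degIn Γ v A : ℝ) ≤ 2 * p * w ∧ (degIn Γ v B : ℝ) ≤ 2 * p * w ∧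
      κh * p * w < ((hvy Γ p A B v).card : ℝ)).card : ℝ) ≤ ζ * w := by
  have hwR : (0 : ℝ) < w := by exact_mod_cast hw
  have hd := abs_le.1 (h.dens hA hB hw hp hμ hμw (by norm_num) hκ2)
  have hcut := h.cut hA hB hw hp hμ hμw (by positivity) hκ
  rw [show 2 * (ηh / 2) = ηh by ring] at hcut
  have h4μ : 4 ≤ 4 / μ := by rw [le_div_iff₀ hμ]; linarith
  have h24 : 2 / μ ≤ 4 / μ := by gcongr; norm_num
  have key := hP A B hAB (by omega) (by rw [hA]; exact hμw) Γ le_rfl (by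
    have : 4 * p ≤ 4 / μ * p := mul_le_mul_of_nonneg_right h4μ hp.le
    linarith) hcut
  rw [hA] at key
  refine le_trans ?_ key
  norm_cast
  refine card_le_card fun v hv => ?_
  rw [mem_filter] at hv ⊢
  obtain ⟨hv0, hv1, hv2, hv3⟩ := hv
  have h2 : 2 * (p * w) ≤ 4 / μ * (p * w) := mul_le_mul_of_nonneg_right (by linarith) (by positivity)
  refine ⟨hv0, ?_, ?_, nbhdIn Γ v A, Subset.refl _, hvy Γ p A B v, filter_subset _ _, ?_, ?_, ?_⟩
  · rw [nbhd_card, hA]; linarith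
  · rw [nbhd_card, hA]; linarith
  · intro x hx
    rw [hA]
    refine (hN.deg hη0 hp.le hμ hμw x B).trans ?_
    rw [mul_assoc, mul_assoc]
    exact mul_le_mul_of_nonneg_right h24 (by positivity)
  · intro y hy
    rw [hA, codeg_deg]
    have hvy' : v ≠ y := (mem_filter.1 (mem_filter.1 hy).1).2.ne
    refine (hN.codeg hη0 hμ hμw hvy' A).trans ?_
    rw [mul_assoc, mul_assoc]
    exact mul_le_mul_of_nonneg_right h24 (by positivity)
  · have e1 : ((hvy Γ p A B v).card : ℝ) * (4 * p ^ 2 * w) ≤ eBtw Γ (nbhdIn Γ v A) (hvy Γ p A B v) := by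
      rw [e_comm, e_deg, ← nsmul_eq_mul]
      refine Finset.card_nsmul_le_sum _ _ _ fun y hy => ?_
      have := (mem_filter.1 hy).2
      rw [hA] at this
      exact this.le
    have e2 : RandomTriangle.dens Γ A B * ((nbhdIn Γ v A).card * (hvy Γ p A B v).card) ≤ 3 / 2 * p * (2 * p * w * (hvy Γ p A B v).card) := by
      refine mul_le_mul (by linarith) (mul_le_mul_of_nonneg_right ?_ (by positivity)) (by positivity) (by positivity)
      rw [nbhd_card]; exact hv1
    refine lt_of_lt_of_le ?_ (le_abs_self _)
    have e3 : κh * p * w * (p ^ 2 * w) < (hvy Γ p A B v).card * (p ^ 2 * w) := mul_lt_mul_of_pos_right hv3 (by positivity)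
    rw [hA]
    linarith

def Typ {n : ℕ} (Γ G : SimpleGraph (Fin n)) (ε1 κh p : ℝ) (A B : Finset (Fin n)) (v : Fin n) : Prop :=
  (degIn Γ v A : ℝ) ≤ 2 * p * A.card ∧ (degIn Γ v B : ℝ) ≤ 2 * p * A.card ∧ ¬ P3Bad Γ G ε1 4 p A B v ∧
    ((hvy Γ p A B v).card : ℝ) ≤ κh * p * A.card

lemma Typ.use {n : ℕ} {Γ G : SimpleGraph (Fin n)} {ε1 κh p : ℝ} {A B : Finset (Fin n)} {v : Fin n}
    (h : Typ Γ G ε1 κh p A B v) (hp : 0 ≤ p) (hG : G ≤ Γ) {S T : Finset (Fin n)} (hS : S ⊆ nbhdIn Γ v A)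
    (hT : T ⊆ nbhdIn Γ v B \ hvy Γ p A B v) (hSd : ∀ x ∈ S, (degIn Γ x B : ℝ) ≤ 2 * p * A.card) :
    |(eBtw G S T : ℝ) - RandomTriangle.dens G A B * S.card * T.card| ≤ ε1 * p ^ 3 * A.card ^ 2 := by
  by_contra hc
  push Not at hc
  have h0 : 0 ≤ p * A.card := by positivity
  refine h.2.2.1 ⟨?_, ?_, S, hS, T, fun y hy => (mem_sdiff.1 (hT hy)).1, ?_, ?_, hc⟩
  · rw [nbhd_card]; linarith [h.1]
  · rw [nbhd_card]; linarith [h.2.1]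
  · intro x hx
    have := hSd x hx
    have h2 : (degIn G x B : ℝ) ≤ degIn Γ x B := by exact_mod_cast deg_mono hG x (Subset.refl B)
    linarith
  · intro y hy
    have h1 := mem_sdiff.1 (hT hy)
    have h2 : ¬ (4 * p ^ 2 * A.card < (degIn Γ y (nbhdIn Γ v A) : ℝ)) := fun h' => h1.2 (mem_filter.2 ⟨h1.1, h'⟩)
    have h3 : (degIn G y (nbhdIn Γ v A) : ℝ) ≤ degIn Γ y (nbhdIn Γ v A) := by exact_mod_cast deg_mono hG y (Subset.refl _)
    linarith

end Part17

section Part18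
/-! ## Module 18: counting vertices with many bad edges -/

def BadE {n : ℕ} (G : SimpleGraph (Fin n)) (ε' : ℝ) (A B C Q : Finset (Fin n)) (u w : Fin n) : Prop :=
  G.Adj u w ∧ (codegIn G u w (A \ Q) : ℝ) < (1 - 2 * ε') *
    (RandomTriangle.dens G A B * RandomTriangle.dens G A C * A.card)

def bedge {n : ℕ} (G : SimpleGraph (Fin n)) (ε' : ℝ) (A B C X Q : Finset (Fin n)) (v : Fin n) : Finset (Fin n × Fin n) :=
  ((nbhdIn G v (B \ X)) ×ˢ (nbhdIn G v (C \ X))).filter fun z => BadE G ε' A B C Q z.1 z.2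

lemma bedge_sum {n : ℕ} (G : SimpleGraph (Fin n)) (ε' : ℝ) (A B C X Q : Finset (Fin n)) :
    ∑ v ∈ A, ((bedge G ε' A B C X Q v).card : ℝ) =
      ∑ u ∈ B \ X, ∑ w ∈ (C \ X).filter (fun w => BadE G ε' A B C Q u w), (codegIn G u w A : ℝ) := by
  have h1 : ∀ v, ((bedge G ε' A B C X Q v).card : ℝ) = ∑ u ∈ B \ X, ∑ w ∈ (C \ X).filter (fun w => BadE G ε' A B C Q u w),
      ad G u v * ad G w v := by
    intro v
    unfold bedge
    rw [Finset.card_filter]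
    push_cast
    rw [Finset.sum_product]
    unfold nbhdIn
    rw [Finset.sum_filter]
    refine Finset.sum_congr rfl fun u hu => ?_
    rw [Finset.sum_filter, Finset.sum_filter]
    by_cases hvu : G.Adj v u
    · rw [if_pos hvu]
      refine Finset.sum_congr rfl fun w hw => ?_
      unfold ad
      rw [if_pos hvu.symm, G.adj_comm w v]
      split_ifs <;> simp
    · rw [if_neg hvu]
      symm
      refine Finset.sum_eq_zero fun w hw => ?_
      have h0 : ad G u v = 0 := by unfold ad; exact if_neg (fun h => hvu h.symm)
      rw [h0, zero_mul, ite_self]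
  simp_rw [h1]
  rw [Finset.sum_comm]
  refine Finset.sum_congr rfl fun u hu => ?_
  rw [Finset.sum_comm]
  refine Finset.sum_congr rfl fun w hw => ?_
  rw [codeg_sum]

lemma per_u {n w : ℕ} {Γ G : SimpleGraph (Fin n)} {p μ ε1 κh η0 c1 : ℝ} {A C T : Finset (Fin n)} {u : Fin n}
    (hN : N1 η0 n p Γ) (hη0 : η0 ≤ 1) (hp : 0 < p) (hμ : 0 < μ) (hμw : μ * n ≤ (w : ℝ)) (hA : A.card = w)
    (hG : G ≤ Γ) (hκ : κh ≤ c1 * μ) (hu : Typ Γ G ε1 κh p A C u) (hT : T ⊆ nbhdIn Γ u C) :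
    ∑ y ∈ T, (codegIn G u y A : ℝ) ≤ (T \ hvy Γ p A C u).card * (4 * p ^ 2 * w) + 2 * c1 * (p ^ 3 * w ^ 2) := by
  have hdis : T = (T \ hvy Γ p A C u) ∪ (T ∩ hvy Γ p A C u) := (sdiff_union_inter _ _).symm
  have h0 : ∑ y ∈ T, (codegIn G u y A : ℝ) = ∑ y ∈ T \ hvy Γ p A C u, (codegIn G u y A : ℝ)
      + ∑ y ∈ T ∩ hvy Γ p A C u, (codegIn G u y A : ℝ) := by
    conv_lhs => rw [hdis]
    exact Finset.sum_union (disjoint_sdiff_inter _ _)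
  have hle : ∀ y, (codegIn G u y A : ℝ) ≤ codegIn Γ u y A := fun y => by
    exact_mod_cast codeg_mono hG _ _ (Subset.refl A)
  have h1 : ∑ y ∈ T \ hvy Γ p A C u, (codegIn G u y A : ℝ) ≤ (T \ hvy Γ p A C u).card * (4 * p ^ 2 * w) := by
    rw [← nsmul_eq_mul]
    refine Finset.sum_le_card_nsmul _ _ _ fun y hy => (hle y).trans ?_
    have h := mem_sdiff.1 hy
    by_contra hc
    push Not at hc
    refine h.2 (mem_filter.2 ⟨hT h.1, ?_⟩)
    rw [codeg_deg, hA]; exact hc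
  have h2 : ∑ y ∈ T ∩ hvy Γ p A C u, (codegIn G u y A : ℝ) ≤ (T ∩ hvy Γ p A C u).card * (2 / μ * p ^ 2 * w) := by
    rw [← nsmul_eq_mul]
    refine Finset.sum_le_card_nsmul _ _ _ fun y hy => (hle y).trans ?_
    refine hN.codeg hη0 hμ hμw ?_ A
    exact (mem_filter.1 (hT (mem_inter.1 hy).1)).2.ne
  have h3 : ((T ∩ hvy Γ p A C u).card : ℝ) ≤ c1 * μ * (p * w) := by
    have e1 : ((T ∩ hvy Γ p A C u).card : ℝ) ≤ (hvy Γ p A C u).card := by exact_mod_cast card_le_card inter_subset_right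
    have e2 := hu.2.2.2
    rw [hA] at e2
    have e3 := mul_le_mul_of_nonneg_right hκ (show (0 : ℝ) ≤ p * w by positivity)
    linarith
  have h4 : ((T ∩ hvy Γ p A C u).card : ℝ) * (2 / μ * p ^ 2 * w) ≤ c1 * μ * (p * w) * (2 / μ * p ^ 2 * w) :=
    mul_le_mul_of_nonneg_right h3 (by positivity)
  have h5 : c1 * μ * (p * w) * (2 / μ * p ^ 2 * w) = 2 * c1 * (p ^ 3 * w ^ 2) := by
    field_simp
  linarith

set_option maxHeartbeats 1000000 in
lemma c2_count {n w : ℕ} {Γ G : SimpleGraph (Fin n)} {p μ ε1 κh η0 c1 δ0 ε' ρ η ζ ζ3 ε2 : ℝ} {A B C X Q : Finset (Fin n)}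
    (hN : N1 η0 n p Γ) (hη0 : η0 ≤ 1) (hp : 0 < p) (hμ : 0 < μ) (hμw : μ * n ≤ (w : ℝ))
    (hA : A.card = w) (hB : B.card = w) (hw : 0 < w)
    (hG : G ≤ Γ) (hc1 : 0 ≤ c1) (hc11 : c1 ≤ 1) (hκ : κh ≤ c1 * μ) (hε1 : ε1 ≤ c1 * (ε' * δ0 ^ 2)) (he : 0 < ε') (hδ : 0 < δ0)
    (hη : 2 * η ≤ ζ * (ε' * δ0)) (hρ : ρ ≤ ε' / 2) (hε2 : 0 < ε2) (hζ3 : 6 * c1 + 10 * ζ ≤ ζ3 * ε2)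
    (hcut : CutReg G η p B A) (hdB : δ0 * p ≤ RandomTriangle.dens G A B) (hdC : δ0 * p ≤ RandomTriangle.dens G A C)
    (hTyp : ∀ u ∈ B \ X, Typ Γ G ε1 κh p A C u) (hdeg : ∀ x ∈ A \ X, (degIn Γ x C : ℝ) ≤ 2 * p * w)
    (hXQ : X ⊆ Q) (hQ : ((Q ∩ A).card : ℝ) ≤ ρ * w) :
    ((A.filter fun v => ε2 * (p ^ 3 * w ^ 2) < ((bedge G ε' A B C X Q v).card : ℝ)).card : ℝ) ≤ ζ3 * w := by
  have hwR : (0 : ℝ) < w := by exact_mod_cast hw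
  set T : Fin n → Finset (Fin n) := fun u => (C \ X).filter (fun w => BadE G ε' A B C Q u w) with hTd
  set d1 := RandomTriangle.dens G A B with hd1
  set d2 := RandomTriangle.dens G A C with hd2
  have hd20 : 0 ≤ d2 := dens_nonneg _ _ _
  have hd10 : 0 ≤ d1 := dens_nonneg _ _ _
  set low := B.filter fun v => (degIn G v (A \ Q) : ℝ) < (1 - ε') * (d1 * w) with hlow
  have hlowc : (low.card : ℝ) ≤ ζ * w := by
    have := low_count (Q := Q) hcut hB hA hw hp (by rw [dens_comm]; exact hdB) he hδ hη hρ hQ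
    rw [dens_comm] at this
    exact this
  have hTsub : ∀ u, T u ⊆ nbhdIn Γ u C := by
    intro u y hy
    have := mem_filter.1 hy
    exact mem_filter.2 ⟨(mem_sdiff.1 this.1).1, hG this.2.1⟩
  have hper : ∀ u ∈ B \ X, ∑ y ∈ T u, (codegIn G u y A : ℝ) ≤ 6 * c1 * (p ^ 3 * w ^ 2) + (if u ∈ low then 10 * (p ^ 3 * w ^ 2) else 0) := by
    intro u hu
    have h1 := per_u hN hη0 hp hμ hμw hA hG hκ (hTyp u hu) (hTsub u)
    have hpw : 0 < p ^ 3 * (w : ℝ) ^ 2 := by positivity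
    have hc1p : c1 * (p ^ 3 * (w : ℝ) ^ 2) ≤ 1 * (p ^ 3 * (w : ℝ) ^ 2) := mul_le_mul_of_nonneg_right hc11 hpw.le
    have hc1p0 : 0 ≤ c1 * (p ^ 3 * (w : ℝ) ^ 2) := by positivity
    by_cases hl : u ∈ low
    · rw [if_pos hl]
      have h2 : ((T u \ hvy Γ p A C u).card : ℝ) ≤ 2 * p * w := by
        have e1 : (T u \ hvy Γ p A C u).card ≤ degIn Γ u C := card_le_card (sdiff_subset.trans (hTsub u))
        have e2 := (hTyp u hu).2.1
        rw [hA] at e2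
        exact le_trans (by exact_mod_cast e1) e2
      have h3 := mul_le_mul_of_nonneg_right h2 (show (0 : ℝ) ≤ 4 * p ^ 2 * w by positivity)
      linarith
    · rw [if_neg hl]
      have hl' : (1 - ε') * (d1 * w) ≤ (degIn G u (A \ Q) : ℝ) := by
        by_contra hc
        push Not at hc
        exact hl (mem_filter.2 ⟨(mem_sdiff.1 hu).1, hc⟩)
      set T' := T u \ hvy Γ p A C u with hT'
      have hS : nbhdIn G u (A \ Q) ⊆ nbhdIn Γ u A := by
        intro x hx
        have := mem_filter.1 hx
        exact mem_filter.2 ⟨(mem_sdiff.1 this.1).1, hG this.2⟩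
      have h2 := (hTyp u hu).use hp.le hG (S := nbhdIn G u (A \ Q)) (T := T') hS
        (sdiff_subset_sdiff (hTsub u) (Subset.refl _)) (by
          intro x hx
          rw [hA]
          have := mem_sdiff.1 (mem_filter.1 hx).1
          exact hdeg x (mem_sdiff.2 ⟨this.1, fun h => this.2 (hXQ h)⟩))
      have h2' := (abs_le.1 h2).1
      rw [hA, ← hd2, nbhd_card] at h2'
      have h3 : (eBtw G (nbhdIn G u (A \ Q)) T' : ℝ) ≤ T'.card * ((1 - 2 * ε') * (d1 * d2 * w)) := by
        rw [e_comm, e_deg, ← nsmul_eq_mul]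
        refine Finset.sum_le_card_nsmul _ _ _ fun y hy => ?_
        rw [codeg_deg]
        have := (mem_filter.1 (mem_sdiff.1 hy).1).2.2
        rw [hA] at this
        exact this.le
      have h4 : d2 * T'.card * ((1 - ε') * (d1 * w)) ≤ d2 * T'.card * (degIn G u (A \ Q) : ℝ) :=
        mul_le_mul_of_nonneg_left hl' (by positivity)
      have h5 : (δ0 * p) * (δ0 * p) ≤ d1 * d2 := mul_le_mul hdB hdC (by positivity) hd10
      have h6 : (T'.card : ℝ) * (ε' * w) * ((δ0 * p) * (δ0 * p)) ≤ T'.card * (ε' * w) * (d1 * d2) :=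
        mul_le_mul_of_nonneg_left h5 (by positivity)
      have h7 : ε1 * (p ^ 3 * w ^ 2) ≤ c1 * (ε' * δ0 ^ 2) * (p ^ 3 * w ^ 2) := mul_le_mul_of_nonneg_right hε1 (by positivity)
      have h8 : (T'.card : ℝ) * (ε' * δ0 ^ 2 * p ^ 2 * w) ≤ c1 * (p * w) * (ε' * δ0 ^ 2 * p ^ 2 * w) := by linarith
      have h9 := le_of_mul_le_mul_right h8 (by positivity)
      have h10 := mul_le_mul_of_nonneg_right h9 (show (0 : ℝ) ≤ 4 * p ^ 2 * w by positivity)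
      linarith
  have hsum : ∑ v ∈ A, ((bedge G ε' A B C X Q v).card : ℝ) ≤ (6 * c1 + 10 * ζ) * (p ^ 3 * w ^ 3) := by
    rw [bedge_sum]
    refine (Finset.sum_le_sum hper).trans ?_
    rw [Finset.sum_add_distrib, Finset.sum_const, nsmul_eq_mul, ← Finset.sum_filter, Finset.sum_const, nsmul_eq_mul]
    have e1 : ((B \ X).card : ℝ) ≤ w := by rw [← hB]; exact_mod_cast card_le_card sdiff_subset
    have e2 : (((B \ X).filter fun u => u ∈ low).card : ℝ) ≤ ζ * w := by
      refine le_trans ?_ hlowc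
      exact_mod_cast card_le_card fun x hx => (mem_filter.1 hx).2
    have e3 := mul_le_mul_of_nonneg_right e1 (show 0 ≤ 6 * c1 * (p ^ 3 * (w : ℝ) ^ 2) by positivity)
    have e4 := mul_le_mul_of_nonneg_right e2 (show 0 ≤ 10 * (p ^ 3 * (w : ℝ) ^ 2) by positivity)
    linarith
  set Z := A.filter fun v => ε2 * (p ^ 3 * w ^ 2) < ((bedge G ε' A B C X Q v).card : ℝ) with hZ
  have h1 : (Z.card : ℝ) * (ε2 * (p ^ 3 * w ^ 2)) ≤ ∑ v ∈ A, ((bedge G ε' A B C X Q v).card : ℝ) := by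
    rw [← nsmul_eq_mul]
    refine (Finset.card_nsmul_le_sum Z _ _ fun v hv => (mem_filter.1 hv).2.le).trans ?_
    exact Finset.sum_le_sum_of_subset_of_nonneg (filter_subset _ _) fun _ _ _ => by positivity
  have h2 := mul_le_mul_of_nonneg_right hζ3 (show 0 ≤ p ^ 3 * (w : ℝ) ^ 3 by positivity)
  have h3 : (Z.card : ℝ) * (ε2 * (p ^ 3 * w ^ 2)) ≤ ζ3 * w * (ε2 * (p ^ 3 * w ^ 2)) := by linarith
  exact le_of_mul_le_mul_right h3 (by positivity)

end Part18

section Part19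
/-! ## Module 19: verification of strong super-regularity -/

lemma dens_close {n : ℕ} {G : SimpleGraph (Fin n)} {S T : Finset (Fin n)} {d E a b c : ℝ}
    (h : |(eBtw G S T : ℝ) - d * S.card * T.card| ≤ E) (ha : 0 < a) (hb : 0 < b) (hc : 0 ≤ c)
    (hS : a ≤ S.card) (hT : b ≤ T.card) (hE : E ≤ c * (a * b)) : |RandomTriangle.dens G S T - d| ≤ c := by
  have hS0 : (0 : ℝ) < S.card := lt_of_lt_of_le ha hS
  have hT0 : (0 : ℝ) < T.card := lt_of_lt_of_le hb hT
  rw [← dens_mul G S T (by exact_mod_cast hS0) (by exact_mod_cast hT0)] at h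
  have h1 : |RandomTriangle.dens G S T - d| * (S.card * T.card) ≤ c * (S.card * T.card) := by
    rw [← abs_of_pos (show (0 : ℝ) < S.card * T.card by positivity), ← abs_mul]
    rw [abs_of_pos (show (0 : ℝ) < S.card * T.card by positivity)]
    rw [show (RandomTriangle.dens G S T - d) * (S.card * T.card : ℝ) = RandomTriangle.dens G S T * S.card * T.card - d * S.card * T.card by ring]
    refine h.trans (hE.trans (mul_le_mul_of_nonneg_left ?_ hc))
    exact mul_le_mul hS hT hb.le hS0.le
  exact le_of_mul_le_mul_right h1 (by positivity)

lemma pair_sub {n w m : ℕ} {G : SimpleGraph (Fin n)} {p η ε δ0 : ℝ} {A B A' B' : Finset (Fin n)}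
    (hcut : CutReg G η p A B) (hA : A.card = w) (hA' : A'.card = m) (hB' : B'.card = m)
    (hAA : A' ⊆ A) (hBB : B' ⊆ B) (hw : 0 < w) (hp : 0 < p) (hm : (1 - ε / 16) * w ≤ m) (he : 0 < ε) (he1 : ε ≤ 1)
    (hδ : 0 < δ0) (hd : δ0 * p ≤ RandomTriangle.dens G A B) (hη1 : 64 * η ≤ ε * δ0) (hη2 : 8 * η ≤ ε ^ 3) :
    (1 - ε / 16) * RandomTriangle.dens G A B ≤ RandomTriangle.dens G A' B' ∧
    RandomTriangle.dens G A' B' ≤ (1 + ε / 16) * RandomTriangle.dens G A B ∧ RegularPair G ε p A' B' := by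
  have hwR : (0 : ℝ) < w := by exact_mod_cast hw
  have hm2 : (w : ℝ) / 2 < m := by
    have : (1 / 2 : ℝ) * w < (1 - ε / 16) * w := mul_lt_mul_of_pos_right (by linarith) hwR
    linarith
  have hm0 : (0 : ℝ) < m := by linarith
  set d := RandomTriangle.dens G A B with hdd
  have key : ∀ S ⊆ A', ∀ T ⊆ B', ∀ e : ℝ, 0 < e → e * m ≤ S.card → e * m ≤ T.card → ∀ c : ℝ, 0 ≤ c → 4 * η * p ≤ c * e ^ 2 →
      |RandomTriangle.dens G S T - d| ≤ c := by
    intro S hS T hT e he0 h1 h2 c hc hce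
    refine dens_close (hcut S (hS.trans hAA) T (hT.trans hBB)) (a := e * (w / 2)) (b := e * (w / 2)) (by positivity) (by positivity) hc
      (le_trans (mul_le_mul_of_nonneg_left hm2.le he0.le) h1) (le_trans (mul_le_mul_of_nonneg_left hm2.le he0.le) h2) ?_
    rw [hA]
    have := mul_le_mul_of_nonneg_right hce (show (0 : ℝ) ≤ w * w / 4 by positivity)
    linarith
  have hfull : ∀ c : ℝ, 0 ≤ c → 4 * η * p ≤ c → |RandomTriangle.dens G A' B' - d| ≤ c := by
    intro c hc hce
    exact key A' (Subset.refl _) B' (Subset.refl _) 1 one_pos (by rw [hA']; linarith) (by rw [hB']; linarith) c hc (by linarith)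
  have h1 := abs_le.1 (hfull (ε / 16 * d) (mul_nonneg (by positivity) (dens_nonneg _ _ _)) (by
    have e1 := mul_le_mul_of_nonneg_right hη1 hp.le
    have e2 := mul_le_mul_of_nonneg_left hd he.le
    linarith))
  refine ⟨by linarith, by linarith, ?_⟩
  intro X' hX' Y' hY' hx hy
  rw [hA'] at hx
  rw [hB'] at hy
  have e1 := key X' hX' Y' hY' ε he hx hy (ε * p / 2) (by positivity) (by
    have := mul_le_mul_of_nonneg_right hη2 hp.le
    linarith)
  have e2 := hfull (ε * p / 2) (by positivity) (by
    have := mul_le_mul_of_nonneg_right hη2 hp.le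
    have h3 : ε ^ 3 ≤ ε := pow_le_of_le_one he.le he1 (by norm_num)
    have := mul_le_mul_of_nonneg_right h3 hp.le
    linarith)
  rw [abs_le] at e1 e2 ⊢
  constructor <;> linarith [e1.1, e1.2, e2.1, e2.2]

lemma gv_lo {ε d e m w : ℝ} (he : 0 < ε) (he1 : ε ≤ 1) (hw : 0 < w) (hm0 : 0 < m) (hmw : m ≤ w) (hd : 0 < d)
    (he' : e ≤ (1 + ε / 16) * d) : (1 - ε) * (e * m) ≤ (1 - ε / 16) * (d * w) := by
  have h1 : e * m ≤ (1 + ε / 16) * d * w := mul_le_mul he' hmw hm0.le (by positivity)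
  have h2 : (1 - ε) * (e * m) ≤ (1 - ε) * ((1 + ε / 16) * d * w) := mul_le_mul_of_nonneg_left h1 (by linarith)
  have h3 : (1 - ε) * (1 + ε / 16) * (d * w) ≤ (1 - ε / 16) * (d * w) :=
    mul_le_mul_of_nonneg_right (by nlinarith) (by positivity)
  linarith

lemma gv_hi {ε d e m w : ℝ} (he : 0 < ε) (he1 : ε ≤ 1) (hw : 0 < w) (hm : (1 - ε / 16) * w ≤ m) (hd : 0 < d)
    (he' : (1 - ε / 16) * d ≤ e) : (1 + ε / 16) * (d * w) ≤ (1 + ε) * (e * m) := by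
  have h1 : (1 - ε / 16) * d * ((1 - ε / 16) * w) ≤ e * m :=
    mul_le_mul he' hm (mul_nonneg (by linarith) hw.le) (le_trans (mul_nonneg (by linarith) hd.le) he')
  have h2 : (1 + ε) * ((1 - ε / 16) * d * ((1 - ε / 16) * w)) ≤ (1 + ε) * (e * m) := mul_le_mul_of_nonneg_left h1 (by linarith)
  have h3 : (1 + ε / 16) * (d * w) ≤ ((1 + ε) * ((1 - ε / 16) * (1 - ε / 16))) * (d * w) := by
    refine mul_le_mul_of_nonneg_right ?_ (by positivity)
    have e1 : 1 - ε / 8 ≤ (1 - ε / 16) * (1 - ε / 16) := by nlinarith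
    have e2 : (1 + ε) * (1 - ε / 8) ≤ (1 + ε) * ((1 - ε / 16) * (1 - ε / 16)) := mul_le_mul_of_nonneg_left e1 (by linarith)
    nlinarith
  linarith

lemma gv_base {ε δ0 p d w : ℝ} (he1 : ε ≤ 1) (hδp : 0 < δ0 * p) (hw : 0 < w) (hd : δ0 * p ≤ d) :
    15 / 16 * (δ0 * (p * w)) ≤ (1 - ε / 16) * (d * w) := by
  have h1 : δ0 * p * w ≤ d * w := mul_le_mul_of_nonneg_right hd hw.le
  have := mul_le_mul (show (15 / 16 : ℝ) ≤ 1 - ε / 16 by linarith) h1 (by positivity) (by linarith)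
  linarith

lemma gv_edge {ε d1 d2 e1 e2 m w : ℝ} (he : 0 < ε) (he1 : ε ≤ 1) (hw : 0 < w) (hm0 : 0 < m) (hmw : m ≤ w) (hd1 : 0 < d1) (hd2 : 0 < d2)
    (e0 : 0 ≤ e2) (h1 : e1 ≤ (1 + ε / 16) * d1) (h2 : e2 ≤ (1 + ε / 16) * d2) :
    (1 - ε) * (e1 * e2 * m) ≤ (1 - 2 * (ε / 16)) * (d1 * d2 * w) := by
  have e2 : e1 * e2 * m ≤ ((1 + ε / 16) * d1) * ((1 + ε / 16) * d2) * w :=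
    mul_le_mul (mul_le_mul h1 h2 e0 (by positivity)) hmw hm0.le (by positivity)
  have e3 := mul_le_mul_of_nonneg_left e2 (show 0 ≤ 1 - ε by linarith)
  have e4 : (1 - ε) * ((1 + ε / 16) * (1 + ε / 16)) * (d1 * d2 * w) ≤ (1 - 2 * (ε / 16)) * (d1 * d2 * w) := by
    refine mul_le_mul_of_nonneg_right ?_ (by positivity)
    have f1 : (1 + ε / 16) * (1 + ε / 16) ≤ 1 + ε / 4 := by nlinarith
    have f2 := mul_le_mul_of_nonneg_left f1 (show 0 ≤ 1 - ε by linarith)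
    nlinarith
  linarith

lemma gv_g {ε x d e : ℝ} (he1 : ε ≤ 1) (hx : 0 < x) (h2 : x ≤ d) (h3 : (1 - ε / 16) * d ≤ e) : 15 / 16 * x ≤ e := by
  refine le_trans ?_ h3
  exact mul_le_mul (by linarith) h2 hx.le (by linarith)

lemma gv_prod {ε x d1 d2 d3 e1 e2 e3 m w : ℝ} (he : 0 < ε) (he1 : ε ≤ 1) (hx : 0 < x) (hw : 0 < w) (hm : 15 / 16 * w ≤ m)
    (a1 : x ≤ d1) (a2 : x ≤ d2) (a3 : x ≤ d3) (b1 : (1 - ε / 16) * d1 ≤ e1) (b2 : (1 - ε / 16) * d2 ≤ e2)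
    (b3 : (1 - ε / 16) * d3 ≤ e3) : ε / 8 * (x ^ 3 * w ^ 2) ≤ ε * (e1 * e2 * e3 * m * m) := by
  have g1 := gv_g he1 hx a1 b1
  have g2 := gv_g he1 hx a2 b2
  have g3 := gv_g he1 hx a3 b3
  have p1 : 0 < e1 := by linarith
  have p2 : 0 < e2 := by linarith
  have p3 : 0 < e3 := by linarith
  have pm : 0 < m := by linarith
  have g4 : (15 / 16 * x) * (15 / 16 * x) * (15 / 16 * x) * (15 / 16 * w) * (15 / 16 * w) ≤ e1 * e2 * e3 * m * m := by
    refine mul_le_mul (mul_le_mul (mul_le_mul (mul_le_mul g1 g2 (by positivity) p1.le) g3 (by positivity) (by positivity)) hm (by positivity) (by positivity)) hm (by positivity) (by positivity)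
  have g5 := mul_le_mul_of_nonneg_left g4 he.le
  have g6 : 0 ≤ ε * (x ^ 3 * w ^ 2) := by positivity
  linarith

set_option maxHeartbeats 1000000 in
lemma good_vertex {n w m : ℕ} {Γ G : SimpleGraph (Fin n)} {p ε δ0 ε1 κh : ℝ} {A B C A' B' C' X Q : Finset (Fin n)} {v : Fin n}
    (hA : A.card = w) (hB : B.card = w) (hA' : A'.card = m) (hB' : B'.card = m) (hC' : C'.card = m)
    (hBB : B' ⊆ B) (hCC : C' ⊆ C) (hw : 0 < w) (hp : 0 < p) (hG : G ≤ Γ)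
    (hm : (1 - ε / 16) * w ≤ m) (hmw : m ≤ w) (he : 0 < ε) (he1 : ε ≤ 1) (hδ : 0 < δ0) (hδ1 : δ0 ≤ 1)
    (hdAB : δ0 * p ≤ RandomTriangle.dens G A B) (hdAC : δ0 * p ≤ RandomTriangle.dens G A C) (hdBC : δ0 * p ≤ RandomTriangle.dens G B C)
    (hAB1 : (1 - ε / 16) * RandomTriangle.dens G A B ≤ RandomTriangle.dens G A' B')
    (hAB2 : RandomTriangle.dens G A' B' ≤ (1 + ε / 16) * RandomTriangle.dens G A B)
    (hAC1 : (1 - ε / 16) * RandomTriangle.dens G A C ≤ RandomTriangle.dens G A' C')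
    (hAC2 : RandomTriangle.dens G A' C' ≤ (1 + ε / 16) * RandomTriangle.dens G A C)
    (hBC1 : (1 - ε / 16) * RandomTriangle.dens G B C ≤ RandomTriangle.dens G B' C')
    (hBC2 : RandomTriangle.dens G B' C' ≤ (1 + ε / 16) * RandomTriangle.dens G B C)
    (hε1 : 400 * ε1 ≤ ε ^ 3 * δ0 ^ 3) (hκh : κh ≤ ε * δ0 / 8) (htyp : Typ Γ G ε1 κh p B C v)
    (hupB : (degIn G v B : ℝ) ≤ (1 + ε / 16) * (RandomTriangle.dens G A B * w))
    (hupC : (degIn G v C : ℝ) ≤ (1 + ε / 16) * (RandomTriangle.dens G A C * w))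
    (hloB : (1 - ε / 16) * (RandomTriangle.dens G A B * w) ≤ (degIn G v (B \ Q) : ℝ))
    (hloC : (1 - ε / 16) * (RandomTriangle.dens G A C * w) ≤ (degIn G v (C \ Q) : ℝ))
    (hdegx : ∀ x ∈ B', (degIn Γ x C : ℝ) ≤ 2 * p * w)
    (hAQ : A \ Q ⊆ A') (hBQ : B \ Q ⊆ B') (hCQ : C \ Q ⊆ C') (hBX : B' ⊆ B \ X) (hCX : C' ⊆ C \ X)
    (hbad : ((bedge G (ε / 16) A B C X Q v).card : ℝ) ≤ ε * δ0 ^ 3 / 8 * (p ^ 3 * w ^ 2)) :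
    GoodVertex G ε p A' B' C' v := by
  have hwR : (0 : ℝ) < w := by exact_mod_cast hw
  have hmwR : (m : ℝ) ≤ w := by exact_mod_cast hmw
  have hm15 : 15 / 16 * (w : ℝ) ≤ m := le_trans (mul_le_mul_of_nonneg_right (by linarith) hwR.le) hm
  have hm0 : (0 : ℝ) < m := by linarith
  set dAB := RandomTriangle.dens G A B with h_dAB
  set dAC := RandomTriangle.dens G A C with h_dAC
  set dBC := RandomTriangle.dens G B C with h_dBC
  set eAB := RandomTriangle.dens G A' B' with h_eAB
  set eAC := RandomTriangle.dens G A' C' with h_eAC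
  set eBC := RandomTriangle.dens G B' C' with h_eBC
  have hδp : 0 < δ0 * p := by positivity
  have pAB : 0 < dAB := by linarith
  have pAC : 0 < dAC := by linarith
  have pBC : 0 < dBC := by linarith
  -- degrees
  have hnB1 : (1 - ε / 16) * (dAB * w) ≤ ((nbhdIn G v B').card : ℝ) := by
    refine hloB.trans ?_
    rw [nbhd_card]; exact_mod_cast deg_mono le_rfl v hBQ
  have hnC1 : (1 - ε / 16) * (dAC * w) ≤ ((nbhdIn G v C').card : ℝ) := by
    refine hloC.trans ?_
    rw [nbhd_card]; exact_mod_cast deg_mono le_rfl v hCQ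
  have hnB2 : ((nbhdIn G v B').card : ℝ) ≤ (1 + ε / 16) * (dAB * w) := by
    refine le_trans ?_ hupB
    rw [nbhd_card]; exact_mod_cast deg_mono le_rfl v hBB
  have hnC2 : ((nbhdIn G v C').card : ℝ) ≤ (1 + ε / 16) * (dAC * w) := by
    refine le_trans ?_ hupC
    rw [nbhd_card]; exact_mod_cast deg_mono le_rfl v hCC
  have hδpw : 0 < δ0 * (p * w) := by positivity
  set N2 := nbhdIn G v B' with hN2
  set N3 := nbhdIn G v C' \ hvy Γ p B C v with hN3
  have hκ2 : κh * (p * w) ≤ ε * δ0 / 8 * (p * w) := mul_le_mul_of_nonneg_right hκh (by positivity)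
  have hN3c : ((nbhdIn G v C').card : ℝ) - κh * (p * w) ≤ N3.card := by
    have h1 := le_card_sdiff (hvy Γ p B C v) (nbhdIn G v C')
    have h2 : ((nbhdIn G v C').card : ℝ) ≤ N3.card + (hvy Γ p B C v).card := by
      have : (nbhdIn G v C').card ≤ N3.card + (hvy Γ p B C v).card := by rw [hN3]; omega
      exact_mod_cast this
    have h3 := htyp.2.2.2
    rw [hB] at h3
    linarith
  have hN2l : δ0 * (p * w) / 2 ≤ N2.card := by linarith [gv_base he1 hδp hwR hdAB]
  have hεδ : ε * (δ0 * (p * w)) ≤ 1 * (δ0 * (p * w)) := mul_le_mul_of_nonneg_right he1 hδpw.le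
  have hN3l : δ0 * (p * w) / 2 ≤ N3.card := by linarith [gv_base he1 hδp hwR hdAC]
  -- density in neighbourhoods
  have key : ∀ S ⊆ N2, ∀ T ⊆ N3, ε * (δ0 * (p * w) / 2) ≤ S.card → ε * (δ0 * (p * w) / 2) ≤ T.card →
      |RandomTriangle.dens G S T - dBC| ≤ ε / 100 * (δ0 * p) := by
    intro S hS T hT h1 h2
    refine dens_close (htyp.use hp.le hG (S := S) (T := T) ?_ ?_ ?_) (a := ε * (δ0 * (p * w) / 2)) (b := ε * (δ0 * (p * w) / 2))
      (by positivity) (by positivity) (by positivity) h1 h2 ?_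
    · intro x hx
      have := mem_filter.1 (hS hx)
      exact mem_filter.2 ⟨hBB this.1, hG this.2⟩
    · intro x hx
      have h3 := mem_sdiff.1 (hT hx)
      have h4 := mem_filter.1 h3.1
      exact mem_sdiff.2 ⟨mem_filter.2 ⟨hCC h4.1, hG h4.2⟩, h3.2⟩
    · intro x hx
      rw [hB]
      exact hdegx x (mem_filter.1 (hS hx)).1
    · rw [hB]
      have := mul_le_mul_of_nonneg_right hε1 (show 0 ≤ p ^ 3 * (w : ℝ) ^ 2 by positivity)
      linarith
  have h1m : ∀ x : ℝ, δ0 * (p * w) / 2 ≤ x → ε * (δ0 * (p * w) / 2) ≤ ε * x := fun x hx => mul_le_mul_of_nonneg_left hx he.le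
  have k0 := key N2 (Subset.refl _) N3 (Subset.refl _) (by linarith) (by linarith)
  have hεp : ε / 100 * (δ0 * p) ≤ ε / 100 * p := by
    refine mul_le_mul_of_nonneg_left ?_ (by positivity)
    have := mul_le_mul_of_nonneg_right hδ1 hp.le
    linarith
  have hεd : ε / 100 * (δ0 * p) ≤ ε / 100 * dBC := mul_le_mul_of_nonneg_left hdBC (by positivity)
  have k0' := abs_le.1 k0
  refine ⟨⟨⟨?_, ?_⟩, ⟨?_, ?_⟩, N2, Subset.refl _, N3, sdiff_subset, ?_, ?_, ?_, ?_, ?_⟩, ?_⟩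
  · rw [hB']; exact (gv_lo he he1 hwR hm0 hmwR pAB hAB2).trans hnB1
  · rw [hB']; exact hnB2.trans (gv_hi he he1 hwR hm pAB hAB1)
  · rw [hC']; exact (gv_lo he he1 hwR hm0 hmwR pAC hAC2).trans hnC1
  · rw [hC']; exact hnC2.trans (gv_hi he he1 hwR hm pAC hAC1)
  · have : 0 ≤ ε * (N2.card : ℝ) := by positivity
    linarith
  · have h3 := mul_le_mul_of_nonneg_left (gv_base he1 hδp hwR hdAC) he.le
    have h4 := mul_le_mul_of_nonneg_left hnC1 he.le
    have h5 : 0 ≤ ε * (δ0 * (p * w)) := by positivity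
    linarith
  · intro S hS T hT h1 h2
    have k1 := key S hS T hT ((h1m _ hN2l).trans h1) ((h1m _ hN3l).trans h2)
    have k1' := abs_le.1 k1
    rw [abs_le]
    have : 0 ≤ ε * p := by positivity
    constructor <;> linarith [k1'.1, k1'.2, k0'.1, k0'.2]
  · have h1 : (1 - ε) * eBC ≤ (1 - ε) * ((1 + ε / 16) * dBC) := mul_le_mul_of_nonneg_left hBC2 (by linarith)
    have h2 : (1 - ε) * (1 + ε / 16) * dBC ≤ (1 - ε / 100) * dBC := mul_le_mul_of_nonneg_right (by nlinarith) pBC.le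
    linarith
  · have h1 : (1 + ε) * ((1 - ε / 16) * dBC) ≤ (1 + ε) * eBC := mul_le_mul_of_nonneg_left hBC1 (by linarith)
    have h2 : (1 + ε / 100) * dBC ≤ (1 + ε) * (1 - ε / 16) * dBC := mul_le_mul_of_nonneg_right (by nlinarith) pBC.le
    linarith
  · have h1 : ((((nbhdIn G v B') ×ˢ (nbhdIn G v C')).filter fun uw => G.Adj uw.1 uw.2 ∧ ¬ GoodEdge G ε A' B' C' uw.1 uw.2).card : ℝ)
        ≤ (bedge G (ε / 16) A B C X Q v).card := by
      norm_cast
      refine card_le_card fun z hz => ?_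
      rw [mem_filter, mem_product] at hz
      obtain ⟨⟨hz1, hz2⟩, hz3, hz4⟩ := hz
      unfold bedge
      rw [mem_filter, mem_product]
      refine ⟨⟨mem_filter.2 ⟨hBX (mem_filter.1 hz1).1, (mem_filter.1 hz1).2⟩, mem_filter.2 ⟨hCX (mem_filter.1 hz2).1, (mem_filter.1 hz2).2⟩⟩, hz3, ?_⟩
      unfold GoodEdge at hz4
      push Not at hz4
      rw [hA', ← h_eAB, ← h_eAC] at hz4
      rw [hA, ← h_dAB, ← h_dAC]
      have e1 : (codegIn G z.1 z.2 (A \ Q) : ℝ) ≤ codegIn G z.1 z.2 A' := by exact_mod_cast codeg_mono le_rfl _ _ hAQ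
      refine lt_of_le_of_lt e1 (lt_of_lt_of_le hz4 ?_)
      exact gv_edge he he1 hwR hm0 hmwR pAB pAC (dens_nonneg _ _ _) hAB2 hAC2
    refine h1.trans (hbad.trans ?_)
    rw [hB', hC']
    refine le_trans (le_of_eq ?_) (gv_prod he he1 hδp hwR hm15 hdAB hdAC hdBC hAB1 hAC1 hBC1)
    ring

end Part19

section Part20
/-- Constants of the deterministic argument together with their relations. -/
structure Cst where
  (ε δ0 ρ ζ ζ3 c1 ε1 η μ κh ηh κ η0 γ θ ρ1 ρ2 : ℝ)
  hε : 0 < ε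
  hε1 : ε ≤ 1
  hδ : 0 < δ0
  hδ1 : δ0 ≤ 1
  hρ0 : 0 < ρ
  hρ : ρ ≤ ε / 16 / 2
  hζ : 0 < ζ
  hc1 : 0 ≤ c1
  hc11 : c1 ≤ 1
  hκhc : κh ≤ c1 * μ
  he1 : ε1 ≤ c1 * (ε / 16 * δ0 ^ 2)
  hηζ : 2 * η ≤ ζ * (ε / 16 * δ0)
  hη0 : 0 < η
  hζ3 : 6 * c1 + 10 * ζ ≤ ζ3 * (ε * δ0 ^ 3 / 8)
  he2 : 400 * ε1 ≤ ε ^ 3 * δ0 ^ 3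
  hκh : κh ≤ ε * δ0 / 8
  hη1 : 64 * η ≤ ε * δ0
  hη2 : 8 * η ≤ ε ^ 3
  hμ : 0 < μ
  hμ1 : μ ≤ 1
  hN : η0 ≤ 1
  hηh : 0 < ηh
  hκ1 : κ ≤ ηh / 2 * μ ^ 2
  hκ2 : κ ≤ 1 / 2 * μ ^ 2
  hκ3 : κ ≤ ζ * μ ^ 2
  hγ : 0 < γ
  hγ1 : γ ≤ 1 / 10
  hNγ : η0 ≤ γ ^ 2 / 27
  hN0 : 0 ≤ η0
  hθ : 0 ≤ θ
  hρ2 : 0 < ρ2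
  hρ2γ : ρ2 ≤ γ ^ 2 / 32
  hρ2ρ : ρ2 ≤ ρ / 2
  hρ1 : 0 < ρ1
  hρ1γ : 64 * ρ1 ≤ γ * ρ2
  hσ : 300 * (θ + 54 * ζ + 9 * ζ3) ≤ ρ1 * γ ^ 2
  ht1 : 32 * η ≤ δ0 * (ρ2 / 4) ^ 2
  ht2 : 8 * κh ≤ δ0 * (ρ2 / 4)
  ht3 : 64 * ε1 ≤ δ0 ^ 3 * (ρ2 / 4) ^ 2

/-- The pseudorandom host graph together with a regular cluster structure. -/
structure Sys (K : Cst) {n : ℕ} (p : ℝ) (Γ G : SimpleGraph (Fin n)) (k w : ℕ)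
    (W : Fin k × Fin 3 → Finset (Fin n)) (R : SimpleGraph (Fin k × Fin 3)) : Prop where
  hp : 0 < p
  hw : 0 < w
  hμw : K.μ * n ≤ (w : ℝ)
  hN1 : N1 K.η0 n p Γ
  hJ : JB Γ p K.κ
  hPa : P3 K.ε1 K.ζ 4 K.μ K.η n p Γ
  hPb : P3 K.κh K.ζ (4 / K.μ) K.μ K.ηh n p Γ
  hG : G ≤ Γ
  hW : ∀ a, (W a).card = w
  hdis : ∀ a b, a ≠ b → Disjoint (W a) (W b)
  hcut : ∀ a b, R.Adj a b → CutReg G K.η p (W a) (W b)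
  hden : ∀ a b, R.Adj a b → K.δ0 * p ≤ RandomTriangle.dens G (W a) (W b)
  htri : ∀ t r s, r ≠ s → R.Adj (t, r) (t, s)
  hp1 : p ≤ 1
  hdeg : ∀ v, (2 / 3 + K.γ) * n * p ≤ (degIn G v univ : ℝ)
  hP4 : P4 (1 / 36) (18 / K.γ ^ 2 + 1) n p Γ
  hcov : (1 - K.θ) * n ≤ 3 * k * (w : ℝ)
  hnon : ∀ a, ((univ.filter fun b => ¬ R.Adj a b).card : ℝ) ≤ (1 / 3 - K.γ / 4) * (3 * k)
  hbig : 4 ≤ K.ρ1 * w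

variable {K : Cst} {n : ℕ} {p : ℝ} {Γ G : SimpleGraph (Fin n)} {k w : ℕ}
    {W : Fin k × Fin 3 → Finset (Fin n)} {R : SimpleGraph (Fin k × Fin 3)}

lemma dens_mono_graph {n : ℕ} {Γ G : SimpleGraph (Fin n)} (hG : G ≤ Γ) (A B : Finset (Fin n)) :
    RandomTriangle.dens G A B ≤ RandomTriangle.dens Γ A B := by
  unfold RandomTriangle.dens
  apply div_le_div_of_nonneg_right _ (by positivity)
  unfold eBtw
  exact_mod_cast card_le_card (fun x hx => by
    rw [mem_filter] at hx ⊢; exact ⟨hx.1, hG hx.2⟩)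

lemma Sys.dens_le (S : Sys K p Γ G k w W R) (a b : Fin k × Fin 3) :
    RandomTriangle.dens G (W a) (W b) ≤ 3 / 2 * p := by
  have := JB.dens S.hJ (S.hW a) (S.hW b) S.hw S.hp K.hμ S.hμw (by norm_num : (0:ℝ) ≤ 1/2) K.hκ2
  have h2 := dens_mono_graph S.hG (W a) (W b)
  have := (abs_le.1 this).2
  linarith

/-- Good initial behaviour of `v` (in the cluster `A`) towards `(B, C)`. -/
def OKv {n : ℕ} (K : Cst) (p : ℝ) (Γ G : SimpleGraph (Fin n)) (w : ℕ) (A B C : Finset (Fin n)) (v : Fin n) : Prop :=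
  (degIn Γ v B : ℝ) ≤ 2 * p * w ∧ (degIn Γ v C : ℝ) ≤ 2 * p * w ∧
  (degIn G v B : ℝ) ≤ (1 + K.ε / 16) * (RandomTriangle.dens G A B * w) ∧
  Typ Γ G K.ε1 K.κh p B C v

lemma card5 {α : Type*} (A F1 F2 F3 F4 F5 : Finset α) {x : ℝ} (h : A ⊆ F1 ∪ F2 ∪ F3 ∪ F4 ∪ F5)
    (h1 : (F1.card : ℝ) ≤ x) (h2 : (F2.card : ℝ) ≤ x) (h3 : (F3.card : ℝ) ≤ x) (h4 : (F4.card : ℝ) ≤ x)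
    (h5 : (F5.card : ℝ) ≤ x) : (A.card : ℝ) ≤ 5 * x := by
  have a1 := card_le_card h
  have a2 := card_union_le (F1 ∪ F2 ∪ F3 ∪ F4) F5
  have a3 := card_union_le (F1 ∪ F2 ∪ F3) F4
  have a4 := card_union_le (F1 ∪ F2) F3
  have a5 := card_union_le F1 F2
  have : (A.card : ℝ) ≤ F1.card + F2.card + F3.card + F4.card + F5.card := by exact_mod_cast (by omega)
  linarith

lemma Sys.ok_count (S : Sys K p Γ G k w W R) {a b c : Fin k × Fin 3} (hab : R.Adj a b) (hac : R.Adj a c)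
    (hbc : R.Adj b c) :
    (((W a).filter fun v => ¬ OKv K p Γ G w (W a) (W b) (W c) v).card : ℝ) ≤ 5 * (K.ζ * w) := by
  have hd1 := S.hdis _ _ hab.ne
  have hd2 := S.hdis _ _ hac.ne
  have hd3 := S.hdis _ _ hbc.ne
  have u1 := gam_count (A := W a) S.hJ (S.hW b) S.hw S.hp K.hμ S.hμw K.hζ.le K.hκ3
  have u2 := gam_count (A := W a) S.hJ (S.hW c) S.hw S.hp K.hμ S.hμw K.hζ.le K.hκ3
  have u3 := up_count (S.hcut a b hab) (S.hW a) (S.hW b) S.hw S.hp (S.hden a b hab)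
    (ε' := K.ε / 16) (by have := K.hε; linarith) K.hδ (ζ := K.ζ) (by have := K.hηζ; have := K.hη0; linarith)
  have u4 := heavy_count S.hJ S.hN1 K.hN S.hPb (S.hW b) (S.hW c) S.hw S.hp K.hμ K.hμ1 S.hμw hd3 K.hηh K.hκ1 K.hκ2
  have u5 := S.hPa (W b) (W c) hd3 (by rw [S.hW, S.hW]) (by rw [S.hW]; exact S.hμw) G S.hG
    ((S.dens_le b c).trans (by have := S.hp; linarith)) (S.hcut b c hbc)
  rw [S.hW b] at u5
  refine card5 _ _ _ _ _ _ ?_ u1 u2 u3 u4 u5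
  intro v hv
  obtain ⟨hva, hv⟩ := mem_filter.1 hv
  have hvn : v ∈ univ \ (W b ∪ W c) := by
    simp only [mem_sdiff, mem_univ, mem_union, true_and, not_or]
    exact ⟨fun h => (disjoint_left.1 hd1 hva h).elim, fun h => (disjoint_left.1 hd2 hva h).elim⟩
  by_contra hcon
  simp only [mem_union, mem_filter, hva, hvn, true_and, not_or, not_lt] at hcon
  obtain ⟨⟨⟨⟨c1, c2⟩, c3⟩, c4⟩, c5⟩ := hcon
  apply hv
  refine ⟨c1, c2, c3, ?_⟩
  unfold Typ
  rw [S.hW b]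
  refine ⟨c1, c2, c5, ?_⟩
  by_contra hh
  exact c4 ⟨c1, c2, not_le.1 hh⟩

/-- `v ∈ W (t,r)` behaves well initially. -/
def Ini {n : ℕ} (K : Cst) (p : ℝ) (Γ G : SimpleGraph (Fin n)) {k : ℕ} (w : ℕ)
    (W : Fin k × Fin 3 → Finset (Fin n)) (a : Fin k × Fin 3) (v : Fin n) : Prop :=
  ∀ s s', s ≠ a.2 → s' ≠ a.2 → s ≠ s' → OKv K p Γ G w (W a) (W (a.1, s)) (W (a.1, s')) v

/-- `v` is currently bad. -/
def Cb {n : ℕ} (K : Cst) (p : ℝ) (G : SimpleGraph (Fin n)) (w : ℕ) (A B C X Q : Finset (Fin n)) (v : Fin n) : Prop :=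
  (degIn G v (B \ Q) : ℝ) < (1 - K.ε / 16) * (RandomTriangle.dens G A B * w) ∨
  K.ε * K.δ0 ^ 3 / 8 * (p ^ 3 * w ^ 2) < ((bedge G (K.ε / 16) A B C X Q v).card : ℝ)

def CB {n : ℕ} (K : Cst) (p : ℝ) (G : SimpleGraph (Fin n)) {k : ℕ} (w : ℕ)
    (W : Fin k × Fin 3 → Finset (Fin n)) (X Q : Finset (Fin n)) (a : Fin k × Fin 3) (v : Fin n) : Prop :=
  ∃ s s', s ≠ a.2 ∧ s' ≠ a.2 ∧ s ≠ s' ∧ Cb K p G w (W a) (W (a.1, s)) (W (a.1, s')) X Q v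

lemma Cb.mono {A B C X Q Q' : Finset (Fin n)} {v : Fin n} (h : Cb K p G w A B C X Q v) (hQ : Q ⊆ Q') :
    Cb K p G w A B C X Q' v := by
  rcases h with h | h
  · left
    refine lt_of_le_of_lt ?_ h
    exact_mod_cast card_le_card (filter_subset_filter _ (sdiff_subset_sdiff (Subset.refl _) hQ))
  · right
    refine lt_of_lt_of_le h ?_
    unfold bedge
    have : ∀ z : Fin n × Fin n, BadE G (K.ε / 16) A B C Q z.1 z.2 → BadE G (K.ε / 16) A B C Q' z.1 z.2 := by
      intro z hz
      refine ⟨hz.1, lt_of_le_of_lt ?_ hz.2⟩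
      exact_mod_cast card_le_card (filter_subset_filter _ (sdiff_subset_sdiff (Subset.refl _) hQ))
    exact_mod_cast card_le_card (fun z hz => by
      rw [mem_filter] at hz ⊢; exact ⟨hz.1, this z hz.2⟩)

lemma CB.mono {X Q Q' : Finset (Fin n)} {a : Fin k × Fin 3} {v : Fin n} (h : CB K p G w W X Q a v) (hQ : Q ⊆ Q') :
    CB K p G w W X Q' a v := by
  obtain ⟨s, s', h1, h2, h3, h4⟩ := h
  exact ⟨s, s', h1, h2, h3, h4.mono hQ⟩

lemma count9 {n : ℕ} {A : Finset (Fin n)} (P : Fin 3 × Fin 3 → Fin n → Prop) (c : Fin 3 × Fin 3 → Prop) {x : ℝ} (hx : 0 ≤ x)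
    (h : ∀ z, c z → ((A.filter fun v => P z v).card : ℝ) ≤ x) :
    ((A.filter fun v => ∃ z, c z ∧ P z v).card : ℝ) ≤ 9 * x := by
  have h1 : (A.filter fun v => ∃ z, c z ∧ P z v) ⊆ (univ.filter c).biUnion fun z => A.filter (P z) := by
    intro v hv
    obtain ⟨hv, z, hz, hP⟩ := mem_filter.1 hv
    rw [mem_biUnion]
    exact ⟨z, mem_filter.2 ⟨mem_univ _, hz⟩, mem_filter.2 ⟨hv, hP⟩⟩
  have h2 := card_le_card h1
  have h3 : (((univ.filter c).biUnion fun z => A.filter (P z)).card : ℝ) ≤ ∑ z ∈ univ.filter c, ((A.filter (P z)).card : ℝ) := by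
    exact_mod_cast card_biUnion_le
  have h4 : ∑ z ∈ univ.filter c, ((A.filter (P z)).card : ℝ) ≤ ((univ.filter c).card : ℝ) * x := by
    rw [← nsmul_eq_mul]
    exact sum_le_card_nsmul _ _ _ fun z hz => h z (mem_filter.1 hz).2
  have h5 : ((univ.filter c).card : ℝ) ≤ 9 := by
    have := card_le_univ (univ.filter c)
    simp at this
    exact_mod_cast this
  calc _ ≤ _ := by exact_mod_cast h2
    _ ≤ _ := h3
    _ ≤ _ := h4
    _ ≤ _ := mul_le_mul_of_nonneg_right h5 hx

lemma Sys.ini_count (S : Sys K p Γ G k w W R) (a : Fin k × Fin 3) :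
    (((W a).filter fun v => ¬ Ini K p Γ G w W a v).card : ℝ) ≤ 45 * (K.ζ * w) := by
  obtain ⟨t, r⟩ := a
  have := count9 (A := W (t, r)) (P := fun z v => ¬ OKv K p Γ G w (W (t, r)) (W (t, z.1)) (W (t, z.2)) v)
    (c := fun z => z.1 ≠ r ∧ z.2 ≠ r ∧ z.1 ≠ z.2) (x := 5 * (K.ζ * w))
    (by have := K.hζ; positivity)
    (fun z hz => by convert S.ok_count (S.htri t r _ hz.1.symm) (S.htri t r _ hz.2.1.symm) (S.htri t _ _ hz.2.2))
  refine le_trans ?_ (this.trans (le_of_eq (by ring)))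
  exact_mod_cast card_le_card (fun v hv => by
    rw [mem_filter] at hv ⊢
    refine ⟨hv.1, ?_⟩
    have h2 := hv.2
    unfold Ini at h2
    push Not at h2
    obtain ⟨s, s', h1, h2, h3, h4⟩ := h2
    exact ⟨(s, s'), ⟨h1, h2, h3⟩, h4⟩)

lemma Cst.hζ3' (K : Cst) : 0 ≤ K.ζ3 := by
  have hε := K.hε
  have hδ := K.hδ
  have h1 := K.hζ3
  have h2 := K.hc1
  have h3 := K.hζ
  by_contra hneg
  have : K.ζ3 * (K.ε * K.δ0 ^ 3 / 8) ≤ 0 := mul_nonpos_of_nonpos_of_nonneg (not_le.1 hneg).le (by positivity)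
  linarith

lemma Sys.cb_count (S : Sys K p Γ G k w W R) (X Q : Finset (Fin n)) (hXQ : X ⊆ Q)
    (hX : ∀ a, ∀ v ∈ W a, v ∉ X → Ini K p Γ G w W a v)
    (a : Fin k × Fin 3) (hQ : ∀ s, ((Q ∩ W (a.1, s)).card : ℝ) ≤ K.ρ * w) :
    (((W a).filter fun v => CB K p G w W X Q a v).card : ℝ) ≤ 9 * ((K.ζ + K.ζ3) * w) := by
  obtain ⟨t, r⟩ := a
  have hε := K.hε
  have hδ := K.hδ
  have hζ3 := K.hζ3'
  have := count9 (A := W (t, r)) (P := fun z v => Cb K p G w (W (t, r)) (W (t, z.1)) (W (t, z.2)) X Q v)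
    (c := fun z => z.1 ≠ r ∧ z.2 ≠ r ∧ z.1 ≠ z.2) (x := (K.ζ + K.ζ3) * w)
    (by have := K.hζ; positivity) ?_
  · refine le_trans ?_ this
    exact_mod_cast card_le_card (fun v hv => by
      rw [mem_filter] at hv ⊢
      refine ⟨hv.1, ?_⟩
      obtain ⟨s, s', h1, h2, h3, h4⟩ := hv.2
      exact ⟨(s, s'), ⟨h1, h2, h3⟩, h4⟩)
  · rintro ⟨s, s'⟩ ⟨h1, h2, h3⟩
    dsimp only at h1 h2 h3 hQ ⊢
    have l1 := low_count (S.hcut _ _ (S.htri t r s h1.symm)) (S.hW _) (S.hW _) S.hw S.hp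
      (S.hden _ _ (S.htri t r s h1.symm)) (ε' := K.ε / 16) (by positivity) K.hδ K.hηζ K.hρ (hQ s)
    have l2 := c2_count (X := X) (C := W (t, s')) S.hN1 K.hN S.hp K.hμ S.hμw (S.hW (t, r)) (S.hW (t, s)) S.hw S.hG K.hc1 K.hc11 K.hκhc
      K.he1 (by positivity) K.hδ K.hηζ K.hρ (ε2 := K.ε * K.δ0 ^ 3 / 8) (by positivity) K.hζ3
      (S.hcut _ _ (S.htri t s r h1)) (S.hden _ _ (S.htri t r s h1.symm)) (S.hden _ _ (S.htri t r s' h2.symm))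
      (fun u hu => ((hX (t, s) u (mem_sdiff.1 hu).1 (mem_sdiff.1 hu).2) r s' h1.symm h3.symm h2.symm).2.2.2)
      (fun u hu => ((hX (t, r) u (mem_sdiff.1 hu).1 (mem_sdiff.1 hu).2) s' s h2 h1 h3.symm).1)
      hXQ (hQ r)
    have hsub : (W (t, r)).filter (fun v => Cb K p G w (W (t, r)) (W (t, s)) (W (t, s')) X Q v) ⊆
      ((W (t, r)).filter fun v => (degIn G v (W (t, s) \ Q) : ℝ) < (1 - K.ε / 16) * (RandomTriangle.dens G (W (t, r)) (W (t, s)) * w)) ∪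
      ((W (t, r)).filter fun v => K.ε * K.δ0 ^ 3 / 8 * (p ^ 3 * w ^ 2) < ((bedge G (K.ε / 16) (W (t, r)) (W (t, s)) (W (t, s')) X Q v).card : ℝ)) := by
      intro v hv
      obtain ⟨hv, hc⟩ := mem_filter.1 hv
      rw [mem_union, mem_filter, mem_filter]
      exact hc.imp (fun h => ⟨hv, h⟩) (fun h => ⟨hv, h⟩)
    have e1 := (card_le_card hsub).trans (card_union_le _ _)
    have e2 := (Nat.cast_le (α := ℝ)).2 e1
    push_cast at e2
    linarith

lemma Sys.strong (S : Sys K p Γ G k w W R) (X Q : Finset (Fin n))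
    (hX : ∀ a, ∀ v ∈ W a, v ∉ X → Ini K p Γ G w W a v) (t : Fin k) (W' : Fin 3 → Finset (Fin n)) (m : ℕ)
    (hm : ∀ r, (W' r).card = m) (hmw : (1 - K.ε / 16) * w ≤ (m : ℝ)) (hsub : ∀ r, W' r ⊆ W (t, r) \ X)
    (hQ : ∀ r, W (t, r) \ Q ⊆ W' r) (hc : ∀ r, ∀ v ∈ W' r, ¬ CB K p G w W X Q (t, r) v) :
    StrongSuperRegularTriple G (K.δ0 / 2) K.ε p (W' 0) (W' 1) (W' 2) := by
  have hε := K.hε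
  have hδ := K.hδ
  have hε1 := K.hε1
  have hsubW : ∀ r, W' r ⊆ W (t, r) := fun r => (hsub r).trans sdiff_subset
  have hps : ∀ r s, r ≠ s → _ := fun r s hrs =>
    pair_sub (S.hcut _ _ (S.htri t r s hrs)) (S.hW _) (hm r) (hm s) (hsubW r) (hsubW s) S.hw S.hp hmw K.hε K.hε1 K.hδ
      (S.hden _ _ (S.htri t r s hrs)) K.hη1 K.hη2
  have hmw' : m ≤ w := by rw [← hm 0, ← S.hW (t, 0)]; exact card_le_card (hsubW 0)
  have hgood : ∀ r s s', r ≠ s → r ≠ s' → s ≠ s' → ∀ v ∈ W' r, GoodVertex G K.ε p (W' r) (W' s) (W' s') v := by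
    intro r s s' h1 h2 h3 v hv
    have hvX := mem_sdiff.1 (hsub r hv)
    have hI := hX (t, r) v hvX.1 hvX.2
    have o1 := hI s s' h1.symm h2.symm h3
    have o2 := hI s' s h2.symm h1.symm h3.symm
    have hncb := hc r v hv
    have n1 : ¬ Cb K p G w (W (t, r)) (W (t, s)) (W (t, s')) X Q v := fun h => hncb ⟨s, s', h1.symm, h2.symm, h3, h⟩
    have n2 : ¬ Cb K p G w (W (t, r)) (W (t, s')) (W (t, s)) X Q v := fun h => hncb ⟨s', s, h2.symm, h1.symm, h3.symm, h⟩
    unfold Cb at n1 n2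
    push Not at n1 n2
    refine good_vertex (X := X) (Q := Q) (S.hW (t, r)) (S.hW (t, s)) (hm r) (hm s) (hm s') (hsubW s) (hsubW s') S.hw S.hp S.hG hmw hmw' K.hε K.hε1 K.hδ K.hδ1
      (S.hden _ _ (S.htri t r s h1)) (S.hden _ _ (S.htri t r s' h2)) (S.hden _ _ (S.htri t s s' h3))
      (hps r s h1).1 (hps r s h1).2.1 (hps r s' h2).1 (hps r s' h2).2.1 (hps s s' h3).1 (hps s s' h3).2.1
      K.he2 K.hκh o1.2.2.2 o1.2.2.1 o2.2.2.1 n1.1 n2.1 ?_ (hQ r) (hQ s) (hQ s') (hsub s) (hsub s') n1.2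
    intro x hx
    have hxX := mem_sdiff.1 (hsub s hx)
    exact ((hX (t, s) x hxX.1 hxX.2) s' r h3.symm h1 h2.symm).1
  have hd : ∀ r s, r ≠ s → K.δ0 / 2 * p ≤ RandomTriangle.dens G (W' r) (W' s) := by
    intro r s hrs
    refine le_trans ?_ (hps r s hrs).1
    have h1 := S.hden _ _ (S.htri t r s hrs)
    have h2 : (1 - K.ε / 16) * (K.δ0 * p) ≤ (1 - K.ε / 16) * RandomTriangle.dens G (W (t, r)) (W (t, s)) :=
      mul_le_mul_of_nonneg_left h1 (by linarith)
    have h3 : (1 / 2) * (K.δ0 * p) ≤ (1 - K.ε / 16) * (K.δ0 * p) :=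
      mul_le_mul_of_nonneg_right (by linarith) (by have := S.hp; positivity)
    linarith
  have g0 := hgood 0 1 2 (by decide) (by decide) (by decide)
  have g1 := hgood 1 0 2 (by decide) (by decide) (by decide)
  have g2 := hgood 2 0 1 (by decide) (by decide) (by decide)
  exact ⟨⟨⟨(hps 0 1 (by decide)).2.2, (hps 0 2 (by decide)).2.2, (hps 1 2 (by decide)).2.2⟩,
    hd 0 1 (by decide), hd 0 2 (by decide), hd 1 2 (by decide), fun v hv => (g0 v hv).1, fun v hv => (g1 v hv).1, fun v hv => (g2 v hv).1⟩,
    g0, g1, g2⟩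

end Part20

section Part21
variable {K : Cst} {n : ℕ} {p : ℝ} {Γ G : SimpleGraph (Fin n)} {k w : ℕ}
    {W : Fin k × Fin 3 → Finset (Fin n)} {R : SimpleGraph (Fin k × Fin 3)}

lemma half_count {n w : ℕ} {G : SimpleGraph (Fin n)} {η p δ0 r : ℝ} {A B B' : Finset (Fin n)}
    (h : CutReg G η p A B) (hA : A.card = w) (hw : 0 < w) (hp : 0 < p)
    (hd : δ0 * p ≤ RandomTriangle.dens G A B) (hδ : 0 < δ0) (hr : 0 < r) (hB' : B' ⊆ B)
    (hη : 32 * η ≤ δ0 * r ^ 2) (hb : r / 2 * w ≤ B'.card) :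
    ((A.filter fun v => (degIn G v B' : ℝ) < δ0 * p / 2 * B'.card).card : ℝ) ≤ r / 8 * w := by
  have hwR : (0 : ℝ) < w := by exact_mod_cast hw
  set Z := A.filter fun v => (degIn G v B' : ℝ) < δ0 * p / 2 * B'.card with hZ
  set d := RandomTriangle.dens G A B with hdd
  have h1 := (abs_le.1 (h Z (filter_subset _ _) B' hB')).1
  rw [← hdd, hA] at h1
  have h2 : (eBtw G Z B' : ℝ) ≤ Z.card * (δ0 * p / 2 * B'.card) := by
    rw [e_deg, ← nsmul_eq_mul]
    exact sum_le_card_nsmul _ _ _ fun v hv => (mem_filter.1 hv).2.le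
  have h3 : (Z.card : ℝ) * B'.card * (δ0 * p) ≤ (Z.card : ℝ) * B'.card * d :=
    mul_le_mul_of_nonneg_left hd (by positivity)
  have h4 : (Z.card : ℝ) * (δ0 * p / 2) * (r / 2 * w) ≤ Z.card * (δ0 * p / 2) * B'.card :=
    mul_le_mul_of_nonneg_left hb (by positivity)
  have h5 : 32 * η * (p * (w * w)) ≤ δ0 * r ^ 2 * (p * (w * w)) := mul_le_mul_of_nonneg_right hη (by positivity)
  have h6 : (Z.card : ℝ) * (δ0 * p * r * w) ≤ r / 8 * w * (δ0 * p * r * w) := by linarith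
  exact le_of_mul_le_mul_right h6 (by positivity)

lemma Cst.rho (K : Cst) : 640 * K.ρ1 ≤ K.ρ2 ∧ 30000 * (K.θ + 54 * K.ζ + 9 * K.ζ3) ≤ K.ρ1 ∧
    0 ≤ K.θ + 54 * K.ζ + 9 * K.ζ3 := by
  have h1 := K.hρ1γ
  have h2 := K.hσ
  have h3 := K.hγ1
  have h4 := K.hγ
  have h5 : K.γ * K.ρ2 ≤ 1 / 10 * K.ρ2 := mul_le_mul_of_nonneg_right h3 K.hρ2.le
  have h6 : K.γ ^ 2 ≤ 1 / 100 := by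
    calc K.γ ^ 2 ≤ (1 / 10) ^ 2 := pow_le_pow_left₀ h4.le h3 2
      _ = _ := by norm_num
  have h7 : K.ρ1 * K.γ ^ 2 ≤ K.ρ1 * (1 / 100) := mul_le_mul_of_nonneg_left h6 K.hρ1.le
  have h8 := K.hζ3'
  have h9 := K.hζ
  have h10 := K.hθ
  refine ⟨by linarith, by linarith, by linarith⟩

lemma tri_final {p w δ0 r ε1 d s t e : ℝ} (hp : 0 < p) (hw : 0 < w) (hδ : 0 < δ0) (hr : 0 < r) (hd : δ0 * p ≤ d)
    (hs : δ0 * r * p * w / 4 ≤ s) (ht : δ0 * r * p * w / 4 ≤ t) (he : 64 * ε1 ≤ δ0 ^ 3 * r ^ 2)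
    (h : |e - d * s * t| ≤ ε1 * p ^ 3 * w ^ 2) : 0 < e := by
  have h1 := (abs_le.1 h).1
  have h2 : (δ0 * r * p * w / 4) * (δ0 * r * p * w / 4) ≤ s * t := by
    apply mul_le_mul hs ht (by positivity) (le_trans (by positivity) hs)
  have h3 : δ0 * p * ((δ0 * r * p * w / 4) * (δ0 * r * p * w / 4)) ≤ d * (s * t) :=
    mul_le_mul hd h2 (by positivity) (le_trans (by positivity) hd)
  have h4 : 64 * ε1 * (p ^ 3 * w ^ 2) ≤ δ0 ^ 3 * r ^ 2 * (p ^ 3 * w ^ 2) := mul_le_mul_of_nonneg_right he (by positivity)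
  have h5 : 0 < δ0 ^ 3 * r ^ 2 * (p ^ 3 * w ^ 2) := by positivity
  linarith

lemma Sys.triangle (S : Sys K p Γ G k w W R) {a b c : Fin k × Fin 3} (hab : R.Adj a b) (hac : R.Adj a c)
    (hbc : R.Adj b c) {A B C : Finset (Fin n)} (hA : A ⊆ W a) (hB : B ⊆ W b) (hC : C ⊆ W c)
    (hA' : K.ρ2 / 4 * w ≤ A.card) (hB' : K.ρ2 / 4 * w ≤ B.card) (hC' : K.ρ2 / 4 * w ≤ C.card) :
    ∃ x ∈ A, ∃ y ∈ B, ∃ z ∈ C, G.Adj x y ∧ G.Adj x z ∧ G.Adj y z := by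
  obtain ⟨hr1, hr2, hr3⟩ := K.rho
  have hζ := K.hζ
  have hζ3 := K.hζ3'
  have hθ := K.hθ
  have hρ2 := K.hρ2
  have hρ1 := K.hρ1
  have hp := S.hp
  have hδ := K.hδ
  have hwR : (0 : ℝ) < w := by exact_mod_cast S.hw
  set r := K.ρ2 / 4 with hr
  have hr0 : 0 < r := by positivity
  have hζr : 20 * K.ζ ≤ r := by linarith
  have hζw : 20 * K.ζ * w ≤ r * w := mul_le_mul_of_nonneg_right hζr hwR.le
  set B1 := B.filter fun x => ¬ (2 * p * w < (degIn Γ x (W c) : ℝ)) with hB1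
  have u1 := gam_count (A := W b) S.hJ (S.hW c) S.hw S.hp K.hμ S.hμw K.hζ.le K.hκ3
  have hB1c : r / 2 * w ≤ B1.card := by
    have e1 := card_filter_add_card_filter_not (s := B) (fun x => 2 * p * w < (degIn Γ x (W c) : ℝ))
    have e2 := card_le_card (filter_subset_filter (fun x => 2 * p * w < (degIn Γ x (W c) : ℝ)) hB)
    have e2' := (Nat.cast_le (α := ℝ)).2 e2
    have e3 : (((B.filter fun x => 2 * p * w < (degIn Γ x (W c) : ℝ)).card : ℝ)) + B1.card = B.card := by exact_mod_cast e1
    have : 0 ≤ r * w := by positivity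
    linarith
  have hCc : r / 2 * w ≤ C.card := by
    have : 0 ≤ r * w := by positivity
    linarith
  have c1 := half_count (S.hcut a b hab) (S.hW a) S.hw hp (S.hden a b hab) hδ hr0 (B' := B1)
    ((filter_subset _ _).trans hB) K.ht1 hB1c
  have c2 := half_count (S.hcut a c hac) (S.hW a) S.hw hp (S.hden a c hac) hδ hr0 hC K.ht1 hCc
  have c3 := S.ok_count hab hac hbc
  obtain ⟨x, hxA, hx1, hx2, hx3⟩ : ∃ x ∈ A, OKv K p Γ G w (W a) (W b) (W c) x ∧
      K.δ0 * p / 2 * B1.card ≤ (degIn G x B1 : ℝ) ∧ K.δ0 * p / 2 * C.card ≤ (degIn G x C : ℝ) := by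
    by_contra hcon
    push Not at hcon
    have hsub : A ⊆ ((W a).filter fun v => ¬ OKv K p Γ G w (W a) (W b) (W c) v) ∪
      ((W a).filter fun v => (degIn G v B1 : ℝ) < K.δ0 * p / 2 * B1.card) ∪
      ((W a).filter fun v => (degIn G v C : ℝ) < K.δ0 * p / 2 * C.card) := by
      intro x hx
      have := hcon x hx
      simp only [mem_union, mem_filter, hA hx, true_and]
      by_cases h1 : OKv K p Γ G w (W a) (W b) (W c) x
      · by_cases h2 : K.δ0 * p / 2 * B1.card ≤ (degIn G x B1 : ℝ)
        · exact Or.inr (this h1 h2)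
        · exact Or.inl (Or.inr (not_le.1 h2))
      · exact Or.inl (Or.inl h1)
    have e1 := (card_le_card hsub).trans ((card_union_le _ _).trans (Nat.add_le_add_right (card_union_le _ _) _))
    have e2 := (Nat.cast_le (α := ℝ)).2 e1
    push_cast at e2
    have : 0 < r * w := by positivity
    linarith
  obtain ⟨o1, o2, o3, o4⟩ := hx1
  set S1 := nbhdIn G x B1 with hS1
  set T1 := nbhdIn G x C \ hvy Γ p (W b) (W c) x with hT1
  have hsubΓ : ∀ Y Z : Finset (Fin n), Y ⊆ Z → nbhdIn G x Y ⊆ nbhdIn Γ x Z := fun Y Z hYZ z hz => by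
    unfold nbhdIn at hz ⊢
    rw [mem_filter] at hz ⊢
    exact ⟨hYZ hz.1, S.hG hz.2⟩
  have hu := o4.use hp.le S.hG (S := S1) (T := T1) (hsubΓ _ _ ((filter_subset _ _).trans hB))
    (sdiff_subset_sdiff (hsubΓ _ _ hC) (Subset.refl _)) (by
      intro y hy
      rw [S.hW]
      have := (mem_filter.1 (filter_subset _ _ hy)).2
      exact not_lt.1 this)
  rw [S.hW b] at hu
  have hs1 : K.δ0 * r * p * w / 4 ≤ (S1.card : ℝ) := by
    have h1 : K.δ0 * p / 2 * (r / 2 * w) ≤ K.δ0 * p / 2 * B1.card := mul_le_mul_of_nonneg_left hB1c (by positivity)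
    have h2 : (S1.card : ℝ) = degIn G x B1 := rfl
    linarith
  have ht1 : K.δ0 * r * p * w / 4 ≤ (T1.card : ℝ) := by
    have h1 : K.δ0 * p / 2 * (r * w) ≤ K.δ0 * p / 2 * C.card := mul_le_mul_of_nonneg_left hC' (by positivity)
    have h2 : ((nbhdIn G x C).card : ℝ) = degIn G x C := rfl
    have h3 : ((nbhdIn G x C).card : ℝ) ≤ T1.card + (hvy Γ p (W b) (W c) x).card := by
      exact_mod_cast (card_le_card_sdiff_add_card (t := hvy Γ p (W b) (W c) x) (s := nbhdIn G x C))
    have h4 := o4.2.2.2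
    rw [S.hW b] at h4
    have h5 : 8 * K.κh * (p * w) ≤ K.δ0 * r * (p * w) := mul_le_mul_of_nonneg_right K.ht2 (by positivity)
    have : 0 < K.δ0 * r * (p * w) := by positivity
    linarith
  have hpos := tri_final hp hwR hδ hr0 (S.hden b c hbc) hs1 ht1 K.ht3 hu
  have hpos' : 0 < eBtw G S1 T1 := by exact_mod_cast hpos
  obtain ⟨z, hz⟩ := card_pos.1 hpos'
  rw [mem_filter, mem_product] at hz
  obtain ⟨⟨hz1, hz2⟩, hz3⟩ := hz
  rw [hS1] at hz1
  rw [hT1, mem_sdiff] at hz2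
  unfold nbhdIn at hz1 hz2
  rw [mem_filter] at hz1 hz2
  exact ⟨x, hxA, z.1, (mem_filter.1 hz1.1).1, z.2, hz2.1.1, hz1.2, hz2.1.2, hz3⟩

end Part21

section Part22
variable {K : Cst} {n : ℕ} {p : ℝ} {Γ G : SimpleGraph (Fin n)} {k w : ℕ}
    {W : Fin k × Fin 3 → Finset (Fin n)} {R : SimpleGraph (Fin k × Fin 3)}

/-- Vertices whose initial behaviour is bad. -/
def Xs {n : ℕ} (K : Cst) (p : ℝ) (Γ G : SimpleGraph (Fin n)) {k : ℕ} (w : ℕ)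
    (W : Fin k × Fin 3 → Finset (Fin n)) : Finset (Fin n) :=
  univ.biUnion fun a => (W a).filter fun v => ¬ Ini K p Γ G w W a v

/-- Vertices outside of all clusters. -/
def Vz {n k : ℕ} (W : Fin k × Fin 3 → Finset (Fin n)) : Finset (Fin n) := univ \ univ.biUnion W

lemma Sys.X_ini (a : Fin k × Fin 3) (v : Fin n) (hv : v ∈ W a)
    (hX : v ∉ Xs K p Γ G w W) : Ini K p Γ G w W a v := by
  by_contra h
  exact hX (mem_biUnion.2 ⟨a, mem_univ _, mem_filter.2 ⟨hv, h⟩⟩)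

lemma Sys.cl_unique (S : Sys K p Γ G k w W R) {a b : Fin k × Fin 3} {v : Fin n} (ha : v ∈ W a) (hb : v ∈ W b) : a = b := by
  by_contra h
  exact disjoint_left.1 (S.hdis a b h) ha hb

lemma Sys.X_card (S : Sys K p Γ G k w W R) (a : Fin k × Fin 3) :
    ((Xs K p Γ G w W ∩ W a).card : ℝ) ≤ 45 * (K.ζ * w) := by
  refine le_trans ?_ (S.ini_count a)
  exact_mod_cast card_le_card (fun v hv => by
    obtain ⟨h1, h2⟩ := mem_inter.1 hv
    obtain ⟨b, -, hb⟩ := mem_biUnion.1 h1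
    obtain ⟨hb1, hb2⟩ := mem_filter.1 hb
    have := S.cl_unique h2 hb1
    subst this
    exact hb)

/-- State of the covering process. -/
structure St {n : ℕ} (K : Cst) (p : ℝ) (Γ G : SimpleGraph (Fin n)) {k : ℕ} (w : ℕ)
    (W : Fin k × Fin 3 → Finset (Fin n)) (Z : Finset (Fin n)) (Y : Finset (Fin n)) (T : Finset (Finset (Fin n))) : Prop where
  seed : Vz W ∪ Xs K p Γ G w W ⊆ Y
  pack : IsTrianglePacking G T
  hit : ∀ t ∈ T, ∃ y ∈ t, y ∈ Y
  res : ∀ v ∈ T.biUnion id, v ∈ Z → v ∈ Y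
  bad : ∀ y ∈ Y, y ∉ Vz W ∪ Xs K p Γ G w W → ∃ a, y ∈ W a ∧ CB K p G w W (Xs K p Γ G w W) (Y ∪ T.biUnion id ∪ Z) a y
  us : ∀ a, (((T.biUnion id \ Y) ∩ W a).card : ℝ) ≤ K.ρ1 * w
  ys : ∀ a, (((Y ∩ W a) \ Xs K p Γ G w W).card : ℝ) ≤ K.ρ1 * w

variable {Z Y : Finset (Fin n)} {T : Finset (Finset (Fin n))}

lemma St.cb (S : Sys K p Γ G k w W R) (hZ : ∀ a, ((Z ∩ W a).card : ℝ) ≤ K.ρ2 * w) (h : St K p Γ G w W Z Y T) (a : Fin k × Fin 3) :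
    (((W a).filter fun v => CB K p G w W (Xs K p Γ G w W) (Y ∪ T.biUnion id ∪ Z) a v).card : ℝ) ≤ 9 * ((K.ζ + K.ζ3) * w) := by
  apply S.cb_count
  · exact (subset_union_right.trans h.seed).trans (subset_union_left.trans subset_union_left)
  · exact fun a v hv hX => Sys.X_ini a v hv hX
  · intro s
    have hsub : (Y ∪ T.biUnion id ∪ Z) ∩ W (a.1, s) ⊆ ((Y ∩ W (a.1, s)) \ Xs K p Γ G w W) ∪ (Xs K p Γ G w W ∩ W (a.1, s)) ∪
        ((T.biUnion id \ Y) ∩ W (a.1, s)) ∪ (Z ∩ W (a.1, s)) := by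
      intro v hv
      simp only [mem_inter, mem_union, mem_sdiff] at hv ⊢
      tauto
    have e1 := (card_le_card hsub).trans ((card_union_le _ _).trans (Nat.add_le_add_right ((card_union_le _ _).trans
      (Nat.add_le_add_right (card_union_le _ _) _)) _))
    have e2 := (Nat.cast_le (α := ℝ)).2 e1
    push_cast at e2
    have e3 := h.us (a.1, s)
    have e4 := h.ys (a.1, s)
    have e5 := S.X_card (a.1, s)
    have e6 := hZ (a.1, s)
    obtain ⟨r1, r2, r3⟩ := K.rho
    have hζ := K.hζ
    have hζ3 := K.hζ3'
    have hθ := K.hθ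
    have hρ2 := K.hρ2ρ
    have hρ2' := K.hρ2
    have : (2 * K.ρ1 + 45 * K.ζ + K.ρ2) * w ≤ K.ρ * w := mul_le_mul_of_nonneg_right (by linarith) (by positivity)
    linarith

lemma St.y_card (S : Sys K p Γ G k w W R) (hZ : ∀ a, ((Z ∩ W a).card : ℝ) ≤ K.ρ2 * w) (h : St K p Γ G w W Z Y T) (a : Fin k × Fin 3) :
    ((Y ∩ W a).card : ℝ) ≤ (54 * K.ζ + 9 * K.ζ3) * w := by
  have h1 := h.cb S hZ a
  have h2 := S.X_card a
  have hsub : Y ∩ W a ⊆ (Xs K p Γ G w W ∩ W a) ∪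
      ((W a).filter fun v => CB K p G w W (Xs K p Γ G w W) (Y ∪ T.biUnion id ∪ Z) a v) := by
    intro v hv
    obtain ⟨hv1, hv2⟩ := mem_inter.1 hv
    rw [mem_union]
    by_cases hX : v ∈ Xs K p Γ G w W
    · exact Or.inl (mem_inter.2 ⟨hX, hv2⟩)
    · right
      obtain ⟨b, hb, hc⟩ := h.bad v hv1 (by
        rw [mem_union, not_or]
        refine ⟨?_, hX⟩
        unfold Vz
        rw [mem_sdiff, not_and_not_right]
        exact fun _ => mem_biUnion.2 ⟨a, mem_univ _, hv2⟩)
      have := S.cl_unique hv2 hb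
      subst this
      exact mem_filter.2 ⟨hv2, hc⟩
  have e1 := (card_le_card hsub).trans (card_union_le _ _)
  have e2 := (Nat.cast_le (α := ℝ)).2 e1
  push_cast at e2
  linarith

lemma Sys.tot (S : Sys K p Γ G k w W R) : ((univ.biUnion W).card : ℝ) = 3 * k * w ∧ 3 * (k : ℝ) * w ≤ n := by
  have h1 : (univ.biUnion W).card = 3 * k * w := by
    rw [card_biUnion (fun a _ b _ hab => S.hdis a b hab), sum_congr rfl fun a _ => S.hW a]
    simp [mul_comm]
  have h2 := card_le_univ (univ.biUnion W)
  rw [h1] at h2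
  simp only [Fintype.card_fin] at h2
  refine ⟨by rw [h1]; push_cast; ring, by exact_mod_cast h2⟩

lemma Sys.sum_le (S : Sys K p Γ G k w W R) (F : Finset (Fin n)) {c : ℝ} (hc : 0 ≤ c) (h : ∀ a, ((F ∩ W a).card : ℝ) ≤ c * w) :
    (F.card : ℝ) ≤ (Vz W).card + c * n := by
  have hsub : F ⊆ Vz W ∪ univ.biUnion fun a => F ∩ W a := by
    intro v hv
    rw [mem_union]
    by_cases hh : v ∈ Vz W
    · exact Or.inl hh
    · right
      unfold Vz at hh
      rw [mem_sdiff, not_and_not_right] at hh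
      obtain ⟨a, -, ha⟩ := mem_biUnion.1 (hh (mem_univ _))
      exact mem_biUnion.2 ⟨a, mem_univ _, mem_inter.2 ⟨hv, ha⟩⟩
  have e1 := (card_le_card hsub).trans ((card_union_le _ _).trans (Nat.add_le_add_left card_biUnion_le _))
  have e2 := (Nat.cast_le (α := ℝ)).2 e1
  push_cast at e2
  have e3 : ∑ a : Fin k × Fin 3, ((F ∩ W a).card : ℝ) ≤ (univ : Finset (Fin k × Fin 3)).card • (c * w) :=
    sum_le_card_nsmul _ _ _ fun a _ => h a
  simp only [card_univ, Fintype.card_prod, Fintype.card_fin, nsmul_eq_mul] at e3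
  push_cast at e3
  have e4 := mul_le_mul_of_nonneg_left S.tot.2 hc
  linarith

lemma Sys.Vz_card (S : Sys K p Γ G k w W R) : ((Vz W).card : ℝ) ≤ K.θ * n := by
  have h1 := S.tot.1
  have h2 := S.hcov
  unfold Vz
  rw [card_sdiff_real (subset_univ _)]
  simp only [card_univ, Fintype.card_fin]
  linarith

lemma St.Y_tot (S : Sys K p Γ G k w W R) (hZ : ∀ a, ((Z ∩ W a).card : ℝ) ≤ K.ρ2 * w) (h : St K p Γ G w W Z Y T) :
    (Y.card : ℝ) ≤ (K.θ + 54 * K.ζ + 9 * K.ζ3) * n := by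
  have h1 := S.sum_le Y (c := 54 * K.ζ + 9 * K.ζ3) (by have := K.hζ; have := K.hζ3'; linarith) (fun a => h.y_card S hZ a)
  have h2 := S.Vz_card
  linarith

lemma St.T_card (h : St K p Γ G w W Z Y T) : T.card ≤ Y.card ∧ (T.biUnion id \ Y).card ≤ 2 * T.card := by
  constructor
  · have h1 : T.card ≤ ∑ t ∈ T, (t ∩ Y).card := by
      rw [card_eq_sum_ones]
      exact sum_le_sum fun t ht => by
        obtain ⟨y, h1, h2⟩ := h.hit t ht
        exact card_pos.2 ⟨y, mem_inter.2 ⟨h1, h2⟩⟩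
    rw [← card_biUnion] at h1
    · exact h1.trans (card_le_card (biUnion_subset.2 fun t _ => inter_subset_right))
    · exact fun s hs t ht hst => disjoint_of_subset_left inter_subset_left (disjoint_of_subset_right inter_subset_left (h.pack.2 s hs t ht hst))
  · have h1 : T.biUnion id \ Y ⊆ T.biUnion fun t => t \ Y := by
      intro v hv
      obtain ⟨h1, h2⟩ := mem_sdiff.1 hv
      obtain ⟨t, ht, hvt⟩ := mem_biUnion.1 h1
      exact mem_biUnion.2 ⟨t, ht, mem_sdiff.2 ⟨hvt, h2⟩⟩
    refine (card_le_card h1).trans (card_biUnion_le.trans ?_)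
    rw [mul_comm, ← smul_eq_mul]
    refine sum_le_card_nsmul _ _ _ fun t ht => ?_
    obtain ⟨y, hy1, hy2⟩ := h.hit t ht
    have h3 := (h.pack.1 t ht).1
    have : t \ Y ⊆ t.erase y := fun v hv => by
      obtain ⟨a1, a2⟩ := mem_sdiff.1 hv
      exact mem_erase.2 ⟨fun hh => a2 (hh ▸ hy2), a1⟩
    have := card_le_card this
    rw [card_erase_of_mem hy1, h3] at this
    exact this

/-- Adding a currently bad vertex as a new seed. -/
lemma St.add_seed (S : Sys K p Γ G k w W R) (hZ : ∀ a, ((Z ∩ W a).card : ℝ) ≤ K.ρ2 * w) (h : St K p Γ G w W Z Y T)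
    {a : Fin k × Fin 3} {v : Fin n} (hv : v ∈ W a) (hc : CB K p G w W (Xs K p Γ G w W) (Y ∪ T.biUnion id ∪ Z) a v) :
    St K p Γ G w W Z (insert v Y) T := by
  have hmono : Y ∪ T.biUnion id ∪ Z ⊆ insert v Y ∪ T.biUnion id ∪ Z :=
    union_subset_union (union_subset_union (subset_insert _ _) (Subset.refl _)) (Subset.refl _)
  have hbad : ∀ y ∈ insert v Y, y ∉ Vz W ∪ Xs K p Γ G w W →
      ∃ a, y ∈ W a ∧ CB K p G w W (Xs K p Γ G w W) (Y ∪ T.biUnion id ∪ Z) a y := by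
    intro y hy hn
    rcases mem_insert.1 hy with rfl | hy
    · exact ⟨a, hv, hc⟩
    · exact h.bad y hy hn
  refine ⟨h.seed.trans (subset_insert _ _), h.pack, ?_, ?_, ?_, ?_, ?_⟩
  · intro t ht
    obtain ⟨y, h1, h2⟩ := h.hit t ht
    exact ⟨y, h1, mem_insert_of_mem h2⟩
  · exact fun x hx hxZ => mem_insert_of_mem (h.res x hx hxZ)
  · intro y hy hn
    obtain ⟨b, h1, h2⟩ := hbad y hy hn
    exact ⟨b, h1, h2.mono hmono⟩
  · intro b
    refine le_trans ?_ (h.us b)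
    exact_mod_cast card_le_card (inter_subset_inter (sdiff_subset_sdiff (Subset.refl _) (subset_insert _ _)) (Subset.refl _))
  · intro b
    have h1 := h.cb S hZ b
    have h2 : ((insert v Y ∩ W b) \ Xs K p Γ G w W) ⊆
      ((W b).filter fun v => CB K p G w W (Xs K p Γ G w W) (Y ∪ T.biUnion id ∪ Z) b v) := by
      intro y hy
      obtain ⟨hy1, hyX⟩ := mem_sdiff.1 hy
      obtain ⟨hy1, hyb⟩ := mem_inter.1 hy1
      obtain ⟨c, hc1, hc2⟩ := hbad y hy1 (by
        rw [mem_union, not_or]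
        refine ⟨?_, hyX⟩
        unfold Vz
        rw [mem_sdiff, not_and_not_right]
        exact fun _ => mem_biUnion.2 ⟨b, mem_univ _, hyb⟩)
      have := S.cl_unique hyb hc1
      subst this
      exact mem_filter.2 ⟨hyb, hc2⟩
    have h3 := (Nat.cast_le (α := ℝ)).2 (card_le_card h2)
    obtain ⟨r1, r2, r3⟩ := K.rho
    have hζ := K.hζ
    have hζ3 := K.hζ3'
    have hθ := K.hθ
    have : (9 * (K.ζ + K.ζ3)) * w ≤ K.ρ1 * w := mul_le_mul_of_nonneg_right (by linarith) (by positivity)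
    linarith

/-- Covering a pending seed by a triangle. -/
lemma St.add_tri (h : St K p Γ G w W Z Y T) {v x y : Fin n} (hv : v ∈ Y) (hvT : v ∉ T.biUnion id)
    (hx : x ∉ Y ∪ T.biUnion id ∪ Z) (hy : y ∉ Y ∪ T.biUnion id ∪ Z)
    (hfx : ∀ a, x ∈ W a → (((T.biUnion id \ Y) ∩ W a).card : ℝ) + 2 ≤ K.ρ1 * w)
    (hfy : ∀ a, y ∈ W a → (((T.biUnion id \ Y) ∩ W a).card : ℝ) + 2 ≤ K.ρ1 * w)
    (h1 : G.Adj v x) (h2 : G.Adj v y) (h3 : G.Adj x y) :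
    St K p Γ G w W Z Y (insert {v, x, y} T) ∧ (insert {v, x, y} T).card = T.card + 1 := by
  simp only [mem_union, not_or] at hx hy
  have hbi : (insert {v, x, y} T).biUnion id = {v, x, y} ∪ T.biUnion id := by
    rw [biUnion_insert]; rfl
  have hmono : Y ∪ T.biUnion id ∪ Z ⊆ Y ∪ (insert {v, x, y} T).biUnion id ∪ Z := by
    rw [hbi]
    exact union_subset_union (union_subset_union (Subset.refl _) subset_union_right) (Subset.refl _)
  have hdisj : ∀ t ∈ T, Disjoint ({v, x, y} : Finset (Fin n)) t := by
    intro t ht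
    rw [disjoint_left]
    intro z hz hzt
    have hzb : z ∈ T.biUnion id := mem_biUnion.2 ⟨t, ht, hzt⟩
    simp only [mem_insert, mem_singleton] at hz
    rcases hz with rfl | rfl | rfl
    · exact hvT hzb
    · exact hx.1.2 hzb
    · exact hy.1.2 hzb
  refine ⟨⟨h.seed, ⟨?_, ?_⟩, ?_, ?_, ?_, ?_, h.ys⟩, ?_⟩
  · intro t ht
    rcases mem_insert.1 ht with rfl | ht
    · refine ⟨card_eq_three.2 ⟨v, x, y, h1.ne, h2.ne, h3.ne, rfl⟩, ?_⟩
      intro a ha b hb hab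
      simp only [mem_insert, mem_singleton] at ha hb
      rcases ha with rfl | rfl | rfl <;> rcases hb with rfl | rfl | rfl <;>
        first | exact absurd rfl hab | assumption | (apply SimpleGraph.Adj.symm; assumption)
    · exact h.pack.1 t ht
  · intro s hs t ht hst
    rcases mem_insert.1 hs with hs | hs <;> rcases mem_insert.1 ht with ht | ht
    · exact absurd (hs.trans ht.symm) hst
    · rw [hs]; exact hdisj t ht
    · rw [ht]; exact (hdisj s hs).symm
    · exact h.pack.2 s hs t ht hst
  · intro t ht
    rcases mem_insert.1 ht with rfl | ht
    · exact ⟨v, by simp, hv⟩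
    · exact h.hit t ht
  · intro z hz hzZ
    rw [hbi, mem_union] at hz
    rcases hz with hz | hz
    · simp only [mem_insert, mem_singleton] at hz
      rcases hz with rfl | rfl | rfl
      · exact hv
      · exact absurd hzZ hx.2
      · exact absurd hzZ hy.2
    · exact h.res z hz hzZ
  · intro z hz hn
    obtain ⟨b, e1, e2⟩ := h.bad z hz hn
    exact ⟨b, e1, e2.mono hmono⟩
  · intro a
    by_cases hxy : x ∈ W a ∨ y ∈ W a
    · have hsub : ((insert {v, x, y} T).biUnion id \ Y) ∩ W a ⊆ ((T.biUnion id \ Y) ∩ W a) ∪ {x, y} := by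
        rw [hbi]
        intro z hz
        simp only [mem_inter, mem_sdiff, mem_union, mem_insert, mem_singleton] at hz ⊢
        rcases hz with ⟨⟨(rfl | rfl | rfl) | hz, hzY⟩, hza⟩
        · exact absurd hv hzY
        · tauto
        · tauto
        · tauto
      have e1 := (card_le_card hsub).trans ((card_union_le _ _).trans (Nat.add_le_add_left (card_le_two) _))
      have e2 := (Nat.cast_le (α := ℝ)).2 e1
      push_cast at e2
      rcases hxy with hh | hh
      · linarith [hfx a hh]
      · linarith [hfy a hh]
    · refine le_trans ?_ (h.us a)
      rw [not_or] at hxy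
      exact_mod_cast card_le_card (fun z hz => by
        rw [hbi] at hz
        simp only [mem_inter, mem_sdiff, mem_union, mem_insert, mem_singleton] at hz ⊢
        rcases hz with ⟨⟨(rfl | rfl | rfl) | hz, hzY⟩, hza⟩
        · exact absurd hv hzY
        · exact absurd hza hxy.1
        · exact absurd hza hxy.2
        · tauto)
  · rw [card_insert_of_notMem]
    intro hmem
    exact hvT (mem_biUnion.2 ⟨_, hmem, by simp⟩)

end Part22

section Part23
variable {K : Cst} {n : ℕ} {p : ℝ} {Γ G : SimpleGraph (Fin n)} {k w : ℕ}
    {W : Fin k × Fin 3 → Finset (Fin n)} {R : SimpleGraph (Fin k × Fin 3)}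
variable {Z Y : Finset (Fin n)} {T : Finset (Finset (Fin n))}

lemma Vz_not {n k : ℕ} {W : Fin k × Fin 3 → Finset (Fin n)} {a : Fin k × Fin 3} {v : Fin n} (h : v ∈ W a) : v ∉ Vz W := by
  unfold Vz
  rw [mem_sdiff, not_and_not_right]
  exact fun _ => mem_biUnion.2 ⟨a, mem_univ _, h⟩

lemma St.init : St K p Γ G w W Z (Vz W ∪ Xs K p Γ G w W) ∅ := by
  refine ⟨Subset.refl _, ⟨by simp, by simp⟩, by simp, by simp, fun y hy hn => absurd hy hn, ?_, ?_⟩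
  · intro a
    have := K.hρ1
    simp
    positivity
  · intro a
    have h0 : ((Vz W ∪ Xs K p Γ G w W) ∩ W a) \ Xs K p Γ G w W = ∅ := by
      rw [eq_empty_iff_forall_notMem]
      intro v hv
      simp only [mem_sdiff, mem_inter, mem_union] at hv
      have := Vz_not hv.1.2
      tauto
    rw [h0]
    have := K.hρ1
    simp
    positivity

lemma full_count (S : Sys K p Γ G k w W R) (U : Finset (Fin n)) {x : ℝ} (hU : (U.card : ℝ) ≤ x) :
    ((((univ.filter fun a => ¬ (((U ∩ W a).card : ℝ) + 2 ≤ K.ρ1 * w)).biUnion W).card : ℝ)) * K.ρ1 ≤ 2 * x := by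
  set Fu := univ.filter fun a => ¬ (((U ∩ W a).card : ℝ) + 2 ≤ K.ρ1 * w) with hFu
  have h1 : ((Fu.biUnion W).card : ℝ) ≤ Fu.card * w := by
    have : (Fu.biUnion W).card ≤ Fu.card * w := card_biUnion_le_card_mul _ _ _ fun a _ => (S.hW a).le
    exact_mod_cast this
  have h2 : (Fu.card : ℝ) * (K.ρ1 * w / 2) ≤ ∑ a ∈ Fu, ((U ∩ W a).card : ℝ) := by
    rw [← nsmul_eq_mul]
    apply card_nsmul_le_sum
    intro a ha
    have := (mem_filter.1 ha).2
    have hb := S.hbig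
    linarith
  have h3 : ∑ a ∈ Fu, ((U ∩ W a).card : ℝ) ≤ U.card := by
    have : ∑ a ∈ Fu, (U ∩ W a).card ≤ U.card := by
      rw [← card_biUnion]
      · exact card_le_card (biUnion_subset.2 fun a _ => inter_subset_left)
      · exact fun a _ b _ hab => disjoint_of_subset_left inter_subset_right (disjoint_of_subset_right inter_subset_right (S.hdis a b hab))
    exact_mod_cast this
  have h4 := mul_le_mul_of_nonneg_right h1 K.hρ1.le
  linarith

lemma forb_arith {σ θ ρ1 ρ2 γ n f x : ℝ} (hρ1 : 0 < ρ1) (hρ1' : ρ1 ≤ 1) (hn : 0 ≤ n) (hσ : 300 * σ ≤ ρ1 * γ ^ 2) (hθ : θ ≤ σ) (hσ0 : 0 ≤ σ)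
    (hρ2 : ρ2 ≤ γ ^ 2 / 32) (hf : f * ρ1 ≤ 4 * (σ * n)) (hx : x ≤ 3 * (σ * n) + θ * n + ρ2 * n + f) : x ≤ γ ^ 2 / 16 * n := by
  have h1 : f ≤ 4 * γ ^ 2 / 300 * n := by
    have : f * ρ1 ≤ (4 * γ ^ 2 / 300 * n) * ρ1 := by
      have := mul_le_mul_of_nonneg_right hσ hn
      linarith
    exact le_of_mul_le_mul_right this hρ1
  have h2 : ρ1 * γ ^ 2 ≤ 1 * γ ^ 2 := mul_le_mul_of_nonneg_right hρ1' (sq_nonneg _)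
  have h3 : σ * n ≤ γ ^ 2 / 300 * n := mul_le_mul_of_nonneg_right (by linarith) hn
  have h4 : θ * n ≤ γ ^ 2 / 300 * n := mul_le_mul_of_nonneg_right (by linarith) hn
  have h5 : ρ2 * n ≤ γ ^ 2 / 32 * n := mul_le_mul_of_nonneg_right hρ2 hn
  have h6 : 0 ≤ γ ^ 2 * n := by positivity
  linarith

/-- Terminal state of the process. -/
lemma Sys.process (S : Sys K p Γ G k w W R) (hn : 0 < n) (hZ : ∀ a, ((Z ∩ W a).card : ℝ) ≤ K.ρ2 * w) :
    ∃ Y T, St K p Γ G w W Z Y T ∧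
      (∀ a, ∀ v ∈ W a, v ∉ Y ∪ T.biUnion id → ¬ CB K p G w W (Xs K p Γ G w W) (Y ∪ T.biUnion id ∪ Z) a v) ∧
      ((Y \ T.biUnion id).card : ℝ) < (18 / K.γ ^ 2 + 2) / p ^ 2 := by
  obtain ⟨⟨Y, T⟩, hmem, hmax⟩ := exists_max_image
    (univ.filter fun z : Finset (Fin n) × Finset (Finset (Fin n)) => St K p Γ G w W Z z.1 z.2)
    (fun z => z.1.card + z.2.card) ⟨(Vz W ∪ Xs K p Γ G w W, ∅), mem_filter.2 ⟨mem_univ _, St.init⟩⟩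
  have h : St K p Γ G w W Z Y T := (mem_filter.1 hmem).2
  have hmax' : ∀ Y' T', St K p Γ G w W Z Y' T' → Y'.card + T'.card ≤ Y.card + T.card :=
    fun Y' T' h' => hmax (Y', T') (mem_filter.2 ⟨mem_univ _, h'⟩)
  refine ⟨Y, T, h, ?_, ?_⟩
  · intro a v hv hvn hc
    have := hmax' _ _ (h.add_seed S hZ hv hc)
    rw [card_insert_of_notMem (fun hh => hvn (mem_union_left _ hh))] at this
    omega
  · by_contra hcon
    have hYt := h.Y_tot S hZ
    have hTc := h.T_card
    have hU : ((T.biUnion id \ Y).card : ℝ) ≤ 2 * ((K.θ + 54 * K.ζ + 9 * K.ζ3) * n) := by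
      have : ((T.biUnion id \ Y).card : ℝ) ≤ 2 * Y.card := by
        have := hTc.2.trans (Nat.mul_le_mul_left 2 hTc.1)
        exact_mod_cast this
      linarith
    have hfull := full_count S _ hU
    set Fu := univ.filter fun a => ¬ ((((T.biUnion id \ Y) ∩ W a).card : ℝ) + 2 ≤ K.ρ1 * w) with hFu
    have hZc := S.sum_le Z K.hρ2.le hZ
    have hVz := S.Vz_card
    obtain ⟨r1, r2, r3⟩ := K.rho
    have hζ := K.hζ
    have hζ3 := K.hζ3'
    have hFc : ((Y ∪ T.biUnion id ∪ Z ∪ Fu.biUnion W).card : ℝ) ≤ K.γ ^ 2 / 16 * n := by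
      have hsub : Y ∪ T.biUnion id ∪ Z ∪ Fu.biUnion W ⊆ Y ∪ (T.biUnion id \ Y) ∪ Z ∪ Fu.biUnion W := by
        rw [union_sdiff_self_eq_union]
      have e1 := (card_le_card hsub).trans ((card_union_le _ _).trans (Nat.add_le_add_right ((card_union_le _ _).trans
        (Nat.add_le_add_right (card_union_le _ _) _)) _))
      have e2 := (Nat.cast_le (α := ℝ)).2 e1
      push_cast at e2
      refine forb_arith (θ := K.θ) K.hρ1 ?_ (Nat.cast_nonneg n) K.hσ (by linarith) r3 K.hρ2γ (hfull.trans (by linarith)) (e2.trans (by linarith))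
      have := K.hρ2ρ; have := K.hρ; have := K.hε1; have := K.hρ1; linarith
    obtain ⟨v, hv, x, hx, y, hy, a1, a2, a3⟩ := cover K.hN0 S.hp S.hp1 K.hγ K.hγ1 K.hNγ S.hN1 hn S.hP4 S.hG S.hdeg
      (Y ∪ T.biUnion id ∪ Z ∪ Fu.biUnion W) (Y \ T.biUnion id) hFc (not_lt.1 hcon)
    rw [mem_union, not_or] at hx hy
    rw [mem_sdiff] at hv
    have hf : ∀ z, z ∉ Fu.biUnion W → ∀ a, z ∈ W a → (((T.biUnion id \ Y) ∩ W a).card : ℝ) + 2 ≤ K.ρ1 * w := by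
      intro z hz a ha
      by_contra hh
      exact hz (mem_biUnion.2 ⟨a, mem_filter.2 ⟨mem_univ _, hh⟩, ha⟩)
    obtain ⟨h1, h2⟩ := h.add_tri hv.1 hv.2 hx.1 hy.1 (hf x hx.2) (hf y hy.2) a1 a2 a3
    have := hmax' _ _ h1
    omega

end Part23

section Part24
variable {K : Cst} {n : ℕ} {p : ℝ} {Γ G : SimpleGraph (Fin n)} {k w : ℕ}
    {W : Fin k × Fin 3 → Finset (Fin n)} {R : SimpleGraph (Fin k × Fin 3)}

/-- Number of uses of index `a` in a triangle type. -/
def useOf {ι : Type*} (a : ι) (τ : Fin 3 → ι) : ℕ := ∑ r, if τ r = a then 1 else 0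

def cntOf {ι : Type*} (a : ι) : Multiset (Fin 3 → ι) →+ ℕ :=
  Multiset.sumAddMonoidHom.comp (Multiset.mapAddMonoidHom (useOf a))

lemma cntOf_single {ι : Type*} (a : ι) (τ : Fin 3 → ι) : cntOf a {τ} = useOf a τ := by
  simp [cntOf]

lemma Sys.triangle' (S : Sys K p Γ G k w W R) {τ : Fin 3 → Fin k × Fin 3} (hτ : IsTri R τ) (A : Fin k × Fin 3 → Finset (Fin n))
    (hA : ∀ a, A a ⊆ W a) (hA' : ∀ a, K.ρ2 / 4 * w ≤ (A a).card) :
    ∃ x : Fin 3 → Fin n, (∀ r, x r ∈ A (τ r)) ∧ ∀ r s, r ≠ s → G.Adj (x r) (x s) := by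
  obtain ⟨x, hx, y, hy, z, hz, h1, h2, h3⟩ := S.triangle (hτ 0 1 (by decide)) (hτ 0 2 (by decide)) (hτ 1 2 (by decide))
    (hA _) (hA _) (hA _) (hA' _) (hA' _) (hA' _)
  refine ⟨![x, y, z], ?_, ?_⟩
  · intro r; fin_cases r <;> assumption
  · intro r s hrs
    fin_cases r <;> fin_cases s <;> first | exact absurd rfl hrs | assumption | (apply SimpleGraph.Adj.symm; assumption)

lemma Sys.greedy (S : Sys K p Γ G k w W R) (P : Fin k × Fin 3 → Finset (Fin n)) (hP : ∀ a, P a ⊆ W a)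
    (M : Multiset (Fin 3 → Fin k × Fin 3)) (hM : ∀ τ ∈ M, IsTri R τ) 
    (hc : ∀ a, (cntOf a M : ℝ) + K.ρ2 / 4 * w ≤ (P a).card) :
    ∃ T, IsTrianglePacking G T ∧ (∀ a, T.biUnion id ∩ W a ⊆ P a) ∧ T.biUnion id ⊆ univ.biUnion P ∧
      ∀ a, (T.biUnion id ∩ W a).card = cntOf a M := by
  induction M using Multiset.induction_on with
  | empty => exact ⟨∅, ⟨by simp, by simp⟩, by simp, by simp, by simp⟩
  | cons τ M ih =>
    have hcons : ∀ a, cntOf a (τ ::ₘ M) = useOf a τ + cntOf a M := by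
      intro a
      rw [← Multiset.singleton_add, map_add, cntOf_single]
    obtain ⟨T, h1, h2, h3, h4⟩ := ih (fun σ hσ => hM σ (Multiset.mem_cons_of_mem hσ)) (fun a => by
      have := hc a
      rw [hcons] at this
      push_cast at this
      have : (0 : ℝ) ≤ useOf a τ := Nat.cast_nonneg _
      linarith)
    obtain ⟨x, hx, hxa⟩ := S.triangle' (hM τ (Multiset.mem_cons_self _ _)) (fun a => P a \ T.biUnion id)
      (fun a => sdiff_subset.trans (hP a)) (fun a => by
        have e1 := hc a
        rw [hcons] at e1
        push_cast at e1
        have : (0 : ℝ) ≤ useOf a τ := Nat.cast_nonneg _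
        have e2 := card_le_card_sdiff_add_card (s := P a) (t := T.biUnion id ∩ W a)
        have e3 : P a \ (T.biUnion id ∩ W a) ⊆ P a \ T.biUnion id := by
          intro v hv
          simp only [mem_sdiff, mem_inter, not_and] at hv ⊢
          exact ⟨hv.1, fun h => hv.2 h (hP a hv.1)⟩
        have e4 := card_le_card e3
        rw [h4] at e2
        have : ((P a).card : ℝ) ≤ (P a \ T.biUnion id).card + cntOf a M := by exact_mod_cast (by omega)
        linarith)
    have hinj : Function.Injective x := by
      intro r s hrs
      by_contra hne
      exact (hxa r s hne).ne hrs
    have hx' : ∀ r, x r ∈ P (τ r) ∧ x r ∉ T.biUnion id := fun r => mem_sdiff.1 (hx r)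
    set t := univ.image x with ht
    have hdis : ∀ s ∈ T, Disjoint t s := by
      intro s hs
      rw [disjoint_left]
      intro v hv hvs
      obtain ⟨r, -, rfl⟩ := mem_image.1 hv
      exact (hx' r).2 (mem_biUnion.2 ⟨s, hs, hvs⟩)
    have hbi : (insert t T).biUnion id = t ∪ T.biUnion id := by
      rw [biUnion_insert]; rfl
    refine ⟨insert t T, ⟨?_, ?_⟩, ?_, ?_, ?_⟩
    · intro s hs
      rcases mem_insert.1 hs with rfl | hs
      · refine ⟨by rw [ht, card_image_of_injective _ hinj]; simp, ?_⟩
        intro u hu v hv huv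
        obtain ⟨r, -, rfl⟩ := mem_image.1 hu
        obtain ⟨q, -, rfl⟩ := mem_image.1 hv
        exact hxa r q (fun h => huv (by rw [h]))
      · exact h1.1 s hs
    · intro a ha b hb hab
      rcases mem_insert.1 ha with ha | ha <;> rcases mem_insert.1 hb with hb | hb
      · exact absurd (ha.trans hb.symm) hab
      · rw [ha]; exact hdis b hb
      · rw [hb]; exact (hdis a ha).symm
      · exact h1.2 a ha b hb hab
    · intro a v hv
      rw [hbi, mem_inter, mem_union] at hv
      obtain ⟨hv | hv, hva⟩ := hv
      · obtain ⟨r, -, rfl⟩ := mem_image.1 hv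
        have := S.cl_unique hva (hP _ (hx' r).1)
        rw [this]
        exact (hx' r).1
      · exact h2 a (mem_inter.2 ⟨hv, hva⟩)
    · rw [hbi]
      refine union_subset ?_ h3
      intro v hv
      obtain ⟨r, -, rfl⟩ := mem_image.1 hv
      exact mem_biUnion.2 ⟨τ r, mem_univ _, (hx' r).1⟩
    · intro a
      rw [hbi, union_inter_distrib_right, card_union_of_disjoint, h4, hcons]
      · congr 1
        have : t ∩ W a = (univ.filter fun r => τ r = a).image x := by
          ext v
          simp only [ht, mem_inter, mem_image, mem_univ, true_and, mem_filter]
          constructor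
          · rintro ⟨⟨r, rfl⟩, hv⟩
            exact ⟨r, (S.cl_unique hv (hP _ (hx' r).1)).symm, rfl⟩
          · rintro ⟨r, hr, rfl⟩
            exact ⟨⟨r, rfl⟩, hr ▸ hP _ (hx' r).1⟩
        rw [this, card_image_of_injective _ hinj, card_filter, useOf]
        refine sum_congr rfl fun r _ => ?_
        congr
      · rw [disjoint_left]
        intro v hv hv2
        obtain ⟨r, -, rfl⟩ := mem_image.1 (mem_inter.1 hv).1
        exact (hx' r).2 (mem_inter.1 hv2).1

lemma wsum_arith {γ ρ1 ρ2 w K0 q kk : ℝ} (hγ : 0 < γ) (hγ1 : γ ≤ 1 / 10) (h1 : 64 * ρ1 ≤ γ * ρ2) (hw : 0 ≤ w) (hρ1 : 0 < ρ1)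
    (hK : ρ2 / 8 * w ≤ K0) (hk : 0 ≤ kk) (hq : q ≤ (1 / 3 - γ / 4) * (3 * kk)) :
    q * (2 * ρ1 * w + K0) ≤ kk * K0 := by
  have h2 : γ * (ρ2 / 8 * w) ≤ γ * K0 := mul_le_mul_of_nonneg_left hK hγ.le
  have h3 : 64 * ρ1 * w ≤ γ * ρ2 * w := mul_le_mul_of_nonneg_right h1 hw
  have h0 : 0 ≤ ρ1 * w := by positivity
  have h6 : 0 ≤ γ * K0 := by linarith
  have h7 : 0 ≤ K0 := by
    by_contra hneg
    have := mul_neg_of_pos_of_neg hγ (not_le.1 hneg)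
    linarith
  have h4 : q * (2 * ρ1 * w + K0) ≤ (1 / 3 - γ / 4) * (3 * kk) * (2 * ρ1 * w + K0) :=
    mul_le_mul_of_nonneg_right hq (by linarith)
  have h5 : (1 - 3 * γ / 4) * (2 * ρ1 * w + K0) ≤ K0 := by
    have : 0 ≤ γ * (ρ1 * w) := by positivity
    linarith
  have h8 := mul_le_mul_of_nonneg_left h5 hk
  linarith

/-- Integral triangle tiling with prescribed approximate usage. -/
lemma Sys.types (S : Sys K p Γ G k w W R) (K0 : ℕ) (hK : K.ρ2 / 8 * w ≤ (K0 : ℝ)) (x : Fin k × Fin 3 → ℕ)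
    (hx : ∀ a, (x a : ℝ) ≤ 2 * K.ρ1 * w) :
    ∃ M : Multiset (Fin 3 → Fin k × Fin 3), (∀ τ ∈ M, IsTri R τ) ∧
      ∀ a, cntOf a M ≤ x a + K0 ∧ x a + K0 ≤ cntOf a M + 3 * (3 * k + 1) := by
  obtain ⟨m, hm, T, y, hT, hy0, hy⟩ := frac_tiling R (fun a => (x a : ℝ) + K0) (fun a => by positivity) (by
    intro i
    have h1 : ∑ j, (if R.Adj i j then (0 : ℝ) else (x j : ℝ) + K0) ≤
        ((univ.filter fun b => ¬ R.Adj i b).card : ℝ) * (2 * K.ρ1 * w + K0) := by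
      rw [← nsmul_eq_mul, ← sum_const, sum_filter]
      refine sum_le_sum fun j _ => ?_
      by_cases h : R.Adj i j
      · simp [h]
      · simp only [h, if_false, not_false_eq_true, if_true]
        linarith [hx j]
    have h2 : 3 * (k : ℝ) * K0 ≤ ∑ j : Fin k × Fin 3, ((x j : ℝ) + K0) := by
      have : (univ : Finset (Fin k × Fin 3)).card • (K0 : ℝ) ≤ ∑ j : Fin k × Fin 3, ((x j : ℝ) + K0) :=
        card_nsmul_le_sum _ _ _ fun j _ => by have : (0 : ℝ) ≤ x j := Nat.cast_nonneg _; linarith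
      simp only [card_univ, Fintype.card_prod, Fintype.card_fin, nsmul_eq_mul] at this
      push_cast at this
      linarith
    have h3 := wsum_arith K.hγ K.hγ1 K.hρ1γ (Nat.cast_nonneg w) K.hρ1 hK (Nat.cast_nonneg k) (S.hnon i)
    linarith)
  refine ⟨∑ j, ⌊y j⌋₊ • {T j}, ?_, ?_⟩
  · intro τ hτ
    obtain ⟨j, -, hj⟩ := Multiset.mem_sum.1 hτ
    have := Multiset.mem_of_mem_nsmul hj
    rw [Multiset.mem_singleton] at this
    rw [this]; exact hT j
  · intro a
    have hcnt : (cntOf a (∑ j, ⌊y j⌋₊ • ({T j} : Multiset (Fin 3 → Fin k × Fin 3))) : ℝ) =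
        ∑ j, ∑ r, (if T j r = a then (⌊y j⌋₊ : ℝ) else 0) := by
      rw [map_sum]
      push_cast
      refine sum_congr rfl fun j _ => ?_
      rw [map_nsmul, cntOf_single, useOf, smul_eq_mul]
      push_cast
      rw [mul_sum]
      refine sum_congr rfl fun r _ => ?_
      split_ifs <;> simp
    have hya := hy a
    constructor
    · have : (cntOf a (∑ j, ⌊y j⌋₊ • ({T j} : Multiset (Fin 3 → Fin k × Fin 3))) : ℝ) ≤ x a + K0 := by
        rw [hcnt, ← hya]
        refine sum_le_sum fun j _ => sum_le_sum fun r _ => ?_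
        split_ifs
        · exact Nat.floor_le (hy0 j)
        · exact le_rfl
      exact_mod_cast this
    · have : (x a : ℝ) + K0 ≤ (cntOf a (∑ j, ⌊y j⌋₊ • ({T j} : Multiset (Fin 3 → Fin k × Fin 3))) : ℝ) + 3 * m := by
        rw [hcnt, ← hya]
        have h1 : ∑ j, ∑ r, (if T j r = a then y j else 0) ≤
            ∑ j : Fin m, ∑ r : Fin 3, ((if T j r = a then (⌊y j⌋₊ : ℝ) else 0) + 1) := by
          refine sum_le_sum fun j _ => sum_le_sum fun r _ => ?_
          split_ifs
          · exact (Nat.lt_floor_add_one _).le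
          · norm_num
        simp only [sum_add_distrib, sum_const, card_univ, Fintype.card_fin, nsmul_eq_mul, mul_one] at h1
        push_cast at h1
        rw [mul_comm (m : ℝ) 3] at h1
        convert h1
      have h3 : x a + K0 ≤ cntOf a (∑ j, ⌊y j⌋₊ • ({T j} : Multiset (Fin 3 → Fin k × Fin 3))) + 3 * m := by exact_mod_cast this
      simp only [Fintype.card_prod, Fintype.card_fin] at hm
      omega

end Part24

section Part25
variable {K : Cst} {n : ℕ} {p : ℝ} {Γ G : SimpleGraph (Fin n)} {k w : ℕ}
    {W : Fin k × Fin 3 → Finset (Fin n)} {R : SimpleGraph (Fin k × Fin 3)}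

lemma pack_union {G : SimpleGraph (Fin n)} {T T2 : Finset (Finset (Fin n))} (h1 : IsTrianglePacking G T) (h2 : IsTrianglePacking G T2)
    (hd : Disjoint (T.biUnion id) (T2.biUnion id)) : IsTrianglePacking G (T ∪ T2) := by
  have hd' : ∀ s ∈ T, ∀ t ∈ T2, Disjoint s t := fun s hs t ht =>
    disjoint_of_subset_left (subset_biUnion_of_mem id hs) (disjoint_of_subset_right (subset_biUnion_of_mem id ht) hd)
  refine ⟨fun t ht => ?_, fun s hs t ht hst => ?_⟩
  · rcases mem_union.1 ht with ht | ht
    · exact h1.1 t ht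
    · exact h2.1 t ht
  · rcases mem_union.1 hs with hs | hs <;> rcases mem_union.1 ht with ht | ht
    · exact h1.2 s hs t ht hst
    · exact hd' s hs t ht
    · exact (hd' t ht s hs).symm
    · exact h2.2 s hs t ht hst

lemma Sys.reserve (S : Sys K p Γ G k w W R) : ∃ P : Fin k × Fin 3 → Finset (Fin n), (∀ a, P a ⊆ W a) ∧
    (∀ a, univ.biUnion P ∩ W a = P a) ∧ (∀ a, ((P a).card : ℝ) ≤ K.ρ2 * w) ∧ ∀ a, K.ρ2 * w - 1 ≤ ((P a).card : ℝ) := by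
  have hle : ⌊K.ρ2 * w⌋₊ ≤ w := by
    have h1 : K.ρ2 ≤ 1 := by
      have := K.hρ2ρ; have := K.hρ; have := K.hε1; have := K.hρ2; linarith
    have : ((⌊K.ρ2 * w⌋₊ : ℕ) : ℝ) ≤ w := by
      have h2 := Nat.floor_le (mul_nonneg K.hρ2.le (Nat.cast_nonneg (α := ℝ) w))
      have h3 : K.ρ2 * w ≤ 1 * w := mul_le_mul_of_nonneg_right h1 (Nat.cast_nonneg _)
      linarith
    exact_mod_cast this
  have : ∀ a, ∃ P ⊆ W a, P.card = ⌊K.ρ2 * w⌋₊ := fun a => exists_subset_card_eq (by rw [S.hW a]; exact hle)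
  choose P hP hc using this
  refine ⟨P, hP, ?_, ?_, ?_⟩
  · intro a
    ext v
    simp only [mem_inter, mem_biUnion, mem_univ, true_and]
    constructor
    · rintro ⟨⟨b, hb⟩, ha⟩
      rw [S.cl_unique ha (hP b hb)]; exact hb
    · exact fun h => ⟨⟨a, h⟩, hP a h⟩
  · intro a
    rw [hc]; exact Nat.floor_le (mul_nonneg K.hρ2.le (Nat.cast_nonneg _))
  · intro a
    rw [hc]; have := Nat.lt_floor_add_one (K.ρ2 * w); linarith

/-- The shape of the final decomposition. -/
def Fin3 {n : ℕ} (G : SimpleGraph (Fin n)) (k : ℕ) (B Sv : Finset (Fin n)) (W' : Fin k × Fin 3 → Finset (Fin n)) (T : Finset (Finset (Fin n))) : Prop :=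
  Disjoint B Sv ∧ (∀ a, Disjoint B (W' a)) ∧ (∀ a, Disjoint Sv (W' a)) ∧ (∀ a b, a ≠ b → Disjoint (W' a) (W' b)) ∧
  (B ∪ Sv ∪ univ.biUnion W' = univ) ∧ IsTrianglePacking G T ∧ T.biUnion id = Sv

lemma Sys.assemble (S : Sys K p Γ G k w W R) {Y Z : Finset (Fin n)} {T T2 : Finset (Finset (Fin n))} {W' : Fin k × Fin 3 → Finset (Fin n)}
    (h : St K p Γ G w W Z Y T) (h2 : IsTrianglePacking G T2) (hZ : ∀ v ∈ T2.biUnion id, v ∈ Z ∧ v ∉ Y)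
    (hW : ∀ a, W' a ⊆ (W a \ (Y ∪ T.biUnion id)) \ T2.biUnion id) :
    Fin3 G k ((Y \ T.biUnion id) ∪ univ.biUnion fun a => ((W a \ (Y ∪ T.biUnion id)) \ T2.biUnion id) \ W' a)
      (T.biUnion id ∪ T2.biUnion id) W' (T ∪ T2) := by
  have hTT : ∀ v, v ∈ T.biUnion id → v ∈ T2.biUnion id → False := fun v h1 h3 =>
    (hZ v h3).2 (h.res v h1 (hZ v h3).1)
  refine ⟨?_, ?_, ?_, ?_, ?_, pack_union h.pack h2 (disjoint_left.2 fun v h1 h3 => hTT v h1 h3), ?_⟩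
  · rw [disjoint_left]
    intro v hv hv2
    have := hZ v
    simp only [mem_union, mem_sdiff, mem_biUnion (t := fun a => ((W a \ (Y ∪ T.biUnion id)) \ T2.biUnion id) \ W' a), mem_univ, true_and] at hv hv2
    rcases hv with hv | ⟨a, ha⟩ <;> tauto
  · intro a
    rw [disjoint_left]
    intro v hv hv2
    have := hW a hv2
    simp only [mem_union, mem_sdiff, mem_biUnion (t := fun a => ((W a \ (Y ∪ T.biUnion id)) \ T2.biUnion id) \ W' a), mem_univ, true_and] at hv this
    rcases hv with hv | ⟨b, hb⟩
    · tauto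
    · have e := S.cl_unique this.1.1 hb.1.1.1
      subst e
      exact hb.2 hv2
  · intro a
    rw [disjoint_left]
    intro v hv hv2
    have := hW a hv2
    simp only [mem_union, mem_sdiff] at hv this
    tauto
  · intro a b hab
    exact disjoint_of_subset_left ((hW a).trans (sdiff_subset.trans sdiff_subset))
      (disjoint_of_subset_right ((hW b).trans (sdiff_subset.trans sdiff_subset)) (S.hdis a b hab))
  · rw [eq_univ_iff_forall]
    intro v
    by_cases hT : v ∈ T.biUnion id
    · exact mem_union_left _ (mem_union_right _ (mem_union_left _ hT))
    by_cases hT2 : v ∈ T2.biUnion id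
    · exact mem_union_left _ (mem_union_right _ (mem_union_right _ hT2))
    by_cases hY : v ∈ Y
    · exact mem_union_left _ (mem_union_left _ (mem_union_left _ (mem_sdiff.2 ⟨hY, hT⟩)))
    have hVz : v ∉ Vz W := fun hh => hY (h.seed (mem_union_left _ hh))
    unfold Vz at hVz
    rw [mem_sdiff, not_and_not_right] at hVz
    obtain ⟨a, -, ha⟩ := mem_biUnion.1 (hVz (mem_univ _))
    by_cases hw' : v ∈ W' a
    · exact mem_union_right _ (mem_biUnion.2 ⟨a, mem_univ _, hw'⟩)
    · refine mem_union_left _ (mem_union_left _ (mem_union_right _ (mem_biUnion.2 ⟨a, mem_univ _, ?_⟩)))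
      rw [mem_sdiff, mem_sdiff, mem_sdiff, mem_union]
      tauto
  · ext v
    simp only [mem_union, mem_biUnion, id]
    constructor
    · rintro ⟨t, ht | ht, hv⟩
      · exact Or.inl ⟨t, ht, hv⟩
      · exact Or.inr ⟨t, ht, hv⟩
    · rintro (⟨t, ht, hv⟩ | ⟨t, ht, hv⟩)
      · exact ⟨t, Or.inl ht, hv⟩
      · exact ⟨t, Or.inr ht, hv⟩

set_option maxHeartbeats 1000000 in
lemma Sys.finish (S : Sys K p Γ G k w W R) (hn : 0 < n) :
    ∃ B Sv W' T, ∃ m0 : ℕ, Fin3 G k B Sv W' T ∧ (B.card : ℝ) ≤ (18 / K.γ ^ 2 + 2) / p ^ 2 + 9 * k * (3 * k + 1) ∧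
      (∀ t, StrongSuperRegularTriple G (K.δ0 / 2) K.ε p (W' (t, 0)) (W' (t, 1)) (W' (t, 2))) ∧
      (∀ a, (W' a).card = m0) ∧ (w : ℝ) / 2 ≤ m0 := by
  obtain ⟨r1, r2, r3⟩ := K.rho
  have hζ := K.hζ
  have hζ3 := K.hζ3'
  have hθ := K.hθ
  have hρ2 := K.hρ2
  have hρ1 := K.hρ1
  have hbig := S.hbig
  have hwR : (0 : ℝ) < w := by exact_mod_cast S.hw
  obtain ⟨P, hP, hPZ, hPu, hPl⟩ := S.reserve
  set Z := univ.biUnion P with hZ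
  have hZc : ∀ a, ((Z ∩ W a).card : ℝ) ≤ K.ρ2 * w := fun a => by rw [hPZ a]; exact hPu a
  obtain ⟨Y, T, h, hncb, hpend⟩ := S.process hn hZc
  set Sa : Fin k × Fin 3 → Finset (Fin n) := fun a => W a \ (Y ∪ T.biUnion id) with hSa
  have q1 : 640 * (K.ρ1 * w) ≤ K.ρ2 * w := by
    have := mul_le_mul_of_nonneg_right r1 hwR.le; linarith
  have q2 : (54 * K.ζ + 9 * K.ζ3) * w ≤ K.ρ1 * w := mul_le_mul_of_nonneg_right (by linarith) hwR.le
  have q3 : 0 ≤ (54 * K.ζ + 9 * K.ζ3) * w := by positivity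
  have q4 : K.ρ2 * w ≤ K.ε / 64 * w := mul_le_mul_of_nonneg_right (by have := K.hρ2ρ; have := K.hρ; linarith) hwR.le
  have q5 : K.ε * w ≤ 1 * w := mul_le_mul_of_nonneg_right K.hε1 hwR.le
  have hSl : ∀ a, (1 - 2 * K.ρ1) * w ≤ ((Sa a).card : ℝ) := by
    intro a
    have e1 := h.y_card S hZc a
    have e2 := h.us a
    have e3 : W a ⊆ Sa a ∪ (Y ∩ W a) ∪ ((T.biUnion id \ Y) ∩ W a) := by
      intro v hv
      simp only [hSa, mem_union, mem_sdiff, mem_inter]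
      tauto
    have e4 := (card_le_card e3).trans ((card_union_le _ _).trans (Nat.add_le_add_right (card_union_le _ _) _))
    rw [S.hW a] at e4
    have e5 := (Nat.cast_le (α := ℝ)).2 e4
    push_cast at e5
    linarith
  have hSu : ∀ a, (Sa a).card ≤ w := fun a => by rw [← S.hW a]; exact card_le_card sdiff_subset
  set s0 := ⌈(1 - 2 * K.ρ1) * (w : ℝ)⌉₊ with hs0
  have hs0l : (1 - 2 * K.ρ1) * w ≤ (s0 : ℝ) := Nat.le_ceil _
  have hs0u : ∀ a, s0 ≤ (Sa a).card := fun a => Nat.ceil_le.2 (hSl a)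
  set K0 := ⌊K.ρ2 * (w : ℝ) / 4⌋₊ with hK0
  have hK0u : (K0 : ℝ) ≤ K.ρ2 * w / 4 := Nat.floor_le (by positivity)
  have hK0l : K.ρ2 * w / 4 - 1 ≤ (K0 : ℝ) := by have := Nat.lt_floor_add_one (K.ρ2 * (w : ℝ) / 4); linarith
  clear_value s0 K0
  have hsK : K0 ≤ s0 := by
    have : (K0 : ℝ) ≤ s0 := by linarith
    exact_mod_cast this
  set x : Fin k × Fin 3 → ℕ := fun a => (Sa a).card - s0 with hx
  have hxS : ∀ a, (Sa a).card = s0 + x a := fun a => by have := hs0u a; simp only [hx]; omega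
  have hxu : ∀ a, (x a : ℝ) ≤ 2 * K.ρ1 * w := by
    intro a
    have e1 : ((Sa a).card : ℝ) ≤ w := by exact_mod_cast hSu a
    have e2 : ((Sa a).card : ℝ) = s0 + x a := by exact_mod_cast hxS a
    linarith
  obtain ⟨M, hM, hMc⟩ := S.types K0 (by linarith) x hxu
  have hMu : ∀ a, (cntOf a M : ℝ) ≤ 2 * K.ρ1 * w + K.ρ2 * w / 4 := by
    intro a
    have : (cntOf a M : ℝ) ≤ x a + K0 := by exact_mod_cast (hMc a).1
    linarith [hxu a]
  have hPY : ∀ a, K.ρ2 * w - 1 - K.ρ1 * w ≤ ((P a \ Y).card : ℝ) := by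
    intro a
    have e1 : P a ⊆ (P a \ Y) ∪ (Y ∩ W a) := by
      intro v hv
      have := hP a hv
      simp only [mem_union, mem_sdiff, mem_inter]
      tauto
    have e2 := (card_le_card e1).trans (card_union_le _ _)
    have e3 := (Nat.cast_le (α := ℝ)).2 e2
    push_cast at e3
    linarith [hPl a, h.y_card S hZc a]
  obtain ⟨T2, hT2p, hT2a, hT2b, hT2c⟩ := S.greedy (fun a => P a \ Y) (fun a => sdiff_subset.trans (hP a)) M hM (fun a => by
    linarith [hPY a, hMu a])
  have hT2Z : ∀ v ∈ T2.biUnion id, v ∈ Z ∧ v ∉ Y := by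
    intro v hv
    obtain ⟨a, -, ha⟩ := mem_biUnion.1 (hT2b hv)
    obtain ⟨a1, a2⟩ := mem_sdiff.1 ha
    exact ⟨mem_biUnion.2 ⟨a, mem_univ _, a1⟩, a2⟩
  -- sizes
  have hPS : ∀ a, P a \ Y ⊆ Sa a := by
    intro a v hv
    obtain ⟨a1, a2⟩ := mem_sdiff.1 hv
    simp only [hSa, mem_sdiff, mem_union, not_or]
    exact ⟨hP a a1, a2, fun ht => a2 (h.res v ht (mem_biUnion.2 ⟨a, mem_univ _, a1⟩))⟩
  have hA1 : ∀ a, (Sa a \ Z).card ≤ s0 - K0 := by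
    intro a
    have e1 : Sa a \ Z ⊆ Sa a \ (P a \ Y) := by
      refine sdiff_subset_sdiff (Subset.refl _) ?_
      exact sdiff_subset.trans (subset_biUnion_of_mem P (mem_univ a))
    have e2 := (Nat.cast_le (α := ℝ)).2 (card_le_card e1)
    rw [card_sdiff_real (hPS a)] at e2
    have e3 : ((Sa a).card : ℝ) = s0 + x a := by exact_mod_cast hxS a
    have e4 : ((Sa a \ Z).card : ℝ) ≤ ((s0 - K0 : ℕ) : ℝ) := by
      rw [Nat.cast_sub hsK]
      linarith [hPY a, hxu a]
    exact_mod_cast e4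
  have hA2 : ∀ a, (Sa a \ T2.biUnion id).card = s0 + x a - cntOf a M := by
    intro a
    have e1 : Sa a \ T2.biUnion id = Sa a \ (T2.biUnion id ∩ W a) := by
      ext v
      simp only [mem_sdiff, mem_inter, not_and, hSa]
      tauto
    rw [e1, card_sdiff_of_subset ((hT2a a).trans (hPS a)), hxS, hT2c]
  have hex : ∀ a, ∃ V : Finset (Fin n), Sa a \ Z ⊆ V ∧ V ⊆ Sa a \ T2.biUnion id ∧ V.card = s0 - K0 := by
    intro a
    apply exists_subsuperset_card_eq
    · exact sdiff_subset_sdiff (Subset.refl _) fun v hv => (hT2Z v hv).1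
    · exact hA1 a
    · rw [hA2]; have := (hMc a).1; omega
  choose W' hW1 hW2 hW3 using hex
  have hfin := S.assemble h hT2p hT2Z hW2
  have hm0 : (1 - K.ε / 16) * (w : ℝ) ≤ ((s0 - K0 : ℕ) : ℝ) := by
    rw [Nat.cast_sub hsK]
    linarith
  refine ⟨_, _, W', _, s0 - K0, hfin, ?_, ?_, hW3, ?_⟩
  · have e1 := card_union_le (Y \ T.biUnion id) (univ.biUnion fun a => ((W a \ (Y ∪ T.biUnion id)) \ T2.biUnion id) \ W' a)
    have e2 : (univ.biUnion fun a => ((W a \ (Y ∪ T.biUnion id)) \ T2.biUnion id) \ W' a).card ≤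
        (univ : Finset (Fin k × Fin 3)).card * (3 * (3 * k + 1)) := by
      refine card_biUnion_le_card_mul _ _ _ fun a _ => ?_
      have e3 := card_sdiff_of_subset (hW2 a)
      rw [hW3, hA2] at e3
      have e4 : ((W a \ (Y ∪ T.biUnion id)) \ T2.biUnion id) \ W' a = (Sa a \ T2.biUnion id) \ W' a := rfl
      rw [e4, e3]
      have := (hMc a).2
      omega
    simp only [card_univ, Fintype.card_prod, Fintype.card_fin] at e2
    have e5 := (Nat.cast_le (α := ℝ)).2 (e1.trans (Nat.add_le_add_left e2 _))
    push_cast at e5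
    linarith
  · intro t
    refine S.strong (Xs K p Γ G w W) (Y ∪ T.biUnion id ∪ Z) (fun a v hv hX => Sys.X_ini a v hv hX) t (fun r => W' (t, r))
      (s0 - K0) (fun r => hW3 _) hm0 ?_ ?_ ?_
    · intro r v hv
      have := hW2 _ hv
      simp only [hSa, mem_sdiff, mem_union, not_or] at this
      exact mem_sdiff.2 ⟨this.1.1, fun hX => this.1.2.1 (h.seed (mem_union_right _ hX))⟩
    · intro r v hv
      apply hW1
      simp only [hSa, mem_sdiff, mem_union, not_or] at hv ⊢
      tauto
    · intro r v hv
      have := hW2 _ hv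
      simp only [hSa, mem_sdiff, mem_union, not_or] at this
      exact hncb _ v this.1.1 (by rw [mem_union]; tauto)
  · linarith

end Part25

section Part26
/-! ## Final assembly -/

/-- The conclusion of the theorem for one `n` and one value of `p`. -/
def Concl (γ δ ε D ξ : ℝ) (n : ℕ) (p : ℝ) (Gnp : SimpleGraph (Fin n)) : Prop :=
  ∀ G : SimpleGraph (Fin n), G ≤ Gnp →
    (∀ v, (2 / 3 + γ) * n * p ≤ (degIn G v Finset.univ : ℝ)) →
    ∃ G' : SimpleGraph (Fin n), G' ≤ G ∧
    ∃ k : ℕ, (k : ℝ) ≤ D ∧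
    ∃ B S : Finset (Fin n), ∃ Ws : Fin (3 * k) → Finset (Fin n),
      Disjoint B S ∧ (∀ i, Disjoint B (Ws i)) ∧ (∀ i, Disjoint S (Ws i)) ∧
      (∀ i j, i ≠ j → Disjoint (Ws i) (Ws j)) ∧
      B ∪ S ∪ Finset.univ.biUnion Ws = (Finset.univ : Finset (Fin n)) ∧
      (B.card : ℝ) ≤ D / p ^ 2 ∧
      (∃ T : Finset (Finset (Fin n)),
        IsTrianglePacking G T ∧ T.sup id = S) ∧
      (∀ t : Fin k, StrongSuperRegularTriple G' δ ε p
        (Ws (idx0 t)) (Ws (idx1 t)) (Ws (idx2 t))) ∧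
      (∀ t : Fin k, (Ws (idx0 t)).card = (Ws (idx1 t)).card ∧
        (Ws (idx1 t)).card = (Ws (idx2 t)).card ∧
        ξ * n ≤ ((Ws (idx0 t)).card : ℝ))

/-- index conversion -/
def cidx {k : ℕ} (i : Fin (3 * k)) : Fin k × Fin 3 :=
  (⟨i.1 / 3, by have := i.2; omega⟩, ⟨i.1 % 3, by omega⟩)

lemma cidx_inj {k : ℕ} {i j : Fin (3 * k)} (h : cidx i = cidx j) : i = j := by
  unfold cidx at h
  simp only [Prod.mk.injEq, Fin.mk.injEq] at h
  apply Fin.ext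
  omega

lemma cidx0 {k : ℕ} (t : Fin k) : cidx (idx0 t) = (t, 0) := by
  unfold cidx idx0
  ext <;> simp

lemma cidx1 {k : ℕ} (t : Fin k) : cidx (idx1 t) = (t, 1) := by
  unfold cidx idx1
  ext <;> simp <;> omega

lemma cidx2 {k : ℕ} (t : Fin k) : cidx (idx2 t) = (t, 2) := by
  unfold cidx idx2
  ext <;> simp <;> omega

lemma cidx_surj {k : ℕ} (a : Fin k × Fin 3) : ∃ i, cidx (k := k) i = a := by
  obtain ⟨t, r⟩ := a
  fin_cases r
  · exact ⟨idx0 t, cidx0 t⟩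
  · exact ⟨idx1 t, cidx1 t⟩
  · exact ⟨idx2 t, cidx2 t⟩

lemma P3.mono_eta {ε ζ Λ μ η η' : ℝ} {n : ℕ} {p : ℝ} {Γ : SimpleGraph (Fin n)} (hη : η' ≤ η)
    (hp : 0 ≤ p) (h : P3 ε ζ Λ μ η n p Γ) : P3 ε ζ Λ μ η' n p Γ := by
  intro A B hAB hc hμ H hH hd hcut
  refine h A B hAB hc hμ H hH hd ?_
  intro S hS T hT
  refine (hcut S hS T hT).trans ?_
  exact mul_le_mul_of_nonneg_right (mul_le_mul_of_nonneg_right hη hp) (by positivity)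

lemma Sys.concl {K : Cst} {n : ℕ} {p : ℝ} {Γ G : SimpleGraph (Fin n)} {k w : ℕ}
    {W : Fin k × Fin 3 → Finset (Fin n)} {R : SimpleGraph (Fin k × Fin 3)}
    (S : Sys K p Γ G k w W R) (hn : 0 < n) {D : ℝ}
    (hD : D = 18 / K.γ ^ 2 + 2 + 9 * (1 / K.μ) * (3 * (1 / K.μ) + 1) + 1 / K.μ) :
    ∃ G' : SimpleGraph (Fin n), G' ≤ G ∧
    ∃ k : ℕ, (k : ℝ) ≤ D ∧
    ∃ B S : Finset (Fin n), ∃ Ws : Fin (3 * k) → Finset (Fin n),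
      Disjoint B S ∧ (∀ i, Disjoint B (Ws i)) ∧ (∀ i, Disjoint S (Ws i)) ∧
      (∀ i j, i ≠ j → Disjoint (Ws i) (Ws j)) ∧
      B ∪ S ∪ Finset.univ.biUnion Ws = (Finset.univ : Finset (Fin n)) ∧
      (B.card : ℝ) ≤ D / p ^ 2 ∧
      (∃ T : Finset (Finset (Fin n)),
        IsTrianglePacking G T ∧ T.sup id = S) ∧
      (∀ t : Fin k, StrongSuperRegularTriple G' (K.δ0 / 2) K.ε p
        (Ws (idx0 t)) (Ws (idx1 t)) (Ws (idx2 t))) ∧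
      (∀ t : Fin k, (Ws (idx0 t)).card = (Ws (idx1 t)).card ∧
        (Ws (idx1 t)).card = (Ws (idx2 t)).card ∧
        K.μ / 2 * n ≤ ((Ws (idx0 t)).card : ℝ)) := by
  have hμ := K.hμ
  have hp := S.hp
  have hn' : (0:ℝ) < n := by exact_mod_cast hn
  have hk : (k : ℝ) ≤ 1 / K.μ := by
    have h1 := S.tot.2
    have h2 := S.hμw
    rw [le_div_iff₀ hμ]
    have h3 : 3 * (k : ℝ) * (K.μ * n) ≤ 1 * n := by
      have := mul_le_mul_of_nonneg_left h2 (show (0:ℝ) ≤ 3 * k by positivity)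
      linarith
    have h4 : 3 * (k : ℝ) * K.μ ≤ 1 := by
      apply le_of_mul_le_mul_right _ hn'
      linarith
    have : 0 ≤ (k : ℝ) * K.μ := by positivity
    linarith
  have hk0 : (0:ℝ) ≤ k := by positivity
  have hq : (0:ℝ) < 1 / K.μ := by positivity
  have hg : 0 ≤ 18 / K.γ ^ 2 := by positivity
  have hq2 : 0 ≤ 9 * (1 / K.μ) * (3 * (1 / K.μ) + 1) := by positivity
  obtain ⟨B, Sv, W', T, m0, ⟨f1, f2, f3, f4, f5, f6, f7⟩, hB, hSS, hm, hw⟩ := S.finish hn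
  refine ⟨G, le_refl _, k, by linarith, B, Sv, fun i => W' (cidx i), f1, fun i => f2 _, fun i => f3 _,
    fun i j hij => f4 _ _ (fun h => hij (cidx_inj h)), ?_, ?_, ⟨T, f6, ?_⟩, ?_, ?_⟩
  · rw [← f5]
    congr 1
    ext v
    simp only [mem_biUnion, mem_univ, true_and]
    constructor
    · rintro ⟨i, hi⟩; exact ⟨_, hi⟩
    · rintro ⟨a, ha⟩
      obtain ⟨i, rfl⟩ := cidx_surj a
      exact ⟨i, ha⟩
  · refine hB.trans ?_
    have h1 : 9 * (k:ℝ) * (3 * k + 1) ≤ 9 * (1 / K.μ) * (3 * (1 / K.μ) + 1) := by gcongr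
    have h2 : 9 * (1 / K.μ) * (3 * (1 / K.μ) + 1) ≤ 9 * (1 / K.μ) * (3 * (1 / K.μ) + 1) / p ^ 2 := by
      rw [le_div_iff₀ (by positivity)]
      have : p ^ 2 ≤ 1 := by
        have := S.hp1
        nlinarith
      have := mul_le_mul_of_nonneg_left this hq2
      linarith
    have h3 : 0 ≤ 1 / K.μ / p ^ 2 := by positivity
    have h4 : D / p ^ 2 = (18 / K.γ ^ 2 + 2) / p ^ 2 + 9 * (1 / K.μ) * (3 * (1 / K.μ) + 1) / p ^ 2 + 1 / K.μ / p ^ 2 := by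
      rw [hD, ← add_div, ← add_div]
    rw [h4]
    linarith
  · rw [sup_eq_biUnion]; exact f7
  · intro t
    simp only [cidx0, cidx1, cidx2]
    exact hSS t
  · intro t
    simp only [cidx0, cidx1, cidx2, hm, true_and]
    have := S.hμw
    linarith

lemma pn_large {C κ : ℝ} (hC : 0 < C) (hκ : 0 < κ) : ∃ n0 : ℕ, ∀ n ≥ n0, ∀ p : ℝ,
    C * Real.sqrt (Real.log n / n) ≤ p → p ≤ 1 → 2 / (p * n) ≤ κ := by
  obtain ⟨m, hm⟩ := exists_nat_gt (Real.exp (2 / κ / C ^ 2))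
  refine ⟨max m 2, fun n hn p hp hp1 => ?_⟩
  have hn2 : 2 ≤ n := le_trans (le_max_right _ _) hn
  have hnm : (m : ℝ) ≤ n := by exact_mod_cast le_trans (le_max_left _ _) hn
  obtain ⟨h0, h1⟩ := p_facts hC hn2 hp
  have hn' : (0:ℝ) < n := by positivity
  have hl : 2 / κ / C ^ 2 ≤ Real.log n := by
    rw [Real.le_log_iff_exp_le hn']; linarith
  rw [div_le_iff₀ (by positivity)] at hl
  have h2 : p ^ 2 * n ≤ p * n := by
    apply mul_le_mul_of_nonneg_right _ hn'.le
    nlinarith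
  rw [div_le_iff₀ (by positivity)]
  have h3 : 2 / κ ≤ p * n := by linarith
  rw [div_le_iff₀ hκ] at h3
  linarith

lemma Whp.mono_large {C C' : ℝ} {P Q : ∀ n : ℕ, ℝ → SimpleGraph (Fin n) → Prop} (hC : 0 ≤ C)
    (hCC : C ≤ C') (h : Whp C P) (N : ℕ)
    (hPQ : ∀ n ≥ N, ∀ p, C' * Real.sqrt (Real.log n / n) ≤ p → p ≤ 1 → ∀ G, P n p G → Q n p G) :
    Whp C' Q := by
  intro τ hτ
  obtain ⟨n0, hn0⟩ := h τ hτ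
  refine ⟨max n0 N, fun n hn p hp hp1 => ?_⟩
  have h1 : C * Real.sqrt (Real.log n / n) ≤ p :=
    le_trans (mul_le_mul_of_nonneg_right hCC (Real.sqrt_nonneg _)) hp
  have h2 : 0 ≤ p := le_trans (mul_nonneg hC (Real.sqrt_nonneg _)) h1
  refine le_trans (gnpProb_mono h2 hp1 ?_) (hn0 n (le_trans (le_max_left _ _) hn) p h1 hp1)
  intro G hG h3
  exact hG (hPQ n (le_trans (le_max_right _ _) hn) p hp hp1 G h3)

lemma eBtw_mono_graph {n : ℕ} {Γ G : SimpleGraph (Fin n)} (hG : G ≤ Γ) (A B : Finset (Fin n)) :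
    eBtw G A B ≤ eBtw Γ A B := by
  unfold eBtw
  exact card_le_card (monotone_filter_right _ fun a _ h => hG h)

set_option maxHeartbeats 1000000 in
theorem main_whp (γ ε : ℝ) (hγ : 0 < γ) (hγ1 : γ ≤ 1 / 10) (hε : 0 < ε) (hε1 : ε ≤ 1) :
    ∃ C D ξ : ℝ, 0 < C ∧ 0 < D ∧ 0 < ξ ∧ Whp C (Concl γ (γ / 40) ε D ξ) := by
  obtain ⟨δ0, hδe⟩ : ∃ δ0, δ0 = γ / 20 := ⟨_, rfl⟩
  have hδ : 0 < δ0 := by rw [hδe]; positivity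
  obtain ⟨ρ2, hρ2, hρ2a, hρ2b⟩ : ∃ ρ2 : ℝ, 0 < ρ2 ∧ ρ2 ≤ γ ^ 2 / 32 ∧ ρ2 ≤ ε / 32 / 2 :=
    ⟨min (γ ^ 2 / 32) (ε / 32 / 2), by positivity, min_le_left _ _, min_le_right _ _⟩
  obtain ⟨ρ1, hρ1, hρ1a⟩ : ∃ ρ1 : ℝ, 0 < ρ1 ∧ 64 * ρ1 ≤ γ * ρ2 :=
    ⟨γ * ρ2 / 64, by positivity, by linarith⟩
  obtain ⟨s, hs, hsa, hs1⟩ : ∃ s : ℝ, 0 < s ∧ 300 * s ≤ ρ1 * γ ^ 2 ∧ s ≤ 1 := by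
    refine ⟨min (ρ1 * γ ^ 2 / 300) 1, by positivity, ?_, min_le_right _ _⟩
    have := min_le_left (ρ1 * γ ^ 2 / 300) 1
    linarith
  obtain ⟨ζ3, hζ3, hζ3a⟩ : ∃ ζ3 : ℝ, 0 < ζ3 ∧ 27 * ζ3 ≤ s := ⟨s / 27, by positivity, by linarith⟩
  obtain ⟨q, hq⟩ : ∃ q, q = ζ3 * (ε * δ0 ^ 3 / 8) := ⟨_, rfl⟩
  have hq0 : 0 < q := by rw [hq]; positivity
  obtain ⟨ζ, hζ, hζa, hζb⟩ : ∃ ζ : ℝ, 0 < ζ ∧ 162 * ζ ≤ s ∧ 20 * ζ ≤ q := by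
    refine ⟨min (s / 162) (q / 20), by positivity, ?_, ?_⟩
    · linarith [min_le_left (s / 162) (q / 20)]
    · linarith [min_le_right (s / 162) (q / 20)]
  obtain ⟨c1, hc1, hc1a, hc1b⟩ : ∃ c1 : ℝ, 0 < c1 ∧ c1 ≤ 1 ∧ 12 * c1 ≤ q := by
    refine ⟨min 1 (q / 12), by positivity, min_le_left _ _, ?_⟩
    linarith [min_le_right 1 (q / 12)]
  obtain ⟨ε1, hε10, e1a, e1b, e1c⟩ : ∃ ε1 : ℝ, 0 < ε1 ∧ ε1 ≤ c1 * (ε / 16 * δ0 ^ 2) ∧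
      400 * ε1 ≤ ε ^ 3 * δ0 ^ 3 ∧ 64 * ε1 ≤ δ0 ^ 3 * (ρ2 / 4) ^ 2 := by
    refine ⟨min (c1 * (ε / 16 * δ0 ^ 2)) (min (ε ^ 3 * δ0 ^ 3 / 400) (δ0 ^ 3 * (ρ2 / 4) ^ 2 / 64)),
      by positivity, min_le_left _ _, ?_, ?_⟩
    · have := (min_le_right (c1 * (ε / 16 * δ0 ^ 2)) (min (ε ^ 3 * δ0 ^ 3 / 400) (δ0 ^ 3 * (ρ2 / 4) ^ 2 / 64))).trans (min_le_left _ _)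
      linarith
    · have := (min_le_right (c1 * (ε / 16 * δ0 ^ 2)) (min (ε ^ 3 * δ0 ^ 3 / 400) (δ0 ^ 3 * (ρ2 / 4) ^ 2 / 64))).trans (min_le_right _ _)
      linarith
  obtain ⟨ηa, hηa, hPa⟩ := whp_P3 ε1 ζ 4 hε10 hζ (by norm_num)
  obtain ⟨η, hη, n1, n2, n3, n4, n5, n6⟩ : ∃ η : ℝ, 0 < η ∧ η ≤ ηa ∧ 2 * η ≤ ζ * (ε / 16 * δ0) ∧
      64 * η ≤ ε * δ0 ∧ 8 * η ≤ ε ^ 3 ∧ 32 * η ≤ δ0 * (ρ2 / 4) ^ 2 ∧ η ≤ γ / 10 := by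
    obtain ⟨η1, a0, a1, a2⟩ : ∃ η1 : ℝ, 0 < η1 ∧ η1 ≤ ηa ∧ 2 * η1 ≤ ζ * (ε / 16 * δ0) := by
      refine ⟨min ηa (ζ * (ε / 16 * δ0) / 2), by positivity, min_le_left _ _, ?_⟩
      linarith [min_le_right ηa (ζ * (ε / 16 * δ0) / 2)]
    obtain ⟨η2, b0, b1, b2⟩ : ∃ η1 : ℝ, 0 < η1 ∧ 64 * η1 ≤ ε * δ0 ∧ 8 * η1 ≤ ε ^ 3 := by
      refine ⟨min (ε * δ0 / 64) (ε ^ 3 / 8), by positivity, ?_, ?_⟩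
      · linarith [min_le_left (ε * δ0 / 64) (ε ^ 3 / 8)]
      · linarith [min_le_right (ε * δ0 / 64) (ε ^ 3 / 8)]
    obtain ⟨η3, c0, c2, c3⟩ : ∃ η1 : ℝ, 0 < η1 ∧ 32 * η1 ≤ δ0 * (ρ2 / 4) ^ 2 ∧ η1 ≤ γ / 10 := by
      refine ⟨min (δ0 * (ρ2 / 4) ^ 2 / 32) (γ / 10), by positivity, ?_, min_le_right _ _⟩
      linarith [min_le_left (δ0 * (ρ2 / 4) ^ 2 / 32) (γ / 10)]
    have m1 := min_le_left η1 (min η2 η3)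
    have m2 := (min_le_right η1 (min η2 η3)).trans (min_le_left _ _)
    have m3 := (min_le_right η1 (min η2 η3)).trans (min_le_right _ _)
    exact ⟨min η1 (min η2 η3), by positivity, by linarith, by linarith, by linarith, by linarith,
      by linarith, by linarith⟩
  obtain ⟨μ, κ0, N0, hμ, hμ1, hκ0, htil⟩ := tiling γ (s / 3) η hγ hγ1 (by positivity) (by linarith) hη n6
  obtain ⟨κh, hκh, k1, k2, k3⟩ : ∃ κh : ℝ, 0 < κh ∧ κh ≤ c1 * μ ∧ κh ≤ ε * δ0 / 8 ∧ 8 * κh ≤ δ0 * (ρ2 / 4) := by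
    have m1 := min_le_left (c1 * μ) (min (ε * δ0 / 8) (δ0 * (ρ2 / 4) / 8))
    have m2 := (min_le_right (c1 * μ) (min (ε * δ0 / 8) (δ0 * (ρ2 / 4) / 8))).trans (min_le_left _ _)
    have m3 := (min_le_right (c1 * μ) (min (ε * δ0 / 8) (δ0 * (ρ2 / 4) / 8))).trans (min_le_right _ _)
    exact ⟨_, by positivity, m1, m2, by linarith⟩
  obtain ⟨ηh, hηh, hPb⟩ := whp_P3 κh ζ (4 / μ) hκh hζ (by rw [le_div_iff₀ hμ]; linarith)
  obtain ⟨κ, hκ, l1, l2, l3, l4⟩ : ∃ κ : ℝ, 0 < κ ∧ κ ≤ ηh / 2 * μ ^ 2 ∧ κ ≤ 1 / 2 * μ ^ 2 ∧ κ ≤ ζ * μ ^ 2 ∧ κ ≤ κ0 := by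
    refine ⟨min (min (ηh / 2 * μ ^ 2) (1 / 2 * μ ^ 2)) (min (ζ * μ ^ 2) κ0), by positivity, ?_, ?_, ?_, ?_⟩
    · exact (min_le_left _ _).trans (min_le_left _ _)
    · exact (min_le_left _ _).trans (min_le_right _ _)
    · exact (min_le_right _ _).trans (min_le_left _ _)
    · exact (min_le_right _ _).trans (min_le_right _ _)
  obtain ⟨η0, hη0, o1, o2, o3⟩ : ∃ η0 : ℝ, 0 < η0 ∧ η0 ≤ 1 ∧ η0 ≤ γ ^ 2 / 27 ∧ 6 * η0 ≤ κ ^ 2 := by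
    have m1 := min_le_left 1 (min (γ ^ 2 / 27) (κ ^ 2 / 6))
    have m2 := (min_le_right 1 (min (γ ^ 2 / 27) (κ ^ 2 / 6))).trans (min_le_left _ _)
    have m3 := (min_le_right 1 (min (γ ^ 2 / 27) (κ ^ 2 / 6))).trans (min_le_right _ _)
    exact ⟨_, by positivity, m1, m2, by linarith⟩
  let K : Cst :=
  { ε := ε, δ0 := δ0, ρ := ε / 32, ζ := ζ, ζ3 := ζ3, c1 := c1, ε1 := ε1, η := η, μ := μ, κh := κh,
    ηh := ηh, κ := κ, η0 := η0, γ := γ, θ := s / 3, ρ1 := ρ1, ρ2 := ρ2,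
    hε := hε, hε1 := hε1, hδ := hδ, hδ1 := by linarith, hρ0 := by positivity, hρ := by linarith,
    hζ := hζ, hc1 := hc1.le, hc11 := hc1a, hκhc := k1, he1 := e1a, hηζ := n2, hη0 := hη,
    hζ3 := by rw [← hq]; linarith, he2 := e1b, hκh := k2, hη1 := n3, hη2 := n4, hμ := hμ, hμ1 := hμ1,
    hN := o1, hηh := hηh, hκ1 := l1, hκ2 := l2, hκ3 := l3, hγ := hγ, hγ1 := hγ1, hNγ := o2, hN0 := hη0.le,
    hθ := by positivity, hρ2 := hρ2, hρ2γ := hρ2a, hρ2ρ := hρ2b, hρ1 := hρ1, hρ1γ := hρ1a,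
    hσ := by linarith, ht1 := n5, ht2 := k3, ht3 := e1c }
  obtain ⟨C1, hC1, w1⟩ := whp_N1 η0 hη0 o1
  obtain ⟨C2, hC2, w2⟩ := hPa μ hμ
  obtain ⟨C3, hC3, w3⟩ := hPb μ hμ
  obtain ⟨C4, hC4, w4⟩ := whp_P4 (1 / 36) (18 / γ ^ 2 + 1) (by norm_num) (by norm_num) (by positivity)
  obtain ⟨C, hCe⟩ : ∃ C, C = C1 + C2 + C3 + C4 := ⟨_, rfl⟩
  have hC : 0 < C := by linarith
  have v1 := w1.mono hC1.le (show C1 ≤ C by linarith) (fun n p G h => h)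
  have v2 := w2.mono hC2.le (show C2 ≤ C by linarith) (fun n p G h => h)
  have v3 := w3.mono hC3.le (show C3 ≤ C by linarith) (fun n p G h => h)
  have v4 := w4.mono hC4.le (show C4 ≤ C by linarith) (fun n p G h => h)
  obtain ⟨D, hD⟩ : ∃ D, D = 18 / γ ^ 2 + 2 + 9 * (1 / μ) * (3 * (1 / μ) + 1) + 1 / μ := ⟨_, rfl⟩
  obtain ⟨N1', hN1'⟩ := pn_large hC (show 0 < κ ^ 2 / 2 by positivity)
  obtain ⟨N2, hN2⟩ := exists_nat_gt (4 / ρ1 / μ)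
  refine ⟨C, D, μ / 2, hC, by rw [hD]; positivity, by positivity, ?_⟩
  refine Whp.mono_large hC.le le_rfl (v1.and hC.le (v2.and hC.le (v3.and hC.le v4))) (N0 + N1' + N2 + 2) ?_
  rintro n hn p hp hp1 Γ ⟨q1, q2, q3, q4⟩ G hG hdeg
  obtain ⟨hp0, -⟩ := p_facts hC (show 2 ≤ n by omega) hp
  have hn0 : 0 < n := by omega
  have hn0' : (0:ℝ) < n := by exact_mod_cast hn0
  have hJ : JB Γ p κ := by
    intro A B
    refine jumbled hη0.le o1 hp0 q1 hκ.le hn0 ?_ A B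
    have := hN1' n (by omega) p hp hp1
    linarith
  have hUB : UB G p κ := by
    intro A B
    have h1 := (abs_le.1 (hJ A B)).2
    have h2 : (eBtw G A B : ℝ) ≤ eBtw Γ A B := by exact_mod_cast eBtw_mono_graph hG A B
    linarith
  obtain ⟨k, w, W, R, ⟨t1, t2, t3, t4, t5, t6⟩, hw⟩ := htil n (by omega) G p κ hp0 hκ.le l4 hUB hdeg
  have hw0 : 0 < w := by
    have : (0:ℝ) < w := lt_of_lt_of_le (by positivity) hw
    exact_mod_cast this
  have hbig : 4 ≤ ρ1 * w := by
    have h1 : 4 / ρ1 / μ ≤ n := by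
      have : (N2:ℝ) ≤ n := by exact_mod_cast (by omega : N2 ≤ n)
      linarith
    rw [div_le_iff₀ hμ] at h1
    have h2 : 4 / ρ1 ≤ w := by linarith
    rw [div_le_iff₀ hρ1] at h2
    linarith
  have S : Sys K p Γ G k w W R :=
    { hp := hp0, hw := hw0, hμw := hw, hN1 := q1, hJ := hJ, hPa := P3.mono_eta n1 hp0.le q2, hPb := q3,
      hG := hG, hW := t1, hdis := t2, hcut := fun a b h => (t4 a b h).1,
      hden := fun a b h => by
        have := (t4 a b h).2
        show δ0 * p ≤ _
        rw [hδe]; exact this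
      htri := t5, hp1 := hp1, hdeg := hdeg, hP4 := q4, hcov := t3, hnon := t6, hbig := hbig }
  have := S.concl hn0 (D := D) hD
  have hδ2 : K.δ0 / 2 = γ / 40 := by
    show δ0 / 2 = _
    rw [hδe]; ring
  rw [hδ2] at this
  exact this

end Part26

section Part27
lemma RegularPair.mono_eps {n : ℕ} {G : SimpleGraph (Fin n)} {ε ε' p p' : ℝ} (h0 : 0 ≤ ε') (hε : ε' ≤ ε) (hp0 : 0 ≤ p')
    (hp : p' ≤ p) {X Y : Finset (Fin n)} (h : RegularPair G ε' p' X Y) : RegularPair G ε p X Y := by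
  intro X' hX Y' hY h1 h2
  refine (h X' hX Y' hY ?_ ?_).trans (mul_le_mul hε hp hp0 (h0.trans hε))
  · exact (mul_le_mul_of_nonneg_right hε (by positivity)).trans h1
  · exact (mul_le_mul_of_nonneg_right hε (by positivity)).trans h2

lemma dens_nn {n : ℕ} (G : SimpleGraph (Fin n)) (A B : Finset (Fin n)) : 0 ≤ RandomTriangle.dens G A B := by
  unfold RandomTriangle.dens; positivity

lemma low_mono {ε ε' a : ℝ} (hε : ε' ≤ ε) (ha : 0 ≤ a) : (1 - ε) * a ≤ (1 - ε') * a :=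
  mul_le_mul_of_nonneg_right (by linarith) ha

lemma up_mono {ε ε' a : ℝ} (hε : ε' ≤ ε) (ha : 0 ≤ a) : (1 + ε') * a ≤ (1 + ε) * a :=
  mul_le_mul_of_nonneg_right (by linarith) ha

lemma TypicalVertex.mono_eps {n : ℕ} {G : SimpleGraph (Fin n)} {ε ε' p p' : ℝ} (h0 : 0 ≤ ε') (hε : ε' ≤ ε) (hp0 : 0 ≤ p')
    (hp : p' ≤ p) {V₁ V₂ V₃ : Finset (Fin n)} {v : Fin n} (h : TypicalVertex G ε' p' V₁ V₂ V₃ v) :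
    TypicalVertex G ε p V₁ V₂ V₃ v := by
  obtain ⟨⟨a1, a2⟩, ⟨b1, b2⟩, N2, hN2, N3, hN3, c1, c2, c3, c4, c5⟩ := h
  have d2 := dens_nn G V₁ V₂
  have d3 := dens_nn G V₁ V₃
  have d4 := dens_nn G V₂ V₃
  refine ⟨⟨(low_mono hε (by positivity)).trans a1, a2.trans (up_mono hε (by positivity))⟩,
    ⟨(low_mono hε (by positivity)).trans b1, b2.trans (up_mono hε (by positivity))⟩, N2, hN2, N3, hN3,
    (low_mono hε (by positivity)).trans c1, (low_mono hε (by positivity)).trans c2,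
    RegularPair.mono_eps h0 hε hp0 hp c3, (low_mono hε (by positivity)).trans c4, c5.trans (up_mono hε (by positivity))⟩

lemma GoodVertex.mono_eps {n : ℕ} {G : SimpleGraph (Fin n)} {ε ε' p p' : ℝ} (h0 : 0 ≤ ε') (hε : ε' ≤ ε) (hp0 : 0 ≤ p')
    (hp : p' ≤ p) {V₁ V₂ V₃ : Finset (Fin n)} {v : Fin n} (h : GoodVertex G ε' p' V₁ V₂ V₃ v) :
    GoodVertex G ε p V₁ V₂ V₃ v := by
  have d2 := dens_nn G V₁ V₂
  have d3 := dens_nn G V₁ V₃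
  have d4 := dens_nn G V₂ V₃
  refine ⟨TypicalVertex.mono_eps h0 hε hp0 hp h.1, ?_⟩
  refine le_trans ?_ (h.2.trans (mul_le_mul_of_nonneg_right hε (by positivity)))
  norm_cast
  refine card_le_card (monotone_filter_right _ ?_)
  rintro a - ⟨h1, h2⟩
  refine ⟨h1, fun h3 => h2 ?_⟩
  exact (low_mono hε (by positivity)).trans h3

lemma SSR_mono {n : ℕ} {G : SimpleGraph (Fin n)} {δ δ' ε ε' p p' : ℝ} (h0 : 0 ≤ ε') (hε : ε' ≤ ε) (hp0 : 0 ≤ p')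
    (hp : p' ≤ p) (hδ : δ * p ≤ δ' * p') {V₁ V₂ V₃ : Finset (Fin n)}
    (h : StrongSuperRegularTriple G δ' ε' p' V₁ V₂ V₃) : StrongSuperRegularTriple G δ ε p V₁ V₂ V₃ := by
  obtain ⟨⟨⟨r1, r2, r3⟩, a1, a2, a3, t1, t2, t3⟩, g1, g2, g3⟩ := h
  exact ⟨⟨⟨RegularPair.mono_eps h0 hε hp0 hp r1, RegularPair.mono_eps h0 hε hp0 hp r2,
    RegularPair.mono_eps h0 hε hp0 hp r3⟩, hδ.trans a1, hδ.trans a2, hδ.trans a3,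
    fun v hv => TypicalVertex.mono_eps h0 hε hp0 hp (t1 v hv), fun v hv => TypicalVertex.mono_eps h0 hε hp0 hp (t2 v hv),
    fun v hv => TypicalVertex.mono_eps h0 hε hp0 hp (t3 v hv)⟩,
    fun v hv => GoodVertex.mono_eps h0 hε hp0 hp (g1 v hv), fun v hv => GoodVertex.mono_eps h0 hε hp0 hp (g2 v hv),
    fun v hv => GoodVertex.mono_eps h0 hε hp0 hp (g3 v hv)⟩

lemma Concl.mono {γ γ' δ δ' ε ε' D D' ξ p p' : ℝ} {n : ℕ} {Γ Γ' : SimpleGraph (Fin n)} (hΓ : Γ ≤ Γ') (hγ0 : 0 ≤ γ')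
    (hγ : γ' ≤ γ) (h0 : 0 ≤ ε') (hε : ε' ≤ ε) (hp0 : 0 ≤ p') (hp : p' ≤ p) (hδ : δ * p ≤ δ' * p') (hD : D' ≤ D)
    (hDp : D' / p' ^ 2 ≤ D / p ^ 2) (h : Concl γ' δ' ε' D' ξ n p' Γ') : Concl γ δ ε D ξ n p Γ := by
  intro G hG hdeg
  obtain ⟨G', hG', k, hk, B, S, Ws, h1, h2, h3, h4, h5, h6, h7, h8, h9⟩ := h G (hG.trans hΓ) (fun v => by
    refine le_trans ?_ (hdeg v)
    have h1 : (2 / 3 + γ') * n ≤ (2 / 3 + γ) * n := mul_le_mul_of_nonneg_right (by linarith) (by positivity)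
    exact mul_le_mul h1 hp hp0 (by have : 0 ≤ γ := hγ0.trans hγ
                                   positivity))
  exact ⟨G', hG', k, hk.trans hD, B, S, Ws, h1, h2, h3, h4, h5, h6.trans hDp, h7,
    fun t => SSR_mono h0 hε hp0 hp hδ (h8 t), h9⟩

lemma top_of_prob {n : ℕ} {P : SimpleGraph (Fin n) → Prop} (h : gnpProb n 1 {G | ¬ P G} ≤ 1 / 2) : P ⊤ := by
  by_contra hP
  have h2 : wt n 1 (⊤ : SimpleGraph (Fin n)) = 1 := by
    unfold wt
    have : eset (⊤ : SimpleGraph (Fin n)) = ndg n := by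
      ext e
      simp [eset, ndg]
    rw [this, ndg_card]
    simp
  have h3 : (⊤ : SimpleGraph (Fin n)) ∈ {G | ¬ P G} := hP
  have h4 : (1:ℝ) ≤ gnpProb n 1 {G | ¬ P G} := by
    rw [gnpProb_eq]
    unfold Ex
    refine le_trans ?_ (Finset.single_le_sum (s := univ) (a := (⊤ : SimpleGraph (Fin n))) ?_ (mem_univ _))
    · dsimp only
      rw [h2, if_pos h3, mul_one]
    · intro G _
      exact mul_nonneg (wt_nonneg (by norm_num) le_rfl G) (by dsimp only; split_ifs <;> norm_num)
  linarith

lemma sqrt_small {C : ℝ} (hC : 0 < C) : ∃ N : ℕ, ∀ n ≥ N, C * Real.sqrt (Real.log n / n) ≤ 1 := by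
  obtain ⟨N, hN⟩ := exists_nat_gt ((2 * C ^ 2) ^ 2)
  refine ⟨N, fun n hn => ?_⟩
  have hn' : (2 * C ^ 2) ^ 2 < (n : ℝ) := lt_of_lt_of_le hN (by exact_mod_cast hn)
  have hn0 : (0:ℝ) < n := lt_of_le_of_lt (by positivity) hn'
  have hs : 2 * C ^ 2 ≤ Real.sqrt n := Real.le_sqrt_of_sq_le hn'.le
  have hs0 : 0 < Real.sqrt n := Real.sqrt_pos.2 hn0
  have hss : Real.sqrt n * Real.sqrt n = n := Real.mul_self_sqrt hn0.le
  have hl : Real.log n ≤ 2 * Real.sqrt n := by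
    have h1 : Real.log n = 2 * Real.log (Real.sqrt n) := by
      rw [Real.log_sqrt hn0.le]; ring
    have := Real.log_le_sub_one_of_pos hs0
    linarith
  have h2 : Real.sqrt (Real.log n / n) ≤ 1 / C := by
    rw [Real.sqrt_le_left (by positivity), div_le_iff₀ hn0, div_pow, one_pow, div_mul_eq_mul_div, one_mul,
      le_div_iff₀ (by positivity)]
    calc Real.log n * C ^ 2 ≤ 2 * Real.sqrt n * C ^ 2 := mul_le_mul_of_nonneg_right hl (by positivity)
      _ = Real.sqrt n * (2 * C ^ 2) := by ring
      _ ≤ Real.sqrt n * Real.sqrt n := mul_le_mul_of_nonneg_left hs hs0.le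
      _ = n := hss
  calc C * Real.sqrt (Real.log n / n) ≤ C * (1 / C) := mul_le_mul_of_nonneg_left h2 hC.le
    _ = 1 := by field_simp

theorem main_aas (γ : ℝ) (hγ : 0 < γ) :
    ∃ δ : ℝ, 0 < δ ∧
      ∀ ε : ℝ, 0 < ε →
        ∃ C D ξ : ℝ, 0 < C ∧ 0 < D ∧ 0 < ξ ∧
          ∀ p : ℕ → ℝ, (∀ n : ℕ, C * Real.sqrt (Real.log n / n) ≤ p n) →
            AAS p (fun n Gnp => Concl γ δ ε D ξ n (p n) Gnp) := by
  obtain ⟨γ', hγ'⟩ : ∃ γ', γ' = min γ (1 / 10) := ⟨_, rfl⟩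
  have g0 : 0 < γ' := by rw [hγ']; positivity
  have g1 : γ' ≤ γ := by rw [hγ']; exact min_le_left _ _
  have g2 : γ' ≤ 1 / 10 := by rw [hγ']; exact min_le_right _ _
  refine ⟨γ' / 60, by positivity, fun ε hε => ?_⟩
  obtain ⟨C, D, ξ, hC, hD, hξ, hw⟩ := main_whp γ' (min ε 1) g0 g2 (by positivity) (min_le_right _ _)
  refine ⟨C, 9 / 4 * D, ξ, hC, by positivity, hξ, fun p hp => ?_⟩
  obtain ⟨N1', hN1⟩ := sqrt_small hC
  obtain ⟨N2, hN2⟩ := hw (1 / 2) (by norm_num)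
  have he0 : 0 ≤ min ε 1 := by positivity
  unfold AAS
  rw [Metric.tendsto_atTop]
  intro τ hτ
  obtain ⟨N3, hN3⟩ := hw (τ / 2) (by positivity)
  refine ⟨N1' + N2 + N3 + 2, fun n hn => ?_⟩
  obtain ⟨hp0, -⟩ := p_facts hC (show 2 ≤ n by omega) (hp n)
  by_cases hp1 : p n ≤ 1
  · have h1 := hN3 n (by omega) (p n) (hp n) hp1
    rw [gnpProb_compl]
    have h2 : gnpProb n (p n) {G | ¬ Concl γ (γ' / 60) ε (9 / 4 * D) ξ n (p n) G} ≤ τ / 2 := by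
      refine le_trans (gnpProb_mono hp0.le hp1 ?_) h1
      intro G hG h3
      refine hG (Concl.mono le_rfl g0.le g1 he0 (min_le_left _ _) hp0.le le_rfl ?_ (by linarith) ?_ h3)
      · exact mul_le_mul_of_nonneg_right (by linarith) hp0.le
      · exact div_le_div_of_nonneg_right (by linarith) (by positivity)
    have h3 := gnpProb_nonneg hp0.le hp1 {G | ¬ Concl γ (γ' / 60) ε (9 / 4 * D) ξ n (p n) G}
    rw [Real.dist_eq, abs_lt]
    constructor <;> linarith
  · push Not at hp1
    have hall : ∀ Γ : SimpleGraph (Fin n), Concl γ (γ' / 60) ε (9 / 4 * D) ξ n (p n) Γ := by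
      intro Γ
      by_cases hp2 : p n ≤ 3 / 2
      · have h1 := top_of_prob (hN2 n (by omega) 1 (hN1 n (by omega)) le_rfl)
        refine Concl.mono le_top g0.le g1 he0 (min_le_left _ _) zero_le_one hp1.le ?_ (by linarith) ?_ h1
        · have := mul_le_mul_of_nonneg_left hp2 (show 0 ≤ γ' / 60 by positivity)
          linarith
        · rw [le_div_iff₀ (by positivity)]
          have : p n ^ 2 ≤ 9 / 4 := by nlinarith
          have := mul_le_mul_of_nonneg_left this hD.le
          linarith
      · push Not at hp2
        intro G hG hdeg
        exfalso
        have hn0 : (0:ℝ) < n := by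
          have : 0 < n := by omega
          exact_mod_cast this
        have h1 := hdeg ⟨0, by omega⟩
        have h2 : (degIn G (⟨0, by omega⟩ : Fin n) univ : ℝ) ≤ n := by
          have : degIn G (⟨0, by omega⟩ : Fin n) univ ≤ n := by
            unfold degIn
            exact (card_le_univ _).trans (by simp)
          exact_mod_cast this
        have h3 : (2 / 3 + γ) * n * (3 / 2) ≤ (2 / 3 + γ) * n * p n := mul_le_mul_of_nonneg_left hp2.le (by positivity)
        have h4 : 0 < γ * n := by positivity
        linarith
    rw [gnpProb_true _ _ hall]
    simpa using hτ

end Part27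

/-- **Theorem (decomposition into strong-super-regular triples).** For every `γ > 0` there is
`δ > 0` such that for every `ε > 0` there are constants `C`, `D`, `ξ > 0` with the following
property. If `p ≥ C√(log n / n)`, then a.a.s. every subgraph `G ⊆ G(n,p)` with
`δ(G) ≥ (2/3 + γ)np` contains a subgraph `G' ⊆ G` whose vertex set can be partitioned into
`B`, `S` and balanced `(δ,ε,p)`-strong-super-regular triples of size at least `ξn`, with
`|B| ≤ D·p⁻²` and a perfect triangle packing of `G[S]`. -/
theorem stmt_19 (γ : ℝ) (hγ : 0 < γ) :
    ∃ δ : ℝ, 0 < δ ∧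
      ∀ ε : ℝ, 0 < ε →
        ∃ C D ξ : ℝ, 0 < C ∧ 0 < D ∧ 0 < ξ ∧
          ∀ p : ℕ → ℝ, (∀ n : ℕ, C * Real.sqrt (Real.log n / n) ≤ p n) →
            AAS p (fun n Gnp =>
              ∀ G : SimpleGraph (Fin n), G ≤ Gnp →
                (∀ v, (2 / 3 + γ) * n * p n ≤ (degIn G v Finset.univ : ℝ)) →
                ∃ G' : SimpleGraph (Fin n), G' ≤ G ∧
                ∃ k : ℕ, (k : ℝ) ≤ D ∧
                ∃ B S : Finset (Fin n), ∃ Ws : Fin (3 * k) → Finset (Fin n),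
                  Disjoint B S ∧ (∀ i, Disjoint B (Ws i)) ∧ (∀ i, Disjoint S (Ws i)) ∧
                  (∀ i j, i ≠ j → Disjoint (Ws i) (Ws j)) ∧
                  B ∪ S ∪ Finset.univ.biUnion Ws = (Finset.univ : Finset (Fin n)) ∧
                  (B.card : ℝ) ≤ D / (p n) ^ 2 ∧
                  (∃ T : Finset (Finset (Fin n)),
                    IsTrianglePacking G T ∧ T.sup id = S) ∧
                  (∀ t : Fin k, StrongSuperRegularTriple G' δ ε (p n)
                    (Ws (idx0 t)) (Ws (idx1 t)) (Ws (idx2 t))) ∧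
                  (∀ t : Fin k, (Ws (idx0 t)).card = (Ws (idx1 t)).card ∧
                    (Ws (idx1 t)).card = (Ws (idx2 t)).card ∧
                    ξ * n ≤ ((Ws (idx0 t)).card : ℝ))) := by
  exact main_aas γ hγ
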